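/- For every m ∈ ℕ there exists a number η(m), depending only on m, such that every finite group G satisfying g^m = 1 for all g ∈ G has height h(G) ≤ η(m). -/

import Mathlib

/-- A finite group is *semisimple* if it is a direct product of non-abelian simple
groups. -/
def IsSemisimpleGroup' (F : Type*) [Group F] : Prop :=
  ∃ (ι : Type) (_ : Fintype ι) (S : ι → Type) (_ : ∀ i, Group (S i)),
    (∀ i, IsSimpleGroup (S i)) ∧
    (∀ i, ∃ x y : S i, x * y ≠ y * x) ∧
    Nonempty (F ≃* ((i : ι) → S i))

/-- `HasNilpotentSemisimpleChain G n` says that `G` admits a chain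
`1 = G₀ ≤ G₁ ≤ … ≤ Gₙ = G` of normal subgroups of `G` in which every factor
`Gᵢ₊₁/Gᵢ` is either nilpotent or semisimple. -/
def HasNilpotentSemisimpleChain (G : Type*) [Group G] (n : ℕ) : Prop :=
  ∃ c : Fin (n + 1) → Subgroup G,
    Monotone c ∧ c 0 = ⊥ ∧ c (Fin.last n) = ⊤ ∧ (∀ i, (c i).Normal) ∧
    ∀ i : Fin n, ∃ (F : Type) (_ : Group F) (φ : ↥(c i.succ) →* F),
      Function.Surjective φ ∧ φ.ker = (c i.castSucc).subgroupOf (c i.succ) ∧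
      (Group.IsNilpotent F ∨ IsSemisimpleGroup' F)

/-- The *height* `h(G)` of a finite group `G`: the minimal length of a chain of normal
subgroups of `G` whose successive factors are nilpotent or semisimple. -/
noncomputable def groupHeight (G : Type*) [Group G] : ℕ :=
  sInf {n : ℕ | HasNilpotentSemisimpleChain G n}

section

open Subgroup
open scoped Pointwise

/-! ### Conjugates of subgroups, relative Sylow subgroups -/

/-- The conjugate `g H g⁻¹`. -/
def conjSub {G : Type*} [Group G] (g : G) (H : Subgroup G) : Subgroup G :=
  H.map (MulAut.conj g).toMonoidHom

theorem mem_conjSub {G : Type*} [Group G] {g x : G} {H : Subgroup G} :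
    x ∈ conjSub g H ↔ g⁻¹ * x * g ∈ H := by
  constructor
  · rintro ⟨y, hy, rfl⟩
    simpa [mul_assoc] using hy
  · intro h
    exact ⟨_, h, by simp [mul_assoc]⟩

theorem conjSub_one {G : Type*} [Group G] (H : Subgroup G) : conjSub 1 H = H := by
  ext x; simp [mem_conjSub]

theorem conjSub_conjSub {G : Type*} [Group G] (g h : G) (H : Subgroup G) :
    conjSub g (conjSub h H) = conjSub (g * h) H := by
  ext x; simp [mem_conjSub, mul_assoc]

theorem conjSub_mono {G : Type*} [Group G] {g : G} {H K : Subgroup G} (h : H ≤ K) :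
    conjSub g H ≤ conjSub g K := fun x hx => by
  rw [mem_conjSub] at *; exact h hx

theorem conjSub_le_iff {G : Type*} [Group G] {g : G} {H K : Subgroup G} :
    conjSub g H ≤ K ↔ H ≤ conjSub g⁻¹ K := by
  constructor
  · intro h x hx
    rw [mem_conjSub]
    apply h
    rw [mem_conjSub]
    simpa [mul_assoc] using hx
  · intro h x hx
    rw [mem_conjSub] at hx
    have := h hx
    rw [mem_conjSub] at this
    simpa [mul_assoc] using this

theorem card_conjSub {G : Type*} [Group G] (g : G) (H : Subgroup G) :
    Nat.card (conjSub g H) = Nat.card H :=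
  (Nat.card_congr (H.equivMapOfInjective _ (MulAut.conj g).injective).toEquiv).symm

theorem isPGroup_conjSub {G : Type*} [Group G] {p : ℕ} {g : G} {H : Subgroup G}
    (h : IsPGroup p H) : IsPGroup p (conjSub g H) :=
  h.map _

theorem mem_normalizer_iff_conjSub {G : Type*} [Group G] [Finite G] {g : G} {H : Subgroup G} :
    g ∈ normalizer (H : Set G) ↔ conjSub g H = H := by
  rw [Subgroup.mem_normalizer_iff]
  constructor
  · intro h
    ext x
    rw [mem_conjSub, h]; simp [mul_assoc]
  · intro h x
    conv_rhs => rw [← h, mem_conjSub]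
    simp [mul_assoc]

theorem mem_normalizer_of_conj {G : Type*} [Group G] [Finite G] {g : G} {H : Subgroup G}
    (h : ∀ x ∈ H, g * x * g⁻¹ ∈ H) : g ∈ normalizer (H : Set G) := by
  rw [mem_normalizer_iff_conjSub]
  have hle : conjSub g H ≤ H := fun x hx => by
    rw [mem_conjSub] at hx
    have := h _ hx
    simpa [mul_assoc] using this
  exact Subgroup.eq_of_le_of_card_ge hle (card_conjSub g H).ge

theorem conj_mem_of_mem_normalizer {G : Type*} [Group G] {g x : G} {H : Subgroup G}
    (h : g ∈ normalizer (H : Set G)) (hx : x ∈ H) : g * x * g⁻¹ ∈ H :=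
  (Subgroup.mem_normalizer_iff.1 h x).1 hx

theorem conj_mem_of_mem_normalizer' {G : Type*} [Group G] {g x : G} {H : Subgroup G}
    (h : g ∈ normalizer (H : Set G)) (hx : x ∈ H) : g⁻¹ * x * g ∈ H := by
  simpa using conj_mem_of_mem_normalizer (inv_mem h) hx

theorem conjSub_eq_of_mem {G : Type*} [Group G] [Finite G] {g : G} {H : Subgroup G} (h : g ∈ H) :
    conjSub g H = H :=
  mem_normalizer_iff_conjSub.1 (Subgroup.le_normalizer h)

theorem conjSub_normal {G : Type*} [Group G] [Finite G] (g : G) (H : Subgroup G) [hn : H.Normal] :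
    conjSub g H = H :=
  mem_normalizer_iff_conjSub.1 (by rw [Subgroup.normalizer_eq_top]; trivial)

/-- `R` is a Sylow `t`-subgroup of the subgroup `V`. -/
def IsSylIn {G : Type*} [Group G] (t : ℕ) (R V : Subgroup G) : Prop :=
  R ≤ V ∧ IsPGroup t R ∧ ∀ S : Subgroup G, S ≤ V → IsPGroup t S → R ≤ S → S = R

namespace IsSylIn

theorem exists_ge {G : Type*} [Group G] [Finite G] {t : ℕ} {W V : Subgroup G} (hW : W ≤ V)
    (hp : IsPGroup t W) : ∃ R, IsSylIn t R V ∧ W ≤ R := by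
  have hfin : Set.Finite {S : Subgroup G | S ≤ V ∧ IsPGroup t S} := Set.toFinite _
  obtain ⟨R, hWR, hR⟩ := hfin.exists_le_maximal (a := W) ⟨hW, hp⟩
  exact ⟨R, ⟨hR.1.1, hR.1.2, fun S h1 h2 h3 => le_antisymm (hR.2 ⟨h1, h2⟩ h3) h3⟩, hWR⟩

theorem mono {G : Type*} [Group G] {t : ℕ} {R U V : Subgroup G} (h : IsSylIn t R V)
    (hRU : R ≤ U) (hUV : U ≤ V) : IsSylIn t R U :=
  ⟨hRU, h.2.1, fun S h1 h2 h3 => h.2.2 S (h1.trans hUV) h2 h3⟩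

theorem conj {G : Type*} [Group G] {t : ℕ} {R V : Subgroup G} (g : G)
    (h : IsSylIn t R V) : IsSylIn t (conjSub g R) (conjSub g V) := by
  refine ⟨conjSub_mono h.1, isPGroup_conjSub h.2.1, fun S h1 h2 h3 => ?_⟩
  have := h.2.2 (conjSub g⁻¹ S) (by rw [conjSub_le_iff]; simpa using h1) (isPGroup_conjSub h2)
    (by rwa [← conjSub_le_iff])
  rw [← this, conjSub_conjSub]; simp [conjSub_one]

/-- The Sylow subgroup of `↥V` corresponding to `R`. -/
def toSylow {G : Type*} [Group G] {t : ℕ} {R V : Subgroup G} (h : IsSylIn t R V) : Sylow t V where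
  carrier := (R.subgroupOf V : Set V)
  mul_mem' := (R.subgroupOf V).mul_mem
  one_mem' := (R.subgroupOf V).one_mem
  inv_mem' := (R.subgroupOf V).inv_mem
  isPGroup' := (h.2.1.comap_subtype : IsPGroup t (R.subgroupOf V))
  is_maximal' := by
    intro Q hQ hle
    have h1 := h.2.2 (Q.map V.subtype) (Subgroup.map_subtype_le Q) (hQ.map _) (by
      intro x hx
      exact ⟨⟨x, h.1 hx⟩, hle (Subgroup.mem_subgroupOf.2 hx), rfl⟩)
    apply le_antisymm _ hle
    intro x hx
    change x ∈ R.subgroupOf V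
    rw [Subgroup.mem_subgroupOf, ← h1]
    exact ⟨x, hx, rfl⟩

theorem exists_conj {G : Type*} [Group G] [Finite G] {t : ℕ} [Fact t.Prime] {R R' V : Subgroup G}
    (h : IsSylIn t R V) (h' : IsSylIn t R' V) : ∃ v ∈ V, R' = conjSub v R := by
  obtain ⟨v, hv⟩ := MulAction.exists_smul_eq V h.toSylow h'.toSylow
  refine ⟨v, v.2, ?_⟩
  have hle : R' ≤ conjSub (v : G) R := by
    intro x hx
    have : (⟨x, h'.1 hx⟩ : V) ∈ h'.toSylow := hx
    rw [← hv] at this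
    have this : (⟨x, h'.1 hx⟩ : V) ∈ ((MulAut.conj v • (h.toSylow : Subgroup V) : Subgroup V)) := this
    have h2 := Subgroup.mem_pointwise_smul_iff_inv_smul_mem.1 this
    rw [mem_conjSub]
    have h3 : (((MulAut.conj v)⁻¹ • (⟨x, h'.1 hx⟩ : V) : V) : G) ∈ R := h2
    rw [← map_inv] at h3
    simpa [MulAut.smul_def] using h3
  have := h'.2.2 (conjSub (v : G) R) ((conjSub_mono h.1).trans (conjSub_eq_of_mem v.2).le) (isPGroup_conjSub h.2.1) hle
  exact this.symm

theorem frattini {G : Type*} [Group G] [Finite G] {t : ℕ} [Fact t.Prime] {R V : Subgroup G}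
    (h : IsSylIn t R V) {g : G} (hg : g ∈ normalizer (V : Set G)) :
    ∃ v ∈ V, g * v ∈ normalizer (R : Set G) := by
  have h1 := h.conj g⁻¹
  rw [mem_normalizer_iff_conjSub.1 (inv_mem hg)] at h1
  obtain ⟨v, hv, hvR⟩ := h.exists_conj h1
  refine ⟨v, hv, ?_⟩
  rw [mem_normalizer_iff_conjSub, ← conjSub_conjSub, ← hvR, conjSub_conjSub]
  simp [conjSub_one]

theorem card_dvd {G : Type*} [Group G] [Finite G] {t : ℕ} [Fact t.Prime] {R V : Subgroup G}
    (h : IsSylIn t R V) : ∃ k, Nat.card V = Nat.card R * k ∧ ¬ t ∣ k := by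
  have h1 : Nat.card (h.toSylow : Subgroup V) = Nat.card R :=
    Nat.card_congr (Subgroup.subgroupOfEquivOfLe h.1).toEquiv
  refine ⟨(h.toSylow : Subgroup V).index, ?_, h.toSylow.not_dvd_index⟩
  rw [← h1]; exact (Subgroup.card_mul_index _).symm

end IsSylIn

/-! ### Elements of prime power order and fixed points -/

/-- `g` has `p`-power order. -/
def PEl {G : Type*} [Group G] (p : ℕ) (g : G) : Prop := ∃ k : ℕ, g ^ p ^ k = 1

theorem PEl.conj {G : Type*} [Group G] {p : ℕ} {g : G} (h : PEl p g) (x : G) :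
    PEl p (x * g * x⁻¹) := by
  obtain ⟨k, hk⟩ := h
  exact ⟨k, by rw [conj_pow, hk]; simp⟩

theorem PEl.inv {G : Type*} [Group G] {p : ℕ} {g : G} (h : PEl p g) : PEl p g⁻¹ := by
  obtain ⟨k, hk⟩ := h
  exact ⟨k, by rw [inv_pow, hk]; simp⟩

theorem PEl.of_mem {G : Type*} [Group G] {p : ℕ} {H : Subgroup G} (h : IsPGroup p H) {g : G}
    (hg : g ∈ H) : PEl p g := by
  obtain ⟨k, hk⟩ := h ⟨g, hg⟩
  exact ⟨k, by simpa [Subtype.ext_iff] using hk⟩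

theorem isPGroup_of_forall {G : Type*} [Group G] {p : ℕ} {H : Subgroup G}
    (h : ∀ g ∈ H, PEl p g) : IsPGroup p H := by
  rintro ⟨g, hg⟩
  obtain ⟨k, hk⟩ := h g hg
  exact ⟨k, by simpa [Subtype.ext_iff] using hk⟩

theorem PEl.zpowers {G : Type*} [Group G] {p : ℕ} {g : G} (h : PEl p g) :
    IsPGroup p (Subgroup.zpowers g) := by
  obtain ⟨k, hk⟩ := h
  apply isPGroup_of_forall
  rintro _ ⟨n, rfl⟩
  exact ⟨k, by
    simp only
    rw [← zpow_natCast, ← zpow_mul, mul_comm, zpow_mul, zpow_natCast, hk, one_zpow]⟩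

theorem PEl.eq_one_of_coprime {G : Type*} [Group G] {p q : ℕ} [Fact p.Prime] [Fact q.Prime]
    (hpq : p ≠ q) {g : G} (hp : PEl p g) (hq : PEl q g) : g = 1 := by
  obtain ⟨k, hk⟩ := hp
  obtain ⟨l, hl⟩ := hq
  have : Nat.Coprime (p ^ k) (q ^ l) :=
    Nat.Coprime.pow _ _ ((Nat.coprime_primes Fact.out Fact.out).2 hpq)
  have h1 : orderOf g ∣ 1 := by
    rw [← this.gcd_eq_one]
    exact Nat.dvd_gcd (orderOf_dvd_of_pow_eq_one hk) (orderOf_dvd_of_pow_eq_one hl)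
  exact orderOf_eq_one_iff.1 (Nat.dvd_one.1 h1)

theorem not_dvd_card_of_isPGroup {G : Type*} [Group G] [Finite G] {p t : ℕ} [Fact p.Prime]
    [Fact t.Prime] (htp : t ≠ p) {O : Subgroup G} (hO : IsPGroup p O) : ¬ t ∣ Nat.card O := by
  obtain ⟨n, hn⟩ := IsPGroup.iff_card.1 hO
  rw [hn]
  intro h
  exact htp ((Nat.prime_dvd_prime_iff_eq Fact.out Fact.out).1 (Nat.Prime.dvd_of_dvd_pow Fact.out h))

/-- A `t`-group acting by conjugation on a set whose size is not divisible by `t`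
has a fixed point. -/
theorem exists_fixed_conj {G : Type*} [Group G] [Finite G] {t : ℕ} [Fact t.Prime]
    {R : Subgroup G} (hR : IsPGroup t R) {S : Set G} (hS : ∀ b ∈ R, ∀ s ∈ S, b * s * b⁻¹ ∈ S)
    (hcard : ¬ t ∣ Nat.card S) : ∃ s ∈ S, ∀ b ∈ R, b * s = s * b := by
  let : MulAction R S :=
    { smul := fun b s => ⟨b * s * b⁻¹, hS b b.2 s s.2⟩
      one_smul := fun s => Subtype.ext (by change (1 : R) * s.1 * (1 : R)⁻¹ = s.1; simp)
      mul_smul := fun a b s => Subtype.ext (by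
        change ((a * b : R) : G) * s.1 * ((a * b : R) : G)⁻¹ = a * (b * s.1 * b⁻¹) * a⁻¹
        simp [mul_assoc]) }
  obtain ⟨s, hs⟩ := hR.nonempty_fixed_point_of_prime_not_dvd_card S hcard
  refine ⟨s, s.2, fun b hb => ?_⟩
  have h1 : (b * s.1 * b⁻¹ : G) = s.1 := congrArg Subtype.val (hs ⟨b, hb⟩)
  rw [mul_inv_eq_iff_eq_mul] at h1
  exact h1

theorem card_coset {G : Type*} [Group G] (z : G) (O : Subgroup G) :
    Nat.card {g : G | z⁻¹ * g ∈ O} = Nat.card O :=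
  Nat.card_congr
    { toFun := fun g => ⟨z⁻¹ * g, g.2⟩
      invFun := fun o => ⟨z * o, by simp⟩
      left_inv := fun g => by simp
      right_inv := fun o => by simp }

/-- If a `t`-group `R` normalises the coset `zO` of a `p`-group `O`, `p ≠ t`, then it centralises
some element of it. -/
theorem exists_fixed_coset {G : Type*} [Group G] [Finite G] {p t : ℕ} [Fact p.Prime]
    [Fact t.Prime] (htp : t ≠ p) {R O : Subgroup G} (hR : IsPGroup t R) (hO : IsPGroup p O)
    (hRO : R ≤ normalizer (O : Set G)) {z : G} (hz : ∀ b ∈ R, z⁻¹ * (b * z * b⁻¹) ∈ O) :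
    ∃ o ∈ O, ∀ b ∈ R, b * (z * o) = z * o * b := by
  obtain ⟨s, hs, h⟩ := exists_fixed_conj hR (S := {g : G | z⁻¹ * g ∈ O}) (by
    intro b hb s hs
    have h1 : z⁻¹ * (b * s * b⁻¹) = z⁻¹ * (b * z * b⁻¹) * (b * (z⁻¹ * s) * b⁻¹) := by group
    rw [Set.mem_ofPred_eq, h1]
    exact O.mul_mem (hz b hb) (conj_mem_of_mem_normalizer (hRO hb) hs))
    (by rw [card_coset]; exact not_dvd_card_of_isPGroup htp hO)
  exact ⟨z⁻¹ * s, hs, fun b hb => by simpa using h b hb⟩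

/-- Two `r`-elements in the same coset `yO` of a `p`-group normalised by `y` are conjugate
under `O`. -/
theorem exists_conj_of_coset {G : Type*} [Group G] [Finite G] {p r : ℕ} [Fact p.Prime]
    [Fact r.Prime] (hrp : r ≠ p) {O : Subgroup G} (hO : IsPGroup p O) {y y' : G}
    (hy : y ∈ normalizer (O : Set G)) (hyy : y⁻¹ * y' ∈ O) (h1 : PEl r y) (h2 : PEl r y') :
    ∃ o ∈ O, y' = o⁻¹ * y * o := by
  classical
  obtain ⟨k, hk⟩ : ∃ k, y ^ r ^ k = 1 ∧ y' ^ r ^ k = 1 := by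
    obtain ⟨a, ha⟩ := h1
    obtain ⟨b, hb⟩ := h2
    exact ⟨a + b, by rw [pow_add, pow_mul, ha, one_pow], by
      rw [add_comm, pow_add, pow_mul, hb, one_pow]⟩
  have hf : ∀ o : G, o ∈ O → y⁻¹ * o * y' ∈ O := fun o ho => by
    have : y⁻¹ * o * y' = (y⁻¹ * o * y) * (y⁻¹ * y') := by group
    rw [this]; exact O.mul_mem (conj_mem_of_mem_normalizer' hy ho) hyy
  let f : O → O := fun o => ⟨y⁻¹ * o * y', hf o o.2⟩
  have hinj : Function.Injective f := by
    intro a b hab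
    have : y⁻¹ * (a : G) * y' = y⁻¹ * b * y' := congrArg Subtype.val hab
    exact Subtype.ext (by simpa using this)
  let σ : Equiv.Perm O := Equiv.ofBijective f (Finite.injective_iff_bijective.1 hinj)
  have hσ : ∀ (n : ℕ) (o : O), ((σ ^ n) o : G) = (y ^ n)⁻¹ * o * y' ^ n := by
    intro n
    induction n with
    | zero => intro o; simp
    | succ n ih =>
      intro o
      rw [pow_succ', Equiv.Perm.mul_apply]
      change y⁻¹ * (((σ ^ n) o : O) : G) * y' = _
      rw [ih, pow_succ, pow_succ]; group
  have : Fintype O := Fintype.ofFinite _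
  obtain ⟨o, ho⟩ := Equiv.Perm.exists_fixed_point_of_prime (p := r) (n := k) (σ := σ) (by
    rw [← Nat.card_eq_fintype_card]; exact not_dvd_card_of_isPGroup hrp hO) (by
    ext o; rw [hσ, hk.1, hk.2]; simp)
  refine ⟨o, o.2, ?_⟩
  have : y⁻¹ * (o : G) * y' = o := congrArg Subtype.val ho
  rw [mul_assoc, inv_mul_eq_iff_eq_mul] at this
  rw [mul_assoc, ← this]; group

/-! ### The largest normal `p`-subgroup -/

/-- The largest normal `p`-subgroup of the subgroup `H`. -/
def pCore {G : Type*} [Group G] (p : ℕ) (H : Subgroup G) : Subgroup G :=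
  sSup {N | N ≤ H ∧ H ≤ normalizer (N : Set G) ∧ IsPGroup p N}

theorem le_pCore {G : Type*} [Group G] {p : ℕ} {H N : Subgroup G} (h1 : N ≤ H)
    (h2 : H ≤ normalizer (N : Set G)) (h3 : IsPGroup p N) : N ≤ pCore p H :=
  le_sSup ⟨h1, h2, h3⟩

theorem normalizer_sup_le {G : Type*} [Group G] [Finite G] {N M : Subgroup G} {g : G}
    (h1 : g ∈ normalizer (N : Set G)) (h2 : g ∈ normalizer (M : Set G)) :
    g ∈ normalizer ((N ⊔ M : Subgroup G) : Set G) := by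
  rw [mem_normalizer_iff_conjSub] at *
  rw [conjSub, Subgroup.map_sup, ← conjSub, ← conjSub, h1, h2]

theorem pCore_mem {G : Type*} [Group G] [Finite G] (p : ℕ) (H : Subgroup G) :
    pCore p H ≤ H ∧ H ≤ normalizer (pCore p H : Set G) ∧ IsPGroup p (pCore p H) := by
  have hfin : Set.Finite {N : Subgroup G | N ≤ H ∧ H ≤ normalizer (N : Set G) ∧ IsPGroup p N} :=
    Set.toFinite _
  obtain ⟨M, -, hM⟩ := hfin.exists_le_maximal (a := ⊥) ⟨bot_le, by
    intro g _; apply mem_normalizer_of_conj; intro x hx; rw [mem_bot] at *; simp [hx],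
      IsPGroup.of_bot⟩
  have : pCore p H = M := by
    apply le_antisymm
    · apply sSup_le
      rintro N ⟨h1, h2, h3⟩
      have h4 : N ⊔ M ≤ M := hM.2 ⟨sup_le h1 hM.1.1, fun g hg =>
        normalizer_sup_le (h2 hg) (hM.1.2.1 hg),
        IsPGroup.to_sup_of_normal_right' h3 hM.1.2.2 (h1.trans hM.1.2.1)⟩ le_sup_right
      exact le_sup_left.trans h4
    · exact le_sSup hM.1
  rw [this]; exact hM.1

theorem pCore_le {G : Type*} [Group G] [Finite G] (p : ℕ) (H : Subgroup G) : pCore p H ≤ H :=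
  (pCore_mem p H).1

theorem isPGroup_pCore {G : Type*} [Group G] [Finite G] (p : ℕ) (H : Subgroup G) :
    IsPGroup p (pCore p H) := (pCore_mem p H).2.2

theorem conjSub_pCore {G : Type*} [Group G] [Finite G] (p : ℕ) (g : G) (H : Subgroup G) :
    conjSub g (pCore p H) = pCore p (conjSub g H) := by
  have key : ∀ (g : G) (H : Subgroup G), conjSub g (pCore p H) ≤ pCore p (conjSub g H) := by
    intro g H
    refine le_pCore (conjSub_mono (pCore_le p H)) ?_ (isPGroup_conjSub (isPGroup_pCore p H))
    intro x hx
    rw [mem_conjSub] at hx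
    have h1 := mem_normalizer_iff_conjSub.1 ((pCore_mem p H).2.1 hx)
    rw [mem_normalizer_iff_conjSub, conjSub_conjSub]
    conv_rhs => rw [← h1, conjSub_conjSub]
    congr 1; group
  apply le_antisymm (key g H)
  have := key g⁻¹ (conjSub g H)
  rw [conjSub_conjSub, inv_mul_cancel, conjSub_one, conjSub_le_iff, inv_inv] at this
  exact this

theorem normalizer_le_pCore {G : Type*} [Group G] [Finite G] (p : ℕ) {g : G} {H : Subgroup G}
    (h : g ∈ normalizer (H : Set G)) : g ∈ normalizer (pCore p H : Set G) := by
  rw [mem_normalizer_iff_conjSub] at *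
  rw [conjSub_pCore, h]

end

section

open Subgroup
open scoped commutatorElement

/-! ### Subgroups covering a quotient -/

/-- `H` covers the quotient by `V`. -/
def Cov {G : Type*} [Group G] (V H : Subgroup G) : Prop := ∀ g : G, ∃ v ∈ V, g * v ∈ H

theorem Cov.mono {G : Type*} [Group G] {V H K : Subgroup G} (h : Cov V H) (hK : H ≤ K) :
    Cov V K := fun g => by
  obtain ⟨v, hv, h1⟩ := h g
  exact ⟨v, hv, hK h1⟩

theorem cov_iff_map {G : Type*} [Group G] {V H : Subgroup G} [V.Normal] :
    Cov V H ↔ H.map (QuotientGroup.mk' V) = ⊤ := by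
  constructor
  · intro h
    rw [eq_top_iff]
    rintro x -
    obtain ⟨g, rfl⟩ := QuotientGroup.mk'_surjective V x
    obtain ⟨v, hv, h1⟩ := h g
    refine ⟨_, h1, ?_⟩
    rw [map_mul, (QuotientGroup.eq_one_iff v).2 hv |> fun h => (h : QuotientGroup.mk' V v = 1),
      mul_one]
  · intro h g
    have : QuotientGroup.mk' V g ∈ H.map (QuotientGroup.mk' V) := by rw [h]; trivial
    obtain ⟨x, hx, hxg⟩ := this
    refine ⟨g⁻¹ * x, ?_, by simpa using hx⟩
    exact QuotientGroup.eq.1 (hxg.symm : (g : G ⧸ V) = x)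

theorem cov_iff_sup {G : Type*} [Group G] {V H : Subgroup G} [V.Normal] :
    Cov V H ↔ H ⊔ V = ⊤ := by
  rw [cov_iff_map]
  constructor
  · intro h
    have := Subgroup.comap_map_eq (QuotientGroup.mk' V) H
    rw [h, QuotientGroup.ker_mk', Subgroup.comap_top] at this
    exact this.symm
  · intro h
    have : (H ⊔ V).map (QuotientGroup.mk' V) = ⊤ := by
      rw [h, ← MonoidHom.range_eq_map, MonoidHom.range_eq_top]
      exact QuotientGroup.mk'_surjective V
    rw [Subgroup.map_sup, QuotientGroup.map_mk'_self, sup_bot_eq] at this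
    exact this

theorem Cov.commutator {G : Type*} [Group G] {V X Y : Subgroup G} [V.Normal]
    (hp : Cov V (_root_.commutator G)) (hX : Cov V X) (hY : Cov V Y) : Cov V ⁅X, Y⁆ := by
  rw [cov_iff_map] at *
  rw [Subgroup.map_commutator, hX, hY]
  rw [_root_.commutator_def, Subgroup.map_commutator] at hp
  rw [eq_top_iff]
  exact hp.ge.trans (Subgroup.commutator_mono le_top le_top)

theorem Cov.exists_mem {G : Type*} [Group G] {V H C : Subgroup G} (h : Cov V H) (hH : H ≤ C)
    {g : G} (hg : g ∈ C) : ∃ v ∈ V, v ∈ C ∧ g * v ∈ H := by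
  obtain ⟨v, hv, h1⟩ := h g
  refine ⟨v, hv, ?_, h1⟩
  have := C.mul_mem (C.inv_mem hg) (hH h1)
  simpa using this

theorem normalizer_inf {G : Type*} [Group G] [Finite G] {g : G} {W U : Subgroup G}
    (hg : g ∈ normalizer (W : Set G)) (hg' : g ∈ normalizer (U : Set G)) :
    g ∈ normalizer ((W ⊓ U : Subgroup G) : Set G) := by
  apply mem_normalizer_of_conj
  intro x hx
  exact ⟨conj_mem_of_mem_normalizer hg hx.1, conj_mem_of_mem_normalizer hg' hx.2⟩

theorem mem_normalizer_of_normal {G : Type*} [Group G] {V : Subgroup G} [V.Normal] (g : G) :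
    g ∈ normalizer (V : Set G) := by
  rw [Subgroup.normalizer_eq_top]; trivial

theorem centralizer_le_normalizer' {G : Type*} [Group G] {W : Subgroup G} :
    centralizer (W : Set G) ≤ normalizer (W : Set G) := by
  intro g hg
  rw [mem_centralizer_iff] at hg
  rw [Subgroup.mem_normalizer_iff]
  intro h
  constructor
  · intro hh
    rw [← hg h hh]; simpa using hh
  · intro hh
    have h1 := hg _ hh
    have : h = g * h * g⁻¹ := by
      have h2 : g * h * g⁻¹ * g = g * (g * h * g⁻¹) := h1
      have h3 : g * h = g * (g * h * g⁻¹) := by rw [← h2]; group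
      exact mul_left_cancel h3
    rw [this]; exact hh

theorem commutator_centralizes {G : Type*} [Group G] {U : Subgroup G} {x y : G}
    (hx : x ∈ centralizer (U : Set G)) (hy : y ∈ normalizer (U : Set G)) :
    ⁅x, y⁆ ∈ centralizer (U : Set G) := by
  rw [mem_centralizer_iff] at *
  intro u hu
  have h1 := hx _ (conj_mem_of_mem_normalizer' hy hu)
  have h2 := hx _ hu
  rw [commutatorElement_def]
  calc u * (x * y * x⁻¹ * y⁻¹) = (u * x) * y * x⁻¹ * y⁻¹ := by group
    _ = x * y * (y⁻¹ * u * y) * x⁻¹ * y⁻¹ := by rw [h2]; group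
    _ = x * y * x⁻¹ * (x * (y⁻¹ * u * y)) * x⁻¹ * y⁻¹ := by group
    _ = x * y * x⁻¹ * y⁻¹ * u := by rw [← h1]; group

/-! ### The hypotheses of the covering theorem -/

/-- The hypotheses of the covering theorem `XHyp.concl`. -/
structure XHyp {G : Type*} [Group G] (p : ℕ) (V : Subgroup G) : Prop where
  perf : Cov V (commutator G)
  cent : ∀ r : ℕ, r.Prime → r ≠ p → ∀ W ≤ V, IsPGroup r W → Cov V (centralizer (W : Set G))
  div : ∀ B : Subgroup G, B.Normal → V ≤ B → B ≠ ⊤ → ∀ q : ℕ, q.Prime → q ≠ p →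
    q ∣ Nat.card V → q ∣ B.index

/-- The conclusion of the covering theorem. -/
def XConcl {G : Type*} [Group G] (p : ℕ) (V : Subgroup G) : Prop :=
  ∃ O ≤ V, V ≤ normalizer (O : Set G) ∧ IsPGroup p O ∧ ∀ g : G, ∃ v ∈ V, ∀ x ∈ V, ⁅x, g * v⁆ ∈ O

namespace XHyp

theorem glue {G : Type*} [Group G] [Finite G] {p : ℕ} {V : Subgroup G} [V.Normal]
    (h : XHyp p V) {r t : ℕ} (hr : r.Prime) (ht : t.Prime) (hrp : r ≠ p) (htp : t ≠ p)
    {U W : Subgroup G} (hU : U ≤ V) (hW : W ≤ V) (hUr : IsPGroup r U) (hWt : IsPGroup t W)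
    (hUW : W ≤ centralizer (U : Set G)) :
    Cov V (centralizer (U : Set G) ⊓ centralizer (W : Set G)) := by
  have := Fact.mk hr
  have := Fact.mk ht
  by_cases hrt : t = r
  · subst hrt
    have h1 : IsPGroup t (U ⊔ W : Subgroup G) :=
      IsPGroup.to_sup_of_normal_left' hUr hWt (hUW.trans centralizer_le_normalizer')
    refine (h.cent t ht htp _ (sup_le hU hW) h1).mono ?_
    exact le_inf (centralizer_le (SetLike.coe_subset_coe.2 le_sup_left))
      (centralizer_le (SetLike.coe_subset_coe.2 le_sup_right))
  obtain ⟨W', hW', hWW'⟩ := IsSylIn.exists_ge (le_inf hW hUW) hWt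
  have hUW' : U ≤ centralizer (W' : Set G) := by
    rw [Subgroup.le_centralizer_iff]; exact hW'.1.trans inf_le_right
  obtain ⟨U', hU', hUU'⟩ := IsSylIn.exists_ge (le_inf hU hUW') hUr
  have hW'2 : IsSylIn t W' (V ⊓ centralizer (U' : Set G)) := by
    refine hW'.mono (le_inf (hW'.1.trans inf_le_left) ?_)
      (inf_le_inf_left _ (centralizer_le (SetLike.coe_subset_coe.2 hUU')))
    rw [Subgroup.le_centralizer_iff]; exact hU'.1.trans inf_le_right
  have key : ∀ (a b : ℕ) (A B : Subgroup G), a.Prime → b.Prime → a ≠ p → IsPGroup a A → A ≤ V →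
      IsSylIn b B (V ⊓ centralizer (A : Set G)) →
      Cov V (centralizer (A : Set G) ⊓ normalizer (B : Set G)) := by
    intro a b A B ha hb hap hA hAV hB g
    have := Fact.mk hb
    obtain ⟨v, hv, h1⟩ := h.cent a ha hap A hAV hA g
    obtain ⟨v', hv', h2⟩ := hB.frattini (g := g * v)
      (normalizer_inf (mem_normalizer_of_normal _) (Subgroup.le_normalizer h1))
    refine ⟨v * v', V.mul_mem hv hv'.1, ?_⟩
    rw [← mul_assoc]
    exact ⟨mul_mem h1 hv'.2, h2⟩
  have hX := key r t U' W' hr ht hrp hU'.2.1 (hU'.1.trans inf_le_left) hW'2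
  have hX' := key t r W' U' ht hr htp hW'.2.1 (hW'.1.trans inf_le_left) hU'
  refine (Cov.commutator h.perf hX hX').mono ?_
  rw [Subgroup.commutator_le]
  intro x hx y hy
  constructor
  · exact centralizer_le (SetLike.coe_subset_coe.2 hUU') (commutator_centralizes hx.1 hy.2)
  · have := commutator_centralizes hy.1 hx.2
    have h2 := inv_mem this
    rw [commutatorElement_inv] at h2
    exact centralizer_le (SetLike.coe_subset_coe.2 hWW') h2

theorem restrict {G : Type*} [Group G] [Finite G] {p : ℕ} {V : Subgroup G} [V.Normal]
    (h : XHyp p V) {r : ℕ} (hr : r.Prime) (hrp : r ≠ p) {U : Subgroup G} (hU : U ≤ V)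
    (hUr : IsPGroup r U) :
    XHyp p (V.subgroupOf (centralizer (U : Set G))) := by
  set C := centralizer (U : Set G) with hC
  have hCV : Cov V C := h.cent r hr hrp U hU hUr
  have hdvd : Nat.card (V.subgroupOf C) ∣ Nat.card V :=
    Subgroup.card_comap_dvd_of_injective _ _ C.subtype_injective
  refine ⟨?_, ?_, ?_⟩
  · rintro ⟨c, hc⟩
    have h1 := Cov.commutator h.perf hCV hCV
    obtain ⟨v, hv, hvC, hv2⟩ := h1.exists_mem (C := C)
      (Subgroup.commutator_le_self C) hc
    refine ⟨⟨v, hvC⟩, hv, ?_⟩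
    rw [← Subgroup.map_subtype_commutator] at hv2
    obtain ⟨y, hy, hy2⟩ := hv2
    have : (⟨c, hc⟩ * ⟨v, hvC⟩ : C) = y := Subtype.ext hy2.symm
    rw [this]; exact hy
  · intro t ht htp W hW hWt
    have h1 := h.glue hr ht hrp htp (U := U) (W := W.map C.subtype) hU (by
      rintro _ ⟨w, hw, rfl⟩; exact hW hw) hUr (hWt.map _) (by
      rintro _ ⟨w, hw, rfl⟩; exact w.2)
    rintro ⟨c, hc⟩
    obtain ⟨v, hv, hvC, hv2⟩ := h1.exists_mem (C := C) inf_le_left hc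
    refine ⟨⟨v, hvC⟩, hv, ?_⟩
    rw [mem_centralizer_iff]
    intro w hw
    exact Subtype.ext ((mem_centralizer_iff.1 hv2.2) w ⟨w, hw, rfl⟩)
  · intro B hB hVB hBt q hq hqp hqV
    have hcomap : (B.map C.subtype ⊔ V).subgroupOf C = B := by
      ext c
      rw [Subgroup.mem_subgroupOf, Subgroup.mem_sup_of_normal_right]
      constructor
      · rintro ⟨_, ⟨b, hb, rfl⟩, v, hv, hbv⟩
        have : b⁻¹ * c ∈ B := hVB (by
          rw [Subgroup.mem_subgroupOf]
          have : ((b⁻¹ * c : C) : G) = v := by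
            rw [Subgroup.coe_mul, ← hbv]; simp
          rw [this]; exact hv)
        simpa using B.mul_mem hb this
      · intro hc
        exact ⟨c, ⟨c, hc, rfl⟩, 1, V.one_mem, by simp⟩
    have hn : (B.map C.subtype ⊔ V).Normal := by
      rw [← Subgroup.normalizer_eq_top_iff, eq_top_iff, ← cov_iff_sup.1 hCV, sup_le_iff]
      constructor
      · intro c hc
        refine normalizer_sup_le ?_ (mem_normalizer_of_normal c)
        apply mem_normalizer_of_conj
        rintro _ ⟨b, hb, rfl⟩
        exact ⟨_, hB.conj_mem b hb ⟨c, hc⟩, rfl⟩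
      · exact le_sup_right.trans le_normalizer
    have hidx : (B.map C.subtype ⊔ V).index = B.index := by
      conv_rhs => rw [← hcomap]
      change _ = Subgroup.relIndex _ _
      rw [← Subgroup.relIndex_sup_right]
      have : C ⊔ (B.map C.subtype ⊔ V) = ⊤ := by
        rw [eq_top_iff, ← cov_iff_sup.1 hCV]
        exact sup_le_sup_left le_sup_right _
      rw [this, Subgroup.relIndex_top_right]
    rw [← hidx]
    refine h.div _ hn le_sup_right ?_ q hq hqp (hqV.trans hdvd)
    intro htop
    apply hBt
    rw [← hcomap, htop]; simp

end XHyp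

/-- The elements normalising `O` and centralising `V` modulo `O`. -/
def zMod {G : Type*} [Group G] (V O : Subgroup G) : Subgroup G where
  carrier := {g | g ∈ normalizer (O : Set G) ∧ ∀ x ∈ V, ⁅x, g⁆ ∈ O}
  one_mem' := ⟨one_mem _, fun x _ => by simp⟩
  mul_mem' := by
    rintro a b ⟨ha, ha'⟩ ⟨hb, hb'⟩
    refine ⟨mul_mem ha hb, fun x hx => ?_⟩
    rw [commutatorElement_mul_right_eq_mul_conj]
    have := O.mul_mem (ha' x hx) (conj_mem_of_mem_normalizer ha (hb' x hx))
    simpa [mul_assoc] using this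
  inv_mem' := by
    rintro a ⟨ha, ha'⟩
    refine ⟨inv_mem ha, fun x hx => ?_⟩
    rw [commutatorElement_inv_right, ← commutatorElement_inv]
    exact conj_mem_of_mem_normalizer' ha (O.inv_mem (ha' x hx))

/-- A `p`-subgroup of a quotient lifts to a `p`-subgroup. -/
theorem exists_isPGroup_map_eq {G H : Type*} [Group G] [Group H] [Finite G] {f : G →* H}
    (hf : Function.Surjective f) {r : ℕ} [Fact r.Prime] {U : Subgroup H} (hU : IsPGroup r U) :
    ∃ R : Subgroup G, IsPGroup r R ∧ R.map f = U := by
  let f' := f.subgroupComap U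
  have hf' : Function.Surjective f' := by
    rintro ⟨u, hu⟩
    obtain ⟨g, rfl⟩ := hf u
    exact ⟨⟨g, hu⟩, rfl⟩
  obtain ⟨P⟩ : Nonempty (Sylow r (U.comap f)) := inferInstance
  have h1 : ((P.mapSurjective hf' : Sylow r U) : Subgroup U) = ⊤ := by
    have := (P.mapSurjective hf').is_maximal' (Q := ⊤) (hU.of_equiv Subgroup.topEquiv.symm) le_top
    exact this.symm
  rw [Sylow.coe_mapSurjective] at h1
  refine ⟨(P : Subgroup _).map (U.comap f).subtype, P.isPGroup'.map _, ?_⟩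
  apply le_antisymm
  · rintro _ ⟨_, ⟨x, hx, rfl⟩, rfl⟩
    exact x.2
  · intro u hu
    have : (⟨u, hu⟩ : U) ∈ (P : Subgroup _).map f' := by rw [h1]; trivial
    obtain ⟨x, hx, hxu⟩ := this
    exact ⟨x, ⟨x, hx, rfl⟩, congrArg Subtype.val hxu⟩

theorem normal_of_forall_mem_normalizer {G : Type*} [Group G] {O : Subgroup G}
    (h : ∀ g, g ∈ normalizer (O : Set G)) : O.Normal := by
  rw [← Subgroup.normalizer_eq_top_iff, eq_top_iff]
  exact fun g _ => h g

instance pCore_normal {G : Type*} [Group G] [Finite G] {p : ℕ} {V : Subgroup G} [V.Normal] :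
    (pCore p V).Normal :=
  normal_of_forall_mem_normalizer fun _ => normalizer_le_pCore p (mem_normalizer_of_normal _)

theorem XConcl.cov {G : Type*} [Group G] [Finite G] {p : ℕ} {V : Subgroup G} [V.Normal]
    (h : XConcl p V) : Cov V (zMod V (pCore p V)) := by
  obtain ⟨O, hO, hVO, hOp, hc⟩ := h
  intro g
  obtain ⟨v, hv, h1⟩ := hc g
  exact ⟨v, hv, mem_normalizer_of_normal _, fun x hx => le_pCore hO hVO hOp (h1 x hx)⟩

namespace XHyp

theorem map_central {G : Type*} [Group G] [Finite G] {p : ℕ} {V W : Subgroup G} [V.Normal]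
    [W.Normal] (h : XHyp p V) (hWV : W ≤ V) : XHyp p (V.map (QuotientGroup.mk' W)) := by
  have hs := QuotientGroup.mk'_surjective W
  have hcov : ∀ H : Subgroup G, Cov V H →
      Cov (V.map (QuotientGroup.mk' W)) (H.map (QuotientGroup.mk' W)) := by
    intro H hH x
    obtain ⟨g, rfl⟩ := hs x
    obtain ⟨v, hv, h1⟩ := hH g
    exact ⟨_, ⟨v, hv, rfl⟩, g * v, h1, by simp⟩
  refine ⟨?_, ?_, ?_⟩
  · refine (hcov _ h.perf).mono ?_
    rw [_root_.commutator_def, Subgroup.map_commutator, _root_.commutator_def]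
    exact Subgroup.commutator_mono le_top le_top
  · intro r hr hrp U hU hUr
    have := Fact.mk hr
    obtain ⟨R, hR, rfl⟩ := exists_isPGroup_map_eq hs hUr
    have hRV : R ≤ V := by
      intro x hx
      obtain ⟨v, hv, hvx⟩ := hU ⟨x, hx, rfl⟩
      have : v⁻¹ * x ∈ W := QuotientGroup.eq.1 hvx
      simpa using V.mul_mem hv (hWV this)
    refine (hcov _ (h.cent r hr hrp R hRV hR)).mono ?_
    rintro _ ⟨c, hc, rfl⟩
    rw [mem_centralizer_iff]
    rintro _ ⟨x, hx, rfl⟩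
    rw [← map_mul, ← map_mul, mem_centralizer_iff.1 hc x hx]
  · intro B hB hVB hBt q hq hqp hqV
    rw [← Subgroup.index_comap_of_surjective B hs]
    refine h.div _ inferInstance ?_ ?_ q hq hqp (hqV.trans (Subgroup.card_map_dvd _ _))
    · rwa [← Subgroup.map_le_iff_le_comap]
    · intro ht
      apply hBt
      rw [← Subgroup.map_comap_eq_self_of_surjective hs B, ht, ← MonoidHom.range_eq_map,
        MonoidHom.range_eq_top.2 hs]

theorem concl_of_central {G : Type*} [Group G] [Finite G] {p : ℕ} [Fact p.Prime]
    {V W : Subgroup G} [V.Normal]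
    [W.Normal] (h : XHyp p V) (hWV : W ≤ V) (hWc : W ≤ center G)
    (hX : XConcl p (V.map (QuotientGroup.mk' W))) : XConcl p V := by
  have hs := QuotientGroup.mk'_surjective W
  set f := QuotientGroup.mk' W with hf
  have : (V.map f).Normal := Subgroup.Normal.map inferInstance f hs
  have hcov := hX.cov
  set Ō := pCore p (V.map f) with hŌ
  obtain ⟨O', hO'0, hO'm⟩ := exists_isPGroup_map_eq hs (isPGroup_pCore p (V.map f))
  have hO1 : Ō.comap f ≤ V := by
    intro x hx
    obtain ⟨v, hv, hvx⟩ := pCore_le p _ hx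
    have : v⁻¹ * x ∈ W := QuotientGroup.eq.1 hvx
    simpa using V.mul_mem hv (hWV this)
  have hO'1 : O' ≤ Ō.comap f := by
    rw [← Subgroup.map_le_iff_le_comap, hO'm]
  obtain ⟨O, hO, hO'O⟩ := IsSylIn.exists_ge hO'1 hO'0
  have hdec : ∀ x ∈ Ō.comap f, ∃ o ∈ O, ∃ w ∈ W, x = o * w := by
    intro x hx
    have : f x ∈ O'.map f := by rw [hO'm]; exact hx
    obtain ⟨o, ho, hox⟩ := this
    exact ⟨o, hO'O ho, o⁻¹ * x, QuotientGroup.eq.1 hox, by simp⟩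
  have hn : ∀ g : G, g ∈ normalizer (O : Set G) := by
    intro g
    obtain ⟨v, hv, h1⟩ := hO.frattini (g := g) (mem_normalizer_of_normal g)
    have hvn : v ∈ normalizer (O : Set G) := by
      obtain ⟨o, ho, w, hw, rfl⟩ := hdec v hv
      refine mul_mem (le_normalizer ho) ?_
      apply mem_normalizer_of_conj
      intro x hx
      have := Subgroup.mem_center_iff.1 (hWc hw) x
      rw [← this]; simpa using hx
    have := mul_mem h1 (inv_mem hvn)
    simpa using this
  have hON : O.Normal := normal_of_forall_mem_normalizer hn
  refine ⟨O, hO.1.trans hO1, fun g _ => hn g, hO.2.1, ?_⟩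
  set B := (zMod (V.map f) Ō).comap f with hB
  have hBc : Cov V B := by
    intro g
    obtain ⟨_, ⟨v, hv, rfl⟩, h1⟩ := hcov (f g)
    exact ⟨v, hv, by rw [hB, Subgroup.mem_comap, map_mul]; exact h1⟩
  let k := QuotientGroup.mk' O
  have hWk : W.map k ≤ center (G ⧸ O) := by
    rintro _ ⟨w, hw, rfl⟩
    rw [Subgroup.mem_center_iff]
    intro x
    obtain ⟨g, rfl⟩ := QuotientGroup.mk'_surjective O x
    rw [← map_mul, ← map_mul, Subgroup.mem_center_iff.1 (hWc hw) g]
  have h1 : ⁅V.map k, B.map k⁆ ≤ center (G ⧸ O) := by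
    rw [Subgroup.commutator_le]
    rintro _ ⟨v, hv, rfl⟩ _ ⟨b, hb, rfl⟩
    rw [← map_commutatorElement]
    have : ⁅v, b⁆ ∈ Ō.comap f := by
      rw [Subgroup.mem_comap, map_commutatorElement]
      exact hb.2 _ ⟨v, hv, rfl⟩
    obtain ⟨o, ho, w, hw, he⟩ := hdec _ this
    rw [he, map_mul]
    have h2 : k o = 1 := (QuotientGroup.eq_one_iff o).2 ho
    rw [h2, one_mul]
    exact hWk ⟨w, hw, rfl⟩
  have h2 : ⁅⁅B.map k, B.map k⁆, V.map k⁆ = ⊥ := by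
    have h3 : ⁅center (G ⧸ O), B.map k⁆ = ⊥ := by
      rw [Subgroup.commutator_eq_bot_iff_le_centralizer]
      exact Subgroup.center_le_centralizer _
    apply Subgroup.commutator_commutator_eq_bot_of_rotate
    · rw [Subgroup.commutator_comm (B.map k) (V.map k), eq_bot_iff, ← h3]
      exact Subgroup.commutator_mono h1 le_rfl
    · rw [eq_bot_iff, ← h3]
      exact Subgroup.commutator_mono h1 le_rfl
  intro g
  obtain ⟨v, hv, h3⟩ := Cov.commutator h.perf hBc hBc g
  refine ⟨v, hv, fun x hx => ?_⟩
  rw [← QuotientGroup.eq_one_iff]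
  change k ⁅x, g * v⁆ = 1
  rw [map_commutatorElement, ← commutatorElement_inv, inv_eq_one, ← Subgroup.mem_bot, ← h2]
  refine Subgroup.commutator_mem_commutator ?_ (Subgroup.mem_map_of_mem k hx)
  rw [← Subgroup.map_commutator]
  exact Subgroup.mem_map_of_mem k h3

end XHyp

/-- A nontrivial element of `V` of prime power order, the prime being different from `p`. -/
def Good {G : Type*} [Group G] (p : ℕ) (V : Subgroup G) (s : G) : Prop :=
  s ∈ V ∧ s ≠ 1 ∧ ∃ r : ℕ, r.Prime ∧ r ≠ p ∧ PEl r s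

/-- `O_p` of the centraliser of `s` in `V`. -/
def oLoc {G : Type*} [Group G] (p : ℕ) (V : Subgroup G) (s : G) : Subgroup G :=
  pCore p (V ⊓ centralizer {s})

/-- A system of canonical `q`-elements attached to the good elements of `V`. -/
structure CanData {G : Type*} [Group G] (p q : ℕ) (V : Subgroup G) (x₀ : G) where
  can : G → Set G
  nonempty : ∀ s, Good p V s → (can s).Nonempty
  comm : ∀ s, ∀ y ∈ can s, y * s = s * y
  pel : ∀ s, ∀ y ∈ can s, PEl q y
  coset : ∀ s, ∀ y ∈ can s, x₀⁻¹ * y ∈ V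
  zmod : ∀ s, ∀ y ∈ can s, ∀ x ∈ V, x * s = s * x → ⁅x, y⁆ ∈ oLoc p V s
  diff : ∀ s, ∀ y ∈ can s, ∀ y' ∈ can s, y⁻¹ * y' ∈ oLoc p V s
  conj : ∀ s, ∀ y ∈ can s, ∀ v ∈ V, v * y * v⁻¹ ∈ can (v * s * v⁻¹)
  trans : ∀ s, Good p V s → ∀ s', Good p V s' → s * s' = s' * s →
    ∀ y ∈ can s, y * s' = s' * y → y ∈ can s'

/-- The subgroup centralising `s` and centralising `C_V(s)` modulo its `p`-core. -/
def zLoc {G : Type*} [Group G] (p : ℕ) (V : Subgroup G) (s : G) : Subgroup G :=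
  zMod (V ⊓ centralizer {s}) (oLoc p V s) ⊓ centralizer {s}

section

variable {G : Type*} [Group G] [Finite G] {p : ℕ} {V : Subgroup G}

omit [Finite G] in
theorem mem_cent {s x : G} : x ∈ centralizer {s} ↔ x * s = s * x := by
  rw [Subgroup.mem_centralizer_singleton_iff]

omit [Finite G] in
theorem conjSub_centralizer (v s : G) :
    conjSub v (centralizer {s}) = centralizer {v * s * v⁻¹} := by
  ext x
  rw [mem_conjSub, mem_cent, mem_cent]
  constructor
  · intro h
    have : x * (v * s * v⁻¹) = v * (v⁻¹ * x * v * s) * v⁻¹ := by group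
    rw [this, h]; group
  · intro h
    have : v⁻¹ * x * v * s = v⁻¹ * (x * (v * s * v⁻¹)) * v := by group
    rw [this, h]; group

theorem conjSub_inf {G : Type*} [Group G] (v : G) (H K : Subgroup G) :
    conjSub v (H ⊓ K) = conjSub v H ⊓ conjSub v K := by
  ext x; simp only [mem_conjSub, Subgroup.mem_inf]

theorem conjSub_oLoc [V.Normal] (v s : G) :
    conjSub v (oLoc p V s) = oLoc p V (v * s * v⁻¹) := by
  rw [oLoc, conjSub_pCore, conjSub_inf, conjSub_normal v V, conjSub_centralizer, oLoc]

theorem oLoc_le_left (s : G) : oLoc p V s ≤ V := (pCore_le _ _).trans inf_le_left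

theorem oLoc_comm {s x : G} (h : x ∈ oLoc p V s) : x * s = s * x :=
  mem_cent.1 (pCore_le _ _ h).2

theorem isPGroup_oLoc (s : G) : IsPGroup p (oLoc p V s) := isPGroup_pCore _ _

theorem normalizer_oLoc [V.Normal] {s x : G} (h : x * s = s * x) :
    x ∈ normalizer (oLoc p V s : Set G) :=
  normalizer_le_pCore p (normalizer_inf (mem_normalizer_of_normal _)
    (le_normalizer (mem_cent.2 h)))

theorem mem_zLoc [V.Normal] {s g : G} : g ∈ zLoc p V s ↔
    g * s = s * g ∧ ∀ x ∈ V, x * s = s * x → ⁅x, g⁆ ∈ oLoc p V s := by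
  constructor
  · rintro ⟨h1, h2⟩
    exact ⟨mem_cent.1 h2, fun x hx hxs => h1.2 x ⟨hx, mem_cent.2 hxs⟩⟩
  · rintro ⟨h1, h2⟩
    exact ⟨⟨normalizer_oLoc h1, fun x hx => h2 x hx.1 (mem_cent.1 hx.2)⟩, mem_cent.2 h1⟩

theorem oLoc_le_zLoc [V.Normal] (s : G) : oLoc p V s ≤ zLoc p V s := by
  intro x hx
  rw [mem_zLoc]
  refine ⟨oLoc_comm hx, fun y _ hys => ?_⟩
  rw [commutatorElement_def]
  exact mul_mem (conj_mem_of_mem_normalizer (normalizer_oLoc hys) hx) (inv_mem hx)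

theorem zLoc_conj [V.Normal] {s g v : G} (hv : v ∈ V) (h : g ∈ zLoc p V s) :
    v * g * v⁻¹ ∈ zLoc p V (v * s * v⁻¹) := by
  rw [mem_zLoc] at *
  constructor
  · have : v * g * v⁻¹ * (v * s * v⁻¹) = v * (g * s) * v⁻¹ := by group
    rw [this, h.1]; group
  · intro x hx hxs
    rw [← conjSub_oLoc, mem_conjSub]
    have h1 := h.2 (v⁻¹ * x * v) (V.mul_mem (V.mul_mem (V.inv_mem hv) hx) hv) (by
      have : v⁻¹ * x * v * s = v⁻¹ * (x * (v * s * v⁻¹)) * v := by group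
      rw [this, hxs]; group)
    convert h1 using 1
    simp only [commutatorElement_def]; group

/-- A lift of the evaluation homomorphism `FreeGroup G →* G` modulo `V`, with values in `H`. -/
def IsLift (V H : Subgroup G) (ρ : FreeGroup G →* G) : Prop :=
  ∀ x : G, ρ (FreeGroup.of x) ∈ H ∧ x⁻¹ * ρ (FreeGroup.of x) ∈ V

omit [Finite G] in
theorem IsLift.mono {H K : Subgroup G} {ρ : FreeGroup G →* G} (h : IsLift V H ρ) (hK : H ≤ K) :
    IsLift V K ρ := fun x => ⟨hK (h x).1, (h x).2⟩

omit [Finite G] in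
theorem exists_isLift {H : Subgroup G} (h : Cov V H) : ∃ ρ, IsLift V H ρ := by
  choose f hf hfH using h
  refine ⟨FreeGroup.lift fun x => x * f x, fun x => ?_⟩
  simp only [FreeGroup.lift_apply_of]
  exact ⟨hfH x, by simpa using hf x⟩

omit [Finite G] in
theorem IsLift.mem {H : Subgroup G} {ρ : FreeGroup G →* G} (h : IsLift V H ρ)
    (w : FreeGroup G) : ρ w ∈ H := by
  have : (⊤ : Subgroup (FreeGroup G)) ≤ H.comap ρ := by
    rw [← FreeGroup.closure_range_of, Subgroup.closure_le]
    rintro _ ⟨x, rfl⟩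
    exact (h x).1
  exact this trivial

omit [Finite G] in
theorem IsLift.coset [V.Normal] {H : Subgroup G} {ρ : FreeGroup G →* G} (h : IsLift V H ρ)
    (w : FreeGroup G) : (FreeGroup.lift id w)⁻¹ * ρ w ∈ V := by
  rw [← QuotientGroup.eq]
  have : (QuotientGroup.mk' V).comp (FreeGroup.lift id) = (QuotientGroup.mk' V).comp ρ := by
    ext x
    simp only [MonoidHom.comp_apply, FreeGroup.lift_apply_of, id]
    exact QuotientGroup.eq.2 (h x).2
  exact DFunLike.congr_fun this w

omit [Finite G] in
theorem IsLift.conj {H : Subgroup G} [V.Normal] {ρ : FreeGroup G →* G} (h : IsLift V H ρ) {v : G}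
    (hv : v ∈ V) : IsLift V (conjSub v H) ((MulAut.conj v).toMonoidHom.comp ρ) := by
  intro x
  refine ⟨⟨_, (h x).1, rfl⟩, ?_⟩
  have h1 : x⁻¹ * (v * ρ (FreeGroup.of x) * v⁻¹) =
    (x⁻¹ * v * x) * (x⁻¹ * ρ (FreeGroup.of x)) * v⁻¹ := by group
  change x⁻¹ * (v * ρ (FreeGroup.of x) * v⁻¹) ∈ V
  rw [h1]
  have h2 : x⁻¹ * v * x ∈ V := by
    simpa using (inferInstance : V.Normal).conj_mem v hv x⁻¹
  exact V.mul_mem (V.mul_mem h2 (h x).2) (V.inv_mem hv)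

omit [Finite G] in
theorem IsLift.compare [V.Normal] {H O : Subgroup G} (hHO : H ≤ normalizer (O : Set G))
    (hc : ∀ x ∈ V, x ∈ H → ∀ h ∈ H, ⁅x, h⁆ ∈ O) {ρ ρ' : FreeGroup G →* G}
    (h : IsLift V H ρ) (h' : IsLift V H ρ') {w : FreeGroup G} (hw : w ∈ commutator (FreeGroup G)) :
    (ρ w)⁻¹ * ρ' w ∈ O := by
  have hn : (O.subgroupOf H).Normal := by
    refine ⟨fun n hn g => ?_⟩
    rw [Subgroup.mem_subgroupOf] at *
    exact conj_mem_of_mem_normalizer (hHO g.2) hn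
  let a : FreeGroup G →* H := ρ.codRestrict H h.mem
  let b : FreeGroup G →* H := ρ'.codRestrict H h'.mem
  let k := QuotientGroup.mk' (O.subgroupOf H)
  have hz : ∀ f, ∀ x : H ⧸ O.subgroupOf H, (k (a f))⁻¹ * k (b f) * x
      = x * ((k (a f))⁻¹ * k (b f)) := by
    intro f x
    obtain ⟨y, rfl⟩ := QuotientGroup.mk'_surjective _ x
    rw [← commutatorElement_eq_one_iff_mul_comm, ← map_inv, ← map_mul]
    change ⁅k _, k y⁆ = 1
    rw [← map_commutatorElement]
    apply (QuotientGroup.eq_one_iff _).2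
    rw [Subgroup.mem_subgroupOf]
    have h1 := hc ((ρ f)⁻¹ * ρ' f) (by
      have := V.mul_mem (V.inv_mem (h.coset f)) (h'.coset f)
      simpa [mul_assoc] using this) (mul_mem (inv_mem (h.mem f)) (h'.mem f)) y y.2
    exact h1
  have hle : commutator (FreeGroup G) ≤ MonoidHom.eqLocus (k.comp a) (k.comp b) := by
    rw [_root_.commutator_def, Subgroup.commutator_le]
    intro f _ g _
    change (k.comp a) _ = (k.comp b) _
    rw [map_commutatorElement, map_commutatorElement]
    simp only [MonoidHom.comp_apply]
    have hf := hz f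
    have hg := hz g
    obtain ⟨z, hzf⟩ : ∃ z, (k (a f))⁻¹ * k (b f) = z := ⟨_, rfl⟩
    obtain ⟨z', hzg⟩ : ∃ z, (k (a g))⁻¹ * k (b g) = z := ⟨_, rfl⟩
    rw [hzf] at hf
    rw [hzg] at hg
    rw [inv_mul_eq_iff_eq_mul] at hzf hzg
    rw [hzf, hzg]
    generalize k (a f) = A at *
    generalize k (a g) = B at *
    simp only [commutatorElement_def, mul_inv_rev]
    have e1 : A * z * (B * z') * (z⁻¹ * A⁻¹) * (z'⁻¹ * B⁻¹)
      = A * (z * (B * z')) * z⁻¹ * A⁻¹ * z'⁻¹ * B⁻¹ := by group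
    have e2 : A * (B * z' * z) * z⁻¹ * A⁻¹ * z'⁻¹ * B⁻¹ = A * B * (z' * A⁻¹) * z'⁻¹ * B⁻¹ := by group
    rw [e1, hf, e2, hg]; group
  have h1 : k (a w) = k (b w) := hle hw
  have h2 := QuotientGroup.eq.1 h1
  rw [Subgroup.mem_subgroupOf] at h2
  exact h2

theorem exists_mem_zLoc_comm [Fact p.Prime] [V.Normal] {s s' : G} (hs' : Good p V s')
    (hss : s * s' = s' * s) (hc : Cov V (zLoc p V s)) :
    Cov V (zLoc p V s ⊓ centralizer {s'}) := by
  intro g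
  obtain ⟨v, hv, hz⟩ := hc g
  obtain ⟨hs'V, -, t, ht, htp, hts'⟩ := hs'
  have := Fact.mk ht
  have hR : ∀ b ∈ zpowers s', b ∈ V ∧ b * s = s * b := by
    intro b hb
    refine ⟨(zpowers_le.2 hs'V) hb, ?_⟩
    have : zpowers s' ≤ centralizer {s} := zpowers_le.2 (mem_cent.2 hss.symm)
    exact mem_cent.1 (this hb)
  have hz' := mem_zLoc.1 hz
  obtain ⟨o, ho, h1⟩ := exists_fixed_coset htp hts'.zpowers (isPGroup_oLoc (p := p) (V := V) s)
    (fun b hb => normalizer_oLoc (hR b hb).2) (z := g * v) (by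
    intro b hb
    have h2 := hz'.2 b (hR b hb).1 (hR b hb).2
    have h3 := conj_mem_of_mem_normalizer' (normalizer_oLoc hz'.1) h2
    convert h3 using 1
    simp only [commutatorElement_def]; group)
  refine ⟨v * o, V.mul_mem hv (oLoc_le_left _ ho), ?_⟩
  rw [← mul_assoc]
  exact ⟨mul_mem hz (oLoc_le_zLoc _ ho), mem_cent.2 (h1 s' (mem_zpowers s')).symm⟩

/-- The values of `w` on lifts with values in `zLoc p V s`. -/
def canSet (p : ℕ) (V : Subgroup G) (w : FreeGroup G) (s : G) : Set G :=
  {y | ∃ ρ, IsLift V (zLoc p V s) ρ ∧ ρ w = y}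

theorem canSet_conj [V.Normal] {w : FreeGroup G} {s y v : G} (hy : y ∈ canSet p V w s)
    (hv : v ∈ V) : v * y * v⁻¹ ∈ canSet p V w (v * s * v⁻¹) := by
  obtain ⟨ρ, h, rfl⟩ := hy
  refine ⟨_, (h.conj hv).mono ?_, rfl⟩
  intro x hx
  rw [mem_conjSub] at hx
  have := zLoc_conj hv hx
  convert this using 1
  group

theorem canSet_conj' [V.Normal] {w : FreeGroup G} {s y v : G} (hy : y ∈ canSet p V w s)
    (hv : v ∈ V) (hvs : v * s = s * v) : v⁻¹ * y * v ∈ canSet p V w s := by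
  have := canSet_conj hy (V.inv_mem hv)
  rw [inv_inv] at this
  have h2 : v⁻¹ * s * v = s := by rw [mul_assoc, ← hvs]; group
  rwa [h2] at this

theorem canSet_trans [Fact p.Prime] [V.Normal] {q : ℕ} [Fact q.Prime] (hqp : q ≠ p)
    (hc : ∀ s, Good p V s → Cov V (zLoc p V s)) {w : FreeGroup G}
    (hw : w ∈ commutator (FreeGroup G)) (hwq : ∀ ρ : FreeGroup G →* G, PEl q (ρ w))
    {s s' : G} (hs : Good p V s) (hs' : Good p V s') (hss : s * s' = s' * s) {y : G}
    (hy : y ∈ canSet p V w s) (hys : y * s' = s' * y) : y ∈ canSet p V w s' := by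
  obtain ⟨ρ, hρ⟩ := exists_isLift (exists_mem_zLoc_comm hs' hss (hc s hs))
  obtain ⟨ρ', hρ'⟩ := exists_isLift (exists_mem_zLoc_comm hs hss.symm (hc s' hs'))
  set E := V ⊓ centralizer {s} ⊓ centralizer {s'} with hE
  set A := oLoc p V s ⊓ E with hA
  set B := oLoc p V s' ⊓ E with hB
  have hnE : ∀ x, x * s = s * x → x * s' = s' * x → x ∈ normalizer (E : Set G) := fun x h1 h2 =>
    normalizer_inf (normalizer_inf (mem_normalizer_of_normal _) (le_normalizer (mem_cent.2 h1)))
      (le_normalizer (mem_cent.2 h2))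
  have hnA : ∀ x, x * s = s * x → x * s' = s' * x → x ∈ normalizer (A : Set G) := fun x h1 h2 =>
    normalizer_inf (normalizer_oLoc h1) (hnE x h1 h2)
  have hnB : ∀ x, x * s = s * x → x * s' = s' * x → x ∈ normalizer (B : Set G) := fun x h1 h2 =>
    normalizer_inf (normalizer_oLoc h2) (hnE x h1 h2)
  have hEc : ∀ x ∈ E, x ∈ V ∧ x * s = s * x ∧ x * s' = s' * x := fun x hx =>
    ⟨hx.1.1, mem_cent.1 hx.1.2, mem_cent.1 hx.2⟩
  have hAB : A ≤ normalizer (B : Set G) := fun x hx => by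
    obtain ⟨-, h1, h2⟩ := hEc x hx.2
    exact hnB x h1 h2
  have hAp : IsPGroup p A := (isPGroup_oLoc s).to_le inf_le_left
  have hBp : IsPGroup p B := (isPGroup_oLoc s').to_le inf_le_left
  have hABp : IsPGroup p (A ⊔ B : Subgroup G) := IsPGroup.to_sup_of_normal_right' hAp hBp hAB
  set H := zMod E (A ⊔ B) ⊓ centralizer {s} ⊓ centralizer {s'} with hH
  have hEcomm : ∀ x ∈ E, ∀ h, h * s = s * h → h * s' = s' * h → ⁅x, h⁆ ∈ E := fun x hx h h1 h2 => by
    have : ⁅x, h⁆ = x * (h * x⁻¹ * h⁻¹) := by rw [commutatorElement_def]; group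
    rw [this]
    exact E.mul_mem hx (conj_mem_of_mem_normalizer (hnE h h1 h2) (E.inv_mem hx))
  have h1 : IsLift V H ρ := hρ.mono (by
    rintro h ⟨hz, hs'h⟩
    have hz' := mem_zLoc.1 hz
    refine ⟨⟨⟨normalizer_sup_le (hnA h hz'.1 (mem_cent.1 hs'h)) (hnB h hz'.1 (mem_cent.1 hs'h)),
      fun x hx => ?_⟩, hz.2⟩, hs'h⟩
    exact (le_sup_left : A ≤ A ⊔ B) ⟨hz'.2 x (hEc x hx).1 (hEc x hx).2.1,
      hEcomm x hx h hz'.1 (mem_cent.1 hs'h)⟩)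
  have h2 : IsLift V H ρ' := hρ'.mono (by
    rintro h ⟨hz, hs'h⟩
    have hz' := mem_zLoc.1 hz
    refine ⟨⟨⟨normalizer_sup_le (hnA h (mem_cent.1 hs'h) hz'.1) (hnB h (mem_cent.1 hs'h) hz'.1),
      fun x hx => ?_⟩, hs'h⟩, hz.2⟩
    exact (le_sup_right : B ≤ A ⊔ B) ⟨hz'.2 x (hEc x hx).1 (hEc x hx).2.2,
      hEcomm x hx h (mem_cent.1 hs'h) hz'.1⟩)
  have hHn : H ≤ normalizer ((A ⊔ B : Subgroup G) : Set G) := fun h hh => hh.1.1.1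
  have h3 := IsLift.compare hHn (fun x hx hxH h hh => hh.1.1.2 x ⟨⟨hx, hxH.1.2⟩, hxH.2⟩) h1 h2 hw
  obtain ⟨o, ho, h4⟩ := exists_conj_of_coset hqp hABp (hHn (h1.mem w)) h3 (hwq ρ) (hwq ρ')
  rw [← SetLike.mem_coe, Subgroup.coe_mul_of_left_le_normalizer_right _ _ hAB] at ho
  obtain ⟨a, ha, b, hb, rfl⟩ := ho
  have h5 : a⁻¹ * ρ w * a = b * ρ' w * b⁻¹ := by rw [h4]; group
  have h6 : a⁻¹ * ρ w * a ∈ canSet p V w s :=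
    canSet_conj' ⟨ρ, hρ.mono inf_le_left, rfl⟩ (hEc a ha.2).1 (hEc a ha.2).2.1
  have h7 : a⁻¹ * ρ w * a ∈ canSet p V w s' := by
    rw [h5]
    have := canSet_conj' (p := p) (v := b⁻¹) (⟨ρ', hρ'.mono inf_le_left, rfl⟩ : _ ∈ canSet p V w s')
      (V.inv_mem (hEc b hb.2).1) (by
        have := (hEc b hb.2).2.2
        exact (Commute.inv_left (show Commute b s' from this)).eq)
    rwa [inv_inv] at this
  generalize a⁻¹ * ρ w * a = z at *
  obtain ⟨σ, hσ, rfl⟩ := hy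
  obtain ⟨τ, hτ, rfl⟩ := h6
  obtain ⟨τ', hτ', h8⟩ := h7
  have h9 : (σ w)⁻¹ * τ w ∈ oLoc p V s := IsLift.compare (H := zLoc p V s)
    (fun h hh => hh.1.1) (fun x hx hxH h hh => hh.1.2 x ⟨hx, hxH.2⟩) hσ hτ hw
  have h10 : τ w * s' = s' * τ w := by
    rw [← h8]; exact (mem_zLoc.1 (hτ'.mem w)).1
  have h11 : τ w * s = s * τ w := (mem_zLoc.1 (hτ.mem w)).1
  have h12 : (τ w)⁻¹ * σ w ∈ A := by
    refine ⟨by simpa using inv_mem h9, ⟨⟨by simpa using inv_mem (oLoc_le_left _ h9), ?_⟩, ?_⟩⟩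
    · exact (centralizer {s}).mul_mem ((centralizer {s}).inv_mem (mem_cent.2 h11)) (hσ.mem w).2
    · exact (centralizer {s'}).mul_mem ((centralizer {s'}).inv_mem (mem_cent.2 h10)) (mem_cent.2 hys)
  obtain ⟨o, ho, h13⟩ := exists_conj_of_coset hqp hAp (hnA _ h11 h10) h12 (hwq τ) (hwq σ)
  rw [h13, ← h8]
  exact canSet_conj' ⟨τ', hτ', rfl⟩ (hEc o ho.2).1 (hEc o ho.2).2.2

/-- The canonical data obtained from a word. -/
def canData [Fact p.Prime] [V.Normal] {q : ℕ} [Fact q.Prime] (hqp : q ≠ p)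
    (hc : ∀ s, Good p V s → Cov V (zLoc p V s)) {w : FreeGroup G}
    (hw : w ∈ commutator (FreeGroup G)) (hwq : ∀ ρ : FreeGroup G →* G, PEl q (ρ w)) :
    CanData p q V (FreeGroup.lift id w) where
  can := canSet p V w
  nonempty s hs := by
    obtain ⟨ρ, hρ⟩ := exists_isLift (hc s hs)
    exact ⟨_, ρ, hρ, rfl⟩
  comm := by
    rintro s _ ⟨ρ, hρ, rfl⟩
    exact (mem_zLoc.1 (hρ.mem w)).1
  pel := by
    rintro s _ ⟨ρ, hρ, rfl⟩
    exact hwq ρ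
  coset := by
    rintro s _ ⟨ρ, hρ, rfl⟩
    exact hρ.coset w
  zmod := by
    rintro s _ ⟨ρ, hρ, rfl⟩
    exact (mem_zLoc.1 (hρ.mem w)).2
  diff := by
    rintro s _ ⟨σ, hσ, rfl⟩ _ ⟨τ, hτ, rfl⟩
    exact IsLift.compare (H := zLoc p V s) (fun h hh => hh.1.1)
      (fun x hx hxH h hh => hh.1.2 x ⟨hx, hxH.2⟩) hσ hτ hw
  conj s y hy v hv := canSet_conj hy hv
  trans s hs s' hs' hss y hy hys := canSet_trans hqp hc hw hwq hs hs' hss hy hys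

end

end

section

open Subgroup Finset
open scoped commutatorElement Classical

/-! ### Counting lemmas -/

/-- The exponent `c` selects the part of an element with respect to a set of primes not
containing `p`. -/
structure PartExp (G : Type*) [Group G] (p c : ℕ) : Prop where
  idem : ∀ x : G, (x ^ c) ^ c = x ^ c
  kill : ∀ x : G, PEl p x → x ^ c = 1

section

variable {G : Type*} [Group G] [Fintype G] {p q c : ℕ}

omit [Fintype G] in
theorem partExp_zero : PartExp G p 0 := ⟨fun x => by simp, fun x _ => by simp⟩

omit [Fintype G] in
theorem PartExp.coset (hc : PartExp G p c) {O : Subgroup G} (hO : IsPGroup p O) {u o : G}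
    (hu : u ∈ normalizer (O : Set G)) (ho : o ∈ O) (h : u ^ c = 1) : (u * o) ^ c = 1 := by
  have h1 : ∀ n : ℕ, (u ^ n)⁻¹ * (u * o) ^ n ∈ O := by
    intro n
    induction n with
    | zero => simp
    | succ n ih =>
      have : (u ^ (n + 1))⁻¹ * (u * o) ^ (n + 1) = u⁻¹ * ((u ^ n)⁻¹ * (u * o) ^ n) * u * o := by
        rw [pow_succ, pow_succ]; group
      rw [this]
      exact O.mul_mem (conj_mem_of_mem_normalizer' hu ih) ho
  have h2 := h1 c
  rw [h] at h2
  rw [← hc.idem]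
  exact hc.kill _ (PEl.of_mem hO (by simpa using h2))

theorem card_filter_mem (H : Subgroup G) : #{x | x ∈ H} = Nat.card H := by
  rw [Nat.card_eq_fintype_card, Fintype.card_subtype]

theorem exists_mul_comm_of_commutator [Fact p.Prime] [Fact q.Prime] (hqp : q ≠ p)
    {O H : Subgroup G} (hOH : O ≤ H) (hO : IsPGroup p O) {x : G}
    (hx : PEl q x) (hxH : ∀ h ∈ H, ⁅h, x⁆ ∈ O) {v : G} (hv : v ∈ H) :
    ∃ o ∈ O, v * o * x = x * (v * o) := by
  have hxn : x ∈ normalizer (O : Set G) := by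
    apply mem_normalizer_of_conj
    intro o ho
    have h1 := hxH _ (hOH (inv_mem ho))
    have : x * o * x⁻¹ = o * ⁅o⁻¹, x⁆ := by rw [commutatorElement_def]; group
    rw [this]; exact O.mul_mem ho h1
  obtain ⟨o, ho, h1⟩ := exists_conj_of_coset hqp hO (y := x) (y' := v⁻¹ * x * v) hxn (by
    have h1 := conj_mem_of_mem_normalizer' hxn (hxH _ (inv_mem hv))
    convert h1 using 1
    rw [commutatorElement_def]; group) hx (by simpa using hx.conj v⁻¹)
  refine ⟨o⁻¹, inv_mem ho, ?_⟩
  have h2 : x = v * o⁻¹ * x * o * v⁻¹ := by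
    calc x = v * (v⁻¹ * x * v) * v⁻¹ := by group
      _ = _ := by rw [h1]; group
  conv_rhs => rw [h2]
  group

/-- Number of elements killed by `c` in the centraliser of an element acting trivially modulo a
`p`-subgroup. -/
theorem card_cent_mul [Fact p.Prime] [Fact q.Prime] (hqp : q ≠ p) (hc : PartExp G p c)
    {O H : Subgroup G} (hOH : O ≤ H) (hHO : H ≤ normalizer (O : Set G)) (hO : IsPGroup p O) {x : G}
    (hx : PEl q x) (hxH : ∀ h ∈ H, ⁅h, x⁆ ∈ O) :
    #{u | u ∈ H ∧ u ^ c = 1 ∧ u * x = x * u} * Nat.card O =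
      #{u | u ∈ H ∧ u ^ c = 1} * #{o | o ∈ O ∧ o * x = x * o} := by
  apply Finset.card_mul_eq_card_mul (fun u v => u⁻¹ * v ∈ O)
  · intro u hu
    simp only [mem_filter, mem_univ, true_and] at hu
    rw [← card_filter_mem]
    symm
    apply Finset.card_bij (fun o _ => u * o)
    · intro o ho
      simp only [mem_filter, mem_univ, true_and, Finset.mem_bipartiteAbove] at *
      exact ⟨⟨H.mul_mem hu.1 (hOH ho), hc.coset hO (hHO hu.1) ho hu.2.1⟩, by simpa using ho⟩
    · intro a _ b _ h; simpa using h
    · intro v hv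
      simp only [mem_filter, mem_univ, true_and, Finset.mem_bipartiteAbove] at *
      exact ⟨u⁻¹ * v, hv.2, by simp⟩
  · intro v hv
    simp only [mem_filter, mem_univ, true_and] at hv
    obtain ⟨o₀, ho₀, h0⟩ := exists_mul_comm_of_commutator hqp hOH hO hx hxH hv.1
    symm
    apply Finset.card_bij (fun o _ => v * o₀ * o)
    · intro o ho
      simp only [mem_filter, mem_univ, true_and, Finset.mem_bipartiteBelow] at *
      have h3 : o₀ * o ∈ O := O.mul_mem ho₀ ho.1
      refine ⟨⟨?_, ?_, ?_⟩, ?_⟩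
      · rw [mul_assoc]; exact H.mul_mem hv.1 (hOH h3)
      · rw [mul_assoc]; exact hc.coset hO (hHO hv.1) h3 hv.2
      · rw [mul_assoc, ho.2, ← mul_assoc, h0]; group
      · have : (v * o₀ * o)⁻¹ * v = (o₀ * o)⁻¹ := by group
        rw [this]; exact inv_mem h3
    · intro a _ b _ h; simpa using h
    · intro u hu
      simp only [mem_filter, mem_univ, true_and, Finset.mem_bipartiteBelow] at *
      refine ⟨(v * o₀)⁻¹ * u, ⟨?_, ?_⟩, by group⟩
      · have : (v * o₀)⁻¹ * u = o₀⁻¹ * (u⁻¹ * v)⁻¹ := by group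
        rw [this]; exact O.mul_mem (inv_mem ho₀) (inv_mem hu.2)
      · have h1 : Commute (v * o₀) x := h0
        have h2 : Commute u x := hu.1.2.2
        exact (h1.inv_left.mul_left h2).eq

theorem card_conj_fiber {O : Subgroup G} {x o' : G} (ho' : o' ∈ O) :
    #{o | o ∈ O ∧ o⁻¹ * x * o = o'⁻¹ * x * o'} =
      #{o | o ∈ O ∧ o * (o'⁻¹ * x * o') = o'⁻¹ * x * o' * o} := by
  apply Finset.card_bij (fun o _ => o'⁻¹ * o)
  · intro o ho
    simp only [mem_filter, mem_univ, true_and] at *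
    refine ⟨O.mul_mem (inv_mem ho') ho.1, ?_⟩
    rw [← ho.2]
    have : o'⁻¹ * o * (o⁻¹ * x * o) = o'⁻¹ * x * o := by group
    rw [this, ho.2]; group
  · intro a _ b _ h; simpa using h
  · intro o ho
    simp only [mem_filter, mem_univ, true_and] at *
    refine ⟨o' * o, ⟨O.mul_mem ho' ho.1, ?_⟩, by group⟩
    have : (o' * o)⁻¹ * x * (o' * o) = o⁻¹ * (o'⁻¹ * x * o' * o) := by group
    rw [this, ← ho.2]; group

/-- The number of commuting pairs with second member in a class of `O`. -/
theorem sum_card_cent [Fact p.Prime] [Fact q.Prime] (hqp : q ≠ p) (hc : PartExp G p c)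
    {O H : Subgroup G} (hOH : O ≤ H) (hHO : H ≤ normalizer (O : Set G)) (hO : IsPGroup p O) {x : G}
    (hx : PEl q x) (hxH : ∀ h ∈ H, ⁅h, x⁆ ∈ O) {X : Finset G}
    (hX : ∀ y, y ∈ X ↔ ∃ o ∈ O, y = o⁻¹ * x * o) :
    ∑ y ∈ X, #{u | u ∈ H ∧ u ^ c = 1 ∧ u * y = y * u} = #{u | u ∈ H ∧ u ^ c = 1} := by
  have hpos : 0 < Nat.card O := Nat.card_pos
  apply Nat.eq_of_mul_eq_mul_right hpos
  rw [Finset.sum_mul]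
  have h1 : ∀ y ∈ X, #{u | u ∈ H ∧ u ^ c = 1 ∧ u * y = y * u} * Nat.card O =
      #{u | u ∈ H ∧ u ^ c = 1} * #{o ∈ ({o | o ∈ O} : Finset G) | o⁻¹ * x * o = y} := by
    intro y hy
    obtain ⟨o, ho, rfl⟩ := (hX y).1 hy
    rw [Finset.filter_filter, card_conj_fiber ho]
    apply card_cent_mul hqp hc hOH hHO hO (by simpa using hx.conj o⁻¹)
    intro h hh
    have h2 := hxH (o * h * o⁻¹) (H.mul_mem (H.mul_mem (hOH ho) hh) (inv_mem (hOH ho)))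
    have h3 : ⁅h, o⁻¹ * x * o⁆ = o⁻¹ * ⁅o * h * o⁻¹, x⁆ * o := by
      simp only [commutatorElement_def]; group
    rw [h3]
    exact O.mul_mem (O.mul_mem (inv_mem ho) h2) ho
  rw [Finset.sum_congr rfl h1, ← Finset.mul_sum, ← card_filter_mem]
  congr 1
  symm
  apply Finset.card_eq_sum_card_fiberwise
  intro o ho
  simp only [coe_filter, mem_univ, true_and, Set.mem_ofPred_eq] at ho
  exact (hX _).2 ⟨o, ho, rfl⟩

/-- The hypothesis on `X` for an element `s` of `W`. -/
def ClassAt (p q : ℕ) (W : Subgroup G) (s : G) (X : Finset G) : Prop :=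
  X = ∅ ∨ ∃ (O : Subgroup G) (x : G), O ≤ W ⊓ centralizer {s} ∧
    W ⊓ centralizer {s} ≤ normalizer (O : Set G) ∧ IsPGroup p O ∧ PEl q x ∧ x * s = s * x ∧
    (∀ h ∈ W ⊓ centralizer {s}, ⁅h, x⁆ ∈ O) ∧ ∀ y, y ∈ X ↔ ∃ o ∈ O, y = o⁻¹ * x * o

theorem sum_card_pairs [Fact p.Prime] [Fact q.Prime] (hqp : q ≠ p) (hc : PartExp G p c)
    {W : Subgroup G} {s : G} (hs : s ^ c = s) (hsW : s ∈ W) {X : Finset G}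
    (hX : ClassAt p q W s X) :
    ∑ y ∈ X, #{g | g ∈ W ∧ g ^ c = s ∧ g * y = y * g} =
      #{g | g ∈ W ∧ g ^ c = s ∧ X.Nonempty} := by
  rcases hX with rfl | ⟨O, x, h1, h2, h3, h4, hxs, h5, h6⟩
  · simp
  have hxX : x ∈ X := (h6 x).2 ⟨1, one_mem _, by simp⟩
  have hcomm : ∀ y ∈ X, Commute s y := by
    intro y hy
    obtain ⟨o, ho, rfl⟩ := (h6 y).1 hy
    have ho' : Commute o s := mem_cent.1 (h1 ho).2
    have hx' : Commute x s := hxs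
    exact ((ho'.inv_left.mul_left hx').mul_left ho').symm
  have key := sum_card_cent hqp hc h1 h2 h3 h4 h5 h6
  have hpow : ∀ u, u * s = s * u → u ^ c = 1 → (s * u) ^ c = s := by
    intro u h h'
    rw [(show Commute s u from h.symm).mul_pow, hs, h', mul_one]
  have hpow' : ∀ g, g ^ c = s → (s⁻¹ * g) * s = s * (s⁻¹ * g) ∧ (s⁻¹ * g) ^ c = 1 := by
    intro g h
    have h0 : Commute g s := by rw [← h]; exact Commute.self_pow g c
    refine ⟨?_, ?_⟩
    · rw [mul_assoc, h0.eq]; group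
    · rw [(h0.symm.inv_left).mul_pow, inv_pow, hs, h]; simp
  have e1 : ∀ y ∈ X, #{g | g ∈ W ∧ g ^ c = s ∧ g * y = y * g} =
      #{u | u ∈ W ⊓ centralizer {s} ∧ u ^ c = 1 ∧ u * y = y * u} := by
    intro y hy
    symm
    apply Finset.card_bij (fun u _ => s * u)
    · intro u hu
      simp only [mem_filter, mem_univ, true_and] at *
      refine ⟨W.mul_mem hsW hu.1.1, hpow u (mem_cent.1 hu.1.2) hu.2.1, ?_⟩
      exact ((hcomm y hy).mul_left (show Commute u y from hu.2.2)).eq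
    · intro a _ b _ h; simpa using h
    · intro g hg
      simp only [mem_filter, mem_univ, true_and] at *
      refine ⟨s⁻¹ * g, ⟨⟨W.mul_mem (inv_mem hsW) hg.1, mem_cent.2 (hpow' g hg.2.1).1⟩,
        (hpow' g hg.2.1).2, ?_⟩, by group⟩
      exact ((hcomm y hy).inv_left.mul_left (show Commute g y from hg.2.2)).eq
  rw [Finset.sum_congr rfl e1, key]
  apply Finset.card_bij (fun u _ => s * u)
  · intro u hu
    simp only [mem_filter, mem_univ, true_and] at *
    exact ⟨W.mul_mem hsW hu.1.1, hpow u (mem_cent.1 hu.1.2) hu.2, x, hxX⟩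
  · intro a _ b _ h; simpa using h
  · intro g hg
    simp only [mem_filter, mem_univ, true_and] at *
    exact ⟨s⁻¹ * g, ⟨⟨W.mul_mem (inv_mem hsW) hg.1, mem_cent.2 (hpow' g hg.2.1).1⟩,
        (hpow' g hg.2.1).2⟩, by group⟩

/-- The main counting lemma. -/
theorem card_pairs [Fact p.Prime] [Fact q.Prime] (hqp : q ≠ p) (hc : PartExp G p c)
    {W : Subgroup G} {X : G → Finset G}
    (hX : ∀ s ∈ W, s ≠ 1 → s ^ c = s → ClassAt p q W s (X s)) :
    #{z : G × G | z.1 ∈ W ∧ z.1 ^ c ≠ 1 ∧ z.2 ∈ X (z.1 ^ c) ∧ z.1 * z.2 = z.2 * z.1} =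
      #{g | g ∈ W ∧ g ^ c ≠ 1 ∧ (X (g ^ c)).Nonempty} := by
  have hS : ∀ s ∈ ({s | s ∈ W ∧ s ≠ 1 ∧ s ^ c = s} : Finset G),
      #{z ∈ ({z : G × G | z.1 ∈ W ∧ z.1 ^ c ≠ 1 ∧ z.2 ∈ X (z.1 ^ c) ∧
        z.1 * z.2 = z.2 * z.1} : Finset (G × G)) | z.1 ^ c = s} =
      #{g ∈ ({g | g ∈ W ∧ g ^ c ≠ 1 ∧ (X (g ^ c)).Nonempty} : Finset G) | g ^ c = s} := by
    intro s hs
    simp only [mem_filter, mem_univ, true_and] at hs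
    have h1 := sum_card_pairs hqp hc hs.2.2 hs.1 (hX s hs.1 hs.2.1 hs.2.2)
    have e1 : #{g ∈ ({g | g ∈ W ∧ g ^ c ≠ 1 ∧ (X (g ^ c)).Nonempty} : Finset G) | g ^ c = s} =
        #{g | g ∈ W ∧ g ^ c = s ∧ (X s).Nonempty} := by
      congr 1; ext g
      simp only [mem_filter, mem_univ, true_and]
      constructor
      · rintro ⟨⟨a, b, d⟩, e⟩; exact ⟨a, e, e ▸ d⟩
      · rintro ⟨a, e, d⟩; exact ⟨⟨a, e ▸ hs.2.1, e ▸ d⟩, e⟩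
    rw [e1, ← h1, Finset.card_eq_sum_card_fiberwise (f := Prod.snd) (t := X s)]
    · apply Finset.sum_congr rfl
      intro y hy
      symm
      apply Finset.card_bij (fun g _ => (g, y))
      · intro g hg
        simp only [mem_filter, mem_univ, true_and] at *
        obtain ⟨a, b, d⟩ := hg
        subst b
        exact ⟨⟨⟨a, hs.2.1, hy, d⟩, rfl⟩, trivial⟩
      · intro a _ b _ h; simpa using h
      · rintro ⟨g, y'⟩ hg
        simp only [mem_filter, mem_univ, true_and] at *
        obtain ⟨⟨⟨a, b, d, e⟩, f⟩, rfl⟩ := hg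
        exact ⟨g, ⟨a, f, e⟩, rfl⟩
    · rintro ⟨g, y⟩ hz
      simp only [coe_filter, mem_filter, mem_univ, true_and, Set.mem_ofPred_eq] at hz
      obtain ⟨⟨a, b, d, e⟩, f⟩ := hz
      subst f; exact d
  rw [Finset.card_eq_sum_card_fiberwise (f := fun z : G × G => z.1 ^ c)
    (t := ({s | s ∈ W ∧ s ≠ 1 ∧ s ^ c = s} : Finset G)), Finset.sum_congr rfl hS]
  · symm
    apply Finset.card_eq_sum_card_fiberwise
    intro g hg
    simp only [coe_filter, mem_filter, mem_univ, true_and, Set.mem_ofPred_eq] at *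
    exact ⟨W.pow_mem hg.1 c, hg.2.1, hc.idem g⟩
  · intro z hz
    simp only [coe_filter, mem_filter, mem_univ, true_and, Set.mem_ofPred_eq] at *
    exact ⟨W.pow_mem hz.1 c, hz.2.1, hc.idem _⟩

end

/-! ### Exponents selecting parts -/

section

variable {G : Type*} [Group G] [Finite G] {p q t : ℕ}

theorem PEl.pow {G : Type*} [Group G] {p : ℕ} {g : G} (h : PEl p g) (n : ℕ) : PEl p (g ^ n) := by
  obtain ⟨k, hk⟩ := h
  exact ⟨k, by rw [← pow_mul, mul_comm, pow_mul, hk, one_pow]⟩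

omit [Finite G] in
theorem PEl.orderOf_dvd [Fact t.Prime] {x : G} (hx : PEl t x) {a k : ℕ}
    (h : Nat.card G = t ^ a * k) (hk : ¬ t ∣ k) : orderOf x ∣ t ^ a := by
  obtain ⟨j, hj⟩ := hx
  have h1 : (orderOf x).Coprime k :=
    Nat.Coprime.coprime_dvd_left (orderOf_dvd_of_pow_eq_one hj)
      (Nat.Coprime.pow_left _ ((Nat.Prime.coprime_iff_not_dvd Fact.out).2 hk))
  exact h1.dvd_of_dvd_mul_right (h ▸ orderOf_dvd_natCard x)

theorem pow_eq_self_of_modEq {G : Type*} [Group G] {x : G} {c n : ℕ} (h : c ≡ 1 [MOD n])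
    (hx : orderOf x ∣ n) : x ^ c = x := by
  have : x ^ c = x ^ 1 := pow_eq_pow_iff_modEq.2 (h.of_dvd hx)
  simpa using this

theorem exists_tPart (G : Type*) [Group G] [Finite G] (t : ℕ) [Fact t.Prime] :
    ∃ c : ℕ, (∀ x : G, PEl t (x ^ c)) ∧ ∀ x : G, PEl t x → x ^ c = x := by
  obtain ⟨a, k, hk, h⟩ := Nat.exists_eq_pow_mul_and_not_dvd (n := Nat.card G) Nat.card_pos.ne' t
    (Nat.Prime.ne_one Fact.out)
  have hco : (t ^ a).Coprime k :=
    Nat.Coprime.pow_left _ ((Nat.Prime.coprime_iff_not_dvd Fact.out).2 hk)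
  obtain ⟨c, hc1, hc2⟩ := Nat.chineseRemainder hco 1 0
  refine ⟨c, fun x => ⟨a, ?_⟩, fun x hx => pow_eq_self_of_modEq hc1 (hx.orderOf_dvd h hk)⟩
  rw [← pow_mul]
  apply orderOf_dvd_iff_pow_eq_one.1
  refine (orderOf_dvd_natCard x).trans ?_
  rw [h, mul_comm]
  exact Nat.mul_dvd_mul_right ((Nat.modEq_zero_iff_dvd).1 hc2) _

omit [Finite G] in
theorem partExp_tPart [Fact p.Prime] [Fact t.Prime] (htp : t ≠ p) {c : ℕ}
    (h1 : ∀ x : G, PEl t (x ^ c)) (h2 : ∀ x : G, PEl t x → x ^ c = x) : PartExp G p c :=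
  ⟨fun x => h2 _ (h1 x), fun x hx => PEl.eq_one_of_coprime htp (h1 x) (hx.pow c)⟩

theorem exists_p'Part (G : Type*) [Group G] [Finite G] (p : ℕ) [Fact p.Prime] :
    ∃ c : ℕ, PartExp G p c ∧ ∀ x : G, x ^ c = 1 → PEl p x := by
  obtain ⟨a, k, hk, h⟩ := Nat.exists_eq_pow_mul_and_not_dvd (n := Nat.card G) Nat.card_pos.ne' p
    (Nat.Prime.ne_one Fact.out)
  have hco : (p ^ a).Coprime k :=
    Nat.Coprime.pow_left _ ((Nat.Prime.coprime_iff_not_dvd Fact.out).2 hk)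
  obtain ⟨c, hc1, hc2⟩ := Nat.chineseRemainder hco 0 1
  refine ⟨c, ⟨fun x => pow_eq_self_of_modEq hc2 ?_, fun x hx => ?_⟩, fun x hx => ⟨a, ?_⟩⟩
  · apply orderOf_dvd_of_pow_eq_one
    rw [← pow_mul]
    apply orderOf_dvd_iff_pow_eq_one.1
    refine (orderOf_dvd_natCard x).trans ?_
    rw [h]
    exact Nat.mul_dvd_mul_right ((Nat.modEq_zero_iff_dvd).1 hc1) _
  · exact orderOf_dvd_iff_pow_eq_one.1
      ((hx.orderOf_dvd h hk).trans ((Nat.modEq_zero_iff_dvd).1 hc1))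
  · have h1 : (x ^ p ^ a) ^ c = x ^ p ^ a := by
      apply pow_eq_self_of_modEq hc2
      apply orderOf_dvd_of_pow_eq_one
      rw [← pow_mul, ← h]
      exact pow_card_eq_one'
    rw [← h1, ← pow_mul, mul_comm, pow_mul, hx, one_pow]

theorem exists_prime_tPart {c : ℕ} [Fact p.Prime] (hc : PartExp G p c) {s : G} (hs : s ^ c = s)
    (hs1 : s ≠ 1) : ∃ t : ℕ, t.Prime ∧ t ≠ p ∧ ∃ k : ℕ, s ^ k ≠ 1 ∧ PEl t (s ^ k) := by
  have ho : orderOf s ≠ 1 := fun h => hs1 (orderOf_eq_one_iff.1 h)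
  obtain ⟨t, ht, hts⟩ := Nat.exists_prime_and_dvd ho
  obtain ⟨k, hk⟩ := hts
  have hkpos : 0 < k := Nat.pos_of_ne_zero fun h => (orderOf_pos s).ne' (by rw [hk, h, mul_zero])
  have h1 : s ^ k ≠ 1 := fun h => by
    have := Nat.le_of_dvd hkpos (orderOf_dvd_of_pow_eq_one h)
    have := ht.two_le
    nlinarith
  have h2 : PEl t (s ^ k) := ⟨1, by rw [pow_one, ← pow_mul, mul_comm, ← hk, pow_orderOf_eq_one]⟩
  refine ⟨t, ht, ?_, k, h1, h2⟩
  rintro rfl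
  apply h1
  rw [← hc.kill _ h2, ← pow_mul, mul_comm, pow_mul, hs]

end

/-! ### The classes of canonical elements -/

namespace CanData

variable {G : Type*} [Group G] {p q t : ℕ} {V : Subgroup G} {x₀ : G}

/-- `y` centralises a Sylow `t`-subgroup of `V` and is canonical for all its nontrivial elements. -/
structure Base (D : CanData p q V x₀) (t : ℕ) (y : G) : Prop where
  pel : PEl q y
  coset : x₀⁻¹ * y ∈ V
  ex : ∃ R, IsSylIn t R V ∧ ∀ b ∈ R, b * y = y * b ∧ (b ≠ 1 → y ∈ D.can b)

variable {D : CanData p q V x₀} [Finite G] [V.Normal] [Fact p.Prime] [Fact q.Prime]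

theorem mem_can_iff (D : CanData p q V x₀) (hqp : q ≠ p) {s y y' : G} (hy : y ∈ D.can s) :
    y' ∈ D.can s ↔ ∃ o ∈ oLoc p V s, y' = o⁻¹ * y * o := by
  constructor
  · intro hy'
    exact exists_conj_of_coset hqp (isPGroup_oLoc s) (normalizer_oLoc (D.comm s y hy))
      (D.diff s y hy y' hy') (D.pel s y hy) (D.pel s y' hy')
  · rintro ⟨o, ho, rfl⟩
    have h1 := D.conj s y hy o⁻¹ (inv_mem (oLoc_le_left _ ho))
    have h2 : o⁻¹ * s * o = s := by rw [mul_assoc, ← oLoc_comm ho]; group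
    simpa [h2] using h1

theorem not_dvd_card_can [Fact t.Prime] (D : CanData p q V x₀) (hqp : q ≠ p) (htp : t ≠ p) {s y : G}
    (hy : y ∈ D.can s) : ¬ t ∣ Nat.card (D.can s) := by
  have := Fintype.ofFinite G
  intro h
  apply not_dvd_card_of_isPGroup htp (isPGroup_oLoc (p := p) (V := V) s)
  refine h.trans ⟨#{o | o ∈ oLoc p V s ∧ o * y = y * o}, ?_⟩
  have hX : ∀ z, z ∈ (D.can s).toFinset ↔ ∃ o ∈ oLoc p V s, z = o⁻¹ * y * o := fun z => by
    rw [Set.mem_toFinset, D.mem_can_iff hqp hy]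
  rw [← card_filter_mem, Nat.card_eq_card_toFinset, ← smul_eq_mul, ← Finset.sum_const,
    Finset.card_eq_sum_card_fiberwise (f := fun o => o⁻¹ * y * o) (t := (D.can s).toFinset)]
  · apply Finset.sum_congr rfl
    intro z hz
    obtain ⟨o, ho, rfl⟩ := (hX z).1 hz
    rw [Finset.filter_filter]
    apply Finset.card_bij (fun a _ => a * o⁻¹)
    · intro a ha
      simp only [mem_filter, mem_univ, true_and] at *
      refine ⟨mul_mem ha.1 (inv_mem ho), ?_⟩
      have : a * o⁻¹ * y = a * (o⁻¹ * y * o) * o⁻¹ := by group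
      rw [this, ← ha.2]; group
    · intro a _ b _ h; simpa using h
    · intro a ha
      simp only [mem_filter, mem_univ, true_and] at *
      refine ⟨a * o, ⟨mul_mem ha.1 ho, ?_⟩, by group⟩
      have : (a * o)⁻¹ * y * (a * o) = o⁻¹ * (a⁻¹ * (y * a)) * o := by group
      rw [this, ← ha.2]; group
  · intro o ho
    simp only [coe_filter, mem_univ, true_and, Set.mem_ofPred_eq] at ho
    exact (hX _).2 ⟨o, ho, rfl⟩

theorem exists_base (D : CanData p q V x₀) (hqp : q ≠ p) (ht : t.Prime) (htp : t ≠ p)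
    (htV : t ∣ Nat.card V) : ∃ y, D.Base t y := by
  have := Fact.mk ht
  obtain ⟨R, hR, -⟩ := IsSylIn.exists_ge (t := t) (bot_le (a := V)) IsPGroup.of_bot
  have hRp := hR.2.1
  have hnt : Nontrivial R := by
    rw [← not_subsingleton_iff_nontrivial]
    intro hs
    obtain ⟨k, hk, hk'⟩ := hR.card_dvd
    rw [Nat.card_of_subsingleton (1 : R), one_mul] at hk
    exact hk' (hk ▸ htV)
  have := hRp.center_nontrivial
  obtain ⟨f, hf⟩ := exists_ne (1 : center R)
  have hfR : ∀ b ∈ R, b * (f : R) = (f : R) * b := fun b hb => by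
    have := Subgroup.mem_center_iff.1 f.2 ⟨b, hb⟩
    exact congrArg Subtype.val this
  have hgood : ∀ b ∈ R, b ≠ 1 → Good p V b := fun b hb hb1 =>
    ⟨hR.1 hb, hb1, t, ht, htp, PEl.of_mem hRp hb⟩
  have hfg : Good p V ((f : R) : G) := hgood _ f.1.2 (by simpa using hf)
  obtain ⟨y, hy⟩ := D.nonempty _ hfg
  obtain ⟨y0, hy0, hc⟩ := exists_fixed_conj hRp (S := D.can ((f : R) : G)) (by
    intro b hb s hs
    have := D.conj _ s hs b (hR.1 hb)
    rwa [hfR b hb, mul_inv_cancel_right] at this) (D.not_dvd_card_can hqp htp hy)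
  refine ⟨y0, D.pel _ _ hy0, D.coset _ _ hy0, R, hR, fun b hb => ⟨hc b hb, fun hb1 => ?_⟩⟩
  exact D.trans _ hfg _ (hgood b hb hb1) (hfR b hb).symm _ hy0 (hc b hb).symm

namespace Base

omit [Fact p.Prime] [Fact q.Prime] in
theorem conj {y v : G} (h : D.Base t y) (hv : v ∈ V) : D.Base t (v * y * v⁻¹) := by
  obtain ⟨h1, h2, R, hR, h3⟩ := h
  refine ⟨h1.conj v, ?_, conjSub v R, ?_, ?_⟩
  · have : x₀⁻¹ * (v * y * v⁻¹) = (x₀⁻¹ * v * x₀) * (x₀⁻¹ * y) * v⁻¹ := by group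
    rw [this]
    have h4 : x₀⁻¹ * v * x₀ ∈ V := by
      simpa using (inferInstance : V.Normal).conj_mem v hv x₀⁻¹
    exact V.mul_mem (V.mul_mem h4 h2) (V.inv_mem hv)
  · have := hR.conj v
    rwa [conjSub_normal v V] at this
  · intro b hb
    rw [mem_conjSub] at hb
    obtain ⟨h4, h5⟩ := h3 _ hb
    constructor
    · have : b * (v * y * v⁻¹) = v * (v⁻¹ * b * v * y) * v⁻¹ := by group
      rw [this, h4]; group
    · intro hb1
      have h6 := D.conj _ _ (h5 (by
        intro h; apply hb1
        have : b = v * (v⁻¹ * b * v) * v⁻¹ := by group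
        rw [this, h]; group)) v hv
      have : v * (v⁻¹ * b * v) * v⁻¹ = b := by group
      rwa [this] at h6

omit [V.Normal] [Fact p.Prime] [Fact q.Prime] in
theorem mem_can [V.Normal] (ht : t.Prime) {y a : G} (h : D.Base t y) (ha : a ∈ V) (ha1 : a ≠ 1)
    (hat : PEl t a) (hya : y * a = a * y) : y ∈ D.can a := by
  have := Fact.mk ht
  obtain ⟨h1, h2, R, hR, h3⟩ := h
  have hRC : IsSylIn t R (V ⊓ centralizer {y}) :=
    hR.mono (fun b hb => ⟨hR.1 hb, mem_cent.2 (h3 b hb).1⟩) inf_le_left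
  have haC : zpowers a ≤ V ⊓ centralizer {y} := zpowers_le.2 ⟨ha, mem_cent.2 hya.symm⟩
  obtain ⟨R', hR', haR'⟩ := IsSylIn.exists_ge haC hat.zpowers
  obtain ⟨w, hw, rfl⟩ := hRC.exists_conj hR'
  have haw := haR' (mem_zpowers a)
  rw [mem_conjSub] at haw
  have h4 := (h3 _ haw).2 (by
    intro h; apply ha1
    have : a = w * (w⁻¹ * a * w) * w⁻¹ := by group
    rw [this, h]; group)
  have h5 := D.conj _ _ h4 w hw.1
  have h6 : w * (w⁻¹ * a * w) * w⁻¹ = a := by group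
  have h7 : w * y * w⁻¹ = y := by rw [mem_cent.1 hw.2]; group
  rwa [h6, h7] at h5

theorem exists_conj (hqp : q ≠ p) (ht : t.Prime) {y b z : G} (h : D.Base t y) (hb : b ∈ V)
    (hb1 : b ≠ 1) (hbt : PEl t b) (hz : z ∈ D.can b) : ∃ v ∈ V, z = v * y * v⁻¹ := by
  have := Fact.mk ht
  obtain ⟨h1, h2, R, hR, h3⟩ := h
  obtain ⟨R', hR', hbR'⟩ := IsSylIn.exists_ge (zpowers_le.2 hb) hbt.zpowers
  obtain ⟨w, hw, rfl⟩ := hR.exists_conj hR'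
  have hbw := hbR' (mem_zpowers b)
  rw [mem_conjSub] at hbw
  have h4 := (h3 _ hbw).2 (by
    intro h; apply hb1
    have : b = w * (w⁻¹ * b * w) * w⁻¹ := by group
    rw [this, h]; group)
  have h5 := D.conj _ _ h4 w hw
  have h6 : w * (w⁻¹ * b * w) * w⁻¹ = b := by group
  rw [h6] at h5
  obtain ⟨o, ho, rfl⟩ := (D.mem_can_iff hqp h5).1 hz
  exact ⟨o⁻¹ * w, V.mul_mem (inv_mem (oLoc_le_left _ ho)) hw, by group⟩

omit [Fact p.Prime] in
/-- Two members of the class for `t = q` in a common `q`-subgroup coincide. -/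
theorem eq_of_mem [Fact p.Prime] (hqp : q ≠ p) (hqV : q ∣ Nat.card V) {y y' : G} (h : D.Base q y)
    (h' : D.Base q y') {S : Subgroup G} (hS : IsPGroup q S) (hy : y ∈ S) (hy' : y' ∈ S) :
    y = y' := by
  have hq : q.Prime := Fact.out
  obtain ⟨a, ha1, haq, haV, haS⟩ : ∃ a : G, a ≠ 1 ∧ PEl q a ∧ a ∈ V ∧ ∀ s ∈ S, s * a = a * s := by
    let act : MulAction S V := MulAction.compHom V ((MulAut.conjNormal (H := V)).comp S.subtype)
    have hact : ∀ (s : S) (v : V), ((s • v : V) : G) = s * v * (s : G)⁻¹ := fun s v =>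
      MulAut.conjNormal_apply (H := V) (s : G) v
    have h1 : q ∣ Nat.card (MulAction.fixedPoints S V) :=
      (Nat.modEq_zero_iff_dvd).1 ((hS.card_modEq_card_fixedPoints V).symm.trans
        ((Nat.modEq_zero_iff_dvd).2 hqV))
    have h2 : (1 : V) ∈ MulAction.fixedPoints S V := fun s => Subtype.ext (by rw [hact]; simp)
    have h3 : Nat.card (MulAction.fixedPoints S V) = Nat.card (V ⊓ centralizer (S : Set G) : Subgroup G) := by
      apply Nat.card_congr
      refine ⟨fun v => ⟨v.1, v.1.2, ?_⟩, fun g => ⟨⟨g, g.2.1⟩, ?_⟩, fun v => rfl, fun g => rfl⟩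
      · change ((v : V) : G) ∈ centralizer (S : Set G)
        rw [mem_centralizer_iff]
        intro s hs
        have := congrArg Subtype.val (v.2 ⟨s, hs⟩)
        rw [hact] at this
        exact mul_inv_eq_iff_eq_mul.1 this
      · intro s
        apply Subtype.ext
        rw [hact]
        exact mul_inv_eq_iff_eq_mul.2 (mem_centralizer_iff.1 g.2.2 s s.2)
    rw [h3] at h1
    obtain ⟨a, ha⟩ := exists_prime_orderOf_dvd_card' q h1
    refine ⟨a, ?_, ⟨1, ?_⟩, a.2.1, mem_centralizer_iff.1 a.2.2⟩
    · intro h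
      rw [Subtype.ext h (a2 := (1 : (V ⊓ centralizer (S : Set G) : Subgroup G))), orderOf_one] at ha
      exact hq.ne_one ha.symm
    · rw [pow_one, ← ha, ← Subgroup.orderOf_coe, pow_orderOf_eq_one]
  have h1 := h.mem_can hq haV ha1 haq (haS y hy)
  have h2 := h'.mem_can hq haV ha1 haq (haS y' hy')
  have h3 := PEl.eq_one_of_coprime (p := p) (q := q) hqp.symm
    (PEl.of_mem (isPGroup_oLoc a) (D.diff _ _ h1 _ h2))
    (PEl.of_mem hS (S.mul_mem (S.inv_mem hy) hy'))
  exact inv_mul_eq_one.1 h3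

end Base

end CanData

/-- Two `q`-elements in the same coset of a normal subgroup are, up to conjugation, in a common
`q`-subgroup. -/
theorem exists_common_isPGroup {G : Type*} [Group G] [Finite G] {q : ℕ} [Fact q.Prime]
    {V : Subgroup G} [V.Normal] {y y' : G} (hy : PEl q y) (hy' : PEl q y') (h : y⁻¹ * y' ∈ V) :
    ∃ v ∈ V, ∃ S : Subgroup G, IsPGroup q S ∧ y ∈ S ∧ v * y' * v⁻¹ ∈ S := by
  set H := V ⊔ zpowers y with hH
  have h1 : zpowers y ≤ H := le_sup_right
  have hy'H : y' ∈ H := by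
    have : y' = y * (y⁻¹ * y') := by group
    rw [this]; exact H.mul_mem (h1 (mem_zpowers y)) ((le_sup_left : V ≤ H) h)
  obtain ⟨S, hS, hyS⟩ := IsSylIn.exists_ge h1 hy.zpowers
  obtain ⟨S', hS', hyS'⟩ := IsSylIn.exists_ge (zpowers_le.2 hy'H) hy'.zpowers
  obtain ⟨w, hw, rfl⟩ := hS'.exists_conj hS
  obtain ⟨v, hv, z, hz, rfl⟩ := Subgroup.mem_sup_of_normal_left.1 hw
  have hzS : z ∈ conjSub (v * z) S' := (zpowers_le.2 (hyS (mem_zpowers y))) hz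
  have hw2 : v * z * y' * (v * z)⁻¹ ∈ conjSub (v * z) S' := by
    rw [mem_conjSub]
    have : (v * z)⁻¹ * (v * z * y' * (v * z)⁻¹) * (v * z) = y' := by group
    rw [this]; exact hyS' (mem_zpowers y')
  refine ⟨z⁻¹ * v * z, by simpa using (inferInstance : V.Normal).conj_mem v hv z⁻¹, _, hS.2.1,
    hyS (mem_zpowers y), ?_⟩
  have := mul_mem (mul_mem (inv_mem hzS) hw2) hzS
  convert this using 1
  group

section

variable {G : Type*} [Group G] [Fintype G] {p q t : ℕ}

theorem conj_pow' {G : Type*} [Group G] (v g : G) (n : ℕ) : (v * g * v⁻¹) ^ n = v * g ^ n * v⁻¹ :=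
  conj_pow

theorem card_class_pairs (W : Subgroup G) (y : G) {φ : G → Prop}
    (hφ : ∀ v ∈ W, ∀ g, φ g → φ (v * g * v⁻¹)) :
    #{z : G × G | z.1 ∈ W ∧ φ z.1 ∧ (∃ v ∈ W, z.2 = v * y * v⁻¹) ∧ z.1 * z.2 = z.2 * z.1} *
      #{n | n ∈ W ∧ n * y = y * n} = Nat.card W * #{g | g ∈ W ∧ φ g ∧ g * y = y * g} := by
  have h1 : Nat.card W * #{g | g ∈ W ∧ φ g ∧ g * y = y * g} =
      #((({v | v ∈ W} : Finset G)) ×ˢ ({g | g ∈ W ∧ φ g ∧ g * y = y * g} : Finset G)) * 1 := by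
    rw [mul_one, card_product, card_filter_mem]
  rw [h1]
  apply Finset.card_mul_eq_card_mul
    (fun z w => z.1 = w.1 * w.2 * w.1⁻¹ ∧ z.2 = w.1 * y * w.1⁻¹)
  · rintro ⟨g, x⟩ hz
    simp only [mem_filter, mem_univ, true_and] at hz
    obtain ⟨hg, hφg, ⟨v, hv, rfl⟩, hc⟩ := hz
    symm
    apply Finset.card_bij (fun n _ => (v * n, (v * n)⁻¹ * g * (v * n)))
    · intro n hn
      simp only [mem_filter, mem_univ, true_and, Finset.mem_bipartiteAbove, mem_product] at *
      have hvn := W.mul_mem hv hn.1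
      have e : n * y * n⁻¹ = y := by rw [hn.2]; group
      refine ⟨⟨hvn, W.mul_mem (W.mul_mem (inv_mem hvn) hg) hvn, ?_, ?_⟩, by group, ?_⟩
      · simpa using hφ _ (inv_mem hvn) g hφg
      · have h2 : v * y * v⁻¹ = v * n * y * (v * n)⁻¹ := by
          calc v * y * v⁻¹ = v * (n * y * n⁻¹) * v⁻¹ := by rw [e]
            _ = _ := by group
        rw [h2] at hc
        generalize v * n = a at *
        calc a⁻¹ * g * a * y = a⁻¹ * (g * (a * y * a⁻¹)) * a := by group
          _ = _ := by rw [hc]; group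
      · calc v * y * v⁻¹ = v * (n * y * n⁻¹) * v⁻¹ := by rw [e]
            _ = _ := by group
    · intro a _ b _ h
      simp only [Prod.mk.injEq] at h
      simpa using h.1
    · rintro ⟨w, u⟩ hw
      simp only [mem_filter, mem_univ, true_and, Finset.mem_bipartiteAbove, mem_product] at *
      obtain ⟨⟨hw1, hu⟩, rfl, h3⟩ := hw
      refine ⟨v⁻¹ * w, ⟨W.mul_mem (inv_mem hv) hw1, ?_⟩, ?_⟩
      · calc v⁻¹ * w * y = v⁻¹ * (w * y * w⁻¹) * w := by group
          _ = _ := by rw [← h3]; group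
      · simp only [Prod.mk.injEq]
        exact ⟨by group, by group⟩
  · rintro ⟨v, g⟩ hz
    simp only [mem_filter, mem_univ, true_and, mem_product] at hz
    rw [Finset.card_eq_one]
    refine ⟨(v * g * v⁻¹, v * y * v⁻¹), ?_⟩
    ext ⟨a, b⟩
    simp only [mem_filter, mem_univ, true_and, Finset.mem_bipartiteBelow, mem_singleton,
      Prod.mk.injEq]
    constructor
    · rintro ⟨-, h⟩; exact h
    · rintro ⟨rfl, rfl⟩
      refine ⟨⟨W.mul_mem (W.mul_mem hz.1 hz.2.1) (inv_mem hz.1), hφ _ hz.1 _ hz.2.2.1,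
        ⟨v, hz.1, rfl⟩, ?_⟩, rfl, rfl⟩
      calc v * g * v⁻¹ * (v * y * v⁻¹) = v * (g * y) * v⁻¹ := by group
        _ = _ := by rw [hz.2.2.2]; group

/-- The number of elements of `V` of order divisible by `t`. -/
noncomputable def singCount (t : ℕ) (V : Subgroup G) : ℕ :=
  #{g | g ∈ V ∧ ∃ k, g ^ k ≠ 1 ∧ PEl t (g ^ k)}

theorem singCount_eq {c : ℕ} (h1 : ∀ x : G, PEl t (x ^ c)) (h2 : ∀ x : G, PEl t x → x ^ c = x)
    (V : Subgroup G) : singCount t V = #{g | g ∈ V ∧ g ^ c ≠ 1} := by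
  rw [singCount]
  congr 1; ext g
  simp only [mem_filter, mem_univ, true_and]
  refine and_congr_right fun _ => ⟨?_, fun h => ⟨c, h, h1 g⟩⟩
  rintro ⟨k, hk, hk'⟩ h
  apply hk
  rw [← h2 _ hk', ← pow_mul, mul_comm, pow_mul, h, one_pow]

theorem le_singCount {c : ℕ} (h1 : ∀ x : G, PEl q (x ^ c)) (h2 : ∀ x : G, PEl q x → x ^ c = x)
    (V : Subgroup G) {a : G} (haV : a ∈ V) (ha : PEl q a) (ha1 : a ≠ 1) :
    Nat.card V * #{u | u ∈ V ⊓ centralizer {a} ∧ u ^ c = 1} ≤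
      Nat.card (V ⊓ centralizer {a} : Subgroup G) * singCount q V := by
  rw [singCount_eq h1 h2, ← card_filter_mem V, ← card_product]
  have hpow : ∀ v u, u ∈ centralizer {a} → u ^ c = 1 →
      (v * (a * u) * v⁻¹) ^ c = v * a * v⁻¹ := by
    intro v u hu hu1
    rw [conj_pow', (show Commute a u from (mem_cent.1 hu).symm).mul_pow, hu1, h2 a ha, mul_one]
  apply Finset.card_le_mul_card_image_of_maps_to (f := fun z => z.1 * (a * z.2) * z.1⁻¹)
  · rintro ⟨v, u⟩ hz
    simp only [mem_filter, mem_univ, true_and, mem_product] at *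
    refine ⟨V.mul_mem (V.mul_mem hz.1 (V.mul_mem haV hz.2.1.1)) (inv_mem hz.1), ?_⟩
    rw [hpow v u hz.2.1.2 hz.2.2]
    simpa using ha1
  · intro g hg
    rcases Finset.eq_empty_or_nonempty ({z ∈ (({v | v ∈ V} : Finset G)) ×ˢ
      ({u | u ∈ V ⊓ centralizer {a} ∧ u ^ c = 1} : Finset G) |
        z.1 * (a * z.2) * z.1⁻¹ = g}) with h | ⟨⟨v₀, u₀⟩, h0⟩
    · rw [h]; simp
    · simp only [mem_filter, mem_univ, true_and, mem_product] at h0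
      rw [← card_filter_mem]
      apply Finset.card_le_card_of_injOn (fun z => v₀⁻¹ * z.1)
      · rintro ⟨v, u⟩ hz
        simp only [coe_filter, mem_filter, mem_univ, true_and, mem_product,
          Set.mem_ofPred_eq] at *
        refine ⟨V.mul_mem (inv_mem h0.1.1) hz.1.1, mem_cent.2 ?_⟩
        have e1 := hpow v u hz.1.2.1.2 hz.1.2.2
        have e2 := hpow v₀ u₀ h0.1.2.1.2 h0.1.2.2
        rw [hz.2] at e1
        rw [h0.2, e1] at e2
        calc v₀⁻¹ * v * a = v₀⁻¹ * (v * a * v⁻¹) * v := by group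
          _ = _ := by rw [e2]; group
      · rintro ⟨v, u⟩ hz ⟨v', u'⟩ hz' h
        simp only [coe_filter, mem_filter, mem_univ, true_and, mem_product,
          Set.mem_ofPred_eq] at *
        have hv : v = v' := by simpa using h
        subst hv
        have h3 := hz.2.trans hz'.2.symm
        simpa using h3

namespace CanData

variable {V : Subgroup G} {x₀ : G} {D : CanData p q V x₀} [V.Normal] [Fact p.Prime] [Fact q.Prime]

theorem classAt (D : CanData p q V x₀) (hqp : q ≠ p) {s : G} (hs : Good p V s) :
    ClassAt p q V s (D.can s).toFinset := by
  obtain ⟨x, hx⟩ := D.nonempty s hs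
  refine Or.inr ⟨oLoc p V s, x, pCore_le _ _, fun h hh => normalizer_oLoc (mem_cent.1 hh.2),
    isPGroup_oLoc s, D.pel s x hx, D.comm s x hx,
    fun h hh => D.zmod s x hx h hh.1 (mem_cent.1 hh.2), fun y => ?_⟩
  rw [Set.mem_toFinset, D.mem_can_iff hqp hx]

theorem normalizer_inf_cent {x y : G} (hxy : x * y = y * x) :
    x ∈ normalizer ((V ⊓ centralizer {y} : Subgroup G) : Set G) :=
  normalizer_inf (mem_normalizer_of_normal _) (le_normalizer (mem_cent.2 hxy))

theorem commutator_mem_of_normalizer {G : Type*} [Group G] {N : Subgroup G} {h x : G} (hh : h ∈ N)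
    (hx : x ∈ normalizer (N : Set G)) : ⁅h, x⁆ ∈ N := by
  have : ⁅h, x⁆ = h * (x * h⁻¹ * x⁻¹) := by rw [commutatorElement_def]; group
  rw [this]
  exact N.mul_mem hh (conj_mem_of_mem_normalizer hx (N.inv_mem hh))

theorem classAt_inter (D : CanData p q V x₀) (hqp : q ≠ p) {y₁ y₂ s : G}
    (h12 : y₁ * y₂ = y₂ * y₁) :
    ClassAt p q (V ⊓ centralizer {y₂}) s
      ({x | x ∈ D.can s ∧ ∃ n ∈ V ⊓ centralizer {y₂}, x = n * y₁ * n⁻¹} : Finset G) := by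
  set N := V ⊓ centralizer {y₂} with hN
  by_cases hne : ({x | x ∈ D.can s ∧ ∃ n ∈ N, x = n * y₁ * n⁻¹} : Finset G) = ∅
  · exact Or.inl hne
  obtain ⟨x, hx⟩ := Finset.nonempty_iff_ne_empty.2 hne
  simp only [mem_filter, mem_univ, true_and] at hx
  have hcomm : ∀ n ∈ N, (n * y₁ * n⁻¹) * y₂ = y₂ * (n * y₁ * n⁻¹) := fun n hn => by
    have h1 : Commute n y₂ := mem_cent.1 hn.2
    exact ((h1.mul_left h12).mul_left h1.inv_left).eq
  obtain ⟨hxs, n, hn, hxn⟩ := hx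
  have hxy : x * y₂ = y₂ * x := by rw [hxn]; exact hcomm n hn
  have hle : oLoc p V s ⊓ N ≤ V ⊓ centralizer {s} := fun o ho =>
    ⟨ho.2.1, mem_cent.2 (oLoc_comm ho.1)⟩
  refine Or.inr ⟨oLoc p V s ⊓ N, x, fun o ho => ⟨ho.2, (hle ho).2⟩, fun h hh => ?_,
    (isPGroup_oLoc s).to_le inf_le_left, D.pel s x hxs, D.comm s x hxs, fun h hh => ?_,
    fun y => ?_⟩
  · exact normalizer_inf (normalizer_oLoc (mem_cent.1 hh.2)) (le_normalizer hh.1)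
  · exact ⟨D.zmod s x hxs h hh.1.1 (mem_cent.1 hh.2),
      commutator_mem_of_normalizer hh.1 (normalizer_inf_cent hxy)⟩
  · simp only [mem_filter, mem_univ, true_and]
    constructor
    · rintro ⟨hys, n', hn', rfl⟩
      have h1 := D.diff s x hxs _ hys
      have h2 : x⁻¹ * (n' * y₁ * n'⁻¹) ∈ N := by
        refine ⟨oLoc_le_left _ h1, mem_cent.2 ?_⟩
        have c1 : Commute x y₂ := hxy
        have c2 : Commute (n' * y₁ * n'⁻¹) y₂ := hcomm n' hn'
        exact (c1.inv_left.mul_left c2).eq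
      exact exists_conj_of_coset hqp ((isPGroup_oLoc s).to_le inf_le_left)
        (normalizer_inf (normalizer_oLoc (D.comm s x hxs)) (normalizer_inf_cent hxy))
        ⟨h1, h2⟩ (D.pel s x hxs) (D.pel s _ hys)
    · rintro ⟨o, ho, rfl⟩
      refine ⟨(D.mem_can_iff hqp hxs).2 ⟨o, ho.1, rfl⟩, o⁻¹ * n, N.mul_mem (inv_mem ho.2) hn, ?_⟩
      rw [hxn]; group

theorem arith_lt {Mt Mq n T Q x k s v va kv o co : ℕ} (hA : Mt * n ≤ v * T)
    (hB : n * s ≤ Q * x) (hs : s + k = x) (hC : T + Q + 1 ≤ n) (h1 : k * o = kv * co)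
    (h0 : x * o = va * co) (hE : v * kv ≤ va * Mq) (ho : 0 < o) (hco : 0 < co) (hx : 0 < x)
    (hv : 0 < v) : Mt < Mq := by
  have hn : 0 < n := by omega
  have hva : 0 < va := by
    rcases Nat.eq_zero_or_pos va with h | h
    · rw [h, zero_mul] at h0; have := Nat.mul_pos hx ho; omega
    · exact h
  have h2 : k * va = kv * x := by
    apply Nat.eq_of_mul_eq_mul_right (Nat.mul_pos ho hco)
    calc k * va * (o * co) = (k * o) * (va * co) := by ring
      _ = _ := by rw [h1, ← h0]; ring
  have h3 : x * Mt < v * k := by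
    apply Nat.lt_of_mul_lt_mul_right (a := n)
    have e1 : x * (Mt * n) ≤ x * (v * T) := Nat.mul_le_mul_left _ hA
    have e2 : x * v * (T + Q + 1) ≤ x * v * n := Nat.mul_le_mul_left _ hC
    have e3 : v * (n * s) ≤ v * (Q * x) := Nat.mul_le_mul_left _ hB
    have e4 : 0 < x * v := Nat.mul_pos hx hv
    subst hs
    nlinarith
  apply Nat.lt_of_mul_lt_mul_right (a := va * x)
  calc Mt * (va * x) = (x * Mt) * va := by ring
    _ < (v * k) * va := Nat.mul_lt_mul_of_pos_right h3 hva
    _ = (v * kv) * x := by rw [mul_assoc, h2]; ring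
    _ ≤ (va * Mq) * x := Nat.mul_le_mul_right _ hE
    _ = Mq * (va * x) := by ring

theorem sing_lt (hqp : q ≠ p) (ht : t.Prime) (htp : t ≠ p)
    (hqV : q ∣ Nat.card V) {y₂ : G} (h₂ : D.Base t y₂) (hn : ¬ D.Base q y₂) :
    singCount t V < singCount q V := by
  have hq : q.Prime := Fact.out
  have := Fact.mk ht
  obtain ⟨y₀, h₀⟩ := D.exists_base hqp hq hqp hqV
  have h20 : y₂⁻¹ * y₀ ∈ V := by
    have := V.mul_mem (V.inv_mem h₂.coset) h₀.coset
    simpa [mul_assoc] using this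
  obtain ⟨v, hv, S, hS, hy2S, hy1S⟩ := exists_common_isPGroup h₂.pel h₀.pel h20
  have h₁ := h₀.conj hv
  generalize v * y₀ * v⁻¹ = y₁ at *
  have haV : y₁⁻¹ * y₂ ∈ V := by
    have := V.mul_mem (V.inv_mem h₁.coset) h₂.coset
    simpa [mul_assoc] using this
  have h12 : y₁ * y₂ = y₂ * y₁ := by
    have hw : y₂ * y₁⁻¹ ∈ V := by
      have := (inferInstance : V.Normal).conj_mem _ haV y₁
      simpa using this
    have h3 := h₁.conj hw
    have h4 : y₂ * y₁⁻¹ * y₁ * (y₂ * y₁⁻¹)⁻¹ = y₂ * y₁ * y₂⁻¹ := by group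
    rw [h4] at h3
    have h5 := h₁.eq_of_mem hqp hqV h3 hS hy1S
      (S.mul_mem (S.mul_mem hy2S hy1S) (S.inv_mem hy2S))
    exact eq_mul_inv_iff_mul_eq.1 h5
  obtain ⟨a, ha⟩ : ∃ a, y₁⁻¹ * y₂ = a := ⟨_, rfl⟩
  have haq : PEl q a := ha ▸ PEl.of_mem hS (S.mul_mem (S.inv_mem hy1S) hy2S)
  rw [ha] at haV
  have ha1 : a ≠ 1 := fun h => hn (by
    rw [h, inv_mul_eq_one] at ha
    rwa [← ha])
  have hy2 : y₂ = y₁ * a := by rw [← ha]; group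
  have hya : y₁ * a = a * y₁ := by
    rw [← ha]
    exact ((Commute.refl y₁).inv_right.mul_right h12).eq
  have hcan := h₁.mem_can hq haV ha1 haq hya
  obtain ⟨ct, ht1, ht2⟩ := exists_tPart G t
  obtain ⟨cq, hq1, hq2⟩ := exists_tPart G q
  have hct := partExp_tPart htp ht1 ht2
  have hcq := partExp_tPart hqp hq1 hq2
  set N := V ⊓ centralizer {y₂} with hN
  have hconj : ∀ (c : ℕ) (v g : G), g ^ c ≠ 1 → (v * g * v⁻¹) ^ c ≠ 1 := fun c v g h h' => h (by
    rw [conj_pow'] at h'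
    simpa using h')
  have hNcard : #{n | n ∈ V ∧ n * y₂ = y₂ * n} = Nat.card N := by
    rw [← card_filter_mem]
    congr 1; ext g
    simp only [mem_filter, mem_univ, true_and]
    exact ⟨fun h => ⟨h.1, mem_cent.2 h.2⟩, fun h => ⟨h.1, mem_cent.1 h.2⟩⟩
  have hA : singCount t V * Nat.card N ≤ Nat.card V * #{g | g ∈ N ∧ g ^ ct ≠ 1} := by
    have e1 := card_class_pairs V y₂ (φ := fun g => g ^ ct ≠ 1) (fun v _ g => hconj ct v g)
    have e2 := card_pairs hqp hct (W := V) (X := fun s => (D.can s).toFinset) (by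
      intro s hs hs1 hsc
      exact D.classAt hqp ⟨hs, hs1, t, ht, htp, hsc ▸ ht1 s⟩)
    have e3 : #{g | g ∈ V ∧ g ^ ct ≠ 1 ∧ ((D.can (g ^ ct)).toFinset).Nonempty} = singCount t V := by
      rw [singCount_eq ht1 ht2]
      congr 1; ext g
      simp only [mem_filter, mem_univ, true_and]
      refine ⟨fun h => ⟨h.1, h.2.1⟩, fun h => ⟨h.1, h.2, ?_⟩⟩
      rw [Set.toFinset_nonempty]
      exact D.nonempty _ ⟨V.pow_mem h.1 _, h.2, t, ht, htp, ht1 g⟩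
    rw [← e3, ← e2, ← hNcard]
    have e4 : #{g | g ∈ N ∧ g ^ ct ≠ 1} = #{g | g ∈ V ∧ g ^ ct ≠ 1 ∧ g * y₂ = y₂ * g} := by
      congr 1; ext g
      simp only [mem_filter, mem_univ, true_and]
      exact ⟨fun h => ⟨h.1.1, h.2, mem_cent.1 h.1.2⟩, fun h => ⟨⟨h.1, mem_cent.2 h.2.2⟩, h.2.1⟩⟩
    rw [e4]
    refine le_trans (Nat.mul_le_mul_right _ ?_) (le_of_eq (by convert e1))
    apply Finset.card_le_card
    rintro ⟨g, x⟩ hz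
    simp only [mem_filter, mem_univ, true_and, Set.mem_toFinset] at *
    exact ⟨hz.1, hz.2.1, h₂.exists_conj hqp ht (V.pow_mem hz.1 _) hz.2.1 (ht1 g) hz.2.2.1,
      hz.2.2.2⟩
  have hB : Nat.card N * #{g | g ∈ N ∧ g ^ cq ≠ 1 ∧ g * y₁ = y₁ * g} ≤
      #{g | g ∈ N ∧ g ^ cq ≠ 1} * #{n | n ∈ N ∧ n * y₁ = y₁ * n} := by
    have e1 := card_class_pairs N y₁ (φ := fun g => g ^ cq ≠ 1) (fun v _ g => hconj cq v g)
    have e2 := card_pairs hqp hcq (W := N) (X := fun s =>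
      ({x | x ∈ D.can s ∧ ∃ n ∈ N, x = n * y₁ * n⁻¹} : Finset G)) (by
      intro s hs hs1 hsc
      exact D.classAt_inter hqp h12)
    refine le_trans (le_of_eq (by convert e1.symm)) (Nat.mul_le_mul_right _ ?_)
    refine le_trans (Finset.card_le_card ?_) (e2.le.trans (Finset.card_le_card ?_))
    · rintro ⟨g, x⟩ hz
      simp only [mem_filter, mem_univ, true_and] at *
      refine ⟨hz.1, hz.2.1, ⟨?_, hz.2.2.1⟩, hz.2.2.2⟩
      obtain ⟨n, hnN, hx⟩ := hz.2.2.1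
      have hx' := h₁.conj hnN.1
      rw [← hx] at hx'
      exact hx'.mem_can hq (V.pow_mem hz.1.1 _) hz.2.1 (hq1 g)
        ((show Commute x g from hz.2.2.2.symm).pow_right cq).eq
    · intro g hg
      simp only [mem_filter, mem_univ, true_and] at *
      exact ⟨hg.1, hg.2.1⟩
  have hs : #{g | g ∈ N ∧ g ^ cq ≠ 1 ∧ g * y₁ = y₁ * g} +
      #{u | u ∈ V ⊓ centralizer {a} ∧ u ^ cq = 1 ∧ u * y₁ = y₁ * u} =
      #{n | n ∈ N ∧ n * y₁ = y₁ * n} := by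
    rw [add_comm, ← Finset.card_filter_add_card_filter_not (s := {n | n ∈ N ∧ n * y₁ = y₁ * n})
      (fun g => g ^ cq = 1), Finset.filter_filter, Finset.filter_filter]
    congr 2
    · ext u
      simp only [mem_filter, mem_univ, true_and]
      constructor
      · rintro ⟨h1, h2, h3⟩
        refine ⟨⟨⟨h1.1, mem_cent.2 ?_⟩, h3⟩, h2⟩
        rw [hy2]
        exact (Commute.mul_right (show Commute u y₁ from h3) (mem_cent.1 h1.2)).eq
      · rintro ⟨⟨h1, h3⟩, h2⟩
        refine ⟨⟨h1.1, mem_cent.2 ?_⟩, h2, h3⟩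
        rw [← ha]
        exact (Commute.mul_right (show Commute u y₁ from h3).inv_right (mem_cent.1 h1.2)).eq
    · ext u
      simp only [mem_filter, mem_univ, true_and]
      tauto
  have hC : #{g | g ∈ N ∧ g ^ ct ≠ 1} + #{g | g ∈ N ∧ g ^ cq ≠ 1} + 1 ≤ Nat.card N := by
    rw [← card_filter_mem N, ← Finset.card_union_of_disjoint]
    · rw [← Finset.card_singleton (1 : G), ← Finset.card_union_of_disjoint]
      · apply Finset.card_le_card
        intro g hg
        simp only [mem_filter, mem_univ, true_and, mem_union, mem_singleton] at *
        rcases hg with (h | h) | rfl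
        · exact h.1
        · exact h.1
        · exact one_mem _
      · rw [Finset.disjoint_singleton_right]
        simp
    · rw [Finset.disjoint_left]
      intro g hg hg'
      simp only [mem_filter, mem_univ, true_and] at *
      apply hn
      have hyg : Commute y₂ g := (mem_cent.1 hg.1.2).symm
      have c1 := h₂.mem_can ht (V.pow_mem hg.1.1 ct) hg.2 (ht1 g) (hyg.pow_right ct).eq
      have c2 := D.trans _ ⟨V.pow_mem hg.1.1 ct, hg.2, t, ht, htp, ht1 g⟩ _
        ⟨V.pow_mem hg.1.1 cq, hg'.2, q, hq, hqp, hq1 g⟩ (Commute.pow_pow_self g ct cq).eq _ c1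
        (hyg.pow_right cq).eq
      obtain ⟨w, hw, hwy⟩ := h₁.exists_conj hqp hq (V.pow_mem hg.1.1 cq) hg'.2 (hq1 g) c2
      rw [hwy]
      exact h₁.conj hw
  have hHO : V ⊓ centralizer {a} ≤ normalizer (oLoc p V a : Set G) := fun h hh =>
    normalizer_oLoc (mem_cent.1 hh.2)
  have hz : ∀ h ∈ V ⊓ centralizer {a}, ⁅h, y₁⁆ ∈ oLoc p V a := fun h hh =>
    D.zmod a y₁ hcan h hh.1 (mem_cent.1 hh.2)
  have k1 := card_cent_mul hqp hcq (pCore_le _ _) hHO (isPGroup_oLoc a) h₁.pel hz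
  have k0 := card_cent_mul hqp (partExp_zero (p := p)) (pCore_le _ _) hHO (isPGroup_oLoc a)
    h₁.pel hz
  simp only [pow_zero, true_and, and_true] at k0
  rw [card_filter_mem] at k0
  have k0' : #{u | u ∈ V ⊓ centralizer {a} ∧ u * y₁ = y₁ * u} =
      #{n | n ∈ N ∧ n * y₁ = y₁ * n} := by
    congr 1; ext u
    simp only [mem_filter, mem_univ, true_and]
    constructor
    · rintro ⟨h1, h3⟩
      refine ⟨⟨h1.1, mem_cent.2 ?_⟩, h3⟩
      rw [hy2]
      exact (Commute.mul_right (show Commute u y₁ from h3) (mem_cent.1 h1.2)).eq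
    · rintro ⟨h1, h3⟩
      refine ⟨⟨h1.1, mem_cent.2 ?_⟩, h3⟩
      rw [← ha]
      exact (Commute.mul_right (show Commute u y₁ from h3).inv_right (mem_cent.1 h1.2)).eq
  rw [k0'] at k0
  exact arith_lt hA hB hs hC k1 k0 (le_singCount hq1 hq2 V haV haq ha1) Nat.card_pos
    (Finset.card_pos.2 ⟨1, by simp⟩) (Finset.card_pos.2 ⟨1, by simp⟩) Nat.card_pos

end CanData

end

theorem card_mul_card_inf_le {G : Type*} [Group G] [Finite G] {A B W : Subgroup G}
    (h : ∀ w ∈ W, ∃ a ∈ A, ∃ b ∈ B, w = a * b) :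
    Nat.card W * Nat.card (A ⊓ B : Subgroup G) ≤ Nat.card A * Nat.card B := by
  choose! f hf g hg hfg using h
  rw [← Nat.card_prod, ← Nat.card_prod]
  refine Nat.card_le_card_of_injective (fun z : W × (A ⊓ B : Subgroup G) =>
    ((⟨f z.1 * z.2, A.mul_mem (hf _ z.1.2) z.2.2.1⟩,
      ⟨(z.2 : G)⁻¹ * g z.1, B.mul_mem (B.inv_mem z.2.2.2) (hg _ z.1.2)⟩) : A × B)) ?_
  rintro ⟨w, d⟩ ⟨w', d'⟩ hz
  simp only [Prod.mk.injEq, Subtype.mk.injEq] at hz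
  have h1 : (w : G) = w' := by
    rw [hfg w w.2, hfg w' w'.2]
    calc f w * g w = (f w * d) * ((d : G)⁻¹ * g w) := by group
      _ = (f w' * d') * ((d' : G)⁻¹ * g w') := by rw [hz.1, hz.2]
      _ = _ := by group
  have h2 : w = w' := Subtype.ext h1
  subst h2
  have h3 : (d : G) = d' := mul_left_cancel hz.1
  rw [Subtype.ext h3]

theorem exists_mul_of_card {G : Type*} [Group G] [Finite G] {A B W : Subgroup G} (hA : A ≤ W)
    (hB : B ≤ W)
    (h : Nat.card W * Nat.card (A ⊓ B : Subgroup G) ≤ Nat.card A * Nat.card B) :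
    ∀ w ∈ W, ∃ a ∈ A, ∃ b ∈ B, w = a * b := by
  set I : Set G := {w | ∃ a ∈ A, ∃ b ∈ B, w = a * b} with hI
  have hIW : I ⊆ W := by
    rintro _ ⟨a, ha, b, hb, rfl⟩
    exact W.mul_mem (hA ha) (hB hb)
  have hch : ∀ w : I, ∃ a ∈ A, a⁻¹ * w ∈ B := by
    rintro ⟨_, a, ha, b, hb, rfl⟩
    exact ⟨a, ha, by simpa using hb⟩
  choose f hf hf' using hch
  have hinj : Nat.card A * Nat.card B ≤ Nat.card I * Nat.card (A ⊓ B : Subgroup G) := by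
    rw [← Nat.card_prod, ← Nat.card_prod]
    have hm : ∀ z : A × B, (z.1 * z.2 : G) ∈ I := fun z => ⟨_, z.1.2, _, z.2.2, rfl⟩
    refine Nat.card_le_card_of_injective (fun z : A × B => ((⟨_, hm z⟩,
      ⟨(f ⟨_, hm z⟩)⁻¹ * z.1, A.mul_mem (A.inv_mem (hf _)) z.1.2, ?_⟩) :
        I × (A ⊓ B : Subgroup G))) ?_
    · have h1 := hf' ⟨_, hm z⟩
      have h2 : (f ⟨_, hm z⟩)⁻¹ * (z.1 : G) = (f ⟨_, hm z⟩)⁻¹ * (z.1 * z.2) * (z.2 : G)⁻¹ := by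
        group
      rw [h2]
      exact B.mul_mem h1 (B.inv_mem z.2.2)
    · rintro ⟨a, b⟩ ⟨a', b'⟩ hz
      simp only [Prod.mk.injEq, Subtype.mk.injEq] at hz
      obtain ⟨h1, h2⟩ := hz
      simp only [h1] at h2
      have h3 : (a : G) = a' := mul_left_cancel (congrArg Subtype.val h2)
      have h4 : (b : G) = b' := by
        rw [h3] at h1
        exact mul_left_cancel h1
      rw [Subtype.ext h3, Subtype.ext h4]
  have hpos : 0 < Nat.card (A ⊓ B : Subgroup G) := Nat.card_pos
  have h5 : Nat.card W ≤ Nat.card I := Nat.le_of_mul_le_mul_right (h.trans hinj) hpos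
  have h6 : I = (W : Set G) := by
    apply Set.eq_of_subset_of_ncard_le hIW ?_ (Set.toFinite _)
    rwa [← Nat.card_coe_set_eq, ← Nat.card_coe_set_eq]
  intro w hw
  have : w ∈ I := h6 ▸ hw
  exact this

section

variable {G : Type*} [Group G] [Fintype G] {p q : ℕ} [Fact p.Prime] [Fact q.Prime]
  {V : Subgroup G} [V.Normal] {x₀ : G} {D : CanData p q V x₀}

theorem CanData.classAt_conj {c : ℕ} (hc : PartExp G p c) (hqp : q ≠ p) {y : G}
    (hU : ∀ t : ℕ, t.Prime → t ≠ p → D.Base t y) {W : Subgroup G} (hWV : W ≤ V)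
    (hyW : y ∈ normalizer (W : Set G)) {s : G} (hs : s ∈ W) (hs1 : s ≠ 1) (hsc : s ^ c = s) :
    ClassAt p q W s ({x | (∃ v ∈ W, x = v * y * v⁻¹) ∧ x * s = s * x} : Finset G) := by
  by_cases hne : ({x | (∃ v ∈ W, x = v * y * v⁻¹) ∧ x * s = s * x} : Finset G) = ∅
  · exact Or.inl hne
  obtain ⟨x, hx⟩ := Finset.nonempty_iff_ne_empty.2 hne
  simp only [mem_filter, mem_univ, true_and] at hx
  obtain ⟨⟨v, hv, hxv⟩, hxs⟩ := hx
  obtain ⟨t, ht, htp, k, hk1, hkt⟩ := exists_prime_tPart hc hsc hs1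
  have hcan : ∀ x, (∃ v ∈ W, x = v * y * v⁻¹) → x * s = s * x → x ∈ D.can (s ^ k) := by
    rintro x ⟨v, hv, rfl⟩ hx
    exact ((hU t ht htp).conj (hWV hv)).mem_can ht (V.pow_mem (hWV hs) k) hk1 hkt
      ((show Commute _ s from hx).pow_right k).eq
  have hnorm : ∀ x, (∃ v ∈ W, x = v * y * v⁻¹) → x ∈ normalizer (W : Set G) := by
    rintro x ⟨v, hv, rfl⟩
    exact mul_mem (mul_mem (le_normalizer hv) hyW) (le_normalizer (inv_mem hv))
  have hsk : ∀ h, h * s = s * h → h * s ^ k = s ^ k * h := fun h hh =>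
    ((show Commute h s from hh).pow_right k).eq
  have hxc := hcan x ⟨v, hv, hxv⟩ hxs
  have hxW := hnorm x ⟨v, hv, hxv⟩
  have hxq : PEl q x := D.pel _ x hxc
  have hOp : IsPGroup p (oLoc p V (s ^ k) ⊓ (W ⊓ centralizer {s}) : Subgroup G) :=
    (isPGroup_oLoc (s ^ k)).to_le inf_le_left
  have hnO : ∀ h, h * s = s * h → h ∈ normalizer (W : Set G) →
      h ∈ normalizer ((oLoc p V (s ^ k) ⊓ (W ⊓ centralizer {s}) : Subgroup G) : Set G) :=
    fun h hh hW => normalizer_inf (normalizer_oLoc (hsk h hh))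
      (normalizer_inf hW (le_normalizer (mem_cent.2 hh)))
  refine Or.inr ⟨oLoc p V (s ^ k) ⊓ (W ⊓ centralizer {s}), x, inf_le_right, fun h hh =>
    hnO h (mem_cent.1 hh.2) (le_normalizer hh.1), hOp, hxq, hxs, fun h hh => ?_, fun y' => ?_⟩
  · refine ⟨D.zmod _ x hxc h (hWV hh.1) (hsk h (mem_cent.1 hh.2)),
      commutator_mem_of_normalizer hh.1 hxW, mem_cent.2 ?_⟩
    have c1 : Commute h s := mem_cent.1 hh.2
    have c2 : Commute x s := hxs
    exact (((c1.mul_left c2).mul_left c1.inv_left).mul_left c2.inv_left).eq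
  · simp only [mem_filter, mem_univ, true_and]
    constructor
    · rintro ⟨⟨v', hv', rfl⟩, hys⟩
      have h1 := D.diff _ x hxc _ (hcan _ ⟨v', hv', rfl⟩ hys)
      refine exists_conj_of_coset hqp hOp (hnO x hxs hxW) ⟨h1, ?_, mem_cent.2 ?_⟩ hxq
        (D.pel _ _ (hcan _ ⟨v', hv', rfl⟩ hys))
      · have h2 : v⁻¹ * v' ∈ W := W.mul_mem (W.inv_mem hv) hv'
        have h3 := conj_mem_of_mem_normalizer (inv_mem hyW) h2
        have h4 : x⁻¹ * (v' * y * v'⁻¹) = v * (y⁻¹ * (v⁻¹ * v') * y⁻¹⁻¹) * v'⁻¹ := by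
          rw [hxv]; group
        rw [h4]
        exact W.mul_mem (W.mul_mem hv h3) (W.inv_mem hv')
      · exact ((show Commute x s from hxs).inv_left.mul_left hys).eq
    · rintro ⟨o, ho, rfl⟩
      refine ⟨⟨o⁻¹ * v, W.mul_mem (W.inv_mem ho.2.1) hv, by rw [hxv]; group⟩, ?_⟩
      have c1 : Commute o s := mem_cent.1 ho.2.2
      have c2 : Commute x s := hxs
      exact ((c1.inv_left.mul_left c2).mul_left c1).eq

theorem CanData.card_le_of_uniform {c : ℕ} (hc : PartExp G p c) (hqp : q ≠ p) {y : G}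
    (hU : ∀ t : ℕ, t.Prime → t ≠ p → D.Base t y) {W C : Subgroup G} (hWV : W ≤ V)
    (hyW : y ∈ normalizer (W : Set G)) (hC : W ⊓ centralizer {y} = C) :
    Nat.card C * #{g | g ∈ W ∧ g ^ c = 1} ≤ Nat.card W * #{g | g ∈ C ∧ g ^ c = 1} := by
  have hCm : ∀ g, g ∈ C ↔ g ∈ W ∧ g * y = y * g := fun g => by
    rw [← hC, Subgroup.mem_inf, mem_cent]
  have hCcard : #{n | n ∈ W ∧ n * y = y * n} = Nat.card C := by
    rw [← card_filter_mem]
    congr 1; ext g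
    simp only [mem_filter, mem_univ, true_and, hCm]
  have e1 := card_class_pairs W y (φ := fun g => g ^ c ≠ 1) (fun v _ g h h' => h (by
    rw [conj_pow'] at h'
    simpa using h'))
  have e2 := card_pairs hqp hc (W := W) (X := fun s =>
    ({x | (∃ v ∈ W, x = v * y * v⁻¹) ∧ x * s = s * x} : Finset G))
    (fun s hs hs1 hsc => D.classAt_conj hc hqp hU hWV hyW hs hs1 hsc)
  have hle : Nat.card W * #{g | g ∈ C ∧ g ^ c ≠ 1} ≤ #{g | g ∈ W ∧ g ^ c ≠ 1} * Nat.card C := by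
    have e4 : #{g | g ∈ C ∧ g ^ c ≠ 1} = #{g | g ∈ W ∧ g ^ c ≠ 1 ∧ g * y = y * g} := by
      congr 1; ext g
      simp only [mem_filter, mem_univ, true_and, hCm]
      tauto
    rw [e4, ← hCcard]
    refine le_trans (le_of_eq (by convert e1.symm)) (Nat.mul_le_mul_right _ ?_)
    refine le_trans (Finset.card_le_card ?_) (e2.le.trans (Finset.card_le_card ?_))
    · rintro ⟨g, x⟩ hz
      simp only [mem_filter, mem_univ, true_and] at *
      refine ⟨hz.1, hz.2.1, ⟨hz.2.2.1, ?_⟩, hz.2.2.2⟩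
      exact ((show Commute x g from hz.2.2.2.symm).pow_right c).eq
    · intro g hg
      simp only [mem_filter, mem_univ, true_and] at *
      exact ⟨hg.1, hg.2.1⟩
  have hsplit : ∀ H : Subgroup G,
      #{g | g ∈ H ∧ g ^ c = 1} + #{g | g ∈ H ∧ g ^ c ≠ 1} = Nat.card H := fun H => by
    rw [← card_filter_mem, ← Finset.card_filter_add_card_filter_not (s := {n | n ∈ H})
      (fun g => g ^ c = 1), Finset.filter_filter, Finset.filter_filter]
  have hW := hsplit W
  have hC' := hsplit C
  nlinarith

end

section

variable {G : Type*} [Group G] [Fintype G] {p q : ℕ} [Fact p.Prime] [Fact q.Prime]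
  {V : Subgroup G} [V.Normal] {x₀ : G} {D : CanData p q V x₀}

omit [V.Normal] in
theorem exists_sylow_factorization {N : Subgroup G} (hNV : N ≤ V)
    (h : ∀ t : ℕ, t.Prime → t ≠ p → ∃ R ≤ N, IsSylIn t R V) :
    ∃ P Q : Subgroup G, IsSylIn p P N ∧ IsSylIn p Q V ∧ P ≤ Q ∧ Q ⊓ N = P ∧
      ∀ v ∈ V, ∃ x ∈ Q, ∃ n ∈ N, v = x * n := by
  obtain ⟨P, hP, -⟩ := IsSylIn.exists_ge (t := p) (bot_le (a := N)) IsPGroup.of_bot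
  obtain ⟨Q, hQ, hPQ⟩ := IsSylIn.exists_ge (hP.1.trans hNV) hP.2.1
  have hQN : Q ⊓ N = P :=
    hP.2.2 _ inf_le_right (hQ.2.1.to_le inf_le_left) (le_inf hPQ hP.1)
  refine ⟨P, Q, hP, hQ, hPQ, hQN, exists_mul_of_card hQ.1 hNV ?_⟩
  rw [hQN]
  obtain ⟨k, hk, hpk⟩ := hP.card_dvd
  obtain ⟨k', hk', hpk'⟩ := hQ.card_dvd
  have hdvd : k' ∣ k := by
    rw [← Nat.factorization_prime_le_iff_dvd (by rintro rfl; simp at hpk') (by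
      rintro rfl; simp at hpk)]
    intro t ht
    rcases eq_or_ne t p with rfl | htp
    · rw [Nat.factorization_eq_zero_of_not_dvd hpk']; exact Nat.zero_le _
    have := Fact.mk ht
    obtain ⟨R, hRN, hR⟩ := h t ht htp
    obtain ⟨j, hj, htj⟩ := hR.card_dvd
    obtain ⟨j', hj'⟩ := Subgroup.card_dvd_of_le hRN
    have hN0 : Nat.card N ≠ 0 := Nat.card_pos.ne'
    have hV0 : Nat.card V ≠ 0 := Nat.card_pos.ne'
    have h1 : (Nat.card V).factorization t ≤ (Nat.card N).factorization t := by
      have hj0 : j ≠ 0 := by rintro rfl; simp at htj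
      rw [hj, Nat.factorization_mul Nat.card_pos.ne' hj0, Finsupp.add_apply,
        Nat.factorization_eq_zero_of_not_dvd htj, add_zero]
      exact (Nat.factorization_le_iff_dvd Nat.card_pos.ne' hN0).2 (Subgroup.card_dvd_of_le hRN) t
    have hcop : ∀ {S : Subgroup G}, IsPGroup p S → (Nat.card S).factorization t = 0 := fun {S} hS =>
      Nat.factorization_eq_zero_of_not_dvd (not_dvd_card_of_isPGroup htp hS)
    rw [hk, hk', Nat.factorization_mul Nat.card_pos.ne' (by rintro rfl; simp at hpk'),
      Nat.factorization_mul Nat.card_pos.ne' (by rintro rfl; simp at hpk), Finsupp.add_apply,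
      Finsupp.add_apply, hcop hP.2.1, hcop hQ.2.1, zero_add, zero_add] at h1
    exact h1
  have hk0 : 0 < k := Nat.pos_of_ne_zero (by rintro rfl; simp at hpk)
  rw [hk, hk']
  calc Nat.card Q * k' * Nat.card P = Nat.card Q * (Nat.card P * k') := by ring
    _ ≤ _ := Nat.mul_le_mul_left _ (Nat.mul_le_mul_left _ (Nat.le_of_dvd hk0 hdvd))

theorem lt_inf_normalizer {P Q : Subgroup G} (hQ : IsPGroup p Q) (h : P < Q) :
    P < Q ⊓ normalizer (P : Set G) := by
  have hnc : NormalizerCondition Q := by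
    have := hQ.isNilpotent
    exact Group.normalizerCondition_of_isNilpotent
  have h1 : P.subgroupOf Q < ⊤ := by
    rw [lt_top_iff_ne_top]
    intro h2
    rw [Subgroup.subgroupOf_eq_top] at h2
    exact h.not_ge h2
  have h2 := hnc _ h1
  refine lt_of_le_of_ne (le_inf h.le le_normalizer) fun h3 => ?_
  obtain ⟨⟨x, hx⟩, hxn, hxP⟩ := SetLike.exists_of_lt h2
  apply hxP
  rw [Subgroup.mem_subgroupOf, h3]
  refine ⟨hx, mem_normalizer_of_conj fun z hz => ?_⟩
  exact (Subgroup.mem_normalizer_iff.1 hxn ⟨z, h.le hz⟩).1 hz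

theorem CanData.normalizer_eq_of_uniform (hqp : q ≠ p) {y : G}
    (hU : ∀ t : ℕ, t.Prime → t ≠ p → D.Base t y) {P Q : Subgroup G}
    (hP : IsSylIn p P (V ⊓ centralizer {y})) (hQ : IsSylIn p Q V)
    (hQN : Q ⊓ (V ⊓ centralizer {y}) = P)
    (hVQ : ∀ v ∈ V, ∃ x ∈ Q, ∃ n ∈ V ⊓ centralizer {y}, v = x * n) {P' : Subgroup G}
    (hPP' : P ≤ P') (hP'Q : P' ≤ Q) (hy : y ∈ normalizer (P' : Set G))
    (hC : (V ⊓ centralizer {y}) ⊓ normalizer (P : Set G) ≤ normalizer (P' : Set G)) {g : G}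
    (hg : g ∈ V ⊓ normalizer (P' : Set G)) (hgp : PEl p g) : g ∈ Q ⊓ normalizer (P' : Set G) := by
  set N := V ⊓ centralizer {y} with hN
  set C := N ⊓ normalizer (P : Set G) with hCdef
  set W := V ⊓ normalizer (P' : Set G) with hW
  obtain ⟨c, hc, hcp⟩ := exists_p'Part G p
  have hWC : W ⊓ centralizer {y} = C := by
    apply le_antisymm
    · rintro n ⟨⟨hnV, hnP'⟩, hny⟩
      refine ⟨⟨hnV, hny⟩, mem_normalizer_of_conj fun z hz => ?_⟩
      rw [← hQN]
      refine ⟨hP'Q (conj_mem_of_mem_normalizer hnP' (hPP' hz)), ?_⟩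
      exact N.mul_mem (N.mul_mem ⟨hnV, hny⟩ (hP.1 hz)) (N.inv_mem ⟨hnV, hny⟩)
    · intro n hn
      exact ⟨⟨hn.1.1, hC hn⟩, hn.1.2⟩
  have hyW : y ∈ normalizer (W : Set G) :=
    normalizer_inf (mem_normalizer_of_normal _) (le_normalizer hy)
  have h1 := D.card_le_of_uniform hc hqp hU (W := W) inf_le_left hyW hWC
  have hPC : #{g | g ∈ C ∧ g ^ c = 1} ≤ Nat.card P := by
    rw [← card_filter_mem]
    apply Finset.card_le_card
    intro g hg
    simp only [mem_filter, mem_univ, true_and] at *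
    have h2 : IsPGroup p (P ⊔ zpowers g : Subgroup G) :=
      IsPGroup.to_sup_of_normal_left' hP.2.1 (hcp g hg.2).zpowers (zpowers_le.2 hg.1.2)
    have h3 := hP.2.2 _ (sup_le hP.1 (zpowers_le.2 hg.1.1)) h2 le_sup_left
    rw [← h3]
    exact le_sup_right (a := P) (mem_zpowers g)
  have hprod : Nat.card W * Nat.card ((Q ⊓ normalizer (P' : Set G)) ⊓ C : Subgroup G) ≤
      Nat.card (Q ⊓ normalizer (P' : Set G) : Subgroup G) * Nat.card C := by
    apply card_mul_card_inf_le
    intro v hv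
    obtain ⟨x, hx, n, hn, rfl⟩ := hVQ v hv.1
    have hnC : n ∈ C := by
      refine ⟨hn, mem_normalizer_of_conj fun z hz => ?_⟩
      rw [← hQN]
      refine ⟨?_, N.mul_mem (N.mul_mem hn (hP.1 hz)) (N.inv_mem hn)⟩
      have h2 := hP'Q (conj_mem_of_mem_normalizer hv.2 (hPP' hz))
      have h3 : n * z * n⁻¹ = x⁻¹ * (x * n * z * (x * n)⁻¹) * x := by group
      rw [h3]
      exact Q.mul_mem (Q.mul_mem (Q.inv_mem hx) h2) hx
    refine ⟨x, ⟨hx, ?_⟩, n, hnC, rfl⟩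
    have := (normalizer (P' : Set G)).mul_mem hv.2 (inv_mem (hC hnC))
    simpa using this
  have hinf : (Q ⊓ normalizer (P' : Set G)) ⊓ C = P := by
    apply le_antisymm
    · rw [← hQN]
      exact fun z hz => ⟨hz.1.1, hz.2.1⟩
    · exact le_inf (le_inf (hPP'.trans hP'Q) (hPP'.trans le_normalizer)) (le_inf hP.1 le_normalizer)
  rw [hinf] at hprod
  have hcard : #{g | g ∈ W ∧ g ^ c = 1} ≤ #{g | g ∈ Q ⊓ normalizer (P' : Set G)} := by
    rw [card_filter_mem]
    apply Nat.le_of_mul_le_mul_left _ (Nat.card_pos (α := C))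
    calc _ ≤ _ := h1
      _ ≤ _ := Nat.mul_le_mul_left _ hPC
      _ ≤ _ := hprod
      _ = _ := mul_comm _ _
  have hsub : ({g | g ∈ Q ⊓ normalizer (P' : Set G)} : Finset G) ⊆
      ({g | g ∈ W ∧ g ^ c = 1} : Finset G) := by
    intro g hg
    simp only [mem_filter, mem_univ, true_and] at *
    exact ⟨⟨hQ.1 hg.1, hg.2⟩, hc.kill g (PEl.of_mem hQ.2.1 hg.1)⟩
  have heq := Finset.eq_of_subset_of_card_le hsub hcard
  have hmem : g ∈ ({g | g ∈ W ∧ g ^ c = 1} : Finset G) := by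
    simp only [mem_filter, mem_univ, true_and]
    exact ⟨hg, hc.kill g hgp⟩
  rw [← heq] at hmem
  simpa using hmem

omit [Fact (Nat.Prime p)] in
theorem mem_zMod_of_commutator_mem {Q : Subgroup G} (hQV : Q ≤ V) (hQ : IsPGroup p Q) {y : G}
    (h : ∀ v ∈ V, ⁅v, y⁆ ∈ Q) : y ∈ zMod V (pCore p V) := by
  set K := closure {g : G | ∃ v ∈ V, g = ⁅v, y⁆} with hK
  have hKQ : K ≤ Q := by
    rw [hK, closure_le]
    rintro _ ⟨v, hv, rfl⟩
    exact h v hv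
  have hVK : V ≤ normalizer (K : Set G) := by
    intro u hu
    apply mem_normalizer_of_conj
    have : K ≤ conjSub u⁻¹ K := by
      conv_lhs => rw [hK]
      rw [closure_le]
      rintro _ ⟨v, hv, rfl⟩
      have h1 : u⁻¹⁻¹ * ⁅v, y⁆ * u⁻¹ = ⁅u * v, y⁆ * ⁅u, y⁆⁻¹ := by
        simp only [commutatorElement_def]; group
      rw [SetLike.mem_coe, mem_conjSub, h1]
      exact K.mul_mem (subset_closure ⟨_, V.mul_mem hu hv, rfl⟩)
        (K.inv_mem (subset_closure ⟨_, hu, rfl⟩))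
    intro z hz
    have := mem_conjSub.1 (this hz)
    simpa using this
  have hKp := le_pCore (hKQ.trans hQV) hVK (hQ.to_le hKQ)
  exact ⟨mem_normalizer_of_normal _, fun v hv => hKp (subset_closure ⟨v, hv, rfl⟩)⟩

theorem CanData.mem_zMod_of_uniform (hqp : q ≠ p) {y : G}
    (hU : ∀ t : ℕ, t.Prime → t ≠ p → D.Base t y) : y ∈ zMod V (pCore p V) := by
  set N := V ⊓ centralizer {y} with hN
  obtain ⟨P, Q, hP, hQ, hPQ, hQN, hVQ⟩ := exists_sylow_factorization (p := p) (V := V) (N := N)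
    inf_le_left (fun t ht htp => by
      obtain ⟨R, hR, h⟩ := (hU t ht htp).ex
      exact ⟨R, fun b hb => ⟨hR.1 hb, mem_cent.2 (h b hb).1⟩, hR⟩)
  have hyP : y ∈ normalizer (P : Set G) := by
    refine mem_normalizer_of_conj fun z hz => ?_
    have h1 := mem_cent.1 (hP.1 hz).2
    rw [← h1]; simpa using hz
  obtain ⟨P', ⟨⟨h1, h2, h3, h4⟩, h5⟩⟩ := Set.Finite.exists_maximal
    (s := {P' : Subgroup G | P ≤ P' ∧ P' ≤ Q ∧ y ∈ normalizer (P' : Set G) ∧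
      N ⊓ normalizer (P : Set G) ≤ normalizer (P' : Set G)}) (Set.toFinite _)
    ⟨P, le_rfl, hPQ, hyP, inf_le_right⟩
  have key := fun g => D.normalizer_eq_of_uniform hqp hU hP hQ hQN hVQ h1 h2 h3 h4 (g := g)
  have hinv : ∀ u, u ∈ normalizer (V : Set G) → u ∈ normalizer (P' : Set G) →
      u ∈ normalizer ((Q ⊓ normalizer (P' : Set G) : Subgroup G) : Set G) := by
    intro u hu hu'
    refine mem_normalizer_of_conj fun z hz => ?_
    exact key _ ⟨conj_mem_of_mem_normalizer hu (hQ.1 hz.1),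
      (normalizer (P' : Set G)).mul_mem ((normalizer (P' : Set G)).mul_mem hu' hz.2)
        (inv_mem hu')⟩ ((PEl.of_mem hQ.2.1 hz.1).conj u)
  have hPQ' : P' = Q := by
    by_contra hne
    have hlt := lt_inf_normalizer hQ.2.1 (lt_of_le_of_ne h2 hne)
    refine hlt.not_ge (h5 ⟨h1.trans hlt.le, inf_le_left, hinv y (mem_normalizer_of_normal _) h3,
      fun n hn => hinv n (mem_normalizer_of_normal _) (h4 hn)⟩ hlt.le)
  rw [hPQ'] at h3
  refine mem_zMod_of_commutator_mem hQ.1 hQ.2.1 fun v hv => ?_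
  obtain ⟨x, hx, n, hn, rfl⟩ := hVQ v hv
  have hny := mem_cent.1 hn.2
  have : ⁅x * n, y⁆ = ⁅x, y⁆ := by
    rw [commutatorElement_def, commutatorElement_def]
    calc x * n * y * (x * n)⁻¹ * y⁻¹ = x * (n * y) * n⁻¹ * x⁻¹ * y⁻¹ := by group
      _ = _ := by rw [hny]; group
  rw [this]
  exact commutator_mem_of_normalizer hx h3

end

section

variable {G : Type*} [Group G] [Finite G] {p q : ℕ} {V : Subgroup G} [V.Normal]

instance zMod_normal {O : Subgroup G} [O.Normal] : (zMod V O).Normal := by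
  refine ⟨fun z hz g => ⟨mem_normalizer_of_normal _, fun x hx => ?_⟩⟩
  have h1 : g⁻¹ * x * g ∈ V := by
    simpa using (inferInstance : V.Normal).conj_mem x hx g⁻¹
  have h2 := (inferInstance : O.Normal).conj_mem _ (hz.2 _ h1) g
  have h3 : ⁅x, g * z * g⁻¹⁆ = g * ⁅g⁻¹ * x * g, z⁆ * g⁻¹ := by
    simp only [commutatorElement_def]; group
  rwa [h3]

theorem XConcl.of_cov (h : Cov V (zMod V (pCore p V))) : XConcl p V :=
  ⟨pCore p V, pCore_le _ _, fun _ _ => mem_normalizer_of_normal _, isPGroup_pCore _ _, fun g => by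
    obtain ⟨v, hv, h1⟩ := h g
    exact ⟨v, hv, h1.2⟩⟩

omit [Finite G] in
theorem XConcl.of_isPGroup (h : IsPGroup p V) : XConcl p V :=
  ⟨V, le_rfl, le_normalizer, h, fun g => ⟨1, V.one_mem, fun x hx => by
    rw [mul_one]
    exact CanData.commutator_mem_of_normalizer hx (mem_normalizer_of_normal g)⟩⟩

omit [V.Normal] in
theorem exists_pow_notMem_of_dvd_index (hperf : Cov V (commutator G)) {B : Subgroup G} [B.Normal]
    (hVB : V ≤ B) [Fact q.Prime] (hq : q ∣ B.index) {k : ℕ} (hk : ¬ q ∣ k) :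
    ∃ x ∈ commutator G, x ^ k ∉ B := by
  by_contra! hcon
  rw [Subgroup.index_eq_card] at hq
  obtain ⟨u, hu⟩ := exists_prime_orderOf_dvd_card' q hq
  obtain ⟨g, rfl⟩ := QuotientGroup.mk'_surjective B u
  obtain ⟨v, hv, hgv⟩ := hperf g
  have h1 := hcon _ hgv
  have h2 : (QuotientGroup.mk' B g) ^ k = 1 := by
    have h3 : QuotientGroup.mk' B (g * v) = QuotientGroup.mk' B g := by
      rw [map_mul, (QuotientGroup.eq_one_iff v).2 (hVB hv) |>
        fun h => (h : QuotientGroup.mk' B v = 1), mul_one]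
    rw [← h3, ← map_pow]
    exact (QuotientGroup.eq_one_iff _).2 h1
  exact hk (hu ▸ orderOf_dvd_of_pow_eq_one h2)

theorem XHyp.cov_zLoc_of_restrict {s : G} {C : Subgroup G} (hC : C = centralizer {s})
    (hcov : Cov V C) (h : XConcl p (V.subgroupOf C)) : Cov V (zLoc p V s) := by
  obtain ⟨O, hO, hVO, hOp, hc⟩ := h
  have hle : O.map C.subtype ≤ oLoc p V s := by
    apply le_pCore
    · rintro _ ⟨o, ho, rfl⟩
      exact ⟨hO ho, hC ▸ o.2⟩
    · intro v hv
      rw [← hC] at hv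
      apply mem_normalizer_of_conj
      rintro _ ⟨o, ho, rfl⟩
      exact ⟨_, conj_mem_of_mem_normalizer (hVO (show (⟨v, hv.2⟩ : C) ∈ _ from hv.1)) ho, rfl⟩
    · exact hOp.map _
  intro g
  obtain ⟨v, hv, hgv⟩ := hcov g
  obtain ⟨v', hv', h1⟩ := hc ⟨g * v, hgv⟩
  refine ⟨v * v', V.mul_mem hv hv', mem_zLoc.2 ⟨?_, fun x hx hxs => ?_⟩⟩
  · rw [← mul_assoc]
    exact mem_cent.1 (hC ▸ C.mul_mem hgv v'.2)
  · rw [← mul_assoc]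
    have hxC : x ∈ C := hC ▸ mem_cent.2 hxs
    exact hle ⟨_, h1 ⟨x, hxC⟩ hx, rfl⟩

theorem CanData.uniform [Fact p.Prime] [Fact q.Prime] {x₀ : G} (D : CanData p q V x₀)
    (hqp : q ≠ p) (hqV : q ∣ Nat.card V) [Fintype G]
    (hmin : ∀ t : ℕ, t.Prime → t ≠ p → t ∣ Nat.card V → singCount q V ≤ singCount t V) :
    ∃ y, D.Base q y ∧ ∀ t : ℕ, t.Prime → t ≠ p → D.Base t y := by
  have hq : q.Prime := Fact.out
  obtain ⟨y, hy⟩ := D.exists_base hqp hq hqp hqV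
  refine ⟨y, hy, fun t ht htp => ?_⟩
  have := Fact.mk ht
  by_cases htV : t ∣ Nat.card V
  · obtain ⟨y₂, hy₂⟩ := D.exists_base hqp ht htp htV
    have hy₂q : D.Base q y₂ := by
      by_contra hn
      exact (D.sing_lt hqp ht htp hqV hy₂ hn).not_ge (hmin t ht htp htV)
    obtain ⟨-, -, R, hR, hR'⟩ := hy
    obtain ⟨b, hb, hb1⟩ : ∃ b ∈ R, b ≠ 1 := by
      obtain ⟨k, hk, hqk⟩ := hR.card_dvd
      by_contra! hR1
      rw [(Subgroup.eq_bot_iff_forall R).2 hR1, Subgroup.card_bot, one_mul] at hk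
      exact hqk (hk ▸ hqV)
    obtain ⟨v, hv, rfl⟩ := hy₂q.exists_conj hqp hq (hR.1 hb) hb1 (PEl.of_mem hR.2.1 hb)
      ((hR' b hb).2 hb1)
    exact hy₂.conj hv
  · refine ⟨hy.pel, hy.coset, ⊥, ⟨bot_le, IsPGroup.of_bot, fun S hS hSp _ => ?_⟩, fun b hb => ?_⟩
    · by_contra hS1
      apply htV
      refine dvd_trans ?_ (Subgroup.card_dvd_of_le hS)
      obtain ⟨n, hn⟩ := hSp.exists_card_eq
      rcases n with _ | n
      · exact absurd (Subgroup.eq_bot_of_card_eq S (by simpa using hn)) hS1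
      · rw [hn]; exact dvd_pow_self _ (by omega)
    · rw [Subgroup.mem_bot] at hb
      subst hb
      simp

theorem XHyp.concl_of_zLoc [Fact p.Prime] (h : XHyp p V)
    (hc : ∀ s, Good p V s → Cov V (zLoc p V s)) : XConcl p V := by
  have := Fintype.ofFinite G
  by_cases hV : ∃ q : ℕ, q.Prime ∧ q ≠ p ∧ q ∣ Nat.card V
  swap
  · push Not at hV
    apply XConcl.of_isPGroup
    apply IsPGroup.of_card (n := (Nat.card V).primeFactorsList.length)
    refine Nat.eq_prime_pow_of_unique_prime_dvd Nat.card_pos.ne' fun {d} hd hdV => ?_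
    by_contra hne
    exact hV d hd hne hdV
  apply XConcl.of_cov
  rw [cov_iff_sup]
  by_contra hB
  have hex : ∃ n q, q.Prime ∧ q ≠ p ∧ q ∣ Nat.card V ∧ singCount q V = n := by
    obtain ⟨q, h1, h2, h3⟩ := hV
    exact ⟨_, q, h1, h2, h3, rfl⟩
  obtain ⟨q, hq, hqp, hqV, hqn⟩ := Nat.find_spec hex
  have hmin : ∀ t : ℕ, t.Prime → t ≠ p → t ∣ Nat.card V → singCount q V ≤ singCount t V :=
    fun t ht htp htV => by
      rw [hqn]
      exact Nat.find_min' hex ⟨t, ht, htp, htV, rfl⟩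
  have := Fact.mk hq
  obtain ⟨a, k, hk, hG⟩ := Nat.exists_eq_pow_mul_and_not_dvd (n := Nat.card G) Nat.card_pos.ne' q
    hq.ne_one
  obtain ⟨x, hx, hxB⟩ := exists_pow_notMem_of_dvd_index h.perf (B := zMod V (pCore p V) ⊔ V)
    le_sup_right (h.div _ inferInstance le_sup_right hB q hq hqp hqV) hk
  have hlift : Function.Surjective (FreeGroup.lift (id : G → G)) := fun g =>
    ⟨FreeGroup.of g, by simp⟩
  obtain ⟨w, hw, rfl⟩ : ∃ w ∈ commutator (FreeGroup G), FreeGroup.lift id w = x := by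
    rw [commutator_def, ← Subgroup.map_top_of_surjective _ hlift, ← Subgroup.map_commutator] at hx
    exact hx
  set D := canData hqp hc (pow_mem hw k) (fun ρ => ⟨a, by
    rw [map_pow, ← pow_mul, mul_comm, ← hG, pow_card_eq_one']⟩) with hD
  obtain ⟨y, hy, hU⟩ := D.uniform hqp hqV hmin
  have hyz := D.mem_zMod_of_uniform hqp hU
  apply hxB
  rw [← map_pow]
  have h1 : FreeGroup.lift id (w ^ k) = y * ((FreeGroup.lift id (w ^ k))⁻¹ * y)⁻¹ := by group
  rw [h1]
  exact Subgroup.mul_mem _ (le_sup_left (a := zMod V (pCore p V)) hyz)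
    (le_sup_right (a := zMod V (pCore p V)) (V.inv_mem hy.coset))

end

theorem centralizer_zpowers_eq {G : Type*} [Group G] (s : G) :
    centralizer (zpowers s : Set G) = centralizer {s} := by
  apply le_antisymm
  · exact centralizer_le (by simp)
  · rw [le_centralizer_iff, zpowers_le]
    exact fun x hx => (mem_cent.1 hx)

theorem XHyp.concl_of_card_le (p : ℕ) [Fact p.Prime] : ∀ (n : ℕ) (G : Type*) [Group G] [Finite G]
    (V : Subgroup G) [V.Normal], Nat.card V ≤ n → XHyp p V → XConcl p V := by
  intro n
  induction n with
  | zero =>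
    intro G _ _ V _ hn
    exact absurd hn (by have : 0 < Nat.card V := Nat.card_pos; omega)
  | succ n ih =>
    intro G _ _ V _ hn h
    by_cases hz : ∃ s, Good p V s ∧ ∀ v ∈ V, v * s = s * v
    · obtain ⟨s, ⟨hs, hs1, t, ht, htp, hst⟩, hcom⟩ := hz
      have := Fact.mk ht
      have hWV : zpowers s ≤ V := zpowers_le.2 hs
      have htop : centralizer (zpowers s : Set G) = ⊤ := by
        have hVC : V ≤ centralizer (zpowers s : Set G) := fun v hv => by
          rw [centralizer_zpowers_eq, mem_cent]; exact hcom v hv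
        rw [← sup_eq_left.2 hVC]
        exact cov_iff_sup.1 (h.cent t ht htp _ hWV hst.zpowers)
      have hsc : ∀ g, g * s = s * g := fun g => by
        rw [← mem_cent, ← centralizer_zpowers_eq, htop]; trivial
      have hWc : zpowers s ≤ center G := by
        rw [zpowers_le, mem_center_iff]
        exact hsc
      have : (zpowers s).Normal := ⟨fun x hx g => by
        have h1 := mem_center_iff.1 (hWc hx) g
        rw [h1]; simpa using hx⟩
      refine h.concl_of_central hWV hWc ?_
      have hn' : (V.map (QuotientGroup.mk' (zpowers s))).Normal :=
        Subgroup.Normal.map inferInstance _ (QuotientGroup.mk'_surjective _)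
      refine ih _ _ ?_ (h.map_central hWV)
      have hlt : Nat.card (V.map (QuotientGroup.mk' (zpowers s))) < Nat.card V := by
        refine Nat.lt_of_le_of_ne (Nat.card_le_card_of_surjective
          ((QuotientGroup.mk' (zpowers s)).subgroupMap V)
          (MonoidHom.subgroupMap_surjective _ _)) fun he => ?_
        have hb := (Nat.bijective_iff_surjective_and_card _).2
          ⟨(QuotientGroup.mk' (zpowers s)).subgroupMap_surjective V, he.symm⟩
        have h1 : (⟨s, hs⟩ : V) = 1 := hb.1 (Subtype.ext (by
          simp [MonoidHom.subgroupMap_apply_coe]))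
        exact hs1 (congrArg Subtype.val h1)
      omega
    · push Not at hz
      refine h.concl_of_zLoc fun s hs => ?_
      obtain ⟨v, hv, hvs⟩ := hz s hs
      obtain ⟨hsV, hs1, r, hr, hrp, hsr⟩ := hs
      have hsz : zpowers s ≤ V := zpowers_le.2 hsV
      have hC : centralizer (zpowers s : Set G) = centralizer {s} :=
        centralizer_zpowers_eq s
      refine XHyp.cov_zLoc_of_restrict hC (h.cent r hr hrp _ hsz hsr.zpowers)
        (ih _ _ ?_ (h.restrict hr hrp hsz hsr.zpowers))
      have hlt : Nat.card (V.subgroupOf (centralizer (zpowers s : Set G))) < Nat.card V := by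
        have h1 : Nat.card (V.subgroupOf (centralizer (zpowers s : Set G))) =
            Nat.card (V ⊓ centralizer (zpowers s : Set G) : Subgroup G) := by
          rw [← Subgroup.subgroupOf_map_subtype]
          exact Nat.card_congr (Subgroup.equivMapOfInjective _ _
            (Subgroup.subtype_injective _)).toEquiv
        rw [h1]
        refine Set.Finite.card_lt_card (Set.toFinite _) ⟨inf_le_left, fun h2 => hvs ?_⟩
        exact mem_cent.1 (hC ▸ (h2 hv).2)
      omega

theorem XHyp.concl {p : ℕ} [Fact p.Prime] {G : Type*} [Group G] [Finite G] {V : Subgroup G}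
    [V.Normal] (h : XHyp p V) : XConcl p V :=
  XHyp.concl_of_card_le p _ G V le_rfl h

end

section

open Subgroup
open scoped commutatorElement

/-! ### The coprime residual -/

section

variable {G : Type*} [Group G]

/-- The subgroup generated by the commutators of elements of prime power orders belonging to
different primes. -/
def cres (H : Subgroup G) : Subgroup G :=
  closure {g | ∃ a ∈ H, ∃ b ∈ H, ∃ r s : ℕ, r.Prime ∧ s.Prime ∧ r ≠ s ∧ PEl r a ∧ PEl s b ∧
    g = ⁅a, b⁆}

theorem commutator_mem_cres {H : Subgroup G} {a b : G} (ha : a ∈ H) (hb : b ∈ H) {r s : ℕ}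
    (hr : r.Prime) (hs : s.Prime) (hrs : r ≠ s) (hra : PEl r a) (hsb : PEl s b) :
    ⁅a, b⁆ ∈ cres H :=
  subset_closure ⟨a, ha, b, hb, r, s, hr, hs, hrs, hra, hsb, rfl⟩

theorem cres_le_iff {H K : Subgroup G} : cres H ≤ K ↔ ∀ a ∈ H, ∀ b ∈ H, ∀ r s : ℕ, r.Prime →
    s.Prime → r ≠ s → PEl r a → PEl s b → ⁅a, b⁆ ∈ K := by
  rw [cres, closure_le]
  constructor
  · intro h a ha b hb r s hr hs hrs hra hsb
    exact h ⟨a, ha, b, hb, r, s, hr, hs, hrs, hra, hsb, rfl⟩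
  · rintro h _ ⟨a, ha, b, hb, r, s, hr, hs, hrs, hra, hsb, rfl⟩
    exact h a ha b hb r s hr hs hrs hra hsb

theorem cres_le_commutator (H : Subgroup G) : cres H ≤ ⁅H, H⁆ :=
  cres_le_iff.2 fun _ ha _ hb _ _ _ _ _ _ _ => commutator_mem_commutator ha hb

theorem cres_le (H : Subgroup G) : cres H ≤ H :=
  (cres_le_commutator H).trans (commutator_le_self H)

theorem cres_mono : Monotone (cres (G := G)) := fun _ _ h =>
  cres_le_iff.2 fun _ ha _ hb _ _ hr hs hrs hra hsb =>
    commutator_mem_cres (h ha) (h hb) hr hs hrs hra hsb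

theorem cres_iterate_mono (n : ℕ) : Monotone (cres (G := G))^[n] := cres_mono.iterate n

theorem cres_iterate_le (n : ℕ) (H : Subgroup G) : cres^[n] H ≤ H := by
  induction n with
  | zero => exact le_rfl
  | succ n ih => rw [Function.iterate_succ_apply']; exact (cres_le _).trans ih

theorem cres_iterate_anti {m n : ℕ} (h : m ≤ n) (H : Subgroup G) : cres^[n] H ≤ cres^[m] H := by
  obtain ⟨k, rfl⟩ := Nat.exists_eq_add_of_le' h
  rw [Function.iterate_add_apply]
  exact cres_iterate_le k _

theorem cres_iterate_bot (n : ℕ) : cres^[n] (⊥ : Subgroup G) = ⊥ :=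
  le_bot_iff.1 (cres_iterate_le n ⊥)

theorem cres_iterate_add_eq_bot {H K : Subgroup G} {m n : ℕ} (h1 : cres^[m] H ≤ K)
    (h2 : cres^[n] K = ⊥) : cres^[n + m] H = ⊥ := by
  rw [Function.iterate_add_apply, ← le_bot_iff, ← h2]
  exact cres_iterate_mono n h1

theorem cres_eq_bot_of_comm {H : Subgroup G} (h : ∀ a ∈ H, ∀ b ∈ H, a * b = b * a) :
    cres H = ⊥ := by
  rw [← le_bot_iff, cres_le_iff]
  intro a ha b hb _ _ _ _ _ _ _
  rw [mem_bot, commutatorElement_eq_one_iff_mul_comm]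
  exact h a ha b hb

theorem PEl.map {G' : Type*} [Group G'] {r : ℕ} {a : G} (h : PEl r a) (f : G →* G') :
    PEl r (f a) := by
  obtain ⟨k, hk⟩ := h
  exact ⟨k, by rw [← map_pow, hk, map_one]⟩

/-- Elements of prime power order lift to elements of prime power order. -/
theorem PEl.exists_lift [Finite G] {G' : Type*} [Group G'] {r : ℕ} (hr : r.Prime) {f : G →* G'}
    {g : G} (h : PEl r (f g)) : ∃ k : ℕ, PEl r (g ^ k) ∧ f (g ^ k) = f g := by
  have := Fact.mk hr
  obtain ⟨a, k, hk, hG⟩ := Nat.exists_eq_pow_mul_and_not_dvd (n := Nat.card G) Nat.card_pos.ne' r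
    hr.ne_one
  have hco : (r ^ a).Coprime k := Nat.Coprime.pow_left a ((Nat.Prime.coprime_iff_not_dvd hr).2 hk)
  obtain ⟨c, hc1, hc2⟩ := Nat.chineseRemainder hco 1 0
  refine ⟨c, ⟨a, ?_⟩, ?_⟩
  · obtain ⟨d, rfl⟩ := (Nat.modEq_zero_iff_dvd.1 hc2)
    rw [← pow_mul, show k * d * r ^ a = (r ^ a * k) * d by ring, ← hG, pow_mul, pow_card_eq_one',
      one_pow]
  · rw [map_pow]
    apply pow_eq_self_of_modEq hc1
    obtain ⟨j, hj⟩ := h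
    have h1 : (orderOf (f g)).Coprime k := Nat.Coprime.coprime_dvd_left
      (orderOf_dvd_of_pow_eq_one hj) (Nat.Coprime.pow_left j
        ((Nat.Prime.coprime_iff_not_dvd hr).2 hk))
    refine h1.dvd_of_dvd_mul_right ?_
    rw [← hG]
    exact orderOf_dvd_of_pow_eq_one (by rw [← map_pow, pow_card_eq_one', map_one])

theorem map_cres [Finite G] {G' : Type*} [Group G'] (f : G →* G') (H : Subgroup G) :
    (cres H).map f = cres (H.map f) := by
  apply le_antisymm
  · rw [map_le_iff_le_comap, cres_le_iff]
    intro a ha b hb r s hr hs hrs hra hsb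
    rw [mem_comap, map_commutatorElement]
    exact commutator_mem_cres (mem_map_of_mem f ha) (mem_map_of_mem f hb) hr hs hrs
      (hra.map f) (hsb.map f)
  · rw [cres_le_iff]
    rintro _ ⟨a, ha, rfl⟩ _ ⟨b, hb, rfl⟩ r s hr hs hrs hra hsb
    obtain ⟨k, hk, hk'⟩ := PEl.exists_lift hr hra
    obtain ⟨l, hl, hl'⟩ := PEl.exists_lift hs hsb
    rw [← hk', ← hl', ← map_commutatorElement]
    exact mem_map_of_mem f (commutator_mem_cres (H.pow_mem ha k) (H.pow_mem hb l) hr hs hrs hk hl)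

theorem map_cres_iterate [Finite G] {G' : Type*} [Group G'] (f : G →* G') (n : ℕ)
    (H : Subgroup G) : (cres^[n] H).map f = cres^[n] (H.map f) := by
  induction n with
  | zero => rfl
  | succ n ih => rw [Function.iterate_succ_apply', Function.iterate_succ_apply', map_cres, ih]

theorem map_cres_iterate_top [Finite G] {G' : Type*} [Group G'] {f : G →* G'}
    (hf : Function.Surjective f) (n : ℕ) : (cres^[n] (⊤ : Subgroup G)).map f = cres^[n] ⊤ := by
  rw [map_cres_iterate, map_top_of_surjective f hf]

theorem map_subtype_cres_iterate [Finite G] (n : ℕ) (H : Subgroup G) :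
    (cres^[n] (⊤ : Subgroup H)).map H.subtype = cres^[n] H := by
  rw [map_cres_iterate, ← MonoidHom.range_eq_map, range_subtype]

theorem cres_iterate_normal [Finite G] (n : ℕ) {H : Subgroup G} [H.Normal] :
    (cres^[n] H).Normal := by
  refine ⟨fun x hx g => ?_⟩
  have h1 : (cres^[n] H).map (MulAut.conj g).toMonoidHom = cres^[n] H := by
    rw [map_cres_iterate]
    congr 1
    exact conjSub_normal g H
  rw [← h1]
  exact ⟨x, hx, rfl⟩

theorem cres_lt [Finite G] [Group.IsSolvable G] {H : Subgroup G} (h : H ≠ ⊥) : cres H < H :=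
  (cres_le_commutator H).trans_lt (Group.IsSolvable.commutator_lt_of_ne_bot h)

theorem cres_iterate_eq_bot_of_card [Finite G] [Group.IsSolvable G] (n : ℕ) {H : Subgroup G}
    (h : Nat.card H ≤ n) : cres^[n] H = ⊥ := by
  induction n generalizing H with
  | zero => exact absurd h (by have : 0 < Nat.card H := Nat.card_pos; omega)
  | succ n ih =>
    by_cases hH : H = ⊥
    · rw [hH, cres_iterate_bot]
    rw [Function.iterate_succ_apply]
    apply ih
    have h1 := cres_lt hH
    have h2 : Nat.card (cres H) < Nat.card H := Set.Finite.card_lt_card (Set.toFinite _) h1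
    omega

theorem PEl.of_conj_eq {r : ℕ} {x y z : G} (h : x * y * x⁻¹ = z * y) (hz : Commute z y)
    (hy : PEl r y) : PEl r z := by
  obtain ⟨k, hk⟩ := hy
  refine ⟨k, ?_⟩
  have h1 : (x * y * x⁻¹) ^ r ^ k = 1 := by rw [conj_pow, hk]; simp
  rwa [h, hz.mul_pow, hk, mul_one] at h1

theorem cres_eq_bot_of_central {R N : Subgroup G} (h1 : cres R ≤ N)
    (h2 : ∀ x ∈ R, ∀ n ∈ N, x * n = n * x) : cres R = ⊥ := by
  rw [← le_bot_iff, cres_le_iff]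
  intro a ha b hb r s hr hs hrs hra hsb
  have := Fact.mk hr
  have := Fact.mk hs
  have hc := h1 (commutator_mem_cres ha hb hr hs hrs hra hsb)
  have hca : Commute ⁅a, b⁆ a := (h2 a ha _ hc).symm
  have hcb : Commute ⁅a, b⁆ b := (h2 b hb _ hc).symm
  rw [mem_bot]
  refine PEl.eq_one_of_coprime hrs ?_ ?_
  · rw [← inv_inv ⁅a, b⁆]
    apply PEl.inv
    refine PEl.of_conj_eq (x := b) (y := a) ?_ hca.inv_left hra
    rw [commutatorElement_inv, commutatorElement_def]
    group
  · refine PEl.of_conj_eq (x := a) (y := b) ?_ hcb hsb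
    rw [commutatorElement_def]
    group

end

section

open scoped Classical in
/-- A finite soluble group acting transitively on at least two points, and generated by `D`,
contains an element of `D` fixing at most half of the points. -/
theorem exists_fixes_half {H X : Type*} [Group H] [Finite H] [Group.IsSolvable H] [MulAction H X]
    {Ω : Finset X} (inv : ∀ h : H, ∀ x ∈ Ω, h • x ∈ Ω)
    (tr : ∀ x ∈ Ω, ∀ y ∈ Ω, ∃ h : H, h • x = y) (h1 : 1 < Ω.card) {D : Set H}
    (hD : closure D = ⊤) : ∃ y ∈ D, 2 * (Ω.filter fun x => y • x = x).card ≤ Ω.card := by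
  by_contra! hcon
  let T : Set (Subgroup H) := {N | N.Normal ∧ ¬ ∀ x ∈ Ω, ∀ y ∈ Ω, ∃ h ∈ N, h • x = y}
  have hT : (⊥ : Subgroup H) ∈ T := by
    refine ⟨inferInstance, fun h => ?_⟩
    obtain ⟨x, hx, y, hy, hxy⟩ := Finset.one_lt_card.1 h1
    obtain ⟨n, hn, hn'⟩ := h x hx y hy
    rw [mem_bot.1 hn, one_smul] at hn'
    exact hxy hn'
  obtain ⟨N, ⟨hN, hNt⟩, hmax⟩ := Set.Finite.exists_maximal (Set.toFinite T) ⟨_, hT⟩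
  have hex : ∃ k, derivedSeries H k ≤ N := by
    obtain ⟨k, hk⟩ := (Group.isSolvable_def H).1 inferInstance
    exact ⟨k, hk ▸ bot_le⟩
  have hk0 : Nat.find hex ≠ 0 := by
    intro h0
    have h2 := Nat.find_spec hex
    rw [h0, derivedSeries_zero, top_le_iff] at h2
    apply hNt
    intro x hx y hy
    obtain ⟨h, hh⟩ := tr x hx y hy
    exact ⟨h, h2 ▸ mem_top h, hh⟩
  obtain ⟨k, hk⟩ := Nat.exists_eq_succ_of_ne_zero hk0
  have hk1 : ¬ derivedSeries H k ≤ N := Nat.find_min hex (by omega)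
  have hk2 : ⁅derivedSeries H k, derivedSeries H k⁆ ≤ N := by
    have h2 := Nat.find_spec hex
    rwa [hk, Nat.succ_eq_add_one, derivedSeries_succ] at h2
  set J : Subgroup H := derivedSeries H k ⊔ N with hJ
  have hJJ : ⁅J, J⁆ ≤ N := by
    have h2 : (⁅J, J⁆).map (QuotientGroup.mk' N) = ⊥ := by
      have h3 : J.map (QuotientGroup.mk' N) = (derivedSeries H k).map (QuotientGroup.mk' N) := by
        rw [hJ, Subgroup.map_sup, (Subgroup.map_eq_bot_iff N).2 (by simp), sup_bot_eq]
      rw [map_commutator, h3, ← map_commutator, Subgroup.map_eq_bot_iff]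
      simpa using hk2
    rw [Subgroup.map_eq_bot_iff] at h2
    simpa using h2
  have hJt : ∀ x ∈ Ω, ∀ y ∈ Ω, ∃ h ∈ J, h • x = y := by
    by_contra hJt
    have h2 : J ≤ N := hmax (y := J) ⟨inferInstance, hJt⟩ le_sup_right
    exact hk1 (le_sup_left.trans h2)
  have hNn : ∀ n ∈ N, ∀ g : H, g * n * g⁻¹ ∈ N := hN.conj_mem
  have key : ∀ y ∈ D, ∀ x ∈ Ω, ∃ n ∈ N, y • x = n • x := by
    intro y hy
    have hF := hcon y hy
    have hc : ∀ j ∈ J, ∀ x ∈ Ω, ∃ n ∈ N, ⁅j⁻¹, y⁆ • x = n • x := by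
      intro j hj x hx
      have hJn : J.Normal := inferInstance
      have hcJ : ⁅j⁻¹, y⁆ ∈ J := by
        rw [commutatorElement_def, mul_assoc, mul_assoc]
        refine J.mul_mem (J.inv_mem hj) ?_
        rw [inv_inv, ← mul_assoc]
        exact hJn.conj_mem j hj y
      have h2 : ∃ w ∈ Ω, y • w = w ∧ y • j • w = j • w := by
        by_contra! hno
        have h3 : Disjoint (Ω.filter fun x => y • x = x)
            ((Ω.filter fun x => y • x = x).image fun x => j⁻¹ • x) := by
          rw [Finset.disjoint_left]
          intro w hw hw'
          rw [Finset.mem_filter] at hw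
          obtain ⟨v, hv, hv'⟩ := Finset.mem_image.1 hw'
          rw [Finset.mem_filter] at hv
          apply hno w hw.1 hw.2
          rw [← hv', smul_inv_smul]
          exact hv.2
        have h4 := Finset.card_union_of_disjoint h3
        rw [Finset.card_image_of_injective _ (MulAction.injective j⁻¹)] at h4
        have h5 : (Ω.filter fun x => y • x = x) ∪
            ((Ω.filter fun x => y • x = x).image fun x => j⁻¹ • x) ⊆ Ω := by
          intro w hw
          rcases Finset.mem_union.1 hw with hw | hw
          · exact (Finset.mem_filter.1 hw).1
          · obtain ⟨v, hv, rfl⟩ := Finset.mem_image.1 hw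
            exact inv _ _ (Finset.mem_filter.1 hv).1
        have h6 := Finset.card_le_card h5
        omega
      obtain ⟨w, hw, hw1, hw2⟩ := h2
      have hw3 : ⁅j⁻¹, y⁆ • w = w := by
        rw [commutatorElement_def, mul_smul, mul_smul, mul_smul, inv_inv]
        have : y⁻¹ • w = w := by rw [inv_smul_eq_iff, hw1]
        rw [this, hw2, inv_smul_smul]
      obtain ⟨i, hi, rfl⟩ := hJt w hw x hx
      refine ⟨⁅⁅j⁻¹, y⁆, i⁆, hJJ (commutator_mem_commutator hcJ hi), ?_⟩
      rw [commutatorElement_def ⁅j⁻¹, y⁆ i, mul_smul, mul_smul, mul_smul, inv_smul_smul]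
      congr 2
      rw [eq_inv_smul_iff, hw3]
    have hne : (Ω.filter fun x => y • x = x).Nonempty := by
      rw [← Finset.card_pos]; omega
    obtain ⟨w, hw⟩ := hne
    rw [Finset.mem_filter] at hw
    intro x hx
    obtain ⟨j, hj, rfl⟩ := hJt w hw.1 x hx
    obtain ⟨n, hn, hn'⟩ := hc j hj w hw.1
    refine ⟨j * n * j⁻¹, hNn n hn j, ?_⟩
    rw [mul_smul, mul_smul, inv_smul_smul, ← hn', commutatorElement_def, ← mul_smul, ← mul_smul]
    have : y⁻¹ • w = w := by rw [inv_smul_eq_iff, hw.2]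
    conv_lhs => rw [← this]
    rw [← mul_smul]
    congr 1
    group
  have hall : ∀ g : H, ∀ x ∈ Ω, ∃ n ∈ N, g • x = n • x := by
    intro g
    have hg : g ∈ closure D := hD ▸ mem_top g
    induction hg using closure_induction with
    | mem y hy => exact key y hy
    | one => exact fun x _ => ⟨1, N.one_mem, rfl⟩
    | mul a b _ _ ha hb =>
      intro x hx
      obtain ⟨n, hn, hn'⟩ := hb x hx
      obtain ⟨n', hm, hm'⟩ := ha (b • x) (inv _ _ hx)
      exact ⟨n' * n, N.mul_mem hm hn, by rw [mul_smul, hm', hn', mul_smul]⟩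
    | inv a _ ha =>
      intro x hx
      obtain ⟨n, hn, hn'⟩ := ha (a⁻¹ • x) (inv _ _ hx)
      refine ⟨n⁻¹, N.inv_mem hn, ?_⟩
      rw [eq_inv_smul_iff, ← hn', smul_inv_smul]
  apply hNt
  intro x hx y hy
  obtain ⟨g, rfl⟩ := tr x hx y hy
  obtain ⟨n, hn, hn'⟩ := hall g x hx
  exact ⟨n, hn, hn'.symm⟩

end

section

variable {H M : Type*} [Group H] [AddCommGroup M] [DistribMulAction H M]

/-- The map `m ↦ g • m - m`. -/
def moveHom (M : Type*) [AddCommGroup M] [DistribMulAction H M] (g : H) : M →+ M :=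
  DistribSMul.toAddMonoidHom M g - AddMonoidHom.id M

theorem moveHom_apply (g : H) (m : M) : moveHom M g m = g • m - m := rfl

/-- The common fixed points of a subgroup. -/
def fixSub (M : Type*) [AddCommGroup M] [DistribMulAction H M] (B : Subgroup H) :
    AddSubgroup M where
  carrier := {m | ∀ b ∈ B, b • m = m}
  zero_mem' b _ := smul_zero b
  add_mem' h1 h2 b hb := by rw [smul_add, h1 b hb, h2 b hb]
  neg_mem' h1 b hb := by rw [smul_neg, h1 b hb]

theorem smul_mem_fixSub {B : Subgroup H} {m : M} (h : m ∈ fixSub M B) (g : H) :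
    g • m ∈ fixSub M (conjSub g B) := by
  intro b hb
  rw [mem_conjSub] at hb
  have h1 := h _ hb
  rwa [mul_smul, mul_smul, inv_smul_eq_iff] at h1

theorem smul_mem_fixSub_of_normal {B : Subgroup H} [B.Normal] {m : M} (h : m ∈ fixSub M B)
    (g : H) : g • m ∈ fixSub M B := by
  intro b hb
  have h1 := h (g⁻¹ * b * g) (by simpa using ‹B.Normal›.conj_mem b hb g⁻¹)
  rwa [mul_smul, mul_smul, inv_smul_eq_iff] at h1

theorem card_add_sup_le [Finite M] (A B : AddSubgroup M) :
    Nat.card (A ⊔ B : AddSubgroup M) ≤ Nat.card A * Nat.card B := by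
  rw [← Nat.card_prod]
  refine Nat.card_le_card_of_surjective
    (fun x : A × B => (⟨x.1.1 + x.2.1, AddSubgroup.add_mem_sup x.1.2 x.2.2⟩ :
      (A ⊔ B : AddSubgroup M))) ?_
  rintro ⟨x, hx⟩
  obtain ⟨a, ha, b, hb, rfl⟩ := AddSubgroup.mem_sup.1 hx
  exact ⟨(⟨a, ha⟩, ⟨b, hb⟩), rfl⟩

theorem card_moveHom_mul [Finite M] (g h : H) :
    Nat.card (moveHom M (g * h)).range ≤
      Nat.card (moveHom M g).range * Nat.card (moveHom M h).range := by
  refine le_trans (AddSubgroup.card_le_of_le ?_) (card_add_sup_le _ _)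
  rintro _ ⟨m, rfl⟩
  have : moveHom M (g * h) m = moveHom M g (h • m) + moveHom M h m := by
    simp [moveHom_apply, mul_smul]
  rw [this]
  exact AddSubgroup.add_mem_sup ⟨_, rfl⟩ ⟨_, rfl⟩

theorem card_moveHom_inv [Finite M] (g : H) :
    Nat.card (moveHom M g⁻¹).range ≤ Nat.card (moveHom M g).range := by
  refine AddSubgroup.card_le_of_le ?_
  rintro _ ⟨m, rfl⟩
  refine ⟨-(g⁻¹ • m), ?_⟩
  simp only [moveHom_apply, smul_neg, smul_inv_smul]
  abel

theorem card_moveHom_conj [Finite M] (g h : H) :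
    Nat.card (moveHom M (h * g * h⁻¹)).range ≤ Nat.card (moveHom M g).range := by
  refine Nat.card_le_card_of_injective
    (fun x : (moveHom M (h * g * h⁻¹)).range => (⟨h⁻¹ • x.1, ?_⟩ : (moveHom M g).range)) ?_
  · obtain ⟨_, ⟨m, rfl⟩⟩ := x
    refine ⟨h⁻¹ • m, ?_⟩
    simp [moveHom_apply, mul_smul, smul_sub]
  · intro x y hxy
    exact Subtype.ext (MulAction.injective h⁻¹ (congrArg Subtype.val hxy))

theorem card_moveHom_commutator_left [Finite M] (g h : H) :
    Nat.card (moveHom M ⁅g, h⁆).range ≤ Nat.card (moveHom M g).range ^ 2 := by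
  have : ⁅g, h⁆ = g * (h * g⁻¹ * h⁻¹) := by rw [commutatorElement_def]; group
  rw [this, sq]
  exact (card_moveHom_mul _ _).trans
    (Nat.mul_le_mul le_rfl ((card_moveHom_conj _ _).trans (card_moveHom_inv _)))

theorem card_moveHom_of_injective [Finite M] {g : H} (h : ∀ m : M, g • m = m → m = 0) :
    Nat.card M ≤ Nat.card (moveHom M g).range := by
  refine Nat.card_le_card_of_injective (fun m => ⟨moveHom M g m, m, rfl⟩) ?_
  intro x y hxy
  have h1 : g • x - x = g • y - y := congrArg Subtype.val hxy
  rw [← sub_eq_zero]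
  apply h
  rw [smul_sub, sub_eq_sub_iff_add_eq_add]
  rw [sub_eq_sub_iff_add_eq_add] at h1
  rw [h1, add_comm]

end

section

variable {H M : Type*} [Group H] [Finite H] [AddCommGroup M] [DistribMulAction H M]

open scoped Classical in
/-- The sum of the translates of `m` under the subgroup `B`. -/
noncomputable def traceHom (M : Type*) [AddCommGroup M] [DistribMulAction H M] (B : Subgroup H) :
    M →+ M :=
  letI := Fintype.ofFinite B
  ∑ b : B, DistribSMul.toAddMonoidHom M (b : H)

theorem traceHom_of_mem {B : Subgroup H} {m : M} (h : m ∈ fixSub M B) :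
    traceHom M B m = Nat.card B • m := by
  let _ := Fintype.ofFinite B
  have : traceHom M B m = ∑ b : B, (b : H) • m := by
    simp [traceHom, AddMonoidHom.finsetSum_apply]
  rw [this, Finset.sum_congr rfl fun b _ => h b.1 b.2, Finset.sum_const, Finset.card_univ,
    Nat.card_eq_fintype_card]

theorem traceHom_mem (B : Subgroup H) (m : M) : traceHom M B m ∈ fixSub M B := by
  let _ := Fintype.ofFinite B
  have : traceHom M B m = ∑ b : B, (b : H) • m := by
    simp [traceHom, AddMonoidHom.finsetSum_apply]
  intro b hb
  rw [this, Finset.smul_sum]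
  refine Fintype.sum_equiv (Equiv.mulLeft (⟨b, hb⟩ : B)) _ _ fun x => ?_
  simp [mul_smul]

theorem traceHom_mem_of_comm {B C : Subgroup H} (hBC : ∀ b ∈ B, ∀ c ∈ C, b * c = c * b) {m : M}
    (h : m ∈ fixSub M C) : traceHom M B m ∈ fixSub M C := by
  let _ := Fintype.ofFinite B
  have : traceHom M B m = ∑ b : B, (b : H) • m := by
    simp [traceHom, AddMonoidHom.finsetSum_apply]
  intro c hc
  rw [this, Finset.smul_sum]
  refine Finset.sum_congr rfl fun b _ => ?_
  rw [← mul_smul, ← hBC b b.2 c hc, mul_smul, h c hc]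

/-- Pairwise commuting subgroups with pairwise disjoint fixed points on `M`. -/
structure FixFamily (M : Type*) [AddCommGroup M] [DistribMulAction H M]
    (Ω : Finset (Subgroup H)) : Prop where
  comm : ∀ B ∈ Ω, ∀ C ∈ Ω, ∀ b ∈ B, ∀ c ∈ C, b * c = c * b
  disj : ∀ B ∈ Ω, ∀ C ∈ Ω, B ≠ C → ∀ m : M, m ∈ fixSub M B → m ∈ fixSub M C → m = 0
  tors : ∀ B ∈ Ω, ∀ m : M, Nat.card B • m = 0 → m = 0

variable {Ω : Finset (Subgroup H)}

theorem FixFamily.trace_eq_zero (h : FixFamily M Ω) {B : Subgroup H} (hB : B ∈ Ω)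
    {J : Finset (Subgroup H)} (hJ : J ⊆ Ω) (hBJ : B ∉ J) {m : M}
    (hm : m ∈ J.sup (fixSub M)) : traceHom M B m = 0 := by
  have h1 : J.sup (fixSub M) ≤ (traceHom M B).ker := by
    refine Finset.sup_le fun C hC x hx => ?_
    rw [AddMonoidHom.mem_ker]
    exact h.disj B hB C (hJ hC) (fun e => hBJ (e ▸ hC)) _ (traceHom_mem B x)
      (traceHom_mem_of_comm (h.comm B hB C (hJ hC)) hx)
  exact h1 hm

open scoped Classical in
theorem FixFamily.eq_zero (h : FixFamily M Ω) {I : Finset (Subgroup H)} (hI : I ⊆ Ω) {m : M}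
    (hm : m ∈ I.sup (fixSub M)) (ht : ∀ B ∈ I, traceHom M B m = 0) : m = 0 := by
  induction I using Finset.induction_on generalizing m with
  | empty => simpa using hm
  | insert B I hBI ih =>
    rw [Finset.sup_insert] at hm
    obtain ⟨x, hx, y, hy, rfl⟩ := AddSubgroup.mem_sup.1 hm
    have hI' : I ⊆ Ω := fun C hC => hI (Finset.mem_insert_of_mem hC)
    have hB : B ∈ Ω := hI (Finset.mem_insert_self _ _)
    have h1 := ht B (Finset.mem_insert_self _ _)
    rw [map_add, h.trace_eq_zero hB hI' hBI hy, add_zero, traceHom_of_mem hx] at h1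
    have hx0 := h.tors B hB x h1
    rw [hx0, zero_add]
    refine ih hI' hy fun C hC => ?_
    have h2 := ht C (Finset.mem_insert_of_mem hC)
    rwa [hx0, zero_add] at h2

open scoped Classical in
theorem FixFamily.le_card (h : FixFamily M Ω) [Finite M] {I : Finset (Subgroup H)} (hI : I ⊆ Ω)
    {c : ℕ} (hc : ∀ B ∈ I, c ≤ Nat.card (fixSub M B)) :
    c ^ I.card ≤ Nat.card (I.sup (fixSub M) : AddSubgroup M) := by
  induction I using Finset.induction_on with
  | empty => simp
  | insert B I hBI ih =>
    have hI' : I ⊆ Ω := fun C hC => hI (Finset.mem_insert_of_mem hC)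
    have hB : B ∈ Ω := hI (Finset.mem_insert_self _ _)
    rw [Finset.sup_insert, Finset.card_insert_of_notMem hBI, pow_succ']
    refine (Nat.mul_le_mul (hc B (Finset.mem_insert_self _ _))
      (ih hI' fun C hC => hc C (Finset.mem_insert_of_mem hC))).trans ?_
    rw [← Nat.card_prod]
    refine Nat.card_le_card_of_injective
      (fun x : fixSub M B × (I.sup (fixSub M) : AddSubgroup M) =>
        (⟨x.1.1 + x.2.1, AddSubgroup.add_mem_sup x.1.2 x.2.2⟩ :
          (fixSub M B ⊔ I.sup (fixSub M) : AddSubgroup M))) ?_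
    rintro ⟨⟨x, hx⟩, ⟨y, hy⟩⟩ ⟨⟨x', hx'⟩, ⟨y', hy'⟩⟩ hxy
    have h1 : x + y = x' + y' := congrArg Subtype.val hxy
    have h2 : x - x' = y' - y := by rw [sub_eq_sub_iff_add_eq_add, h1, add_comm]
    have h3 : x - x' = 0 := by
      apply h.tors B hB
      rw [← traceHom_of_mem (sub_mem hx hx'), h2]
      exact h.trace_eq_zero hB hI' hBI (sub_mem hy' hy)
    have h4 : x = x' := sub_eq_zero.1 h3
    rw [h3, eq_comm, sub_eq_zero] at h2
    subst h2 h4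
    rfl

open scoped Classical in
omit [Finite H] in
theorem card_sup_fixSub_le [Finite M] {I : Finset (Subgroup H)}
    {c : ℕ} (hc : ∀ B ∈ I, Nat.card (fixSub M B) ≤ c) :
    Nat.card (I.sup (fixSub M) : AddSubgroup M) ≤ c ^ I.card := by
  induction I using Finset.induction_on with
  | empty => simp
  | insert B I hBI ih =>
    rw [Finset.sup_insert, Finset.card_insert_of_notMem hBI, pow_succ']
    exact (card_add_sup_le _ _).trans (Nat.mul_le_mul (hc B (Finset.mem_insert_self _ _))
      (ih fun C hC => hc C (Finset.mem_insert_of_mem hC)))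

end

section

open scoped Classical in
theorem exists_disjoint_image {X : Type*} (f : Equiv.Perm X) (Ω : Finset X) :
    ∃ I ⊆ Ω, Disjoint I (I.image f) ∧
      Ω.card ≤ (Ω.filter fun x => f x = x).card + 3 * I.card := by
  let T : Set (Finset X) := {I | I ⊆ Ω.filter (fun x => f x ≠ x) ∧ Disjoint I (I.image f)}
  have hT : T.Finite := (Finset.finite_toSet (Ω.filter (fun x => f x ≠ x)).powerset).subset
    fun I hI => Finset.mem_coe.2 (Finset.mem_powerset.2 hI.1)
  obtain ⟨I, ⟨hI, hd⟩, hmax⟩ := hT.exists_maximal ⟨∅, by simp [T]⟩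
  refine ⟨I, hI.trans (Finset.filter_subset _ _), hd, ?_⟩
  have hsub : Ω.filter (fun x => f x ≠ x) ⊆ I ∪ (I.image f ∪ I.image f.symm) := by
    intro x hx
    by_contra hx'
    simp only [Finset.mem_union, not_or] at hx'
    obtain ⟨h1, h2, h3⟩ := hx'
    have h4 : insert x I ∈ T := by
      refine ⟨Finset.insert_subset hx hI, ?_⟩
      rw [Finset.disjoint_left]
      intro z hz hz'
      obtain ⟨w, hw, rfl⟩ := Finset.mem_image.1 hz'
      rcases Finset.mem_insert.1 hw with rfl | hw2
      · rcases Finset.mem_insert.1 hz with hz | hz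
        · exact (Finset.mem_filter.1 hx).2 hz
        · exact h3 (Finset.mem_image.2 ⟨_, hz, by simp⟩)
      · rcases Finset.mem_insert.1 hz with rfl | hz
        · exact h2 (Finset.mem_image_of_mem f hw2)
        · exact Finset.disjoint_left.1 hd hz (Finset.mem_image_of_mem f hw2)
    exact h1 (hmax h4 (Finset.subset_insert x I) (Finset.mem_insert_self x I))
  have h5 := Finset.card_le_card hsub
  have h6 := Finset.card_union_le I (I.image f ∪ I.image f.symm)
  have h7 := Finset.card_union_le (I.image f) (I.image f.symm)
  have h8 : (I.image f).card ≤ I.card := Finset.card_image_le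
  have h9 : (I.image f.symm).card ≤ I.card := Finset.card_image_le
  have h10 := Finset.card_filter_add_card_filter_not (s := Ω) (fun x => f x = x)
  have h11 : (Ω.filter fun x => f x ≠ x).card = (Ω.filter fun x => ¬ f x = x).card := rfl
  omega

variable {H M : Type*} [Group H] [Finite H] [AddCommGroup M] [DistribMulAction H M]

/-- The action of a group on its subgroups by conjugation. -/
abbrev conjMulAction (H : Type*) [Group H] : MulAction H (Subgroup H) where
  smul := conjSub
  one_smul := conjSub_one
  mul_smul g h B := (conjSub_conjSub g h B).symm

/-- Faithfulness and irreducibility of an action. -/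
structure IrrAct (H M : Type*) [Group H] [AddCommGroup M] [DistribMulAction H M] : Prop where
  faithful : ∀ h : H, (∀ m : M, h • m = m) → h = 1
  irr : ∀ N : AddSubgroup M, (∀ (h : H), ∀ n ∈ N, h • n ∈ N) → N ≠ ⊥ → N = ⊤

omit [Finite H] in
theorem IrrAct.eq_bot_of_fixSub (h : IrrAct H M) {B : Subgroup H} [B.Normal]
    (hB : fixSub M B ≠ ⊥) : B = ⊥ := by
  have h1 := h.irr _ (fun g n hn => smul_mem_fixSub_of_normal hn g) hB
  rw [eq_bot_iff]
  intro b hb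
  rw [mem_bot]
  refine h.faithful b fun m => ?_
  have : m ∈ fixSub M B := h1 ▸ AddSubgroup.mem_top m
  exact this b hb

omit [Finite H] in
theorem IrrAct.fix_eq_zero_of_central (h : IrrAct H M) {z : H} (hz : z ∈ center H) (h1 : z ≠ 1)
    {m : M} (hm : z • m = m) : m = 0 := by
  have hn : (zpowers z).Normal := ⟨fun n hn g => by
    have : n ∈ center H := (zpowers_le.2 hz) hn
    rwa [Subgroup.mem_center_iff.1 this g, mul_inv_cancel_right]⟩
  by_contra hm0
  apply h1
  have h2 := h.eq_bot_of_fixSub (B := zpowers z) fun h3 => by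
    have h4 : m ∈ fixSub M (zpowers z) := by
      intro b hb
      have : zpowers z ≤ MulAction.stabilizer H m := zpowers_le.2 hm
      exact this hb
    rw [h3] at h4
    exact hm0 (by simpa using h4)
  simpa using h2

theorem IrrAct.tors (h : IrrAct H M) [Finite M] {A : Subgroup H} [A.Normal]
    (hA : ∀ a ∈ A, ∀ b ∈ A, a * b = b * a) {m : M} (hm : Nat.card A • m = 0) : m = 0 := by
  by_contra hm0
  obtain ⟨p, hp, hpm⟩ := Nat.exists_prime_and_dvd (n := addOrderOf m) (by simpa using hm0)
  have := Fact.mk hp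
  have hpA : p ∣ Nat.card A := hpm.trans (addOrderOf_dvd_of_nsmul_eq_zero hm)
  have htop := h.irr (nsmulAddMonoidHom p : M →+ M).ker (fun g n hn => by
    rw [AddMonoidHom.mem_ker] at *
    have hn' : p • n = 0 := hn
    change p • g • n = 0
    have e : g • (p • n) = p • g • n := map_nsmul (DistribSMul.toAddMonoidHom M g) p n
    rw [← e, hn', smul_zero]) (by
    intro h0
    obtain ⟨k, hk⟩ := hpm
    have h1 : k • m ∈ (nsmulAddMonoidHom p : M →+ M).ker := by
      rw [AddMonoidHom.mem_ker]
      change p • k • m = 0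
      rw [← mul_nsmul', ← hk, addOrderOf_nsmul_eq_zero]
    rw [h0, AddSubgroup.mem_bot] at h1
    have h2 := addOrderOf_dvd_of_nsmul_eq_zero h1
    rw [hk] at h2
    have hk0 : 0 < k := Nat.pos_of_ne_zero fun h3 => by
      have := addOrderOf_pos m
      rw [hk, h3, mul_zero] at this
      exact this.ne rfl
    have := Nat.le_of_dvd hk0 h2
    nlinarith [hp.two_le])
  have hpt : ∀ x : M, p • x = 0 := fun x => by
    have : x ∈ (nsmulAddMonoidHom p : M →+ M).ker := htop ▸ AddSubgroup.mem_top x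
    exact this
  let P : Subgroup H :=
    { carrier := {a | a ∈ A ∧ PEl p a}
      one_mem' := ⟨A.one_mem, 0, one_pow _⟩
      mul_mem' := by
        rintro a b ⟨ha, i, hi⟩ ⟨hb, j, hj⟩
        refine ⟨A.mul_mem ha hb, i + j, ?_⟩
        rw [Commute.mul_pow (hA a ha b hb), pow_add, pow_mul, hi, one_pow, one_mul, mul_comm,
          pow_mul, hj, one_pow]
      inv_mem' := fun ⟨ha, hi⟩ => ⟨A.inv_mem ha, hi.inv⟩ }
  have hPn : P.Normal := ⟨fun a ha g => ⟨‹A.Normal›.conj_mem a ha.1 g, ha.2.conj g⟩⟩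
  have hPp : IsPGroup p P := isPGroup_of_forall fun x hx => hx.2
  have hPne : P ≠ ⊥ := by
    intro h0
    obtain ⟨a, ha⟩ := exists_prime_orderOf_dvd_card' p hpA
    have h1 : (a : H) ∈ P := ⟨a.2, 1, by
      rw [pow_one, ← ha]; exact_mod_cast congrArg Subtype.val (pow_orderOf_eq_one a)⟩
    rw [h0, mem_bot] at h1
    have h2 : a = 1 := Subtype.ext h1
    rw [h2, orderOf_one] at ha
    exact hp.one_lt.ne ha
  have hpM : p ∣ Nat.card M := hpm.trans (addOrderOf_dvd_natCard m)
  obtain ⟨x, hx, hx0⟩ := hPp.exists_fixed_point_of_prime_dvd_card_of_fixed_point M hpM (a := 0)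
    (fun g => smul_zero _)
  refine hPne (h.eq_bot_of_fixSub fun h0 => hx0 ?_)
  have : x ∈ fixSub M P := fun b hb => hx ⟨b, hb⟩
  rw [h0, AddSubgroup.mem_bot] at this
  exact this.symm

end

section

variable {H M : Type*} [Group H] [Finite H] [AddCommGroup M] [DistribMulAction H M]

omit [Finite H] in
theorem card_fixSub_conjSub (g : H) (B : Subgroup H) [Finite M] :
    Nat.card (fixSub M (conjSub g B)) = Nat.card (fixSub M B) := by
  refine (Nat.card_congr (Equiv.ofBijective
    (fun m : fixSub M B => (⟨g • m.1, smul_mem_fixSub m.2 g⟩ : fixSub M (conjSub g B)))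
    ⟨fun x y hxy => Subtype.ext (MulAction.injective g (congrArg Subtype.val hxy)), ?_⟩)).symm
  rintro ⟨m, hm⟩
  refine ⟨⟨g⁻¹ • m, ?_⟩, Subtype.ext (smul_inv_smul g m)⟩
  have := smul_mem_fixSub hm g⁻¹
  rwa [conjSub_conjSub, inv_mul_cancel, conjSub_one] at this

open scoped Classical in
theorem IrrAct.card_le_of_abelian (h : IrrAct H M) [Finite M] [Nontrivial M] [Group.IsSolvable H]
    {D : Set H} (hD : closure D = ⊤) {b : ℕ} (hb : ∀ y ∈ D, Nat.card (moveHom M y).range ≤ b)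
    {A : Subgroup H} [A.Normal] (hA : ∀ a ∈ A, ∀ b ∈ A, a * b = b * a) {g : H} (hgA : g ∈ A)
    (hg1 : g ≠ 1) (hg : Nat.card (moveHom M g).range ≤ b ^ 2) : Nat.card M ≤ b ^ 6 := by
  have hb1 : 0 < b := by
    rcases Nat.eq_zero_or_pos b with rfl | h1
    · have : 0 < Nat.card (moveHom M g).range := Nat.card_pos
      omega
    · exact h1
  let T : Set (Subgroup H) := {B | B ≤ A ∧ fixSub M B ≠ ⊥}
  have hT : (⊥ : Subgroup H) ∈ T := by
    refine ⟨bot_le, fun h0 => ?_⟩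
    obtain ⟨m, hm⟩ := exists_ne (0 : M)
    have : m ∈ fixSub M (⊥ : Subgroup H) := fun b hb => by rw [mem_bot.1 hb, one_smul]
    rw [h0] at this
    exact hm (by simpa using this)
  obtain ⟨B, ⟨hBA, hB⟩, hmax⟩ := Set.exists_max_image T (fun B => Nat.card B) (Set.toFinite _)
    ⟨_, hT⟩
  have hconj : ∀ x : H, conjSub x B ≤ A := fun x y hy => by
    rw [mem_conjSub] at hy
    have := ‹A.Normal›.conj_mem _ (hBA hy) x
    simpa [mul_assoc] using this
  have hlt : ∀ C ≤ A, Nat.card B < Nat.card C → fixSub M C = ⊥ := fun C hC h1 => by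
    by_contra h2
    exact absurd (hmax C ⟨hC, h2⟩) (by simpa using h1)
  by_cases hnorm : ∀ x : H, conjSub x B = B
  · have hBn : B.Normal := ⟨fun n hn x => by
      rw [← hnorm x, mem_conjSub]; simpa [mul_assoc] using hn⟩
    have hB1 := h.eq_bot_of_fixSub hB
    refine (card_moveHom_of_injective (g := g) fun m hm => ?_).trans
      (hg.trans (Nat.pow_le_pow_right hb1 (by norm_num)))
    have h1 := hlt (zpowers g) (zpowers_le.2 hgA) (by
      rw [hB1, Subgroup.card_bot, Nat.card_zpowers]
      have := orderOf_pos g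
      have := (orderOf_eq_one_iff (x := g)).not.2 hg1
      omega)
    have : m ∈ fixSub M (zpowers g) := fun b hb =>
      (zpowers_le.2 hm : zpowers g ≤ MulAction.stabilizer H m) hb
    rw [h1] at this
    simpa using this
  push Not at hnorm
  obtain ⟨x0, hx0⟩ := hnorm
  let _ : MulAction H (Subgroup H) := conjMulAction H
  have hsm : ∀ (x : H) (C : Subgroup H), x • C = conjSub x C := fun _ _ => rfl
  let Ω : Finset (Subgroup H) := (Set.toFinite {C : Subgroup H | ∃ x : H, x • B = C}).toFinset
  have hΩ : ∀ C, C ∈ Ω ↔ ∃ x : H, x • B = C := fun C => by simp [Ω]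
  have hBΩ : B ∈ Ω := (hΩ B).2 ⟨1, one_smul _ _⟩
  have hinv : ∀ x : H, ∀ C ∈ Ω, x • C ∈ Ω := by
    intro x C hC
    obtain ⟨y, rfl⟩ := (hΩ C).1 hC
    exact (hΩ _).2 ⟨x * y, mul_smul _ _ _⟩
  have hle : ∀ C ∈ Ω, C ≤ A := fun C hC => by
    obtain ⟨y, rfl⟩ := (hΩ C).1 hC
    exact hconj y
  have hcard : ∀ C ∈ Ω, Nat.card C = Nat.card B := fun C hC => by
    obtain ⟨y, rfl⟩ := (hΩ C).1 hC
    exact card_conjSub y B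
  have hfix : ∀ C ∈ Ω, Nat.card (fixSub M C) = Nat.card (fixSub M B) := fun C hC => by
    obtain ⟨y, rfl⟩ := (hΩ C).1 hC
    exact card_fixSub_conjSub y B
  obtain ⟨y, hyD, hy⟩ := exists_fixes_half (Ω := Ω) hinv (by
    intro C hC E hE
    obtain ⟨x, rfl⟩ := (hΩ C).1 hC
    obtain ⟨z, rfl⟩ := (hΩ E).1 hE
    exact ⟨z * x⁻¹, by rw [← mul_smul, inv_mul_cancel_right]⟩)
    (Finset.one_lt_card.2 ⟨_, (hΩ _).2 ⟨x0, rfl⟩, B, hBΩ, hx0⟩) hD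
  have hF : FixFamily M Ω :=
    { comm := fun C hC E hE c hc e he => hA c (hle C hC hc) e (hle E hE he)
      tors := fun C hC m hm => h.tors hA (by
        obtain ⟨k, hk⟩ := Subgroup.card_dvd_of_le (hle C hC)
        rw [hk, mul_comm, mul_nsmul', hm, smul_zero])
      disj := by
        intro C hC E hE hCE m hm hm'
        have h1 : m ∈ fixSub M (C ⊔ E) := by
          have h2 : C ⊔ E ≤ MulAction.stabilizer H m :=
            sup_le (fun c hc => hm c hc) fun c hc => hm' c hc
          exact fun c hc => h2 hc
        rw [hlt (C ⊔ E) (sup_le (hle C hC) (hle E hE)) ?_] at h1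
        · simpa using h1
        · rw [← hcard C hC]
          have h0 : C < C ⊔ E → (C : Set H) ⊂ ((C ⊔ E : Subgroup H) : Set H) := fun h => h
          refine Set.Finite.card_lt_card (Set.toFinite _) (h0 (lt_of_le_of_ne le_sup_left ?_))
          intro h2
          apply hCE
          have h3 : E ≤ C := by rw [h2]; exact le_sup_right
          exact (eq_of_le_of_card_ge h3 (by rw [hcard C hC, hcard E hE])).symm }
  have hspan : Ω.sup (fixSub M) = ⊤ := by
    apply h.irr
    · intro x n hn
      have h1 : Ω.sup (fixSub M) ≤
          (Ω.sup (fixSub M)).comap (DistribSMul.toAddMonoidHom M x) := by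
        refine Finset.sup_le fun C hC m hm => ?_
        have h2 : fixSub M (x • C) ≤ Ω.sup (fixSub M) :=
          Finset.le_sup (f := fixSub M) (hinv x C hC)
        exact h2 (smul_mem_fixSub hm x)
      exact h1 hn
    · intro h0
      have : fixSub M B ≤ Ω.sup (fixSub M) := Finset.le_sup (f := fixSub M) hBΩ
      rw [h0, le_bot_iff] at this
      exact hB this
  obtain ⟨I, hI, hd, hIc⟩ := exists_disjoint_image (MulAction.toPerm y) Ω
  have hIc' : Ω.card ≤ (Ω.filter fun x => y • x = x).card + 3 * I.card := hIc
  set c := Nat.card (fixSub M B) with hc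
  have hc1 : 0 < c := Nat.card_pos
  have hM1 : Nat.card M ≤ c ^ Ω.card := by
    have h1 := card_sup_fixSub_le (M := M) (I := Ω) fun C hC => (hfix C hC).le
    rw [hspan] at h1
    rwa [Nat.card_congr AddSubgroup.topEquiv.toEquiv] at h1
  have hM2 : c ^ I.card ≤ b := by
    refine (hF.le_card hI fun C hC => (hfix C (hI hC)).ge).trans (le_trans ?_ (hb y hyD))
    refine Nat.card_le_card_of_injective
      (fun m : (I.sup (fixSub M) : AddSubgroup M) => (⟨moveHom M y m, m, rfl⟩ :
        (moveHom M y).range)) ?_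
    rintro ⟨m, hm⟩ ⟨m', hm'⟩ hmm
    have h1 : y • m - m = y • m' - m' := congrArg Subtype.val hmm
    have h2 : y • (m - m') = m - m' := by
      rw [smul_sub, sub_eq_sub_iff_add_eq_add]
      rw [sub_eq_sub_iff_add_eq_add] at h1
      rw [h1, add_comm]
    have h3 : m - m' ∈ I.sup (fixSub M) := sub_mem hm hm'
    have h4 : y • (m - m') ∈ (I.image fun C => y • C).sup (fixSub M) := by
      have h5 : I.sup (fixSub M) ≤
          ((I.image fun C => y • C).sup (fixSub M)).comap (DistribSMul.toAddMonoidHom M y) := by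
        refine Finset.sup_le fun C hC n hn => ?_
        have h6 : fixSub M (y • C) ≤ (I.image fun C => y • C).sup (fixSub M) :=
          Finset.le_sup (f := fixSub M) (Finset.mem_image_of_mem _ hC)
        exact h6 (smul_mem_fixSub hn y)
      exact h5 h3
    rw [h2] at h4
    have h5 := hF.eq_zero hI h3 fun C hC => hF.trace_eq_zero (hI hC) (by
      intro E hE
      obtain ⟨C, hC, rfl⟩ := Finset.mem_image.1 hE
      exact hinv y C (hI hC)) (Finset.disjoint_left.1 hd hC) h4
    exact Subtype.ext (sub_eq_zero.1 h5)
  calc Nat.card M ≤ c ^ Ω.card := hM1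
    _ ≤ c ^ (I.card * 6) := Nat.pow_le_pow_right hc1 (by omega)
    _ = (c ^ I.card) ^ 6 := pow_mul _ _ _
    _ ≤ b ^ 6 := Nat.pow_le_pow_left hM2 6

/-- A finite soluble group acting faithfully and irreducibly, generated by elements moving
little, is trivial or acts on a small module. -/
theorem IrrAct.card_le (h : IrrAct H M) [Finite M] [Group.IsSolvable H]
    {D : Set H} (hD : closure D = ⊤) {b : ℕ}
    (hb : ∀ y ∈ D, Nat.card (moveHom M y).range ≤ b) :
    (∀ h : H, h = 1) ∨ Nat.card M ≤ b ^ 6 := by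
  by_cases htriv : ∀ h : H, h = 1
  · exact Or.inl htriv
  right
  have hnt : Nontrivial M := by
    by_contra h0
    rw [not_nontrivial_iff_subsingleton] at h0
    exact htriv fun x => h.faithful x fun m => Subsingleton.elim _ _
  have hne : ∃ y ∈ D, y ≠ 1 := by
    by_contra! h0
    apply htriv
    intro x
    have : closure D ≤ ⊥ := (closure_le _).2 fun y hy => by simpa using h0 y hy
    rw [hD] at this
    simpa using this (mem_top x)
  have hb1 : 0 < b := by
    obtain ⟨y, hy, _⟩ := hne
    exact (Nat.card_pos : 0 < Nat.card (moveHom M y).range).trans_le (hb y hy)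
  have hcen : ∀ z ∈ center H, z ≠ 1 → ∀ k ≤ 6, Nat.card (moveHom M z).range ≤ b ^ k →
      Nat.card M ≤ b ^ 6 := fun z hz hz1 k hk hzk =>
    (card_moveHom_of_injective fun m hm => h.fix_eq_zero_of_central hz hz1 hm).trans
      (hzk.trans (Nat.pow_le_pow_right hb1 hk))
  by_cases hab : center H = ⊤
  · obtain ⟨y, hy, hy1⟩ := hne
    exact hcen y (hab ▸ mem_top y) hy1 1 (by norm_num) (by simpa using hb y hy)
  obtain ⟨C, ⟨hCn, hCc⟩, hmin⟩ := Set.Finite.exists_minimal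
    (Set.toFinite {C : Subgroup H | C.Normal ∧ ¬ C ≤ center H})
    ⟨⊤, inferInstance, fun h0 => hab (top_le_iff.1 h0)⟩
  have hmin' : ∀ B : Subgroup H, B.Normal → B ≤ C → B ≠ C → B ≤ center H := by
    intro B hB hBC hne
    by_contra h0
    exact hne (le_antisymm hBC (hmin (y := B) ⟨hB, h0⟩ hBC))
  have hyc : ∃ y ∈ D, ∃ c ∈ C, ⁅y, c⁆ ≠ 1 := by
    by_contra! h0
    apply hCc
    have h1 : closure D ≤ centralizer (C : Set H) := (closure_le _).2 fun y hy => by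
      rw [SetLike.mem_coe, mem_centralizer_iff]
      intro c hc
      exact (commutatorElement_eq_one_iff_mul_comm.1 (h0 y hy c hc)).symm
    intro c hc
    rw [mem_center_iff]
    intro x
    have h2 : x ∈ closure D := hD ▸ mem_top x
    exact (mem_centralizer_iff.1 (h1 h2) c hc).symm
  obtain ⟨y, hy, c, hc, hg1⟩ := hyc
  have hgC : ⁅y, c⁆ ∈ C := by
    rw [commutatorElement_def]
    exact C.mul_mem (hCn.conj_mem c hc y) (C.inv_mem hc)
  have hgb : Nat.card (moveHom M ⁅y, c⁆).range ≤ b ^ 2 :=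
    (card_moveHom_commutator_left y c).trans (Nat.pow_le_pow_left (hb y hy) 2)
  by_cases hgc : ⁅y, c⁆ ∈ center H
  · exact hcen _ hgc hg1 2 (by norm_num) hgb
  by_cases hCa : ∀ a ∈ C, ∀ b ∈ C, a * b = b * a
  · exact h.card_le_of_abelian hD hb hCa hgC hg1 hgb
  have hex : ∃ c' ∈ C, ⁅⁅y, c⁆, c'⁆ ≠ 1 := by
    by_contra! h0
    have h1 : ⁅y, c⁆ ∈ C ⊓ centralizer (C : Set H) := ⟨hgC, by
      refine mem_centralizer_iff.2 ?_
      intro c' hc'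
      exact (commutatorElement_eq_one_iff_mul_comm.1 (h0 c' hc')).symm⟩
    refine hgc (hmin' (C ⊓ centralizer (C : Set H)) inferInstance inf_le_left ?_ h1)
    intro h2
    apply hCa
    intro a ha b hb
    rw [← h2] at hb
    exact mem_centralizer_iff.1 hb.2 a ha
  obtain ⟨c', hc', hz1⟩ := hex
  have hzC : ⁅⁅y, c⁆, c'⁆ ∈ ⁅C, C⁆ := commutator_mem_commutator hgC hc'
  have hCC : ⁅C, C⁆ ≤ center H := by
    refine hmin' _ inferInstance (commutator_le_self C) ?_
    refine (Group.IsSolvable.commutator_lt_of_ne_bot ?_).ne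
    rintro rfl
    exact hCc bot_le
  refine hcen _ (hCC hzC) hz1 4 (by norm_num) ((card_moveHom_commutator_left _ _).trans ?_)
  calc _ ≤ (b ^ 2) ^ 2 := Nat.pow_le_pow_left hgb 2
    _ = b ^ 4 := by ring

end

section

universe u v

variable {H : Type u} {M : Type v} [Group H] [AddCommGroup M] [DistribMulAction H M]

/-- The action on an invariant subgroup. -/
abbrev subAct (N : AddSubgroup M) (hN : ∀ (h : H), ∀ n ∈ N, h • n ∈ N) : DistribMulAction H N where
  smul h n := ⟨h • n.1, hN h n.1 n.2⟩
  one_smul n := Subtype.ext (one_smul H n.1)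
  mul_smul a b n := Subtype.ext (mul_smul a b n.1)
  smul_zero a := Subtype.ext (smul_zero a)
  smul_add a x y := Subtype.ext (smul_add a x.1 y.1)

/-- The action on the quotient by an invariant subgroup. -/
abbrev quotAct (N : AddSubgroup M) (hN : ∀ (h : H), ∀ n ∈ N, h • n ∈ N) :
    DistribMulAction H (M ⧸ N) where
  smul h := QuotientAddGroup.map N N (DistribSMul.toAddMonoidHom M h) (fun n hn => hN h n hn)
  one_smul x := by
    obtain ⟨m, rfl⟩ := QuotientAddGroup.mk_surjective x
    exact congrArg QuotientAddGroup.mk (one_smul H m)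
  mul_smul a b x := by
    obtain ⟨m, rfl⟩ := QuotientAddGroup.mk_surjective x
    exact congrArg QuotientAddGroup.mk (mul_smul a b m)
  smul_zero a := map_zero (QuotientAddGroup.map N N (DistribSMul.toAddMonoidHom M a)
    (fun n hn => hN a n hn))
  smul_add a x y := map_add (QuotientAddGroup.map N N (DistribSMul.toAddMonoidHom M a)
    (fun n hn => hN a n hn)) x y

variable [Finite H] [Group.IsSolvable H] {D : Set H} {b : ℕ}

theorem cres_smul_of_irr [Finite M] (hD : closure D = ⊤)
    (hirr : ∀ N : AddSubgroup M, (∀ (h : H), ∀ n ∈ N, h • n ∈ N) → N ≠ ⊥ → N = ⊤)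
    (hb : ∀ y ∈ D, Nat.card (moveHom M y).range ≤ b) {g : H}
    (hg : g ∈ cres^[(b ^ 6).factorial] (⊤ : Subgroup H)) (m : M) : g • m = m := by
  let φ : H →* (M ≃ₗ[ℤ] M) := DistribMulAction.toModuleAut ℤ M
  have hφ : ∀ (h : H) (m : M), φ h m = h • m := fun _ _ => rfl
  have hfin : Finite φ.range := Finite.of_surjective _ φ.rangeRestrict_surjective
  have hsol : Group.IsSolvable φ.range :=
    Group.isSolvable_of_surjective φ.rangeRestrict_surjective
  have hirrP : IrrAct φ.range M :=
    { faithful := fun h hh => Subtype.ext (LinearEquiv.ext fun m => hh m)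
      irr := fun N hN hN0 => hirr N (fun h n hn => hN ⟨φ h, h, rfl⟩ n hn) hN0 }
  have hcl : closure (φ.rangeRestrict '' D) = ⊤ := by
    rw [← MonoidHom.map_closure, hD, map_top_of_surjective _ φ.rangeRestrict_surjective]
  have hgP : φ.rangeRestrict g ∈ cres^[(b ^ 6).factorial] (⊤ : Subgroup φ.range) := by
    rw [← map_cres_iterate_top φ.rangeRestrict_surjective]
    exact mem_map_of_mem _ hg
  have h1 : φ.rangeRestrict g = 1 := by
    rcases hirrP.card_le hcl (b := b) (by rintro _ ⟨y, hy, rfl⟩; exact hb y hy) with h2 | h2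
    · exact h2 _
    · rw [cres_iterate_eq_bot_of_card, mem_bot] at hgP
      · exact hgP
      rw [card_top]
      let ψ : φ.range → Equiv.Perm M := fun x => x.1.toEquiv
      have hψ : Function.Injective ψ := fun x y hxy =>
        Subtype.ext (LinearEquiv.ext fun m => Equiv.congr_fun hxy m)
      refine (Nat.card_le_card_of_injective ψ hψ).trans ?_
      rw [Nat.card_perm]
      exact Nat.factorial_le h2
  have h2 : φ g = 1 := congrArg Subtype.val h1
  rw [← hφ, h2]
  rfl

theorem cres_smul_of_coprime (hD : closure D = ⊤) {g : H}
    (hg : g ∈ cres^[(b ^ 6).factorial] (⊤ : Subgroup H)) {r : ℕ} (hgr : PEl r g) {t : ℕ}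
    (ht : t.Coprime r) (n : ℕ) (M : Type v) [AddCommGroup M] [DistribMulAction H M] [Finite M]
    (hn : Nat.card M ≤ n)
    (hb : ∀ y ∈ D, Nat.card (moveHom M y).range ≤ b) (m : M) (hm : t • m = 0) : g • m = m := by
  induction n generalizing M with
  | zero => exact absurd hn (by have : 0 < Nat.card M := Nat.card_pos; omega)
  | succ n ih =>
    by_cases htriv : Subsingleton M
    · exact Subsingleton.elim _ _
    rw [not_subsingleton_iff_nontrivial] at htriv
    obtain ⟨N, ⟨hN, hN0⟩, hmin⟩ := Set.Finite.exists_minimal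
      (Set.toFinite {N : AddSubgroup M | (∀ (h : H), ∀ n ∈ N, h • n ∈ N) ∧ N ≠ ⊥})
      ⟨⊤, fun _ _ _ => AddSubgroup.mem_top _, fun h0 => by
        obtain ⟨x, hx⟩ := exists_ne (0 : M)
        have : x ∈ (⊥ : AddSubgroup M) := h0 ▸ AddSubgroup.mem_top x
        exact hx (by simpa using this)⟩
    have hNg : ∀ x ∈ N, g • x = x := by
      let _ := subAct N hN
      intro x hx
      have h1 : g • (⟨x, hx⟩ : N) = ⟨x, hx⟩ := by
        refine cres_smul_of_irr (D := D) (b := b) hD ?_ ?_ hg _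
        · intro K hK hK0
          have h2 : N ≤ K.map N.subtype := by
            refine hmin ⟨?_, ?_⟩ ?_
            · rintro h _ ⟨k, hk, rfl⟩
              exact ⟨h • k, hK h k hk, rfl⟩
            · intro h0
              exact hK0 ((AddSubgroup.map_eq_bot_iff_of_injective _ N.subtype_injective).1 h0)
            · rintro _ ⟨k, hk, rfl⟩
              exact k.2
          rw [eq_top_iff]
          intro k _
          obtain ⟨k', hk', hkk⟩ := h2 k.2
          rwa [Subtype.ext hkk] at hk'
        · intro y hy
          refine le_trans (Nat.card_le_card_of_injective
            (fun x : (moveHom N y).range => (⟨x.1.1, ?_⟩ : (moveHom M y).range)) ?_) (hb y hy)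
          · obtain ⟨_, k, rfl⟩ := x
            exact ⟨k.1, rfl⟩
          · intro a c hac
            exact Subtype.ext (Subtype.ext (congrArg (fun z => z.1) hac))
      exact congrArg Subtype.val h1
    have hq : g • m - m ∈ N := by
      let _ := quotAct N hN
      have h1 : g • (QuotientAddGroup.mk m : M ⧸ N) = QuotientAddGroup.mk m := by
        refine ih (M ⧸ N) ?_ ?_ _ ?_
        · have h2 := AddSubgroup.card_eq_card_quotient_mul_card_addSubgroup N
          have h3 : 1 < Nat.card N := by
            have : N.carrier ≠ {0} := fun h => hN0 (by ext x; exact Set.ext_iff.1 h x)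
            rw [AddSubgroup.one_lt_card_iff_ne_bot]
            exact hN0
          have h4 : 0 < Nat.card (M ⧸ N) := Nat.card_pos
          nlinarith
        · intro y hy
          refine le_trans (Nat.card_le_card_of_surjective
            (fun x : (moveHom M y).range => (⟨QuotientAddGroup.mk x.1, ?_⟩ :
              (moveHom (M ⧸ N) y).range)) ?_) (hb y hy)
          · obtain ⟨_, k, rfl⟩ := x
            exact ⟨QuotientAddGroup.mk k, rfl⟩
          · rintro ⟨_, k, rfl⟩
            obtain ⟨k, rfl⟩ := QuotientAddGroup.mk_surjective k
            exact ⟨⟨moveHom M y k, k, rfl⟩, rfl⟩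
        · rw [← QuotientAddGroup.mk_nsmul, hm, QuotientAddGroup.mk_zero]
      have h2 : (QuotientAddGroup.mk (g • m) : M ⧸ N) = QuotientAddGroup.mk m := h1
      rw [QuotientAddGroup.eq] at h2
      have h3 := N.neg_mem h2
      rwa [neg_add_rev, neg_neg, add_comm, add_comm, ← sub_eq_neg_add] at h3
    have hpow : ∀ k : ℕ, g ^ k • m = m + k • (g • m - m) := by
      intro k
      induction k with
      | zero => simp
      | succ k ih =>
        have h5 : g • (k • (g • m - m)) = k • (g • m - m) := hNg _ (N.nsmul_mem hq k)
        rw [pow_succ', mul_smul, ih, smul_add, h5, succ_nsmul]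
        abel
    obtain ⟨k, hk⟩ := hgr
    have h1 := hpow (r ^ k)
    rw [hk, one_smul, left_eq_add] at h1
    have h2 : t • (g • m - m) = 0 := by
      have e : g • (t • m) = t • g • m := map_nsmul (DistribSMul.toAddMonoidHom M g) t m
      rw [nsmul_sub, ← e, hm, smul_zero, sub_zero]
    have h3 : addOrderOf (g • m - m) ∣ 1 := by
      rw [← (Nat.Coprime.pow_right k ht).gcd_eq_one]
      exact Nat.dvd_gcd (addOrderOf_dvd_of_nsmul_eq_zero h2) (addOrderOf_dvd_of_nsmul_eq_zero h1)
    rw [Nat.dvd_one, AddMonoid.addOrderOf_eq_one_iff] at h3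
    exact sub_eq_zero.1 h3

/-- A finite soluble group generated by elements moving little acts on a finite module through a
group whose iterated coprime residuals vanish after a bounded number of steps. -/
theorem cres_smul_eq [Finite M] (hD : closure D = ⊤)
    (hb : ∀ y ∈ D, Nat.card (moveHom M y).range ≤ b) {g : H}
    (hg : g ∈ cres^[(b ^ 6).factorial + 1] (⊤ : Subgroup H)) (m : M) : g • m = m := by
  let K : Subgroup H := (MulAction.toPermHom H M).ker
  have hK : ∀ x : H, x ∈ K ↔ ∀ m : M, x • m = m := fun x => by
    rw [MonoidHom.mem_ker]
    exact ⟨fun h m => Equiv.congr_fun h m, fun h => Equiv.ext h⟩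
  suffices h : cres^[(b ^ 6).factorial + 1] (⊤ : Subgroup H) ≤ K from (hK g).1 (h hg) m
  rw [Function.iterate_succ_apply', cres_le_iff]
  intro a ha c hc r s hr hs hrs har hcs
  rw [hK]
  have hcop : ∀ (x y : H) (r : ℕ), r.Prime → x ∈ cres^[(b ^ 6).factorial] (⊤ : Subgroup H) →
      PEl r x → ∀ (m : M) (t : ℕ), t.Coprime r → t • m = 0 → x • y • m = y • m := by
    intro x y r hr hx hxr m t ht htm
    refine cres_smul_of_coprime (D := D) hD hx hxr ht (Nat.card M) M le_rfl hb _ ?_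
    have e : y • (t • m) = t • y • m := map_nsmul (DistribSMul.toAddMonoidHom M y) t m
    rw [← e, htm, smul_zero]
  have hM : 0 < Nat.card M := Nat.card_pos
  obtain ⟨i, u, hu, hMu⟩ := Nat.exists_eq_pow_mul_and_not_dvd hM.ne' r hr.ne_one
  obtain ⟨j, v, hv, hMv⟩ := Nat.exists_eq_pow_mul_and_not_dvd hM.ne' s hs.ne_one
  have huc : u.Coprime r := ((Nat.Prime.coprime_iff_not_dvd hr).2 hu).symm
  have hvc : v.Coprime s := ((Nat.Prime.coprime_iff_not_dvd hs).2 hv).symm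
  intro m
  have hA : ⁅a, c⁆ • ((r ^ i) • m) = (r ^ i) • m := by
    have h0 : u • ((r ^ i) • m) = 0 := by
      rw [← mul_nsmul, ← hMu, card_nsmul_eq_zero']
    have h1 := fun y => hcop a y r hr ha har _ u huc h0
    have h2 : ∀ y : H, a⁻¹ • y • ((r ^ i) • m) = y • ((r ^ i) • m) := fun y => by
      rw [inv_smul_eq_iff, h1]
    rw [commutatorElement_def, mul_smul, mul_smul, mul_smul, h2, smul_inv_smul]
    have := h1 1
    rwa [one_smul] at this
  have hB : ⁅a, c⁆ • ((s ^ j) • m) = (s ^ j) • m := by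
    have h0 : v • ((s ^ j) • m) = 0 := by
      rw [← mul_nsmul, ← hMv, card_nsmul_eq_zero']
    have h1 := fun y => hcop c y s hs hc hcs _ v hvc h0
    have h3 : c⁻¹ • ((s ^ j) • m) = (s ^ j) • m := by
      rw [inv_smul_eq_iff]
      have := h1 1
      rw [one_smul] at this
      exact this.symm
    rw [commutatorElement_def, mul_smul, mul_smul, mul_smul, h3, h1, smul_inv_smul]
  have hco : IsCoprime ((r ^ i : ℕ) : ℤ) ((s ^ j : ℕ) : ℤ) :=
    Nat.isCoprime_iff_coprime.2 (Nat.Coprime.pow i j ((Nat.coprime_primes hr hs).2 hrs))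
  obtain ⟨α, β, hαβ⟩ := hco
  have hm : m = α • ((r ^ i) • m) + β • ((s ^ j) • m) := by
    rw [← natCast_zsmul, ← natCast_zsmul, ← mul_zsmul', ← mul_zsmul', ← add_zsmul, mul_comm _ α,
      mul_comm _ β, hαβ, one_zsmul]
  have hz : ∀ (k : ℤ) (x : M), ⁅a, c⁆ • (k • x) = k • ⁅a, c⁆ • x := fun k x =>
    map_zsmul (DistribSMul.toAddMonoidHom M ⁅a, c⁆) k x
  rw [hm, smul_add, hz, hz, hA, hB]

end

end

section

section

variable {E A Λ : Type*} [Group E] [Finite E] [CommGroup A] [Finite A] [Fintype Λ]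

theorem exists_isotropic_step (β : Λ → E →* E →* A) (C : Subgroup E) {S : Finset E} {s₀ : E}
    (h : (Nat.card A) ^ (2 * Fintype.card Λ * S.card) * S.card < C.index) :
    ∃ w : E, (∀ l, ∀ t ∈ S, β l w t = 1 ∧ β l t w = 1) ∧ ∀ t ∈ S, w * s₀ * t⁻¹ ∉ C := by
  by_contra! hcon
  let f : E →* (Λ × S → A × A) :=
    { toFun := fun w i => (β i.1 w i.2, β i.1 i.2 w)
      map_one' := by ext i <;> simp
      map_mul' := fun x y => by ext i <;> simp }
  have hf : ∀ w, w ∈ f.ker → ∀ l, ∀ t ∈ S, β l w t = 1 ∧ β l t w = 1 := fun w hw l t ht => by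
    have := congrFun (MonoidHom.mem_ker.1 hw) (l, ⟨t, ht⟩)
    exact Prod.ext_iff.1 this
  have h1 : f.ker.index ≤ (Nat.card A) ^ (2 * Fintype.card Λ * S.card) := by
    rw [Subgroup.index_ker]
    refine (Nat.card_le_card_of_injective Subtype.val Subtype.val_injective).trans ?_
    rw [Nat.card_fun, Nat.card_prod, Nat.card_prod, ← sq, ← pow_mul, mul_assoc]
    simp
  have h2 : Nat.card f.ker ≤ Nat.card (S × C) := by
    choose g hg hg' using fun w : f.ker => hcon w.1 (hf w.1 w.2)
    refine Nat.card_le_card_of_injective (fun w => (⟨g w, hg w⟩, ⟨_, hg' w⟩)) ?_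
    intro x y hxy
    rw [Prod.mk.injEq, Subtype.mk.injEq, Subtype.mk.injEq] at hxy
    rw [hxy.1] at hxy
    exact Subtype.ext (mul_right_cancel (mul_right_cancel hxy.2))
  rw [Nat.card_prod, Nat.card_eq_fintype_card (α := S), Fintype.card_coe] at h2
  have h3 := f.ker.card_mul_index
  have h4 := C.card_mul_index
  have h5 : 0 < Nat.card C := Nat.card_pos
  have h6 : Nat.card C * C.index ≤ Nat.card C *
      ((Nat.card A) ^ (2 * Fintype.card Λ * S.card) * S.card) := by
    rw [h4, ← h3]
    calc _ ≤ (S.card * Nat.card C) * (Nat.card A) ^ (2 * Fintype.card Λ * S.card) :=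
          Nat.mul_le_mul h2 h1
      _ = _ := by ring
  exact absurd (Nat.le_of_mul_le_mul_left h6 h5) (by omega)

open scoped Classical in
/-- Given finitely many bimultiplicative maps, a subgroup of large index misses a common isotropic
element. -/
theorem exists_isotropic (β : Λ → E →* E →* A) (C : Subgroup E)
    (h : (Nat.card A) ^ (2 * Fintype.card Λ * (Nat.card A) ^ Fintype.card Λ) *
      (Nat.card A) ^ Fintype.card Λ < C.index) : ∃ u ∉ C, ∀ l, β l u u = 1 := by
  set k := (Nat.card A) ^ Fintype.card Λ with hk
  let R : E → E → Prop := fun s t => s * t⁻¹ ∉ C ∧ ∀ l, β l (s * t⁻¹) t = 1 ∧ β l t (s * t⁻¹) = 1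
  have hA : 0 < Nat.card A := Nat.card_pos
  have key : ∀ j ≤ k, ∃ S : Finset E, S.card = j + 1 ∧ (∀ s ∈ S, ∀ t ∈ S, s ≠ t → R s t ∨ R t s) ∧
      ∃ s₀ ∈ S, ∀ t ∈ S, t ≠ s₀ → R s₀ t := by
    intro j
    induction j with
    | zero =>
      intro _
      refine ⟨{1}, rfl, ?_, 1, by simp, by simp⟩
      intro s hs t ht hst
      rw [Finset.mem_singleton] at hs ht
      exact absurd (hs.trans ht.symm) hst
    | succ j ih =>
      intro hj
      obtain ⟨S, hS, hSR, s₀, hs₀, hs₀R⟩ := ih (by omega)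
      obtain ⟨w, hw, hwC⟩ := exists_isotropic_step β C (S := S) (s₀ := s₀) (by
        refine lt_of_le_of_lt ?_ h
        rw [hS]
        exact Nat.mul_le_mul (Nat.pow_le_pow_right hA (Nat.mul_le_mul le_rfl hj)) hj)
      have hwR : ∀ t ∈ S, R (w * s₀) t := by
        intro t ht
        refine ⟨hwC t ht, fun l => ?_⟩
        by_cases hts : t = s₀
        · subst hts
          rw [mul_inv_cancel_right]
          exact hw l t ht
        · obtain ⟨h1, h2⟩ := (hs₀R t ht hts).2 l
          obtain ⟨h3, h4⟩ := hw l t ht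
          rw [mul_assoc, map_mul (β l), MonoidHom.mul_apply, map_mul (β l t), h1, h2, h3, h4]
          simp
      have hwS : w * s₀ ∉ S := fun hmem => by
        have := (hwR _ hmem).1
        rw [mul_inv_cancel] at this
        exact this C.one_mem
      refine ⟨insert (w * s₀) S, by rw [Finset.card_insert_of_notMem hwS, hS], ?_, w * s₀,
        Finset.mem_insert_self _ _, ?_⟩
      · intro s hs t ht hst
        rcases Finset.mem_insert.1 hs with rfl | hs
        · rcases Finset.mem_insert.1 ht with rfl | ht
          · exact absurd rfl hst
          · exact Or.inl (hwR t ht)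
        · rcases Finset.mem_insert.1 ht with rfl | ht
          · exact Or.inr (hwR s hs)
          · exact hSR s hs t ht hst
      · intro t ht hne
        exact hwR t ((Finset.mem_insert.1 ht).resolve_left hne)
  obtain ⟨S, hS, hSR, -⟩ := key k le_rfl
  have := Fintype.ofFinite A
  obtain ⟨s, hs, t, ht, hst, hq⟩ := Finset.exists_ne_map_eq_of_card_lt_of_maps_to
    (s := S) (t := (Finset.univ : Finset (Λ → A))) (f := fun s l => β l s s) (by
      rw [Finset.card_univ, Fintype.card_fun, ← Nat.card_eq_fintype_card (α := A), hS]; omega)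
    (fun _ _ => Finset.mem_univ _)
  have fin : ∀ s t, R s t → (fun l => β l s s) = (fun l => β l t t) →
      ∃ u ∉ C, ∀ l, β l u u = 1 := by
    intro s t hR hq
    refine ⟨s * t⁻¹, hR.1, fun l => ?_⟩
    obtain ⟨h1, h2⟩ := hR.2 l
    have h3 : β l s s = β l (s * t⁻¹ * t) (s * t⁻¹ * t) := by rw [inv_mul_cancel_right]
    rw [map_mul (β l), MonoidHom.mul_apply, map_mul (β l (s * t⁻¹)), map_mul (β l t), h1, h2,
      mul_one, one_mul, congrFun hq l] at h3
    exact right_eq_mul.1 h3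
  rcases hSR s hs t ht hst with hR | hR
  · exact fin s t hR hq
  · exact fin t s hR hq.symm

end

end

section

open Module Module.End

section

variable {K U : Type*} [Field K] [IsAlgClosed K] [AddCommGroup U] [Module K U]
  [FiniteDimensional K U]

omit [IsAlgClosed K] in
theorem maxGenEigenspace_eq_of_pow_eq_one {T : Module.End K U} {n : ℕ} (hn : (n : K) ≠ 0)
    (hT : T ^ n = 1) (c : K) : T.maxGenEigenspace c = T.eigenspace c := by
  have hs : T.IsSemisimple := by
    refine isSemisimple_of_squarefree_aeval_eq_zero
      (p := (Polynomial.X ^ n - 1 : Polynomial K)) ?_ (by simp [hT])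
    exact (Polynomial.X_pow_sub_one_separable_iff.2 hn).squarefree
  exact IsFinitelySemisimple.maxGenEigenspace_eq_eigenspace
    (isFinitelySemisimple_iff_isSemisimple.mpr hs) c

omit [IsAlgClosed K] [FiniteDimensional K U] in
theorem shift_apply {X : Module.End K U} {T : ℕ → Module.End K U}
    (hXT : ∀ a, X * T a = T (a + 1) * X) (j a : ℕ) (w : U) :
    T (a + j) ((X ^ j) w) = (X ^ j) (T a w) := by
  induction j generalizing w with
  | zero => simp
  | succ j ih =>
    have h := fun w => LinearMap.congr_fun (hXT (a + j)) w
    simp only [Module.End.mul_apply] at h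
    rw [pow_succ', Module.End.mul_apply, Module.End.mul_apply, ← add_assoc, ← h, ih]

theorem periodic_prime_pow {α : Type*} {χ : ℕ → α} {p e d : ℕ} (hp : p.Prime) (he : 1 ≤ e)
    (hd0 : 0 < d) (hd : d < p ^ e) (h1 : Function.Periodic χ d)
    (h2 : Function.Periodic χ (p ^ e)) : χ (p ^ (e - 1)) = χ 0 := by
  obtain ⟨k, hk⟩ : ∃ k, d * k % p ^ e = p ^ (e - 1) := by
    obtain ⟨i, hi, hg⟩ := (Nat.dvd_prime_pow hp).1 (Nat.gcd_dvd_right d (p ^ e))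
    have hlt : i < e := by
      rcases hi.lt_or_eq with h | h
      · exact h
      · rw [h] at hg
        exact absurd (Nat.le_of_dvd hd0 (hg ▸ Nat.gcd_dvd_left d (p ^ e))) (by omega)
    obtain ⟨k, -, hk⟩ := Nat.exists_mul_mod_eq_gcd (n := d) (k := p ^ e)
      (hg ▸ Nat.pow_lt_pow_right hp.one_lt hlt)
    refine ⟨k * p ^ (e - 1 - i), ?_⟩
    rw [← mul_assoc, Nat.mul_mod, hk, hg, Nat.mul_mod_mod, ← pow_add,
      show i + (e - 1 - i) = e - 1 by omega, Nat.mod_eq_of_lt]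
    exact Nat.pow_lt_pow_right hp.one_lt (by omega)
  have h3 : Function.Periodic χ (d * k) := by
    rw [mul_comm]
    exact h1.nat_mul k
  rw [← hk, h2.map_mod_nat]
  simpa using h3 0

theorem endomorphism_shift_eq {X : Module.End K U} {T : ℕ → Module.End K U} {p e n : ℕ}
    (hp : p.Prime) (he : 1 ≤ e) (hn : (n : K) ≠ 0)
    (hsum : ∑ j ∈ Finset.range (p ^ e), X ^ j = 0)
    (hXT : ∀ a, X * T a = T (a + 1) * X) (hper : ∀ a, T (a + p ^ e) = T a)
    (hcomm : ∀ a b, Commute (T a) (T b)) (hT : ∀ a, T a ^ n = 1) :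
    T (p ^ (e - 1)) = T 0 := by
  have hE : ∀ a c, (T a).maxGenEigenspace c = (T a).eigenspace c :=
    fun a => maxGenEigenspace_eq_of_pow_eq_one hn (hT a)
  have hmaps : ∀ i j φ, Set.MapsTo (T i) ((T j).maxGenEigenspace φ) ((T j).maxGenEigenspace φ) :=
    fun i j φ => mapsTo_maxGenEigenspace_of_comm (hcomm j i) φ
  have htop := iSup_iInf_maxGenEigenspace_eq_top_of_forall_mapsTo T hmaps
    (fun i => iSup_maxGenEigenspace_eq_top (T i))
  have hind := independent_iInf_maxGenEigenspace_of_forall_mapsTo T hmaps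
  set W : (ℕ → K) → Submodule K U := fun χ => ⨅ i, (T i).maxGenEigenspace (χ i) with hW
  have hmem : ∀ χ w, w ∈ W χ ↔ ∀ a, T a w = χ a • w := fun χ w => by
    simp [hW, hE, Submodule.mem_iInf]
  suffices h : ∀ χ, W χ ≤ LinearMap.eqLocus (T (p ^ (e - 1))) (T 0) by
    have h1 := htop ▸ iSup_le h
    ext w
    exact h1 (Submodule.mem_top (x := w))
  intro χ w hw
  rw [LinearMap.mem_eqLocus]
  have hwχ := (hmem χ w).1 hw
  by_cases hw0 : w = 0
  · simp [hw0]
  rw [hwχ, hwχ]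
  congr 1
  by_contra hne
  have hχper : Function.Periodic χ (p ^ e) := fun a => by
    have := hwχ (a + p ^ e)
    rw [hper, hwχ] at this
    exact (smul_left_injective K hw0 this).symm
  have hshift : ∀ j ≤ p ^ e, (X ^ j) w ∈ W (fun a => χ (a + (p ^ e - j))) := fun j hj => by
    rw [hmem]
    intro a
    have := shift_apply hXT j (a + (p ^ e - j)) w
    rw [show a + (p ^ e - j) + j = a + p ^ e by omega, hper, hwχ] at this
    rw [this, map_smul]
  have hd := hind χ
  refine hw0 (Submodule.disjoint_def.1 hd w hw ?_)
  have hpos : 0 < p ^ e := pow_pos hp.pos e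
  obtain ⟨q, hq⟩ : ∃ q, p ^ e = q + 1 := ⟨p ^ e - 1, by omega⟩
  have hs := LinearMap.congr_fun hsum w
  rw [hq, Finset.sum_range_succ', LinearMap.add_apply] at hs
  have hw' : w = -((∑ j ∈ Finset.range q, X ^ (j + 1)) w) := by
    rw [eq_neg_iff_add_eq_zero, add_comm]
    simpa using hs
  rw [hw']
  refine neg_mem ?_
  rw [LinearMap.sum_apply]
  refine sum_mem fun j hj => ?_
  have hjq := Finset.mem_range.1 hj
  have h1 := hshift (j + 1) (by omega)
  refine Submodule.mem_iSup_of_mem _ (Submodule.mem_iSup_of_mem ?_ h1)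
  intro heq
  refine hne (periodic_prime_pow (d := p ^ e - (j + 1)) hp he (by omega) (by omega) (fun a => ?_)
    hχper)
  exact congrFun heq a

end

end

section

open Subgroup
open scoped commutatorElement

section

variable {K U Γ : Type*} [Field K] [IsAlgClosed K] [AddCommGroup U] [Module K U]
  [FiniteDimensional K U] [Group Γ]

theorem conj_prime_pow_apply_eq {ρ : Γ →* Module.End K U} {p e n : ℕ} (hp : p.Prime)
    (he : 1 ≤ e) (hn : (n : K) ≠ 0) {x u : Γ} (hx : x ^ p ^ e = 1)
    (hsum : ∑ j ∈ Finset.range (p ^ e), ρ x ^ j = 0) (hu : u ^ n = 1)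
    (hcent : ∀ a b c : ℕ, Commute ⁅x ^ a * u * (x ^ a)⁻¹, x ^ b * u * (x ^ b)⁻¹⁆
      (x ^ c * u * (x ^ c)⁻¹)) {w : U}
    (hw : ∀ a b : ℕ, ρ ⁅x ^ a * u * (x ^ a)⁻¹, x ^ b * u * (x ^ b)⁻¹⁆ w = w) :
    ρ (x ^ p ^ (e - 1) * u * (x ^ p ^ (e - 1))⁻¹) w = ρ u w := by
  set v : ℕ → Γ := fun a => x ^ a * u * (x ^ a)⁻¹ with hv
  have hper : ∀ a, v (a + p ^ e) = v a := fun a => by simp [hv, pow_add, hx]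
  have hstep : ∀ a, x * v a * x⁻¹ = v (a + 1) := fun a => by
    simp only [hv, pow_succ']
    group
  have hmul : ∀ g h w, ρ g (ρ h w) = ρ (g * h) w := fun g h w => by
    rw [map_mul, Module.End.mul_apply]
  let V : Submodule K U := ⨅ a, ⨅ b, LinearMap.eqLocus (ρ ⁅v a, v b⁆) LinearMap.id
  have hV : ∀ w, w ∈ V ↔ ∀ a b, ρ ⁅v a, v b⁆ w = w := fun w => by
    simp [V, Submodule.mem_iInf, LinearMap.mem_eqLocus]
  have hVv : ∀ c, ∀ w ∈ V, ρ (v c) w ∈ V := fun c w hw => by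
    rw [hV] at hw ⊢
    intro a b
    rw [hmul, (hcent a b c).eq, ← hmul, hw]
  have hVx : ∀ w ∈ V, ρ x w ∈ V := fun w hw => by
    rw [hV] at hw ⊢
    intro a b
    have hpos : 0 < p ^ e := pow_pos hp.pos e
    have h1 : ∀ a, v a = x * v (a + (p ^ e - 1)) * x⁻¹ := fun a => by
      rw [hstep, show a + (p ^ e - 1) + 1 = a + p ^ e by omega, hper]
    rw [h1 a, h1 b, ← conjugate_commutatorElement, hmul]
    simp only [inv_mul_cancel_right]
    rw [← hmul, hw]
  let X : Module.End K V := (ρ x).restrict hVx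
  let T : ℕ → Module.End K V := fun a => (ρ (v a)).restrict (hVv a)
  have hXpow : ∀ j, ∀ w : V, ((X ^ j) w : U) = (ρ x ^ j) (w : U) := fun j => by
    induction j with
    | zero => simp
    | succ j ih =>
      intro w
      rw [pow_succ', pow_succ', Module.End.mul_apply, Module.End.mul_apply, ← ih]
      rfl
  have hTpow : ∀ a j, ∀ w : V, ((T a ^ j) w : U) = (ρ (v a) ^ j) (w : U) := fun a j => by
    induction j with
    | zero => simp
    | succ j ih =>
      intro w
      rw [pow_succ', pow_succ', Module.End.mul_apply, Module.End.mul_apply, ← ih]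
      rfl
  have key := endomorphism_shift_eq (X := X) (T := T) (n := n) hp he hn ?_ ?_ ?_ ?_ ?_
  · have h1 := congrArg Subtype.val (LinearMap.congr_fun key ⟨w, (hV w).2 hw⟩)
    have h2 : ρ (v (p ^ (e - 1))) w = ρ (v 0) w := h1
    simpa [hv] using h2
  · ext w
    have h := LinearMap.congr_fun hsum (w : U)
    rw [LinearMap.sum_apply] at h ⊢
    simpa [hXpow] using h
  · intro a
    ext w
    change ρ x (ρ (v a) w) = ρ (v (a + 1)) (ρ x w)
    rw [hmul, hmul, ← hstep]
    simp
  · intro a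
    simp only [T, hper]
  · intro a b
    ext w
    change ρ (v a) (ρ (v b) w) = ρ (v b) (ρ (v a) w)
    have h1 := (hV _).1 (hVv b _ (hVv a _ w.2)) a b
    rw [hmul (v b), hmul] at h1
    rw [hmul, hmul, ← h1]
    congr 2
    simp [commutatorElement_def, mul_assoc]
  · intro a
    ext w
    rw [hTpow, ← map_pow]
    have : v a ^ n = 1 := by simp [hv, conj_pow, hu]
    simp [this]

omit [FiniteDimensional K U] [IsAlgClosed K] in
/-- A nonzero common eigenvector of a subgroup of exponent `n` determines a character with values
in the `n`-th roots of unity. -/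
theorem exists_character {ρ : Γ →* Module.End K U} {D : Subgroup Γ} {n : ℕ} [NeZero n]
    (hD : ∀ d ∈ D, d ^ n = 1) {χ : D → K} {v : U} (hv0 : v ≠ 0)
    (hv : ∀ d : D, ρ d v = χ d • v) :
    ∃ φ : D →* rootsOfUnity n K, ∀ d, ((φ d : Kˣ) : K) = χ d := by
  have hinj := smul_left_injective K hv0
  let f : D →* K :=
    { toFun := χ
      map_one' := hinj (by simp [← hv])
      map_mul' := fun a b => hinj (by
        simp only [← hv, Subgroup.coe_mul, map_mul, Module.End.mul_apply, mul_smul]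
        rw [hv b, map_smul, hv a, ← mul_smul, ← mul_smul, mul_comm]) }
  have hf : ∀ d, f.toHomUnits d ∈ rootsOfUnity n K := fun d => by
    rw [mem_rootsOfUnity, ← map_pow]
    have : d ^ n = 1 := Subtype.ext (by simpa using hD d d.2)
    rw [this, map_one]
  exact ⟨f.toHomUnits.codRestrict _ hf, fun d => rfl⟩

theorem iSup_eigenspaces_eq_top {ρ : Γ →* Module.End K U} {D : Subgroup Γ} {n : ℕ}
    (hn : (n : K) ≠ 0) (hD : ∀ d ∈ D, d ^ n = 1) (hab : ∀ a ∈ D, ∀ b ∈ D, a * b = b * a)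
    (P : Submodule K U) (hP : ∀ χ : D → K, ∀ v, (∀ d : D, ρ d v = χ d • v) → v ∈ P) : P = ⊤ := by
  have hcomm : ∀ a b : D, Commute (ρ (a : Γ)) (ρ (b : Γ)) := fun a b => by
    rw [commute_iff_eq, ← map_mul, ← map_mul, hab a a.2 b b.2]
  have htop := Module.End.iSup_iInf_maxGenEigenspace_eq_top_of_forall_mapsTo
    (fun d : D => ρ (d : Γ)) (fun i j φ => Module.End.mapsTo_maxGenEigenspace_of_comm (hcomm j i) φ)
    (fun i => Module.End.iSup_maxGenEigenspace_eq_top _)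
  rw [eq_top_iff, ← htop]
  refine iSup_le fun χ v hv => hP χ v fun d => ?_
  have h1 := (Submodule.mem_iInf _).1 hv d
  rw [maxGenEigenspace_eq_of_pow_eq_one hn (by rw [← map_pow, hD d d.2, map_one])] at h1
  simpa using h1

end

/-- Multiplicative version of `cres_smul_eq`. -/
theorem cres_smul_mul_inv_mem {H E : Type*} [Group H] [Finite H] [Group.IsSolvable H] [Group E]
    [Finite E] (α : H →* MulAut E) (R : Subgroup E) (hR : commutator E ≤ R)
    (hinv : ∀ h, ∀ u ∈ R, α h u ∈ R) {D : Set H} {b : ℕ} (hD : closure D = ⊤)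
    (hb : ∀ y ∈ D, ∀ C : Subgroup E, (∀ u, u ∈ C ↔ α y u * u⁻¹ ∈ R) → C.index ≤ b) {g : H}
    (hg : g ∈ cres^[(b ^ 6).factorial + 1] (⊤ : Subgroup H)) (u : E) : α g u * u⁻¹ ∈ R := by
  have hRn : R.Normal := ⟨fun u hu g => by
    have : g * u * g⁻¹ = ⁅g, u⁆ * u := by simp [commutatorElement_def]
    rw [this]
    exact R.mul_mem (hR (commutator_mem_commutator (mem_top _) (mem_top _))) hu⟩
  let _ : CommGroup (E ⧸ R) :=
    { (inferInstance : Group (E ⧸ R)) with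
      mul_comm := fun a b => by
        induction a using QuotientGroup.induction_on with | _ a
        induction b using QuotientGroup.induction_on with | _ b
        rw [← QuotientGroup.mk_mul, ← QuotientGroup.mk_mul, QuotientGroup.eq]
        refine hR ?_
        have : (a * b)⁻¹ * (b * a) = ⁅b⁻¹, a⁻¹⁆ := by simp [commutatorElement_def, mul_assoc]
        rw [this]
        exact commutator_mem_commutator (mem_top _) (mem_top _) }
  let act : H → (E ⧸ R) →* (E ⧸ R) := fun h =>
    QuotientGroup.map R R (α h).toMonoidHom (fun u hu => hinv h u hu)
  have hact : ∀ (h : H) (u : E), act h (u : E ⧸ R) = ((α h u : E) : E ⧸ R) := fun h u => rfl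
  let _ : DistribMulAction H (Additive (E ⧸ R)) :=
    { smul := fun h x => Additive.ofMul (act h x.toMul)
      one_smul := fun x => by
        change Additive.ofMul (act 1 x.toMul) = x
        induction x using Additive.rec with | _ x
        induction x using QuotientGroup.induction_on with | _ u
        rw [toMul_ofMul, hact, map_one]; rfl
      mul_smul := fun g h x => by
        change Additive.ofMul (act (g * h) x.toMul) = Additive.ofMul (act g (act h x.toMul))
        induction x using Additive.rec with | _ x
        induction x using QuotientGroup.induction_on with | _ u
        rw [toMul_ofMul, hact, hact, hact, map_mul]; rfl
      smul_add := fun h x y => congrArg Additive.ofMul (map_mul (act h) x.toMul y.toMul)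
      smul_zero := fun h => congrArg Additive.ofMul (map_one (act h)) }
  have hsm : ∀ (h : H) (u : E), h • Additive.ofMul (u : E ⧸ R) =
      Additive.ofMul ((α h u : E) : E ⧸ R) := fun h u => rfl
  have key := cres_smul_eq (M := Additive (E ⧸ R)) (b := b) hD ?_ hg (Additive.ofMul (u : E ⧸ R))
  · rw [hsm] at key
    have := QuotientGroup.eq.1 (Additive.ofMul.injective key).symm
    have h2 := hRn.conj_mem _ this u
    simpa using h2
  · intro y hy
    have h1 := hb y hy
      ((AddSubgroup.toSubgroup' (moveHom (Additive (E ⧸ R)) y).ker).comap (QuotientGroup.mk' R)) ?_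
    · rw [Subgroup.index_comap_of_surjective _ (QuotientGroup.mk'_surjective R)] at h1
      have h2 := AddSubgroup.index_ker (moveHom (Additive (E ⧸ R)) y)
      rw [← h2]
      exact h1
    · intro u
      have : u ∈ (AddSubgroup.toSubgroup' (moveHom (Additive (E ⧸ R)) y).ker).comap (QuotientGroup.mk' R) ↔
        y • Additive.ofMul (u : E ⧸ R) - Additive.ofMul (u : E ⧸ R) = 0 := Iff.rfl
      rw [this, hsm, ← ofMul_div, ofMul_eq_zero, div_eq_mul_inv, ← QuotientGroup.mk_inv,
        ← QuotientGroup.mk_mul, QuotientGroup.eq_one_iff]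

section

variable {Γ : Type*} [Group Γ] [Finite Γ]

/-- In a finite soluble group, choose a maximal abelian normal subgroup `D` and then a maximal
normal subgroup `E` of class at most two centralising `D`; then `E` contains its centraliser. -/
theorem exists_critical [Group.IsSolvable Γ] : ∃ D E : Subgroup Γ, D.Normal ∧ E.Normal ∧ D ≤ E ∧
    E ≤ centralizer D ∧ ⁅E, E⁆ ≤ D ∧ centralizer (E : Set Γ) ≤ D := by
  obtain ⟨D, hDmax⟩ := Set.Finite.exists_maximal
    (s := {D : Subgroup Γ | D.Normal ∧ D ≤ centralizer (D : Set Γ)}) (Set.toFinite _)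
    ⟨⊥, inferInstance, bot_le⟩
  obtain ⟨hDn, hDc⟩ := hDmax.1
  obtain ⟨E, hEmax⟩ := Set.Finite.exists_maximal
    (s := {E : Subgroup Γ | E.Normal ∧ D ≤ E ∧ E ≤ centralizer (D : Set Γ) ∧ ⁅E, E⁆ ≤ D})
    (Set.toFinite _) ⟨D, hDn, le_rfl, hDc, commutator_le_right D D⟩
  obtain ⟨hEn, hDE, hEc, hEE⟩ := hEmax.1
  refine ⟨D, E, hDn, hEn, hDE, hEc, hEE, ?_⟩
  have hZ : E ⊓ centralizer (E : Set Γ) ≤ D := by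
    have hCn : (centralizer (E : Set Γ)).Normal := inferInstance
    refine hDmax.2 ⟨inferInstance, ?_⟩ ?_
    · intro a ha
      refine mem_centralizer_iff.2 fun b hb => ?_
      exact mem_centralizer_iff.1 ha.2 b hb.1
    · refine le_inf hDE fun d hd => mem_centralizer_iff.2 fun u hu => ?_
      exact (mem_centralizer_iff.1 (hEc hu) d hd).symm
  by_contra hcon
  obtain ⟨M, hMmin⟩ := Set.Finite.exists_minimal
    (s := {M : Subgroup Γ | M.Normal ∧ M ≤ centralizer (E : Set Γ) ∧ ¬ M ≤ D}) (Set.toFinite _)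
    ⟨centralizer (E : Set Γ), inferInstance, le_rfl, hcon⟩
  obtain ⟨hMn, hMc, hMD⟩ := hMmin.1
  have hM0 : M ≠ ⊥ := fun h => hMD (h ▸ bot_le)
  have hlt := Group.IsSolvable.commutator_lt_of_ne_bot hM0
  have hMM : ⁅M, M⁆ ≤ D := by
    by_contra h
    exact hlt.not_ge (hMmin.2 ⟨inferInstance, hlt.le.trans hMc, h⟩ hlt.le)
  have hEM : E ⊔ M ≤ E := by
    refine hEmax.2 ⟨inferInstance, hDE.trans le_sup_left, sup_le hEc (hMc.trans ?_), ?_⟩ le_sup_left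
    · exact centralizer_le hDE
    · have hME : ⁅M, E⁆ ≤ D := (commutator_eq_bot_iff_le_centralizer.2 hMc).le.trans bot_le
      have hEM : ⁅E, M⁆ ≤ D := by rwa [commutator_comm]
      rw [commutator_le]
      intro a ha b hb
      have key : E ⊔ M ≤ (centralizer ((E ⊔ M).map (QuotientGroup.mk' D) : Set (Γ ⧸ D))).comap
          (QuotientGroup.mk' D) := by
        have aux : ∀ A B : Subgroup Γ, ⁅A, B⁆ ≤ D →
            A.map (QuotientGroup.mk' D) ≤ centralizer (B.map (QuotientGroup.mk' D) : Set (Γ ⧸ D)) :=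
          fun A B h => by
            rw [← commutator_eq_bot_iff_le_centralizer, ← map_commutator, Subgroup.map_eq_bot_iff,
              QuotientGroup.ker_mk']
            exact h
        rw [← map_le_iff_le_comap, Subgroup.map_sup]
        refine sup_le ?_ ?_ <;>
        · rw [le_centralizer_iff]
          refine sup_le ?_ ?_ <;> exact aux _ _ (by assumption)
      have h1 := mem_centralizer_iff.1 (key ha) _ (mem_map_of_mem (QuotientGroup.mk' D) hb)
      rw [← QuotientGroup.ker_mk' D, MonoidHom.mem_ker, map_commutatorElement,
        commutatorElement_eq_one_iff_mul_comm]
      exact h1.symm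
  exact hMD ((le_inf (le_sup_right.trans hEM) hMc).trans hZ)

omit [Finite Γ] in
/-- If `⁅E, E⁆` is central, elements of prime power order outside a central subgroup without such
elements do not occur. -/
theorem eq_one_of_pEl {p : ℕ} {D E : Subgroup Γ} (hEc : E ≤ centralizer D)
    (hEE : ⁅E, E⁆ ≤ D) (hCE : centralizer (E : Set Γ) ≤ D) (hD : ∀ d ∈ D, PEl p d → d = 1)
    {x : Γ} (hx : x ∈ E) (hpx : PEl p x) : x = 1 := by
  refine hD x (hCE (mem_centralizer_iff.2 fun f hf => ?_)) hpx
  have hz : ⁅x, f⁆ ∈ D := hEE (commutator_mem_commutator hx hf)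
  have hc : Commute ⁅x, f⁆⁻¹ x := (Commute.inv_left (mem_centralizer_iff.1 (hEc hx) _ hz))
  obtain ⟨k, hk⟩ := hpx
  have h1 : f * x * f⁻¹ = ⁅x, f⁆⁻¹ * x := by simp [commutatorElement_def, mul_assoc]
  have h2 : (f * x * f⁻¹) ^ p ^ k = 1 := by rw [conj_pow, hk]; simp
  rw [h1, hc.mul_pow, hk, mul_one] at h2
  have h3 := hD _ (inv_mem hz) ⟨k, h2⟩
  rw [h3, one_mul, mul_inv_eq_iff_eq_mul] at h1
  exact h1

end

section

variable {Γ A : Type*} [Group Γ] [CommGroup A] {D E : Subgroup Γ}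

/-- The alternating form on `E` obtained by composing the commutator map `E × E → D` with a
character of the subgroup `D` centralised by `E`. -/
def commForm (hEc : E ≤ centralizer D) (hEE : ⁅E, E⁆ ≤ D) (φ : D →* A) : E →* E →* A :=
  have hD : ∀ u v : E, ⁅(u : Γ), (v : Γ)⁆ ∈ D := fun u v =>
    hEE (commutator_mem_commutator u.2 v.2)
  have hc : ∀ d ∈ D, ∀ u : E, (u : Γ) * d * (u : Γ)⁻¹ = d := fun d hd u => by
    rw [mul_inv_eq_iff_eq_mul]
    exact (mem_centralizer_iff.1 (hEc u.2) d hd).symm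
  have hφ : ∀ (a b c : Γ) (ha : a ∈ D) (hb : b ∈ D) (hc : c ∈ D), a = b * c →
      φ ⟨a, ha⟩ = φ ⟨b, hb⟩ * φ ⟨c, hc⟩ := fun a b c ha hb hc h => by
    subst h
    exact map_mul φ ⟨b, hb⟩ ⟨c, hc⟩
  MonoidHom.mk' (fun u => MonoidHom.mk' (fun v => φ ⟨⁅(u : Γ), (v : Γ)⁆, hD u v⟩) fun v w => by
      refine hφ _ _ _ _ _ _ ?_
      have : ⁅(u : Γ), ((v * w : E) : Γ)⁆ =
          ⁅(u : Γ), (v : Γ)⁆ * ((v : Γ) * ⁅(u : Γ), (w : Γ)⁆ * (v : Γ)⁻¹) := by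
        simp [commutatorElement_def, mul_assoc]
      rw [this, hc _ (hD u w)]) fun u v => by
    refine MonoidHom.ext fun w => ?_
    rw [MonoidHom.mul_apply, mul_comm]
    refine hφ _ _ _ _ _ _ ?_
    have : ⁅((u * v : E) : Γ), (w : Γ)⁆ =
        ((u : Γ) * ⁅(v : Γ), (w : Γ)⁆ * (u : Γ)⁻¹) * ⁅(u : Γ), (w : Γ)⁆ := by
      simp [commutatorElement_def, mul_assoc]
    rw [this, hc _ (hD v w)]

theorem commForm_apply (hEc : E ≤ centralizer D) (hEE : ⁅E, E⁆ ≤ D) (φ : D →* A) (u v : E)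
    (h : ⁅(u : Γ), (v : Γ)⁆ ∈ D) : commForm hEc hEE φ u v = φ ⟨⁅(u : Γ), (v : Γ)⁆, h⟩ := rfl

end

section

variable {K U Γ : Type*} [Field K] [IsAlgClosed K] [AddCommGroup U] [Module K U]
  [FiniteDimensional K U] [Group Γ] [Finite Γ] {D E : Subgroup Γ}

/-- The bound on the class size of the action on `E` modulo the radical of a character. -/
def radBound (n q : ℕ) : ℕ := n ^ (2 * (q * q) * n ^ (q * q)) * n ^ (q * q)

theorem index_le_radBound {ρ : Γ →* Module.End K U} {p e n : ℕ} [NeZero n] (hp : p.Prime)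
    (he : 1 ≤ e) (hn : (n : K) ≠ 0) [E.Normal] (hEc : E ≤ centralizer D)
    (hEE : ⁅E, E⁆ ≤ D)
    (hEn : ∀ u ∈ E, u ^ n = 1) (φ : D →* rootsOfUnity n K) {v : U} (hv0 : v ≠ 0)
    (hv : ∀ d : D, ρ d v = ((φ d : Kˣ) : K) • v) {x : Γ} (hx : x ^ p ^ e = 1)
    (hsum : ∑ j ∈ Finset.range (p ^ e), ρ x ^ j = 0) (C : Subgroup E)
    (hC : ∀ u, u ∈ C ↔
      MulAut.conjNormal (x ^ p ^ (e - 1)) u * u⁻¹ ∈ (commForm hEc hEE φ).ker) :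
    C.index ≤ radBound n (p ^ e) := by
  have : NeZero (n : K) := ⟨hn⟩
  have hcard : Nat.card (rootsOfUnity n K) = n := HasEnoughRootsOfUnity.natCard_rootsOfUnity K n
  by_contra! hlt
  obtain ⟨u, huC, hu⟩ := exists_isotropic (Λ := Fin (p ^ e) × Fin (p ^ e))
    (fun l => ((commForm hEc hEE φ).compl₂
      (MulAut.conjNormal (x ^ (l.2 : ℕ)) : MulAut E).toMonoidHom).comp
      (MulAut.conjNormal (x ^ (l.1 : ℕ)) : MulAut E).toMonoidHom) C (by
        rw [hcard, Fintype.card_prod, Fintype.card_fin]; exact hlt)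
  refine huC ((hC u).2 ?_)
  have hmul : ∀ g h w, ρ g (ρ h w) = ρ (g * h) w := fun g h w => by
    rw [map_mul, Module.End.mul_apply]
  have hconjE : ∀ a : ℕ, x ^ a * u * (x ^ a)⁻¹ ∈ E := fun a =>
    (inferInstance : E.Normal).conj_mem _ u.2 _
  have hcomD : ∀ a b : ℕ, ⁅x ^ a * u * (x ^ a)⁻¹, x ^ b * u * (x ^ b)⁻¹⁆ ∈ D := fun a b =>
    hEE (commutator_mem_commutator (hconjE a) (hconjE b))
  have hpos : 0 < p ^ e := pow_pos hp.pos e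
  have hmod : ∀ a, x ^ a = x ^ (a % p ^ e) := fun a => by
    conv_lhs => rw [← Nat.mod_add_div a (p ^ e), pow_add, pow_mul, hx, one_pow, mul_one]
  have hφ1 : ∀ a b : ℕ, φ ⟨_, hcomD a b⟩ = 1 := fun a b => by
    have h := hu (⟨a % p ^ e, Nat.mod_lt _ hpos⟩, ⟨b % p ^ e, Nat.mod_lt _ hpos⟩)
    rw [← h]
    simp only [hmod a, hmod b]
    rfl
  have hfix : ∀ w, (∀ d : D, ρ d w = ((φ d : Kˣ) : K) • w) →
      ρ (x ^ p ^ (e - 1) * u * (x ^ p ^ (e - 1))⁻¹) w = ρ u w := fun w hw =>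
    conj_prime_pow_apply_eq hp he hn hx hsum (hEn u u.2)
      (fun a b c => mem_centralizer_iff.1 (hEc (hconjE c)) _ (hcomD a b)) fun a b => by
        have := hw ⟨_, hcomD a b⟩
        rw [hφ1] at this
        simpa using this
  have hinv : ∀ g ∈ E, ∀ w, (∀ d : D, ρ d w = ((φ d : Kˣ) : K) • w) →
      ∀ d : D, ρ d (ρ g w) = ((φ d : Kˣ) : K) • ρ g w := fun g hg w hw d => by
    rw [hmul, mem_centralizer_iff.1 (hEc hg) d d.2, ← hmul, hw, map_smul]
  set t : E := MulAut.conjNormal (x ^ p ^ (e - 1)) u * u⁻¹ with ht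
  have htfix : ∀ w, (∀ d : D, ρ d w = ((φ d : Kˣ) : K) • w) → ρ (t : Γ) w = w := fun w hw => by
    have h1 : (t : Γ) = (x ^ p ^ (e - 1) * u * (x ^ p ^ (e - 1))⁻¹) * (u : Γ)⁻¹ := rfl
    rw [h1, ← hmul, hfix _ (hinv _ (inv_mem u.2) w hw), hmul]
    simp
  rw [MonoidHom.mem_ker]
  refine MonoidHom.ext fun f => ?_
  have hD : ⁅(t : Γ), (f : Γ)⁆ ∈ D := hEE (commutator_mem_commutator t.2 f.2)
  rw [commForm_apply _ _ _ _ _ hD, MonoidHom.one_apply]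
  have h1 : ρ ⁅(t : Γ), (f : Γ)⁆ v = v := by
    have h2 : ρ (t : Γ)⁻¹ (ρ (f : Γ)⁻¹ v) = ρ (f : Γ)⁻¹ v := by
      conv_lhs => rw [← htfix _ (hinv _ (inv_mem f.2) v hv)]
      rw [hmul, inv_mul_cancel]; simp
    rw [commutatorElement_def, ← hmul, ← hmul, h2, ← hmul, hmul f, mul_inv_cancel, map_one,
      Module.End.one_apply, htfix v hv]
  have h3 := hv ⟨_, hD⟩
  have h4 : ((1 : K)) • v = ((φ ⟨_, hD⟩ : Kˣ) : K) • v := by rw [← h3, one_smul]; exact h1.symm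
  have h5 := smul_left_injective K hv0 h4
  exact Subtype.ext (Units.ext h5.symm)

end

section

variable {K U Γ : Type*} [Field K] [IsAlgClosed K] [AddCommGroup U] [Module K U]
  [FiniteDimensional K U] [Group Γ] [Finite Γ] [Group.IsSolvable Γ]

theorem cres_closure_pow_eq_bot {ρ : Γ →* Module.End K U} (hρ : Function.Injective ρ) {p e n : ℕ}
    [NeZero n] (hp : p.Prime) (he : 1 ≤ e) (hn : (n : K) ≠ 0) (hexp : ∀ g : Γ, g ^ (n * p ^ e) = 1)
    (hO : ∀ P : Subgroup Γ, P.Normal → (∀ x ∈ P, PEl p x) → P = ⊥)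
    (hx : ∀ x : Γ, PEl p x → x ^ p ^ e = 1 ∧ ∑ j ∈ Finset.range (p ^ e), ρ x ^ j = 0) :
    cres^[2 + ((radBound n (p ^ e) ^ 6).factorial + 1)]
      (closure {y : Γ | ∃ x, PEl p x ∧ x ^ p ^ (e - 1) = y}) = ⊥ := by
  obtain ⟨D, E, hDn, hEn, hDE, hEc, hEE, hCE⟩ := exists_critical (Γ := Γ)
  set S : Set Γ := {y : Γ | ∃ x, PEl p x ∧ x ^ p ^ (e - 1) = y} with hS
  set Y := closure S with hY
  have hDc : ∀ a ∈ D, ∀ b ∈ D, a * b = b * a := fun a ha b hb =>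
    (mem_centralizer_iff.1 (hEc (hDE ha)) b hb).symm
  have hDp : ∀ d ∈ D, PEl p d → d = 1 := by
    let P : Subgroup Γ :=
      { carrier := {d | d ∈ D ∧ PEl p d}
        one_mem' := ⟨D.one_mem, 0, one_pow _⟩
        mul_mem' := by
          rintro a b ⟨ha, i, hi⟩ ⟨hb, j, hj⟩
          refine ⟨D.mul_mem ha hb, i + j, ?_⟩
          rw [(show Commute a b from hDc a ha b hb).mul_pow, pow_add, pow_mul, hi, mul_comm,
            pow_mul, hj]
          simp
        inv_mem' := fun {a} h => ⟨D.inv_mem h.1, h.2.inv⟩ }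
    have hPn : P.Normal := ⟨fun x hx g => ⟨hDn.conj_mem _ hx.1 _, hx.2.conj g⟩⟩
    have hP := hO P hPn fun x hx => hx.2
    intro d hd hpd
    have : d ∈ P := ⟨hd, hpd⟩
    rwa [hP, mem_bot] at this
  have hEp : ∀ u ∈ E, PEl p u → u = 1 := fun u hu hpu =>
    eq_one_of_pEl hEc hEE hCE hDp hu hpu
  have hEpow : ∀ u ∈ E, u ^ n = 1 := fun u hu =>
    hEp _ (pow_mem hu n) ⟨e, by rw [← pow_mul, hexp]⟩
  have hDpow : ∀ d ∈ D, d ^ n = 1 := fun d hd => hEpow d (hDE hd)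
  have hYD : Y ≤ centralizer (D : Set Γ) := by
    rw [hY, closure_le]
    rintro _ ⟨x, hpx, rfl⟩
    refine mem_centralizer_iff.2 fun d hd => ?_
    obtain ⟨h1, h2⟩ := hx x hpx
    have hconj : ∀ a : ℕ, x ^ a * d * (x ^ a)⁻¹ ∈ D := fun a => hDn.conj_mem _ hd _
    have hcom : ∀ a b : ℕ, ⁅x ^ a * d * (x ^ a)⁻¹, x ^ b * d * (x ^ b)⁻¹⁆ = 1 := fun a b =>
      commutatorElement_eq_one_iff_mul_comm.2 (hDc _ (hconj a) _ (hconj b))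
    have h3 : ρ (x ^ p ^ (e - 1) * d * (x ^ p ^ (e - 1))⁻¹) = ρ d := LinearMap.ext fun w =>
      conj_prime_pow_apply_eq hp he hn h1 h2 (hDpow d hd)
        (fun a b c => by rw [hcom]; exact Commute.one_left _) fun a b => by rw [hcom]; simp
    exact (mul_inv_eq_iff_eq_mul.1 (hρ h3)).symm
  set k := (radBound n (p ^ e) ^ 6).factorial + 1 with hk
  set W := cres^[k] Y with hW
  have hWY : W ≤ Y := cres_iterate_le k Y
  have hrad : ∀ g ∈ W, ∀ u ∈ E, ∀ f ∈ E, ∀ (χ : D → K) (v : U), (∀ d : D, ρ d v = χ d • v) →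
      ρ ⁅g * u * g⁻¹ * u⁻¹, f⁆ v = v := by
    intro g hg u hu f hf χ v hv
    by_cases hv0 : v = 0
    · simp [hv0]
    obtain ⟨φ, hφ⟩ := exists_character hDpow hv0 hv
    have hvφ : ∀ d : D, ρ d v = ((φ d : Kˣ) : K) • v := fun d => by rw [hφ, hv]
    set R := (commForm hEc hEE φ).ker with hR
    have hRmem : ∀ t : E, t ∈ R → ∀ f ∈ E, ρ ⁅(t : Γ), f⁆ v = v := by
      intro t ht f hf
      have h1 := DFunLike.congr_fun (MonoidHom.mem_ker.1 ht) (⟨f, hf⟩ : E)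
      rw [commForm_apply _ _ _ _ _ (hEE (commutator_mem_commutator t.2 hf))] at h1
      have h2 := hvφ ⟨_, hEE (commutator_mem_commutator t.2 hf)⟩
      rw [h1] at h2
      simpa using h2
    rw [hW, ← map_subtype_cres_iterate] at hg
    obtain ⟨g, hg, rfl⟩ := hg
    refine hRmem (MulAut.conjNormal (g : Γ) ⟨u, hu⟩ * (⟨u, hu⟩ : E)⁻¹) ?_ f hf
    have := cres_smul_mul_inv_mem (H := Y) (b := radBound n (p ^ e))
      (MulAut.conjNormal.comp Y.subtype) R (Abelianization.commutator_subset_ker _) ?_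
      (closure_closure_coe_preimage (k := S)) ?_ hg ⟨u, hu⟩
    · exact this
    · intro y t ht
      rw [hR, MonoidHom.mem_ker] at ht ⊢
      refine MonoidHom.ext fun f => ?_
      have h1 := DFunLike.congr_fun ht (MulAut.conjNormal (y : Γ)⁻¹ f)
      rw [MonoidHom.one_apply] at h1 ⊢
      rw [← h1]
      refine congrArg φ (Subtype.ext ?_)
      change ⁅(y : Γ) * t * (y : Γ)⁻¹, (f : Γ)⁆ = ⁅(t : Γ), (y : Γ)⁻¹ * f * (y : Γ)⁻¹⁻¹⁆
      have hz : ⁅(t : Γ), (y : Γ)⁻¹ * f * (y : Γ)⁻¹⁻¹⁆ ∈ D :=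
        hEE (commutator_mem_commutator t.2 (hEn.conj_mem _ f.2 _))
      have h2 := mem_centralizer_iff.1 (hYD y.2) _ hz
      refine Eq.trans ?_ (eq_mul_inv_iff_mul_eq.2 h2).symm
      simp [commutatorElement_def, mul_assoc]
    · rintro y ⟨x, hpx, hxy⟩ C hC
      obtain ⟨h1, h2⟩ := hx x hpx
      refine index_le_radBound hp he hn hEc hEE hEpow φ hv0 hvφ h1 h2 C fun u => ?_
      rw [hC u, hxy]
      rfl
  have hEW : ⁅E, W⁆ ≤ D := by
    rw [commutator_comm, commutator_le]
    intro g hg u hu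
    refine hCE (mem_centralizer_iff.2 fun f hf => ?_)
    have h1 : (⊤ : Submodule K U) = LinearMap.eqLocus (ρ ⁅g * u * g⁻¹ * u⁻¹, f⁆) LinearMap.id :=
      (iSup_eigenspaces_eq_top hn hDpow hDc _ fun χ v hv => hrad g hg u hu f hf χ v hv).symm
    have h2 : ρ ⁅g * u * g⁻¹ * u⁻¹, f⁆ = ρ 1 := by
      rw [map_one]
      ext w
      exact h1.le (Submodule.mem_top (x := w))
    exact (commutatorElement_eq_one_iff_mul_comm.1 (hρ h2)).symm
  refine cres_iterate_add_eq_bot (K := W) le_rfl ?_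
  have hWW : ⁅W, W⁆ ≤ D := by
    refine le_trans ?_ hCE
    rw [← commutator_eq_bot_iff_le_centralizer]
    have h1 : ⁅⁅W, E⁆, W⁆ = ⊥ := by
      rw [eq_bot_iff, commutator_comm W E]
      refine (commutator_mono hEW hWY).trans ?_
      rw [commutator_comm]
      exact (commutator_eq_bot_iff_le_centralizer.2 hYD).le
    have h2 : ⁅⁅E, W⁆, W⁆ = ⊥ := by rwa [commutator_comm E W]
    exact commutator_commutator_eq_bot_of_rotate h1 h2
  change cres (cres W) = ⊥
  exact cres_eq_bot_of_comm fun a ha b hb =>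
    hDc a (hWW (cres_le_commutator W ha)) b (hWW (cres_le_commutator W hb))

end

/-- If, in all finite soluble groups of exponent dividing `m`, the `k`-th iterate of `cres`
centralises every minimal normal subgroup, then the next iterate is trivial. -/
theorem cres_iterate_eq_bot_of_centralizes.{u} {m k : ℕ}
    (h : ∀ (G : Type u) [Group G] [Finite G] [Group.IsSolvable G], (∀ g : G, g ^ m = 1) →
      ∀ N : Subgroup G, N.Normal → N ≠ ⊥ → (∀ M : Subgroup G, M.Normal → M ≤ N → M ≠ ⊥ → M = N) →
      cres^[k] (⊤ : Subgroup G) ≤ centralizer (N : Set G)) :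
    ∀ (G : Type u) [Group G] [Finite G] [Group.IsSolvable G], (∀ g : G, g ^ m = 1) →
      cres^[k + 1] (⊤ : Subgroup G) = ⊥ := by
  intro G _ _ _ hG
  induction hc : Nat.card G using Nat.strong_induction_on generalizing G with
  | _ c ih =>
  by_contra hne
  have hn : (cres^[k + 1] (⊤ : Subgroup G)).Normal := cres_iterate_normal (k + 1)
  obtain ⟨N, hNmin⟩ := Set.Finite.exists_minimal
    (s := {N : Subgroup G | N.Normal ∧ N ≤ cres^[k + 1] (⊤ : Subgroup G) ∧ N ≠ ⊥})
    (Set.toFinite _) ⟨_, hn, le_rfl, hne⟩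
  obtain ⟨hNn, hNle, hN0⟩ := hNmin.1
  have hcen := h G hG N hNn hN0 fun M hMn hMN hM0 =>
    le_antisymm hMN (hNmin.2 ⟨hMn, hMN.trans hNle, hM0⟩ hMN)
  have hlt : Nat.card (G ⧸ N) < c := by
    rw [← hc, card_eq_card_quotient_mul_card_subgroup N]
    have h1 : 1 < Nat.card N := by rwa [one_lt_card_iff_ne_bot]
    have h2 : 0 < Nat.card (G ⧸ N) := Nat.card_pos
    nlinarith
  have hsol : Group.IsSolvable (G ⧸ N) :=
    Group.isSolvable_of_surjective (QuotientGroup.mk'_surjective N)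
  have hq := ih _ hlt (G ⧸ N) (fun g => by
    obtain ⟨g, rfl⟩ := QuotientGroup.mk'_surjective N g
    rw [← map_pow, hG, map_one]) rfl
  rw [← map_cres_iterate_top (QuotientGroup.mk'_surjective N), Subgroup.map_eq_bot_iff,
    QuotientGroup.ker_mk', Function.iterate_succ_apply'] at hq
  refine hne ?_
  rw [Function.iterate_succ_apply']
  exact cres_eq_bot_of_central hq fun x hx n hn => (mem_centralizer_iff.1 (hcen hx) n hn).symm

section

variable {G : Type*} [Group G] [Finite G]

/-- A minimal normal subgroup of a finite soluble group is an elementary abelian `p`-group. -/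
theorem exists_elementary_of_minimal [Group.IsSolvable G] {N : Subgroup G} [N.Normal] (hN0 : N ≠ ⊥)
    (hmin : ∀ M : Subgroup G, M.Normal → M ≤ N → M ≠ ⊥ → M = N) :
    (∀ a ∈ N, ∀ b ∈ N, a * b = b * a) ∧ ∃ p : ℕ, p.Prime ∧ ∀ a ∈ N, a ^ p = 1 := by
  have hab : ∀ a ∈ N, ∀ b ∈ N, a * b = b * a := by
    have hlt := Group.IsSolvable.commutator_lt_of_ne_bot hN0
    have h0 : ⁅N, N⁆ = ⊥ := by
      by_contra h
      exact hlt.ne (hmin _ inferInstance hlt.le h)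
    intro a ha b hb
    rw [← commutatorElement_eq_one_iff_mul_comm, ← mem_bot, ← h0]
    exact commutator_mem_commutator ha hb
  refine ⟨hab, ?_⟩
  have h1 : Nat.card N ≠ 1 := by rwa [Ne, card_eq_one]
  obtain ⟨p, hp, hpd⟩ := Nat.exists_prime_and_dvd h1
  have : Fact p.Prime := ⟨hp⟩
  obtain ⟨a, ha⟩ := exists_prime_orderOf_dvd_card' p hpd
  let M : Subgroup G :=
    { carrier := {a | a ∈ N ∧ a ^ p = 1}
      one_mem' := ⟨N.one_mem, one_pow _⟩
      mul_mem' := by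
        rintro a b ⟨ha, hap⟩ ⟨hb, hbp⟩
        refine ⟨N.mul_mem ha hb, ?_⟩
        rw [(show Commute a b from hab a ha b hb).mul_pow, hap, hbp, one_mul]
      inv_mem' := fun {a} h => ⟨N.inv_mem h.1, by rw [inv_pow, h.2, inv_one]⟩ }
  have hM : M.Normal := ⟨fun x hx g =>
    ⟨(inferInstance : N.Normal).conj_mem _ hx.1 _, by rw [conj_pow, hx.2]; simp⟩⟩
  have haM : (a : G) ∈ M := ⟨a.2, by
    rw [← ha, ← orderOf_coe]; exact pow_orderOf_eq_one _⟩
  have hMN := hmin M hM (fun x hx => hx.1) fun h0 => by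
    rw [h0, mem_bot] at haM
    have : a = 1 := Subtype.ext haM
    rw [this, orderOf_one] at ha
    exact hp.one_lt.ne ha
  refine ⟨p, hp, fun x hx => ?_⟩
  rw [← hMN] at hx
  exact hx.2

omit [Finite G] in
theorem mul_pow_eq_prod (a g : G) (q : ℕ) :
    (a * g) ^ q = ((List.range q).map fun j => g ^ j * a * (g ^ j)⁻¹).prod * g ^ q := by
  induction q with
  | zero => simp
  | succ q ih =>
    rw [pow_succ, ih, List.range_succ, List.map_append, List.prod_append, pow_succ]
    simp [mul_assoc]

omit [Finite G] in
theorem PEl.pow_eq_one {p e n : ℕ} (hp : p.Prime) (hpn : ¬ p ∣ n) {g : G} (h : PEl p g)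
    (hg : g ^ (n * p ^ e) = 1) : g ^ p ^ e = 1 := by
  obtain ⟨k, hk⟩ := h
  have h1 := Nat.dvd_gcd (orderOf_dvd_of_pow_eq_one hk) (orderOf_dvd_of_pow_eq_one hg)
  refine orderOf_dvd_iff_pow_eq_one.1 ?_
  have h2 : Nat.Coprime (orderOf g) n :=
    Nat.Coprime.coprime_dvd_left (orderOf_dvd_of_pow_eq_one hk)
      (Nat.Coprime.pow_left k ((Nat.Prime.coprime_iff_not_dvd hp).2 hpn))
  exact h2.dvd_of_dvd_mul_left (orderOf_dvd_of_pow_eq_one hg)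

omit [Finite G] in
theorem PEl.mul_of_normal {p : ℕ} {N : Subgroup G} [N.Normal] (hN : ∀ a ∈ N, a ^ p = 1) {a g : G}
    (ha : a ∈ N) (hg : PEl p g) : PEl p (a * g) := by
  obtain ⟨k, hk⟩ := hg
  refine ⟨k + 1, ?_⟩
  rw [pow_succ, pow_mul]
  refine hN _ ?_
  rw [mul_pow_eq_prod, hk, mul_one]
  refine list_prod_mem fun x hx => ?_
  obtain ⟨j, -, rfl⟩ := List.mem_map.1 hx
  exact (inferInstance : N.Normal).conj_mem _ ha _

end

section

variable {N K : Type*} [CommGroup N] [Field K]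

/-- The contragredient representation of `MulAut N` on the `K`-valued additive characters of `N`. -/
def dualRep (N K : Type*) [CommGroup N] [Field K] :
    MulAut N →* Module.End K (Additive N →+ K) where
  toFun σ :=
    { toFun := fun f => f.comp (MonoidHom.toAdditive (σ⁻¹ : MulAut N).toMonoidHom)
      map_add' := fun f g => rfl
      map_smul' := fun c f => rfl }
  map_one' := rfl
  map_mul' σ τ := by
    ext f a
    change f (Additive.ofMul ((σ * τ)⁻¹ a)) = f (Additive.ofMul (τ⁻¹ (σ⁻¹ a)))
    rw [mul_inv_rev]
    rfl

theorem dualRep_apply (σ : MulAut N) (f : Additive N →+ K) (a : N) :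
    dualRep N K σ f (Additive.ofMul a) = f (Additive.ofMul (σ⁻¹ a)) := rfl

theorem finiteDimensional_addMonoidHom [Finite N] : FiniteDimensional K (Additive N →+ K) :=
  FiniteDimensional.of_injective
    ({ toFun := fun f => f, map_add' := fun _ _ => rfl, map_smul' := fun _ _ => rfl } :
      (Additive N →+ K) →ₗ[K] (Additive N → K)) DFunLike.coe_injective

theorem eq_zero_of_forall_dual_eq_zero {p : ℕ} [Fact p.Prime] {A : Type*} [AddCommGroup A]
    [Module (ZMod p) A] {v : A} (h : ∀ φ : A →ₗ[ZMod p] ZMod p, φ v = 0) : v = 0 :=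
  (Module.forall_dual_apply_eq_zero_iff (ZMod p) v).1 h

theorem dualRep_injective {p : ℕ} [Fact p.Prime] [CharP K p] (hN : ∀ a : N, a ^ p = 1) :
    Function.Injective (dualRep N K) := by
  let _ : Module (ZMod p) (Additive N) := AddCommGroup.zmodModule fun x => hN x.toMul
  let _ : Algebra (ZMod p) K := ZMod.algebra K p
  rw [injective_iff_map_eq_one]
  intro σ hσ
  ext a
  have h1 : Additive.ofMul (σ⁻¹ (σ a)) - Additive.ofMul (σ a) = 0 := by
    refine eq_zero_of_forall_dual_eq_zero (p := p) fun φ => ?_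
    have h := DFunLike.congr_fun (LinearMap.congr_fun hσ
      ((algebraMap (ZMod p) K).toAddMonoidHom.comp φ.toAddMonoidHom)) (Additive.ofMul (σ a))
    rw [dualRep_apply] at h
    rw [LinearMap.map_sub, sub_eq_zero]
    exact (algebraMap (ZMod p) K).injective h
  rw [sub_eq_zero] at h1
  have h2 := Additive.ofMul.injective h1
  rw [MulAut.inv_apply_self] at h2
  exact h2.symm

theorem sum_dualRep_eq_zero {σ : MulAut N} {q : ℕ}
    (h : ∀ a, ((List.range q).map fun j => (σ⁻¹ ^ j) a).prod = 1) :
    ∑ j ∈ Finset.range q, dualRep N K σ ^ j = 0 := by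
  refine LinearMap.ext fun f => AddMonoidHom.ext fun a => ?_
  have h1 : ∀ r, (∑ j ∈ Finset.range r, dualRep N K σ ^ j) f a =
      f (Additive.ofMul ((List.range r).map fun j => (σ⁻¹ ^ j) a.toMul).prod) := fun r => by
    induction r with
    | zero => simp
    | succ r ih =>
      rw [Finset.sum_range_succ, LinearMap.add_apply, AddMonoidHom.add_apply, ih, List.range_succ,
        List.map_append, List.prod_append, ofMul_mul, map_add, ← map_pow]
      simp only [inv_pow, List.map_cons, List.map_nil, List.prod_cons, List.prod_nil, mul_one]
      rfl
  rw [h1, h]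
  simp

end

section

variable {G : Type*} [Group G]

/-- The automorphisms of a normal subgroup that are induced by conjugation. -/
abbrev conjAut (N : Subgroup G) [N.Normal] : Subgroup (MulAut N) :=
  (MulAut.conjNormal : G →* MulAut N).range

/-- The homomorphism sending a group element to the automorphism it induces on `N`. -/
def toConjAut (N : Subgroup G) [N.Normal] : G →* conjAut N :=
  (MulAut.conjNormal : G →* MulAut N).rangeRestrict

theorem toConjAut_surjective (N : Subgroup G) [N.Normal] : Function.Surjective (toConjAut N) :=
  MonoidHom.rangeRestrict_surjective _

theorem toConjAut_apply (N : Subgroup G) [N.Normal] (g : G) (a : N) :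
    (((toConjAut N g : MulAut N) a : N) : G) = g * a * g⁻¹ :=
  MulAut.conjNormal_apply g a

theorem toConjAut_eq_one (N : Subgroup G) [N.Normal] {g : G} :
    toConjAut N g = 1 ↔ g ∈ centralizer (N : Set G) := by
  rw [mem_centralizer_iff]
  constructor
  · intro h a ha
    have h1 := toConjAut_apply N g ⟨a, ha⟩
    rw [h] at h1
    change a = g * a * g⁻¹ at h1
    rw [eq_mul_inv_iff_mul_eq] at h1
    exact h1
  · intro h
    refine Subtype.ext (MulEquiv.ext fun a => Subtype.ext ?_)
    rw [toConjAut_apply, ← h a a.2]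
    simp

/-- A normal `p`-subgroup acts trivially on a minimal normal `p`-subgroup. -/
theorem eq_bot_of_pEl_of_minimal [Finite G] {N : Subgroup G} [N.Normal] {p : ℕ} (hp : p.Prime)
    (hN0 : N ≠ ⊥) (hmin : ∀ M : Subgroup G, M.Normal → M ≤ N → M ≠ ⊥ → M = N)
    (hN : ∀ a ∈ N, a ^ p = 1) {P : Subgroup (conjAut N)} (hP : P.Normal)
    (hP1 : ∀ x ∈ P, PEl p x) : P = ⊥ := by
  have : Fact p.Prime := ⟨hp⟩
  have hPg : IsPGroup p P := isPGroup_of_forall hP1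
  have hNg : IsPGroup p N := fun a => ⟨1, Subtype.ext (by simpa using hN a a.2)⟩
  let F : Subgroup G :=
    { carrier := {a | a ∈ N ∧ ∀ g : G, toConjAut N g ∈ P → g * a * g⁻¹ = a}
      one_mem' := ⟨N.one_mem, fun g _ => by simp⟩
      mul_mem' := fun {a b} ha hb => ⟨N.mul_mem ha.1 hb.1, fun g hg => by
        rw [← conj_mul, ha.2 g hg, hb.2 g hg]⟩
      inv_mem' := fun {a} ha => ⟨N.inv_mem ha.1, fun g hg => by
        rw [← conj_inv, ha.2 g hg]⟩ }
  have hFn : F.Normal := ⟨fun a ha z => ⟨Normal.conj_mem inferInstance a ha.1 z, fun g hg => by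
    have h := ha.2 (z⁻¹ * g * z) (by
      rw [map_mul, map_mul, map_inv]
      simpa using hP.conj_mem _ hg (toConjAut N z)⁻¹)
    calc g * (z * a * z⁻¹) * g⁻¹
        = z * ((z⁻¹ * g * z) * a * (z⁻¹ * g * z)⁻¹) * z⁻¹ := by group
      _ = z * a * z⁻¹ := by rw [h]⟩⟩
  have hF0 : F ≠ ⊥ := by
    have hcard : p ∣ Nat.card N := by
      obtain ⟨k, hk⟩ := IsPGroup.iff_card.1 hNg
      have h1 : 1 < Nat.card N := (Subgroup.one_lt_card_iff_ne_bot N).2 hN0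
      rw [hk] at h1 ⊢
      exact dvd_pow_self p (by rintro rfl; simp at h1)
    obtain ⟨b, hb, hb1⟩ := hPg.exists_fixed_point_of_prime_dvd_card_of_fixed_point (α := N) hcard
      (a := 1) (fun x => map_one ((x : conjAut N) : MulAut N))
    intro h
    refine hb1 (Subtype.ext ?_)
    have h2 : (b : G) ∈ F := ⟨b.2, fun g hg => by
      have := hb ⟨toConjAut N g, hg⟩
      rw [← toConjAut_apply]
      exact congrArg Subtype.val this⟩
    rw [h] at h2
    exact (mem_bot.1 h2).symm
  have hFN := hmin F hFn (fun a ha => ha.1) hF0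
  rw [eq_bot_iff]
  intro x hx
  obtain ⟨g, rfl⟩ := toConjAut_surjective N x
  rw [mem_bot, toConjAut_eq_one, mem_centralizer_iff]
  intro a ha
  rw [← hFN] at ha
  have := ha.2 g hx
  rw [mul_inv_eq_iff_eq_mul] at this
  exact this.symm

theorem exists_cres_bound_of_exponent (m : ℕ) (hm : 0 < m) :
    ∃ S : ℕ, ∀ (G : Type) [Group G] [Finite G] [Group.IsSolvable G], (∀ g : G, g ^ m = 1) →
      cres^[S] (⊤ : Subgroup G) = ⊥ := by
  induction m using Nat.strong_induction_on with
  | _ m ih =>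
  have hS : ∀ p ∈ m.primeFactors, ∃ S : ℕ, ∀ (G : Type) [Group G] [Finite G]
      [Group.IsSolvable G], (∀ g : G, g ^ (m / p) = 1) → cres^[S] (⊤ : Subgroup G) = ⊥ := by
    intro p hp
    have hpp := Nat.prime_of_mem_primeFactors hp
    have hpm := Nat.dvd_of_mem_primeFactors hp
    exact ih (m / p) (Nat.div_lt_self hm hpp.one_lt)
      (Nat.div_pos (Nat.le_of_dvd hm hpm) hpp.pos)
  choose! S hS using hS
  let b : ℕ → ℕ := fun p => 2 + ((radBound (m / p ^ m.factorization p) (p ^ m.factorization p) ^ 6).factorial + 1)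
  let k := m.primeFactors.sup fun p => S p + b p
  refine ⟨k + 1, cres_iterate_eq_bot_of_centralizes fun G _ _ _ hG N hN hN0 hmin => ?_⟩
  obtain ⟨hab, p, hp, hNp⟩ := exists_elementary_of_minimal hN0 hmin
  have : Fact p.Prime := ⟨hp⟩
  have hpm : p ∣ m := by
    obtain ⟨⟨a, ha⟩, ha0⟩ := Subgroup.ne_bot_iff_exists_ne_one.1 hN0
    have ha1 : a ≠ 1 := fun h => ha0 (Subtype.ext h)
    rw [← orderOf_eq_prime (hNp _ ha) ha1]
    exact orderOf_dvd_of_pow_eq_one (hG _)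
  have hpf : p ∈ m.primeFactors := Nat.mem_primeFactors.2 ⟨hp, hpm, hm.ne'⟩
  set e := m.factorization p with he
  set n := m / p ^ e with hn
  have hmn : m = n * p ^ e := (Nat.div_mul_cancel (Nat.ordProj_dvd m p)).symm
  have hpn : ¬ p ∣ n := Nat.not_dvd_ordCompl hp hm.ne'
  have he1 : 1 ≤ e := hp.factorization_pos_of_dvd hm.ne' hpm
  have : NeZero n := ⟨fun h => hpn (h ▸ dvd_zero p)⟩
  let _ : CommGroup N := { (inferInstance : Group N) with
    mul_comm := fun a b => Subtype.ext (hab a a.2 b b.2) }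
  let K := AlgebraicClosure (ZMod p)
  have : FiniteDimensional K (Additive N →+ K) := finiteDimensional_addMonoidHom
  have hpow : ∀ x : conjAut N, x ^ m = 1 := fun x => by
    obtain ⟨g, rfl⟩ := toConjAut_surjective N x
    rw [← map_pow, hG, map_one]
  have hsol : Group.IsSolvable (conjAut N) :=
    Group.isSolvable_of_surjective (toConjAut_surjective N)
  have hpx : ∀ x : conjAut N, PEl p x → x ^ p ^ e = 1 := fun x hx =>
    hx.pow_eq_one hp hpn (hmn ▸ hpow x)
  have hprod : ∀ x : conjAut N, PEl p x → ∀ a : N,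
      ((List.range (p ^ e)).map fun j => ((x : MulAut N) ^ j) a).prod = 1 := by
    intro x hx a
    obtain ⟨g, rfl⟩ := toConjAut_surjective N x
    obtain ⟨r, hr, hr1⟩ := PEl.exists_lift (f := toConjAut N) hp hx
    rw [← hr1]
    have h1 := hr.pow_eq_one hp hpn (hmn ▸ hG _)
    have h2 := (PEl.mul_of_normal hNp a.2 hr).pow_eq_one hp hpn (hmn ▸ hG _)
    rw [mul_pow_eq_prod, h1, mul_one] at h2
    refine Subtype.ext ?_
    change N.subtype _ = 1
    rw [map_list_prod, List.map_map, ← h2]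
    congr 2
    funext j
    rw [← toConjAut_apply, map_pow (toConjAut N) (g ^ r) j]
    rfl
  have hcore := cres_closure_pow_eq_bot (ρ := (dualRep N K).comp (conjAut N).subtype)
    ((dualRep_injective (p := p) fun a => Subtype.ext (by simpa using hNp a a.2)).comp
      (Subgroup.subtype_injective _)) hp he1 (n := n)
    (fun h => hpn ((CharP.cast_eq_zero_iff K p n).1 h)) (fun x => hmn ▸ hpow x)
    (fun P hP hP1 => eq_bot_of_pEl_of_minimal hp hN0 hmin hNp hP hP1)
    (fun x hx => ⟨hpx x hx, by
      have := sum_dualRep_eq_zero (K := K) (σ := (x : MulAut N)) (q := p ^ e)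
        (hprod x⁻¹ hx.inv)
      simpa using this⟩)
  set Y := closure {y : conjAut N | ∃ x, PEl p x ∧ x ^ p ^ (e - 1) = y} with hY
  have hYn : Y.Normal := by
    refine ⟨fun y hy z => ?_⟩
    induction hy using closure_induction with
    | mem y h =>
      obtain ⟨x, hx, rfl⟩ := h
      exact subset_closure ⟨z * x * z⁻¹, hx.conj z, conj_pow⟩
    | one => simp
    | mul a b _ _ ha hb => rw [← conj_mul]; exact Y.mul_mem ha hb
    | inv a _ ha => rw [← conj_inv]; exact Y.inv_mem ha
  have hquot : cres^[S p] (⊤ : Subgroup (conjAut N ⧸ Y)) = ⊥ := by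
    refine hS p hpf _ fun g => ?_
    obtain ⟨x, rfl⟩ := QuotientGroup.mk'_surjective Y g
    rw [← map_pow, ← MonoidHom.mem_ker, QuotientGroup.ker_mk', hY]
    refine subset_closure ⟨x ^ n, ⟨e, by rw [← pow_mul, ← hmn, hpow]⟩, ?_⟩
    rw [← pow_mul]
    congr 1
    rw [hmn]
    obtain ⟨e', he'⟩ : ∃ e', e = e' + 1 := ⟨e - 1, by omega⟩
    rw [he', Nat.add_sub_cancel, pow_succ, ← mul_assoc, Nat.mul_div_cancel _ hp.pos]
  have hle : cres^[S p] (⊤ : Subgroup (conjAut N)) ≤ Y := by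
    rw [← QuotientGroup.ker_mk' Y, ← Subgroup.map_eq_bot_iff, ← hquot]
    exact map_cres_iterate_top (QuotientGroup.mk'_surjective Y) _
  have hfin := cres_iterate_add_eq_bot hle hcore
  have hk : b p + S p ≤ k := by
    rw [add_comm]
    exact Finset.le_sup (f := fun p => S p + b p) hpf
  have h1 : (cres^[k] (⊤ : Subgroup G)).map (toConjAut N) = ⊥ := by
    rw [map_cres_iterate_top (toConjAut_surjective N), eq_bot_iff]
    exact (cres_iterate_anti hk _).trans hfin.le
  intro g hg
  rw [← toConjAut_eq_one, ← mem_bot, ← h1]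
  exact mem_map_of_mem _ hg

end

section

variable {G : Type*} [Group G]

/-- A covering form of `XHyp.concl`: a normal subgroup `V` without centralizer and without normal
`p`-subgroups cannot be centralized Sylow-wise by supplements to a maximal normal subgroup `N ≥ V`
with nonabelian quotient of order divisible by the primes of `V` other than `p`. -/
theorem not_forall_le_centralizer_sup [Finite G] {V N A₁ : Subgroup G} [V.Normal] [N.Normal] {p : ℕ}
    (hp : p.Prime) (hVN : V ≤ N) (hN : N ≠ ⊤)
    (hmax : ∀ K : Subgroup G, K.Normal → N ≤ K → K = N ∨ K = ⊤)
    (hperf : Cov N (_root_.commutator G))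
    (hVp : ∀ O ≤ V, V ≤ normalizer (O : Set G) → IsPGroup p O → O = ⊥)
    (hV : centralizer (V : Set G) = ⊥)
    (hpr : ∀ q : ℕ, q.Prime → q ≠ p → q ∣ Nat.card V → q ∣ N.index)
    (hVA : V ≤ A₁) (hAN : A₁ ⊔ N = ⊤)
    (hA₁ : ∀ r : ℕ, r.Prime → r ≠ p → ∀ W ≤ V, IsPGroup r W →
      A₁ ≤ centralizer (W : Set G) ⊔ V) : False := by
  have : Fact p.Prime := ⟨hp⟩
  obtain ⟨A, hA⟩ := Set.Finite.exists_minimal (s := {A : Subgroup G | V ≤ A ∧ A ≤ A₁ ∧ A ⊔ N = ⊤})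
    (Set.toFinite _) ⟨A₁, hVA, le_rfl, hAN⟩
  obtain ⟨⟨hVA', hAA, hAN'⟩, hAmin⟩ := hA
  have hmin : ∀ B : Subgroup G, V ≤ B → B ≤ A → B ⊔ N = ⊤ → B = A := fun B h1 h2 h3 =>
    le_antisymm h2 (hAmin ⟨h1, h2.trans hAA, h3⟩ h2)
  have hVn : (V.subgroupOf A).Normal := inferInstance
  have hcardV : Nat.card (V.subgroupOf A) = Nat.card V :=
    Nat.card_congr (subgroupOfEquivOfLe hVA').toEquiv
  have hVm : (V.subgroupOf A).map A.subtype = V := by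
    rw [subgroupOf_map_subtype, inf_eq_left.2 hVA']
  have hX : XHyp p (V.subgroupOf A) := by
    refine ⟨?_, fun r hr hrp W hW hWr g => ?_, fun B hB hVB hBt q hq hqp hqV => ?_⟩
    · have h1 : ⁅A, A⁆ ⊔ V = A := by
        refine hmin _ le_sup_right (sup_le (commutator_le.2 fun a ha b hb =>
          A.mul_mem (A.mul_mem (A.mul_mem ha hb) (A.inv_mem ha)) (A.inv_mem hb)) hVA') ?_
        have h2 := cov_iff_sup.1 (hperf.commutator (cov_iff_sup.2 hAN') (cov_iff_sup.2 hAN'))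
        rw [eq_top_iff, ← h2]
        exact sup_le_sup_right le_sup_left _
      rw [cov_iff_sup]
      refine Subgroup.map_injective A.subtype_injective ?_
      rw [Subgroup.map_sup, hVm, ← MonoidHom.range_eq_map, range_subtype, commutator_def,
        Subgroup.map_commutator, ← MonoidHom.range_eq_map, range_subtype, h1]
    · have hWV : W.map A.subtype ≤ V := by
        rw [← hVm]
        exact Subgroup.map_mono hW
      have h1 := hA₁ r hr hrp _ hWV (hWr.map _) (hAA g.2)
      obtain ⟨c, hc, v, hv, hcv⟩ := mem_sup_of_normal_right.1 h1
      have hvA := A.inv_mem (hVA' hv)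
      refine ⟨⟨v⁻¹, hvA⟩, V.inv_mem hv, ?_⟩
      have h2 : (g : G) * v⁻¹ = c := by rw [← hcv]; group
      rw [mem_centralizer_iff] at hc ⊢
      intro w hw
      refine Subtype.ext ?_
      change (w : G) * (g * v⁻¹) = g * v⁻¹ * w
      rw [h2]
      exact hc w (mem_map_of_mem A.subtype hw)
    · let f : A →* G ⧸ N := (QuotientGroup.mk' N).comp A.subtype
      have hAt : A.map (QuotientGroup.mk' N) = ⊤ := cov_iff_map.1 (cov_iff_sup.2 hAN')
      have hf : Function.Surjective f := by
        rw [← MonoidHom.range_eq_top, MonoidHom.range_eq_map, ← Subgroup.map_map,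
          ← MonoidHom.range_eq_map, range_subtype, hAt]
      have hBn : (B.map f).Normal := hB.map f hf
      have h1 : B ≤ f.ker := by
        rcases hmax ((B.map f).comap (QuotientGroup.mk' N)) inferInstance (fun x hx => by
          rw [mem_comap, (QuotientGroup.eq_one_iff x).2 hx |> fun h => (h : QuotientGroup.mk' N x = 1)]
          exact one_mem _) with h | h
        · intro b hb
          have : (b : G) ∈ (B.map f).comap (QuotientGroup.mk' N) := mem_map_of_mem f hb
          rw [h] at this
          exact (QuotientGroup.eq_one_iff _).2 this
        · exfalso
          have h2 : B.map A.subtype ⊔ N = ⊤ := by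
            rw [← cov_iff_sup, cov_iff_map, Subgroup.map_map, eq_top_iff]
            intro x _
            obtain ⟨y, rfl⟩ := QuotientGroup.mk'_surjective N x
            have : y ∈ (B.map f).comap (QuotientGroup.mk' N) := h ▸ mem_top y
            exact this
          have h3 := hmin _ (by rw [← hVm]; exact Subgroup.map_mono hVB)
            (map_subtype_le B) h2
          refine hBt (Subgroup.map_injective A.subtype_injective ?_)
          rw [h3, ← MonoidHom.range_eq_map, range_subtype]
      refine Nat.dvd_trans ?_ (index_dvd_of_le h1)
      rw [index_ker, MonoidHom.range_eq_top.2 hf, card_top]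
      exact hpr q hq hqp (hcardV ▸ hqV)
  obtain ⟨O, hO, hVO, hOp, hc⟩ := hX.concl
  have hO1 : O.map A.subtype = ⊥ := by
    refine hVp _ (by rw [← hVm]; exact Subgroup.map_mono hO) (fun v hv => ?_) (hOp.map _)
    refine mem_normalizer_of_conj ?_
    rintro _ ⟨x, hx, rfl⟩
    exact ⟨⟨v, hVA' hv⟩ * x * ⟨v, hVA' hv⟩⁻¹,
      conj_mem_of_mem_normalizer (hVO (x := ⟨v, hVA' hv⟩) hv) hx, rfl⟩
  have hAV : A ≤ V := by
    intro g hg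
    obtain ⟨v, hv, h1⟩ := hc ⟨g, hg⟩
    have h2 : g * (v : G) ∈ centralizer (V : Set G) := by
      rw [mem_centralizer_iff]
      intro x hx
      have h3 := mem_map_of_mem A.subtype (h1 ⟨x, hVA' hx⟩ hx)
      rw [hO1, mem_bot] at h3
      exact commutatorElement_eq_one_iff_mul_comm.1 h3
    rw [hV, mem_bot] at h2
    rw [eq_inv_of_mul_eq_one_left h2]
    exact V.inv_mem hv
  refine hN ?_
  rw [← hAN', sup_eq_right.2 (hAV.trans hVN)]

end

section

variable {G : Type*} [Group G]

theorem PEl.mem_of_not_dvd_index [Finite G] {N : Subgroup G} [N.Normal] {q : ℕ} (hq : q.Prime) (h : ¬ q ∣ N.index)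
    {x : G} (hx : PEl q x) : x ∈ N := by
  obtain ⟨k, hk⟩ := hx
  have h1 : (x : G ⧸ N) ^ q ^ k = 1 := by
    rw [← QuotientGroup.mk_pow, hk]; rfl
  have h2 : (x : G ⧸ N) ^ N.index = 1 := pow_card_eq_one'
  have h3 : Nat.Coprime (q ^ k) N.index := Nat.Coprime.pow_left k ((hq.coprime_iff_not_dvd).2 h)
  rw [← QuotientGroup.eq_one_iff, ← orderOf_eq_one_iff, ← Nat.dvd_one, ← h3]
  exact Nat.dvd_gcd (orderOf_dvd_of_pow_eq_one h1) (orderOf_dvd_of_pow_eq_one h2)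

/-- A nonabelian minimal normal subgroup has no nontrivial normal `p`-subgroup. -/
theorem eq_bot_of_isPGroup_of_minimal [Finite G] {V : Subgroup G} [V.Normal] {p : ℕ} [Fact p.Prime]
    (hmin : ∀ K : Subgroup G, K.Normal → K ≤ V → K ≠ ⊥ → K = V) (hna : ⁅V, V⁆ ≠ ⊥)
    {O : Subgroup G} (hO : O ≤ V) (hVO : V ≤ normalizer (O : Set G)) (hOp : IsPGroup p O) :
    O = ⊥ := by
  have hn : (pCore p V).Normal := ⟨fun x hx g =>
    conj_mem_of_mem_normalizer (normalizer_le_pCore p (mem_normalizer_of_normal g)) hx⟩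
  by_contra h
  have h1 : pCore p V ≠ ⊥ := fun h2 => h (le_bot_iff.1 (h2 ▸ le_pCore hO hVO hOp))
  have h2 := hmin _ hn (pCore_le p V) h1
  have h3 : IsPGroup p V := h2 ▸ isPGroup_pCore p V
  have h4 : Group.IsNilpotent V := h3.isNilpotent
  have hV0 : V ≠ ⊥ := fun h => h1 (le_bot_iff.1 (h ▸ pCore_le p V))
  have : Nontrivial V := (nontrivial_iff_ne_bot V).2 hV0
  refine (Group.IsSolvable.commutator_lt_top_of_nontrivial V).ne
    (Subgroup.map_injective V.subtype_injective ?_)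
  rw [_root_.commutator_def, Subgroup.map_commutator, ← MonoidHom.range_eq_map, range_subtype]
  exact hmin _ inferInstance (commutator_le_left V V) hna

theorem sup_normal_of_isSylIn [Finite G] {V M R : Subgroup G} [V.Normal] [M.Normal] {r : ℕ}
    [Fact r.Prime] (hR : IsSylIn r R V) : ((M ⊓ centralizer (R : Set G)) ⊔ V).Normal := by
  refine ⟨fun x hx g => ?_⟩
  obtain ⟨v, hv, hg⟩ := hR.frattini (mem_normalizer_of_normal g)
  obtain ⟨c, hc, u, hu, rfl⟩ := mem_sup_of_normal_right.1 hx
  have hv' : v⁻¹ ∈ (M ⊓ centralizer (R : Set G)) ⊔ V := mem_sup_right (V.inv_mem hv)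
  have key : ∀ y ∈ (M ⊓ centralizer (R : Set G)) ⊔ V,
      (g * v) * y * (g * v)⁻¹ ∈ (M ⊓ centralizer (R : Set G)) ⊔ V := by
    intro y hy
    obtain ⟨c, hc, u, hu, rfl⟩ := mem_sup_of_normal_right.1 hy
    rw [← conj_mul]
    refine mul_mem (mem_sup_left ⟨Normal.conj_mem inferInstance _ hc.1 _, ?_⟩)
      (mem_sup_right (Normal.conj_mem inferInstance _ hu _))
    refine mem_centralizer_iff.2 fun z hz => ?_
    have h1 := conj_mem_of_mem_normalizer ((normalizer (R : Set G)).inv_mem hg) hz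
    have h2 := mem_centralizer_iff.1 hc.2 _ h1
    calc z * (g * v * c * (g * v)⁻¹)
        = g * v * (((g * v)⁻¹ * z * (g * v)⁻¹⁻¹) * c) * (g * v)⁻¹ := by group
      _ = g * v * c * (g * v)⁻¹ * z := by rw [h2]; group
  have h := key _ (mul_mem (mul_mem hv' hx) (inv_mem hv'))
  convert h using 1
  group

/-- If `V` is a nonabelian minimal normal subgroup with trivial centralizer and `M / L` is a
nonabelian chief factor above `V` involving all the primes of `V`, then for some prime `r ≠ p`
dividing `|V|` no Sylow `r`-subgroup of `V` is centralized by a supplement of `L` in `M`. -/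
theorem exists_prime_inf_centralizer_le [Finite G] {V L M : Subgroup G} [V.Normal] [L.Normal]
    [M.Normal] (hmin : ∀ K : Subgroup G, K.Normal → K ≤ V → K ≠ ⊥ → K = V) (hna : ⁅V, V⁆ ≠ ⊥)
    (hCV : centralizer (V : Set G) = ⊥) (hVL : V ≤ L) (hLM : L < M)
    (hchief : ∀ K : Subgroup G, K.Normal → L ≤ K → K ≤ M → K = L ∨ K = M)
    (hMna : ¬ ⁅M, M⁆ ≤ L) (hpr : ∀ q : ℕ, q.Prime → q ∣ Nat.card V → ∃ x ∈ M, PEl q x ∧ x ∉ L)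
    {p : ℕ} (hp : p.Prime) :
    ∃ r : ℕ, r.Prime ∧ r ≠ p ∧ r ∣ Nat.card V ∧
      ∀ R : Subgroup G, IsSylIn r R V → M ⊓ centralizer (R : Set G) ≤ L := by
  by_contra hcon
  push Not at hcon
  have : Fact p.Prime := ⟨hp⟩
  have hsup : ∀ K : Subgroup G, K.Normal → K ≤ M → ¬ K ≤ L → K ⊔ L = M := by
    intro K hK hKM hKL
    rcases hchief (K ⊔ L) inferInstance le_sup_right (sup_le hKM hLM.le) with h | h
    · exact (hKL (h ▸ le_sup_left)).elim
    · exact h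
  have hMM : ⁅M, M⁆ ⊔ L = M := hsup _ inferInstance (commutator_le_left _ _) hMna
  obtain ⟨A, hA⟩ := Set.Finite.exists_minimal
    (s := {D : Subgroup G | D.Normal ∧ V ≤ D ∧ D ≤ M ∧ ¬ D ≤ L})
    (Set.toFinite _) ⟨M, inferInstance, hVL.trans hLM.le, le_rfl, hLM.not_ge⟩
  obtain ⟨⟨hAn, hVA, hAM, hAL⟩, hAmin⟩ := hA
  have hAle : ∀ D : Subgroup G, D.Normal → V ≤ D → D ≤ M → ¬ D ≤ L → A ≤ D := by
    intro D hD hVD hDM hDL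
    refine (hAmin ⟨inferInstance, le_inf hVA hVD, inf_le_left.trans hAM, fun h => hMna ?_⟩
      inf_le_left).trans inf_le_right
    have h1 : ⁅A, D⁆ ≤ L := (commutator_le_inf A D).trans h
    rw [← QuotientGroup.ker_mk' L, ← Subgroup.map_eq_bot_iff, Subgroup.map_commutator] at h1 ⊢
    have h2 : ∀ K : Subgroup G, K ⊔ L = M →
        K.map (QuotientGroup.mk' L) = M.map (QuotientGroup.mk' L) := fun K hK => by
      rw [← hK, Subgroup.map_sup, QuotientGroup.map_mk'_self, sup_bot_eq]
    rw [← h1, h2 A (hsup A hAn hAM hAL), h2 D (hsup D hD hDM hDL)]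
  have hAC : ∀ r : ℕ, r.Prime → r ≠ p → ∀ W ≤ V, IsPGroup r W →
      A ≤ centralizer (W : Set G) ⊔ V := by
    intro r hr hrp W hWV hW x hx
    have : Fact r.Prime := ⟨hr⟩
    by_cases hrV : r ∣ Nat.card V
    · obtain ⟨R, hR, hRL⟩ := hcon r hr hrp hrV
      obtain ⟨R', hR', hWR⟩ := IsSylIn.exists_ge hWV hW
      obtain ⟨v, hv, rfl⟩ := hR.exists_conj hR'
      have h1 := hAle _ (sup_normal_of_isSylIn (M := M) hR) le_sup_right
        (sup_le inf_le_left (hVL.trans hLM.le)) (fun h => hRL (le_sup_left.trans h))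
      obtain ⟨c, hc, u, hu, hcu⟩ := mem_sup_of_normal_right.1 (h1 (hAn.conj_mem x hx v⁻¹))
      have h2 : x = (v * c * v⁻¹) * (v * u * v⁻¹) := by
        rw [conj_mul, hcu]; group
      rw [h2]
      refine mul_mem (mem_sup_left ?_) (mem_sup_right (Normal.conj_mem inferInstance _ hu _))
      refine mem_centralizer_iff.2 fun z hz => ?_
      have h3 := mem_centralizer_iff.1 hc.2 _ (mem_conjSub.1 (hWR hz))
      calc z * (v * c * v⁻¹) = v * ((v⁻¹ * z * v) * c) * v⁻¹ := by group
        _ = v * c * v⁻¹ * z := by rw [h3]; group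
    · have h1 : W = ⊥ := by
        obtain ⟨k, hk⟩ := IsPGroup.iff_card.1 hW
        rcases k with _ | k
        · rw [pow_zero] at hk
          exact card_eq_one.1 hk
        · exact (hrV (((dvd_pow_self r k.succ_ne_zero).trans hk.symm.dvd).trans
            (card_dvd_of_le hWV))).elim
      rw [h1]
      refine mem_sup_left (mem_centralizer_iff.2 fun z hz => ?_)
      rw [mem_bot.1 hz, one_mul, mul_one]
  obtain ⟨N, hN⟩ := Set.Finite.exists_maximal
    (s := {K : Subgroup M | K.Normal ∧ L.subgroupOf M ≤ K ∧ K ≠ ⊤}) (Set.toFinite _)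
    ⟨L.subgroupOf M, inferInstance, le_rfl, fun h => hLM.not_ge (subgroupOf_eq_top.1 h)⟩
  obtain ⟨⟨hNn, hLN, hNt⟩, hNmax⟩ := hN
  have hLN' : L ≤ N.map M.subtype := fun x hx => ⟨⟨x, hLM.le hx⟩, hLN hx, rfl⟩
  have hVM := hVL.trans hLM.le
  have hcardV : Nat.card (V.subgroupOf M) = Nat.card V :=
    Nat.card_congr (subgroupOfEquivOfLe hVM).toEquiv
  have hcov : ∀ K : Subgroup G, K ≤ M → K ⊔ L = M → K.subgroupOf M ⊔ N = ⊤ := by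
    intro K hK h
    rw [eq_top_iff]
    rintro ⟨x, hx⟩ -
    rw [← h] at hx
    obtain ⟨a, ha, b, hb, rfl⟩ := mem_sup_of_normal_right.1 hx
    exact mul_mem (a := (⟨a, hK ha⟩ : M)) (b := ⟨b, hLM.le hb⟩) (mem_sup_left ha)
      (mem_sup_right (hLN hb))
  refine not_forall_le_centralizer_sup (G := M) (V := V.subgroupOf M) (N := N)
    (A₁ := A.subgroupOf M) hp (fun x hx => hLN (hVL hx)) hNt (fun K hK hNK => ?_) ?_
    (fun O hO hVO hOp => ?_) ?_ (fun q hq hqp hqV => ?_) (fun x hx => hVA hx)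
    (hcov A hAM (hsup A hAn hAM hAL)) (fun r hr hrp W hW hWr x hx => ?_)
  · by_cases h : K = ⊤
    · exact Or.inr h
    · exact Or.inl (le_antisymm (hNmax ⟨hK, hLN.trans hNK, h⟩ hNK) hNK)
  · rw [cov_iff_sup, ← hcov _ (commutator_le_left _ _) hMM]
    congr 1
    refine Subgroup.map_injective M.subtype_injective ?_
    rw [subgroupOf_map_subtype, inf_eq_left.2 (commutator_le_left _ _), _root_.commutator_def,
      Subgroup.map_commutator, ← MonoidHom.range_eq_map, range_subtype]
  · have h1 : O.map M.subtype = ⊥ := by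
      refine eq_bot_of_isPGroup_of_minimal hmin hna ?_ (fun v hv => ?_) (hOp.map _)
      · rintro _ ⟨x, hx, rfl⟩
        exact hO hx
      · refine mem_normalizer_of_conj ?_
        rintro _ ⟨x, hx, rfl⟩
        exact ⟨⟨v, hVM hv⟩ * x * ⟨v, hVM hv⟩⁻¹,
          conj_mem_of_mem_normalizer (hVO (x := ⟨v, hVM hv⟩) hv) hx, rfl⟩
    exact Subgroup.map_injective M.subtype_injective (h1.trans (Subgroup.map_bot _).symm)
  · rw [eq_bot_iff]
    intro x hx
    have h1 : (x : G) ∈ centralizer (V : Set G) := mem_centralizer_iff.2 fun v hv =>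
      congrArg Subtype.val (mem_centralizer_iff.1 hx ⟨v, hVM hv⟩ hv)
    rw [hCV] at h1
    exact Subtype.ext (mem_bot.1 h1)
  · by_contra hqN
    obtain ⟨x, hxM, hxq, hxL⟩ := hpr q hq (hcardV ▸ hqV)
    have h1 : ∀ y ∈ M, PEl q y → y ∈ N.map M.subtype := by
      rintro y hy ⟨k, hk⟩
      exact ⟨⟨y, hy⟩, PEl.mem_of_not_dvd_index hq hqN ⟨k, Subtype.ext hk⟩, rfl⟩
    rcases hchief (N.map M.subtype).normalCore inferInstance
      ((normal_le_normalCore).2 hLN') ((normalCore_le _).trans (map_subtype_le N)) with h | h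
    · refine hxL (h ▸ fun g => ?_)
      exact h1 _ (Normal.conj_mem inferInstance _ hxM _) (hxq.conj g)
    · refine hNt (eq_top_iff.2 ?_)
      rintro y -
      have h2 : (y : G) ∈ N.map M.subtype := normalCore_le _ (h.ge y.2)
      obtain ⟨z, hz, hzy⟩ := h2
      rwa [← Subtype.ext hzy]
  · have hW' : W.map M.subtype ≤ V := by
      rintro _ ⟨w, hw, rfl⟩
      exact hW hw
    obtain ⟨c, hc, v, hv, hcv⟩ := mem_sup_of_normal_right.1
      (hAC r hr hrp _ hW' (hWr.map _) hx)
    have hcM : c ∈ M := by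
      rw [eq_mul_inv_of_mul_eq hcv]
      exact M.mul_mem x.2 (M.inv_mem (hVM hv))
    have h1 : x = (⟨c, hcM⟩ : M) * ⟨v, hVM hv⟩ := Subtype.ext hcv.symm
    rw [h1]
    refine mul_mem (mem_sup_left (mem_centralizer_iff.2 fun w hw => Subtype.ext ?_))
      (mem_sup_right hv)
    exact mem_centralizer_iff.1 hc _ (mem_map_of_mem M.subtype hw)

end

section

variable {G : Type*} [Group G]

theorem IsSylIn.map [Finite G] {K : Type*} [Group K] {t : ℕ} [Fact t.Prime] {R U : Subgroup G}
    (h : IsSylIn t R U) (f : G →* K) : IsSylIn t (R.map f) (U.map f) := by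
  refine ⟨Subgroup.map_mono h.1, h.2.1.map f, fun S hSU hS hRS => le_antisymm (fun s hs => ?_) hRS⟩
  have hs' := MonoidHom.subgroupMap_surjective f U
  have h1 : (Sylow.mapSurjective hs' h.toSylow : Subgroup (U.map f)) ≤ S.subgroupOf (U.map f) := by
    rw [Sylow.coe_mapSurjective]
    rintro _ ⟨x, hx, rfl⟩
    exact hRS (mem_map_of_mem f hx)
  have h2 := (Sylow.mapSurjective hs' h.toSylow).is_maximal'
    (hS.comap_of_injective _ (subtype_injective _)) h1
  have h3 : (⟨s, hSU hs⟩ : U.map f) ∈ S.subgroupOf (U.map f) := hs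
  rw [subgroupOf, h2, Sylow.coe_mapSurjective] at h3
  obtain ⟨x, hx, hxs⟩ := h3
  exact ⟨x, hx, congrArg Subtype.val hxs⟩

/-- The centralizer of the section `M / N`. -/
def sectionCentralizer (M N : Subgroup G) [N.Normal] : Subgroup G :=
  (centralizer ((M.map (QuotientGroup.mk' N) : Subgroup (G ⧸ N)) : Set (G ⧸ N))).comap
    (QuotientGroup.mk' N)

instance (M N : Subgroup G) [M.Normal] [N.Normal] : (sectionCentralizer M N).Normal := by
  have : (M.map (QuotientGroup.mk' N)).Normal :=
    Normal.map inferInstance _ (QuotientGroup.mk'_surjective N)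
  exact Normal.comap inferInstance _

theorem mem_sectionCentralizer {M N : Subgroup G} [N.Normal] {g : G} :
    g ∈ sectionCentralizer M N ↔ ∀ x ∈ M, ⁅x, g⁆ ∈ N := by
  rw [sectionCentralizer, mem_comap, mem_centralizer_iff]
  constructor
  · intro h x hx
    rw [← QuotientGroup.eq_one_iff]
    exact commutatorElement_eq_one_iff_mul_comm.2 (h _ (mem_map_of_mem _ hx))
  · rintro h _ ⟨x, hx, rfl⟩
    exact commutatorElement_eq_one_iff_mul_comm.1 ((QuotientGroup.eq_one_iff _).2 (h x hx))

theorem le_sectionCentralizer (M N : Subgroup G) [N.Normal] : N ≤ sectionCentralizer M N :=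
  fun _ hg => mem_sectionCentralizer.2 fun x _ =>
    N.mul_mem (Normal.conj_mem inferInstance _ hg x) (N.inv_mem hg)

/-- `M / N` is a nonabelian chief factor. -/
structure IsNonabelianChief (M N : Subgroup G) : Prop where
  lt : N < M
  chief : ∀ K : Subgroup G, K.Normal → N ≤ K → K ≤ M → K = N ∨ K = M
  nonabelian : ¬ ⁅M, M⁆ ≤ N

theorem IsNonabelianChief.sectionCentralizer_inf {M N : Subgroup G} [M.Normal] [N.Normal]
    (h : IsNonabelianChief M N) : sectionCentralizer M N ⊓ M = N := by
  refine (h.chief _ inferInstance (le_inf (le_sectionCentralizer M N) h.lt.le)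
    inf_le_right).resolve_right fun h1 => h.nonabelian ?_
  exact commutator_le.2 fun x hx y hy => mem_sectionCentralizer.1 (inf_eq_right.1 h1 hy) x hx

/-- The prime `p` occurs in the order of `M / N`. -/
def PrimeIn (p : ℕ) (M N : Subgroup G) : Prop := ∃ x ∈ M, PEl p x ∧ x ∉ N

/-- Sylow `r`-subgroups of subgroups covering `M₁ / N₁` act nontrivially on every
element of `M₂` outside `N₂`. -/
def ActsFaithfully (r : ℕ) (M₁ N₁ M₂ N₂ : Subgroup G) : Prop :=
  ∀ H : Subgroup G, (∀ x ∈ M₁, ∃ z ∈ N₁, x * z ∈ H) → ∀ P, IsSylIn r P (M₁ ⊓ H) →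
    ¬ P ≤ N₁ ∧ ∀ g ∈ M₂, (∀ x ∈ P, ⁅x, g⁆ ∈ N₁) → g ∈ N₂

theorem exists_prime_actsFaithfully [Finite G] {M₁ N₁ M₂ N₂ : Subgroup G} [M₁.Normal] [N₁.Normal]
    [M₂.Normal] [N₂.Normal] (h₁ : IsNonabelianChief M₁ N₁) (h₂ : IsNonabelianChief M₂ N₂)
    (hle : M₁ ≤ N₂) (hC : sectionCentralizer M₁ N₁ ⊓ M₂ ≤ N₂)
    (hpr : ∀ q : ℕ, q.Prime → PrimeIn q M₁ N₁ → PrimeIn q M₂ N₂) {p : ℕ} (hp : p.Prime) :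
    ∃ r : ℕ, r.Prime ∧ r ≠ p ∧ ActsFaithfully r M₁ N₁ M₂ N₂ := by
  let f := QuotientGroup.mk' (sectionCentralizer M₁ N₁)
  have hf : Function.Surjective f := QuotientGroup.mk'_surjective _
  have hf1 : ∀ x, f x = 1 ↔ x ∈ sectionCentralizer M₁ N₁ := fun x => QuotientGroup.eq_one_iff x
  have hn : ∀ K : Subgroup G, K.Normal → (K.map f).Normal := fun K hK => hK.map f hf
  have := hn M₁ inferInstance
  have := hn M₂ inferInstance
  have := hn N₂ inferInstance
  have key : ∀ x ∈ M₂, f x ∈ N₂.map f → x ∈ N₂ := by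
    rintro x hx ⟨y, hy, hxy⟩
    have h1 : y⁻¹ * x ∈ N₂ := hC ⟨(hf1 _).1 (by rw [map_mul, map_inv, hxy, inv_mul_cancel]),
      M₂.mul_mem (M₂.inv_mem (h₂.lt.le hy)) hx⟩
    simpa using N₂.mul_mem hy h1
  have hcap : ∀ x ∈ M₁, f x = 1 → x ∈ N₁ := fun x hx h => by
    rw [← h₁.sectionCentralizer_inf]
    exact ⟨(hf1 x).1 h, hx⟩
  have hN₁ : ∀ x ∈ N₁, f x = 1 := fun x hx => (hf1 x).2 (le_sectionCentralizer _ _ hx)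
  have hex : ∃ r : ℕ, r.Prime ∧ r ≠ p ∧ r ∣ Nat.card (M₁.map f) ∧
      ∀ R : Subgroup _, IsSylIn r R (M₁.map f) →
        M₂.map f ⊓ centralizer (R : Set _) ≤ N₂.map f := by
    refine exists_prime_inf_centralizer_le ?_ ?_ ?_ (Subgroup.map_mono hle) ?_ ?_ ?_ ?_ hp
    · intro K hK hKV hK0
      rcases h₁.chief (K.comap f ⊓ M₁) inferInstance
        (le_inf (fun x hx => by rw [mem_comap, hN₁ x hx]; exact one_mem _) h₁.lt.le)
        inf_le_right with h | h
      · refine (hK0 (eq_bot_iff.2 fun k hk => ?_)).elim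
        obtain ⟨x, hx, rfl⟩ := hKV hk
        exact hN₁ x (h.le ⟨hk, hx⟩)
      · refine le_antisymm hKV ?_
        rintro _ ⟨x, hx, rfl⟩
        exact inf_eq_right.1 h hx
    · intro h
      rw [← Subgroup.map_commutator, Subgroup.map_eq_bot_iff] at h
      exact h₁.nonabelian fun x hx => hcap x (commutator_le_left M₁ M₁ hx) (h hx)
    · rw [eq_bot_iff]
      intro y hy
      obtain ⟨g, rfl⟩ := hf y
      rw [mem_bot, hf1, mem_sectionCentralizer]
      intro x hx
      refine hcap _ (commutator_le_left M₁ ⊤ (commutator_mem_commutator hx (mem_top g))) ?_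
      rw [map_commutatorElement]
      exact commutatorElement_eq_one_iff_mul_comm.2
        (mem_centralizer_iff.1 hy _ (mem_map_of_mem f hx))
    · refine lt_of_le_of_ne (Subgroup.map_mono h₂.lt.le) fun h => h₂.lt.not_ge fun x hx => ?_
      exact key x hx (h ▸ mem_map_of_mem f hx)
    · intro K hK hLK hKM
      rcases h₂.chief (K.comap f ⊓ M₂) inferInstance
        (le_inf (fun x hx => hLK (mem_map_of_mem f hx)) h₂.lt.le) inf_le_right with h | h
      · refine Or.inl (le_antisymm (fun k hk => ?_) hLK)
        obtain ⟨x, hx, rfl⟩ := hKM hk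
        exact mem_map_of_mem f (h.le ⟨hk, hx⟩)
      · refine Or.inr (le_antisymm hKM ?_)
        rintro _ ⟨x, hx, rfl⟩
        exact inf_eq_right.1 h hx
    · intro h
      rw [← Subgroup.map_commutator] at h
      exact h₂.nonabelian fun x hx => key x (commutator_le_left M₂ M₂ hx) (h (mem_map_of_mem f hx))
    · intro q hq hqV
      have : Fact q.Prime := ⟨hq⟩
      obtain ⟨⟨v, hv⟩, hvq⟩ := exists_prime_orderOf_dvd_card' q hqV
      have hvq' : orderOf v = q := by rwa [orderOf_mk] at hvq
      obtain ⟨x, hx, rfl⟩ := hv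
      obtain ⟨k, hk, hk1⟩ := PEl.exists_lift (f := f) (g := x) hq
        ⟨1, by rw [pow_one, ← hvq', pow_orderOf_eq_one]⟩
      obtain ⟨y, hy, hyq, hyN⟩ := hpr q hq ⟨x ^ k, M₁.pow_mem hx k, hk, fun h => by
        rw [hN₁ _ h] at hk1
        rw [← hk1, orderOf_one] at hvq'
        exact hq.one_lt.ne hvq'⟩
      exact ⟨f y, mem_map_of_mem f hy, hyq.map f, fun h => hyN (key y hy h)⟩
  obtain ⟨r, hr, hrp, hrV, hR⟩ := hex
  have : Fact r.Prime := ⟨hr⟩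
  refine ⟨r, hr, hrp, fun H hH P hP => ?_⟩
  have hHV : (M₁ ⊓ H).map f = M₁.map f := by
    refine le_antisymm (Subgroup.map_mono inf_le_left) ?_
    rintro _ ⟨x, hx, rfl⟩
    obtain ⟨z, hz, hxz⟩ := hH x hx
    exact ⟨x * z, ⟨M₁.mul_mem hx (h₁.lt.le hz), hxz⟩, by rw [map_mul, hN₁ z hz, mul_one]⟩
  have hP' : IsSylIn r (P.map f) (M₁.map f) := hHV ▸ hP.map f
  constructor
  · intro hPN
    obtain ⟨k, hk, hk1⟩ := hP'.card_dvd
    have h1 : P.map f = ⊥ := by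
      rw [eq_bot_iff]
      rintro _ ⟨x, hx, rfl⟩
      exact hN₁ x (hPN hx)
    rw [h1, card_bot, one_mul] at hk
    exact hk1 (hk ▸ hrV)
  · intro g hg hgP
    refine key g hg (hR _ hP' ⟨mem_map_of_mem f hg, mem_centralizer_iff.2 ?_⟩)
    rintro _ ⟨x, hx, rfl⟩
    have := hN₁ _ (hgP x hx)
    rw [map_commutatorElement] at this
    exact commutatorElement_eq_one_iff_mul_comm.1 this

end

section

theorem exists_descending_choice {α : Type*} {R : α → α → Prop} (a₀ : α) (n : ℕ) :
    ∀ {Q : ℕ → α → Prop}, (∀ i < n, ∀ b, ∃ a, Q i a ∧ R a b) →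
      ∃ r : ℕ → α, ∀ i < n, Q i (r i) ∧ R (r i) (r (i + 1)) := by
  induction n with
  | zero => exact fun _ => ⟨fun _ => a₀, fun i hi => absurd hi (Nat.not_lt_zero i)⟩
  | succ n ih =>
    intro Q h
    obtain ⟨r, hr⟩ := ih (Q := fun i => Q (i + 1)) fun i hi => h (i + 1) (by omega)
    obtain ⟨a, ha⟩ := h 0 (by omega) (r 0)
    refine ⟨fun i => Nat.casesOn i a r, fun i hi => ?_⟩
    cases i with
    | zero => exact ha
    | succ i => exact hr i (by omega)

variable {G : Type*} [Group G]

theorem isSolvable_sup_of_le_normalizer {P K : Subgroup G} (hP : Group.IsSolvable P)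
    (hK : Group.IsSolvable K) (h : K ≤ normalizer (P : Set G)) :
    Group.IsSolvable ↥(P ⊔ K) := by
  have hn : P ⊔ K ≤ normalizer (P : Set G) := sup_le le_normalizer h
  have hPn : (P.subgroupOf (P ⊔ K)).Normal := normal_subgroupOf_of_le_normalizer hn
  let f : P →* ↥(P ⊔ K) := inclusion le_sup_left
  let g := QuotientGroup.mk' (P.subgroupOf (P ⊔ K))
  have hg : Function.Surjective (g.comp (inclusion (le_sup_right : K ≤ P ⊔ K))) := by
    intro y
    obtain ⟨x, rfl⟩ := QuotientGroup.mk'_surjective _ y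
    have h1 : x ∈ P.subgroupOf (P ⊔ K) ⊔ K.subgroupOf (P ⊔ K) := by
      rw [← subgroupOf_sup le_sup_left le_sup_right, subgroupOf_self]
      trivial
    obtain ⟨a, ha, b, hb, rfl⟩ := mem_sup_of_normal_left.1 h1
    refine ⟨⟨b, hb⟩, ?_⟩
    have h2 : QuotientGroup.mk' (P.subgroupOf (P ⊔ K)) a = 1 := (QuotientGroup.eq_one_iff _).2 ha
    rw [map_mul, h2, one_mul]
    rfl
  have := Group.isSolvable_of_surjective hg
  refine Group.isSolvable_of_ker_le_range f g fun x hx => ?_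
  rw [QuotientGroup.ker_mk'] at hx
  exact ⟨⟨x, hx⟩, rfl⟩

theorem exists_isSolvable_of_le_normalizer (n : ℕ) : ∀ {P : ℕ → Subgroup G},
    (∀ i < n, Group.IsSolvable (P i)) → (∀ i j, i < j → j < n → P j ≤ normalizer (P i : Set G)) →
    ∃ X : Subgroup G, Group.IsSolvable X ∧ (∀ i < n, P i ≤ X) ∧
      ∀ K : Subgroup G, (∀ i < n, P i ≤ K) → X ≤ K := by
  induction n with
  | zero =>
    exact fun _ _ => ⟨⊥, inferInstance, fun i hi => absurd hi (Nat.not_lt_zero i),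
      fun K _ => bot_le⟩
  | succ n ih =>
    intro P hP hPn
    obtain ⟨X, hX, hPX, hXK⟩ := ih (P := fun i => P (i + 1)) (fun i hi => hP _ (by omega))
      fun i j hij hj => hPn _ _ (by omega) (by omega)
    refine ⟨P 0 ⊔ X, isSolvable_sup_of_le_normalizer (hP 0 (by omega)) hX
      (hXK _ fun i hi => hPn 0 _ (by omega) (by omega)), fun i hi => ?_, fun K hK =>
      sup_le (hK 0 (by omega)) (hXK K fun i hi => hK _ (by omega))⟩
    cases i with
    | zero => exact le_sup_left
    | succ i => exact (hPX i (by omega)).trans le_sup_right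

/-- Successive Sylow subgroups of the members of a normal chain, each normalizing the
previous ones. -/
theorem exists_tower [Finite G] (n : ℕ) : ∀ {M N : ℕ → Subgroup G} {r : ℕ → ℕ} {H : Subgroup G},
    (∀ i < n, (M i).Normal) → (∀ i < n, (N i).Normal) → (∀ i < n, (r i).Prime) →
    (∀ i < n, N i ≤ M i) → (∀ i j, i < j → j < n → M i ≤ N j) →
    (∀ i < n, ∀ x ∈ M i, ∃ z ∈ N i, x * z ∈ H) →
    ∃ P H' : ℕ → Subgroup G,
      (∀ i < n, (∀ x ∈ M i, ∃ z ∈ N i, x * z ∈ H' i) ∧ IsSylIn (r i) (P i) (M i ⊓ H' i) ∧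
        P i ≤ H) ∧
      ∀ i j, i < j → j < n → P j ≤ normalizer (P i : Set G) := by
  induction n with
  | zero =>
    intro M N r H _ _ _ _ _ _
    exact ⟨fun _ => ⊥, fun _ => ⊥, fun i hi => absurd hi (Nat.not_lt_zero i),
      fun i j _ hj => absurd hj (Nat.not_lt_zero j)⟩
  | succ n ih =>
    intro M N r H hM hN hr hNM hMN hcov
    have hM0 := hM 0 (by omega)
    have : Fact (r 0).Prime := ⟨hr 0 (by omega)⟩
    obtain ⟨P₀, hP₀, -⟩ := IsSylIn.exists_ge (V := M 0 ⊓ H) (t := r 0) bot_le IsPGroup.of_bot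
    obtain ⟨P, H', hP, hPn⟩ := ih (M := fun i => M (i + 1)) (N := fun i => N (i + 1))
      (r := fun i => r (i + 1)) (H := H ⊓ normalizer (P₀ : Set G))
      (fun i hi => hM _ (by omega)) (fun i hi => hN _ (by omega)) (fun i hi => hr _ (by omega))
      (fun i hi => hNM _ (by omega)) (fun i j hij hj => hMN _ _ (by omega) (by omega))
      (fun i hi x hx => by
        have hNi := hN (i + 1) (by omega)
        obtain ⟨z, hz, hxz⟩ := hcov (i + 1) (by omega) x hx
        have h1 : x * z ∈ normalizer ((M 0 ⊓ H : Subgroup G) : Set G) :=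
          normalizer_inf (mem_normalizer_of_normal _) (le_normalizer hxz)
        obtain ⟨v, hv, h2⟩ := hP₀.frattini h1
        refine ⟨z * v, (N (i + 1)).mul_mem hz (hMN 0 (i + 1) (by omega) (by omega) hv.1), ?_⟩
        rw [← mul_assoc]
        exact ⟨H.mul_mem hxz hv.2, h2⟩)
    refine ⟨fun i => Nat.casesOn i P₀ P, fun i => Nat.casesOn i H H', fun i hi => ?_,
      fun i j hij hj => ?_⟩
    · cases i with
      | zero => exact ⟨hcov 0 hi, hP₀, hP₀.1.trans inf_le_right⟩
      | succ i =>
        obtain ⟨h1, h2, h3⟩ := hP i (by omega)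
        exact ⟨h1, h2, h3.trans inf_le_left⟩
    · obtain ⟨j, rfl⟩ : ∃ k, j = k + 1 := ⟨j - 1, by omega⟩
      cases i with
      | zero => exact (hP j (by omega)).2.2.trans inf_le_right
      | succ i => exact hPn i j (by omega) (by omega)

theorem commutator_eq_one_of_coprime_pEl {p q : ℕ} (hp : p.Prime) (hq : q.Prime) (hpq : p ≠ q)
    {b w : G} (hc : PEl p ⁅b, w⁆) (hw : PEl q w) (h : ⁅⁅b, w⁆, w⁆ = 1) : ⁅b, w⁆ = 1 := by
  obtain ⟨k, hk⟩ := hw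
  have h1 : ⁅b, w⁆ * w = b * w * b⁻¹ := by rw [commutatorElement_def]; group
  have h2 : (⁅b, w⁆ * w) ^ q ^ k = 1 := by rw [h1, conj_pow, hk]; group
  have h3 : Commute ⁅b, w⁆ w := commutatorElement_eq_one_iff_mul_comm.1 h
  rw [h3.mul_pow, hk, mul_one] at h2
  have := Fact.mk hp
  have := Fact.mk hq
  exact PEl.eq_one_of_coprime hpq hc ⟨k, h2⟩

theorem exists_mem_cres_iterate [Finite G] {M N P : ℕ → Subgroup G} {r : ℕ → ℕ} {X : Subgroup G} {n : ℕ}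
    (hN : ∀ i < n, (N i).Normal) (hr : ∀ i < n, (r i).Prime)
    (hrr : ∀ i < n, r i ≠ r (i + 1))
    (hPM : ∀ i < n, P i ≤ M i) (hP : ∀ i < n, IsPGroup (r i) (P i))
    (hPn : ∀ i j, i < j → j < n → P j ≤ normalizer (P i : Set G)) (hPX : ∀ i < n, P i ≤ X)
    (hPN : ∀ i < n, ¬ P i ≤ N i)
    (hact : ∀ i < n, ∀ g ∈ M (i + 1), (∀ x ∈ P i, ⁅x, g⁆ ∈ N i) → g ∈ N (i + 1)) (k : ℕ) :
    ∀ i, i + k < n → ∃ x ∈ P i, x ∈ cres^[k] X ∧ x ∉ N i := by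
  induction k with
  | zero =>
    intro i hi
    obtain ⟨x, hx, hxN⟩ := SetLike.not_le_iff_exists.1 (hPN i hi)
    exact ⟨x, hx, hPX i hi hx, hxN⟩
  | succ k ih =>
    intro i hi
    have hi' : i < n := by omega
    have hi1 : i + 1 < n := by omega
    have hNi := hN i hi'
    have hpel : ∀ j < n, ∀ x ∈ P j, PEl (r j) x := fun j hj x hx => PEl.of_mem (hP j hj) hx
    obtain ⟨w, hwP, hwW, hwN⟩ := ih (i + 1) (by omega)
    have hwn : w ∈ normalizer (P i : Set G) := hPn i (i + 1) (by omega) hi1 hwP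
    have hcP : ∀ b ∈ P i, ⁅b, w⁆ ∈ P i := fun b hb => by
      have := (P i).mul_mem hb (conj_mem_of_mem_normalizer hwn ((P i).inv_mem hb))
      rw [commutatorElement_def]
      convert this using 1
      group
    obtain ⟨b, hb, hbN⟩ : ∃ b ∈ P i, ⁅⁅b, w⁆, w⁆ ∉ N i := by
      by_contra hcon
      push Not at hcon
      refine hwN (hact i hi' w (hPM _ hi1 hwP) fun b hb => ?_)
      have h1 := commutator_eq_one_of_coprime_pEl (b := QuotientGroup.mk' (N i) b)
        (w := QuotientGroup.mk' (N i) w) (hr i hi') (hr (i + 1) hi1) (hrr i hi')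
        (by rw [← map_commutatorElement]; exact (hpel i hi' _ (hcP b hb)).map _)
        ((hpel _ hi1 w hwP).map _)
        (by
          rw [← map_commutatorElement, ← map_commutatorElement]
          exact (QuotientGroup.eq_one_iff _).2 (hcon b hb))
      rw [← map_commutatorElement] at h1
      exact (QuotientGroup.eq_one_iff _).1 h1
    have hbW : ⁅b, w⁆ ∈ cres^[k] X := by
      have hn := cres_iterate_normal k (H := (⊤ : Subgroup X))
      rw [← map_subtype_cres_iterate] at hwW ⊢
      obtain ⟨w, hw, rfl⟩ := hwW
      have hbX := hPX i hi' hb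
      refine ⟨⁅(⟨b, hbX⟩ : X), w⁆, ?_, rfl⟩
      rw [commutatorElement_def]
      exact mul_mem (hn.conj_mem w hw ⟨b, hbX⟩) (inv_mem hw)
    refine ⟨_, hcP _ (hcP b hb), ?_, hbN⟩
    rw [Function.iterate_succ_apply']
    exact commutator_mem_cres hbW hwW (hr i hi') (hr _ hi1) (hrr i hi') (hpel i hi' _ (hcP b hb))
      (hpel _ hi1 w hwP)

end

section

variable {G : Type*} [Group G]

/-- A sequence of nonabelian chief factors, each avoiding the centralizers of the previous ones. -/
structure IsNonabelianChain (n : ℕ) (M N : ℕ → Subgroup G) : Prop where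
  normal_left : ∀ i < n, (M i).Normal
  normal_right : ∀ i < n, (N i).Normal
  chief : ∀ i < n, IsNonabelianChief (M i) (N i)
  le : ∀ i j, i < j → j < n → M i ≤ N j
  cent : ∀ i j, i < j → j < n → ∀ g ∈ M j, (∀ x ∈ M i, ⁅x, g⁆ ∈ N i) → g ∈ N j

theorem IsNonabelianChain.comp {n k : ℕ} {M N : ℕ → Subgroup G} (h : IsNonabelianChain n M N)
    {e : ℕ → ℕ} (he : ∀ i < k, e i < n) (he' : ∀ i j, i < j → j < k → e i < e j) :
    IsNonabelianChain k (M ∘ e) (N ∘ e) where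
  normal_left i hi := h.normal_left _ (he i hi)
  normal_right i hi := h.normal_right _ (he i hi)
  chief i hi := h.chief _ (he i hi)
  le i j hij hj := h.le _ _ (he' i j hij hj) (he j hj)
  cent i j hij hj := h.cent _ _ (he' i j hij hj) (he j hj)

theorem IsNonabelianChain.le_of_primes {m S : ℕ}
    (hS : ∀ (K : Type) [Group K] [Finite K] [Group.IsSolvable K], (∀ g : K, g ^ m = 1) →
      cres^[S] (⊤ : Subgroup K) = ⊥)
    {G : Type} [Group G] [Finite G] (hG : ∀ g : G, g ^ m = 1) {n : ℕ} {M N : ℕ → Subgroup G}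
    (h : IsNonabelianChain (n + 1) M N)
    (hpr : ∀ i j, i ≤ n → j ≤ n → ∀ q : ℕ, q.Prime → PrimeIn q (M i) (N i) →
      PrimeIn q (M j) (N j)) : n ≤ S := by
  by_contra hnS
  push Not at hnS
  obtain ⟨r, hr⟩ := exists_descending_choice (α := {p : ℕ // p.Prime}) (R := fun a b => a ≠ b)
    ⟨2, Nat.prime_two⟩ n
    (Q := fun i a => ActsFaithfully (a : ℕ) (M i) (N i) (M (i + 1)) (N (i + 1)))
    fun i hi b => by
      have := h.normal_left i (by omega)
      have := h.normal_right i (by omega)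
      have := h.normal_left (i + 1) (by omega)
      have := h.normal_right (i + 1) (by omega)
      obtain ⟨a, ha, hab, hact⟩ := exists_prime_actsFaithfully (h.chief i (by omega))
        (h.chief (i + 1) (by omega)) (h.le i (i + 1) (by omega) (by omega))
        (fun g hg => h.cent i (i + 1) (by omega) (by omega) g hg.2 (mem_sectionCentralizer.1 hg.1))
        (hpr i (i + 1) (by omega) (by omega)) b.2
      exact ⟨⟨a, ha⟩, hact, fun h => hab (congrArg Subtype.val h)⟩
  obtain ⟨P, H, hP, hPn⟩ := exists_tower n (M := M) (N := N) (r := fun i => r i) (H := ⊤)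
    (fun i hi => h.normal_left i (by omega)) (fun i hi => h.normal_right i (by omega))
    (fun i _ => (r i).2) (fun i hi => (h.chief i (by omega)).lt.le)
    (fun i j hij hj => h.le i j hij (by omega)) (fun i hi x _ => ⟨1, one_mem _, mem_top _⟩)
  have hPs : ∀ i < n, Group.IsSolvable (P i) := fun i hi => by
    have := Fact.mk (r i).2
    have := (hP i hi).2.1.2.1.isNilpotent
    infer_instance
  obtain ⟨X, hX, hPX, -⟩ := exists_isSolvable_of_le_normalizer n hPs hPn
  have hact := fun i (hi : i < n) => (hr i hi).1 _ (hP i hi).1 _ (hP i hi).2.1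
  obtain ⟨x, -, hx, hxN⟩ := exists_mem_cres_iterate
    (fun i hi => h.normal_right i (by omega))
    (fun i _ => (r i).2) (fun i hi heq => (hr i hi).2 (Subtype.ext heq))
    (fun i hi => (hP i hi).2.1.1.trans inf_le_left) (fun i hi => (hP i hi).2.1.2.1) hPn hPX
    (fun i hi => (hact i hi).1) (fun i hi => (hact i hi).2) S 0 (by omega)
  rw [← map_subtype_cres_iterate, hS X fun g => Subtype.ext (hG g), Subgroup.map_bot, mem_bot] at hx
  exact hxN (hx ▸ one_mem _)

theorem exists_bound_of_isNonabelianChain (m : ℕ) (hm : 0 < m) :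
    ∃ ν : ℕ, ∀ (G : Type) [Group G] [Finite G], (∀ g : G, g ^ m = 1) → ∀ n M N,
      IsNonabelianChain (G := G) n M N → n ≤ ν := by
  classical
  obtain ⟨S, hS⟩ := exists_cres_bound_of_exponent m hm
  refine ⟨2 ^ m.primeFactors.card * (S + 1), fun G _ _ hG n M N h => ?_⟩
  by_contra hn
  push Not at hn
  let color : ℕ → Finset ℕ := fun i => m.primeFactors.filter fun q => PrimeIn q (M i) (N i)
  obtain ⟨c, -, hc⟩ := Finset.exists_lt_card_fiber_of_mul_lt_card_of_maps_to
    (s := Finset.range n) (t := m.primeFactors.powerset) (f := color) (n := S + 1)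
    (fun i _ => Finset.mem_powerset.2 (Finset.filter_subset _ _))
    (by rwa [Finset.card_powerset, Finset.card_range])
  set s := {i ∈ Finset.range n | color i = c} with hs
  have hfin : (Set.ofPred (· ∈ s)).Finite := s.finite_toSet
  have hcard : hfin.toFinset.card = s.card := by
    congr 1
    ext x
    exact hfin.mem_toFinset
  let e : ℕ → ℕ := Nat.nth (· ∈ s)
  have hes : ∀ i < S + 2, e i ∈ s := fun i hi =>
    Nat.nth_mem_of_lt_card hfin (by rw [hcard]; omega)
  have he : ∀ i j, i < j → j < S + 2 → e i < e j := fun i j hij hj =>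
    Nat.nth_lt_nth_of_lt_card hfin hij (by rw [hcard]; omega)
  have hlt : ∀ i < S + 2, e i < n := fun i hi =>
    Finset.mem_range.1 (Finset.mem_filter.1 (hes i hi)).1
  have hcol : ∀ i < S + 2, color (e i) = c := fun i hi => (Finset.mem_filter.1 (hes i hi)).2
  have := (h.comp hlt he).le_of_primes (n := S + 1) hS hG fun i j hi hj q hq hqi => by
    have hqm : q ∈ m.primeFactors := by
      obtain ⟨x, -, ⟨k, hk⟩, hxN⟩ := hqi
      refine Nat.mem_primeFactors.2 ⟨hq, ?_, hm.ne'⟩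
      obtain ⟨l, -, hl⟩ := (Nat.dvd_prime_pow hq).1 (orderOf_dvd_of_pow_eq_one hk)
      have h1 : orderOf x ∣ m := orderOf_dvd_of_pow_eq_one (hG x)
      rcases l with _ | l
      · rw [pow_zero, orderOf_eq_one_iff] at hl
        exact (hxN (hl ▸ one_mem _)).elim
      · exact ((dvd_pow_self q l.succ_ne_zero).trans hl.symm.dvd).trans h1
    have h1 : q ∈ color (e i) := Finset.mem_filter.2 ⟨hqm, hqi⟩
    rw [hcol i (by omega), ← hcol j (by omega)] at h1
    exact (Finset.mem_filter.1 h1).2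
  omega

end

section

theorem isNilpotent_of_cres_eq_bot {G : Type*} [Group G] [Finite G]
    (h : cres (⊤ : Subgroup G) = ⊥) : Group.IsNilpotent G := by
  refine ((Group.isNilpotent_of_finite_tfae (G := G)).out 0 3).2 fun p hp P => ?_
  rw [← normalizer_eq_top_iff, ← index_eq_one]
  by_contra h1
  obtain ⟨r, hr, hdvd⟩ := Nat.exists_prime_and_dvd h1
  have := Fact.mk hr
  have hle : ∃ R : Sylow r G, (R : Subgroup G) ≤ normalizer ((P : Subgroup G) : Set G) := by
    by_cases hrp : r = p
    · subst hrp
      exact ⟨P, le_normalizer⟩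
    · obtain ⟨R⟩ := (inferInstance : Nonempty (Sylow r G))
      refine ⟨R, fun x hx => mem_normalizer_of_conj fun y hy => ?_⟩
      have h2 : ⁅x, y⁆ ∈ cres (⊤ : Subgroup G) := commutator_mem_cres (mem_top x) (mem_top y)
        hr hp.out hrp (PEl.of_mem R.2 hx) (PEl.of_mem P.2 hy)
      rw [h, mem_bot, commutatorElement_eq_one_iff_mul_comm] at h2
      rwa [h2, mul_inv_cancel_right]
  obtain ⟨R, hR⟩ := hle
  exact R.not_dvd_index (hdvd.trans (index_dvd_of_le hR))

/-- `M / N` is nilpotent or semisimple. -/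
def IsStep {G : Type} [Group G] (N M : Subgroup G) : Prop :=
  ∃ (F : Type) (_ : Group F) (φ : M →* F), Function.Surjective φ ∧ φ.ker = N.subgroupOf M ∧
    (Group.IsNilpotent F ∨ IsSemisimpleGroup' F)

/-- A series of normal subgroups from `A` to `B` with nilpotent or semisimple factors. -/
def HasSeries {G : Type} [Group G] (n : ℕ) (A B : Subgroup G) : Prop :=
  ∃ c : ℕ → Subgroup G, c 0 = A ∧ c n = B ∧ (∀ i ≤ n, (c i).Normal) ∧
    ∀ i < n, c i ≤ c (i + 1) ∧ IsStep (c i) (c (i + 1))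

variable {G : Type} [Group G]

theorem HasSeries.hasNilpotentSemisimpleChain {n : ℕ} (h : HasSeries n (⊥ : Subgroup G) ⊤) :
    HasNilpotentSemisimpleChain G n := by
  obtain ⟨c, h0, hn, hnor, hstep⟩ := h
  refine ⟨fun i => c i, Fin.monotone_iff_le_succ.2 fun i => (hstep i i.2).1, h0, hn,
    fun i => hnor i (Nat.lt_succ_iff.1 i.2), fun i => (hstep i i.2).2⟩

theorem HasSeries.trans {k n : ℕ} {A B C : Subgroup G} (h : HasSeries k A B)
    (h' : HasSeries n B C) : HasSeries (k + n) A C := by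
  obtain ⟨c, h0, hn, hnor, hstep⟩ := h
  obtain ⟨c', h0', hn', hnor', hstep'⟩ := h'
  have key : ∀ i, (fun i => if i ≤ k then c i else c' (i - k)) (k + i) = c' i := fun i => by
    rcases i with _ | i
    · simp [hn, h0']
    · simp
  refine ⟨fun i => if i ≤ k then c i else c' (i - k), by simp [h0], by rw [key, hn'],
    fun i hi => ?_, fun i hi => ?_⟩
  · rcases le_or_gt i k with h1 | h1
    · simpa only [if_pos h1] using hnor i h1
    · obtain ⟨j, rfl⟩ := Nat.exists_eq_add_of_le h1.le
      rw [key]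
      exact hnor' j (by omega)
  · rcases lt_or_ge i k with h1 | h1
    · simpa only [if_pos h1.le, if_pos (show i + 1 ≤ k from h1)] using hstep i h1
    · obtain ⟨j, rfl⟩ := Nat.exists_eq_add_of_le h1
      rw [add_assoc, key, key]
      exact hstep' j (by omega)

theorem hasSeries_one {A B : Subgroup G} [hA : A.Normal] [hB : B.Normal] (hAB : A ≤ B)
    (h : IsStep A B) : HasSeries 1 A B := by
  refine ⟨fun i => if i = 0 then A else B, rfl, rfl, fun i _ => ?_, fun i hi => ?_⟩
  · rcases i with _ | i
    · exact hA
    · exact hB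
  · obtain rfl : i = 0 := by omega
    exact ⟨hAB, h⟩

theorem IsStep.comap {Q : Type} [Group Q] {f : G →* Q} (hf : Function.Surjective f)
    {A B : Subgroup Q} (h : IsStep A B) : IsStep (A.comap f) (B.comap f) := by
  obtain ⟨F, _, φ, hφ, hker, hF⟩ := h
  refine ⟨F, _, φ.comp (f.subgroupComap B),
    hφ.comp (f.subgroupComap_surjective_of_surjective B hf), ?_, hF⟩
  rw [← MonoidHom.comap_ker, hker]
  rfl

theorem HasSeries.comap {Q : Type} [Group Q] {f : G →* Q} (hf : Function.Surjective f) {n : ℕ}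
    {A B : Subgroup Q} (h : HasSeries n A B) : HasSeries n (A.comap f) (B.comap f) := by
  obtain ⟨c, h0, hn, hnor, hstep⟩ := h
  refine ⟨fun i => (c i).comap f, congrArg _ h0, congrArg _ hn, fun i hi => (hnor i hi).comap f,
    fun i hi => ⟨comap_mono (hstep i hi).1, (hstep i hi).2.comap hf⟩⟩

theorem isStep_cres [Finite G] (H : Subgroup G) [H.Normal] : IsStep (cres H) H := by
  have hn : (cres H).Normal := cres_iterate_normal 1
  let π := QuotientGroup.mk' ((cres H).subgroupOf H)
  have hπ : Function.Surjective π := QuotientGroup.mk'_surjective _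
  refine ⟨_, inferInstance, π, hπ, QuotientGroup.ker_mk' _, .inl (isNilpotent_of_cres_eq_bot ?_)⟩
  rw [← map_top_of_surjective π hπ, ← map_cres, ← le_bot_iff, map_le_iff_le_comap,
    MonoidHom.comap_bot, QuotientGroup.ker_mk', subgroupOf, ← map_le_iff_le_comap, map_cres,
    ← MonoidHom.range_eq_map, range_subtype]

theorem hasSeries_cres [Finite G] (n : ℕ) (H : Subgroup G) [H.Normal] :
    HasSeries n (cres^[n] H) H := by
  refine ⟨fun i => cres^[n - i] H, by simp, by simp, fun i _ => cres_iterate_normal _,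
    fun i hi => ?_⟩
  have := cres_iterate_normal (n - (i + 1)) (H := H)
  have h1 : n - i = n - (i + 1) + 1 := by omega
  simp only [h1, Function.iterate_succ_apply']
  exact ⟨cres_le _, isStep_cres _⟩

end

section

variable {Q : Type} [Group Q]

theorem isSemisimpleGroup_iSup [Finite Q] {ι : Type} [Finite ι] (A : ι → Subgroup Q)
    (hs : ∀ i, IsSimpleGroup (A i)) (hc : ∀ i, ¬ ⁅A i, A i⁆ = ⊥)
    (hcomm : ∀ i j, i ≠ j → ⁅A i, A j⁆ = ⊥) : IsSemisimpleGroup' (⨆ i, A i : Subgroup Q) := by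
  let _ := Fintype.ofFinite ι
  have hcm : Pairwise fun i j : ι => ∀ x y : Q, x ∈ A i → y ∈ A j → Commute x y :=
    fun i j hij x y hx hy => commutatorElement_eq_one_iff_mul_comm.1
      (mem_bot.1 (hcomm i j hij ▸ commutator_mem_commutator hx hy))
  have hind : iSupIndep A := fun i => by
    have hle : ⨆ (j) (_ : j ≠ i), A j ≤ centralizer (A i : Set Q) :=
      iSup₂_le fun j hj y hy => mem_centralizer_iff.2 fun x hx => hcm hj.symm x y hx hy
    rw [disjoint_iff]
    by_contra hne
    have hN : (centralizer (A i : Set Q)).subgroupOf (A i) = ⊤ := by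
      have hn : ((centralizer (A i : Set Q)).subgroupOf (A i)).Normal :=
        ⟨fun x hx g => by
          have h1 : (g : Q) * x = x * g := mem_centralizer_iff.1 hx g g.2
          have h2 : g * x * g⁻¹ = x := Subtype.ext (by simp [h1])
          rwa [h2]⟩
      refine ((hs i).eq_bot_or_eq_top_of_normal _ hn).resolve_left fun h1 => hne ?_
      rw [eq_bot_iff]
      rintro x ⟨hx, hx'⟩
      have h2 : (⟨x, hx⟩ : A i) ∈ (centralizer (A i : Set Q)).subgroupOf (A i) := hle hx'
      rw [h1, mem_bot] at h2
      exact congrArg Subtype.val h2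
    refine hc i ((commutator_eq_bot_iff_le_centralizer).2 ?_)
    exact subgroupOf_eq_top.1 hN
  refine ⟨ι, inferInstance, fun i => A i, fun i => inferInstance, hs, fun i => ?_, ⟨?_⟩⟩
  · by_contra hcon
    push Not at hcon
    refine hc i (eq_bot_iff.2 (commutator_le.2 fun x hx y hy => mem_bot.2
      (commutatorElement_eq_one_iff_mul_comm.2 (congrArg Subtype.val (hcon ⟨x, hx⟩ ⟨y, hy⟩)))))
  · exact ((MulEquiv.subgroupCongr (noncommPiCoprod_range (hcomm := hcm)).symm).trans
      (MonoidHom.ofInjective (injective_noncommPiCoprod_of_iSupIndep hind)).symm)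

/-- `L` is a minimal normal subgroup. -/
def IsMinNormal (L : Subgroup Q) : Prop :=
  L.Normal ∧ L ≠ ⊥ ∧ ∀ K : Subgroup Q, K.Normal → K ≤ L → K = ⊥ ∨ K = L

theorem exists_isMinNormal [Finite Q] {K : Subgroup Q} (hK : K.Normal) (hne : K ≠ ⊥) :
    ∃ L, IsMinNormal L ∧ L ≤ K := by
  obtain ⟨L, hL⟩ := Set.Finite.exists_minimal
    (s := {L : Subgroup Q | L.Normal ∧ L ≠ ⊥ ∧ L ≤ K}) (Set.toFinite _) ⟨K, hK, hne, le_rfl⟩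
  refine ⟨L, ⟨hL.1.1, hL.1.2.1, fun J hJ hJL => ?_⟩, hL.1.2.2⟩
  by_cases hJb : J = ⊥
  · exact .inl hJb
  · exact .inr (le_antisymm hJL (hL.2 ⟨hJ, hJb, hJL.trans hL.1.2.2⟩ hJL))

theorem IsMinNormal.commutator_eq_bot {L L' : Subgroup Q} (h : IsMinNormal L) (h' : IsMinNormal L')
    (hne : L ≠ L') : ⁅L, L'⁆ = ⊥ := by
  have := h.1
  have := h'.1
  have hle : ⁅L, L'⁆ ≤ L ⊓ L' := commutator_le_inf L L'
  rcases h.2.2 (L ⊓ L') inferInstance inf_le_left with h1 | h1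
  · exact eq_bot_iff.2 (hle.trans h1.le)
  rcases h'.2.2 (L ⊓ L') inferInstance inf_le_right with h2 | h2
  · exact eq_bot_iff.2 (hle.trans h2.le)
  · exact (hne (h1.symm.trans h2)).elim

/-- `A` is a minimal normal subgroup of `L`. -/
def IsMinNormalIn (L A : Subgroup Q) : Prop :=
  A ≤ L ∧ L ≤ normalizer (A : Set Q) ∧ A ≠ ⊥ ∧
    ∀ K : Subgroup Q, L ≤ normalizer (K : Set Q) → K ≤ A → K = ⊥ ∨ K = A

theorem exists_isMinNormalIn [Finite Q] {L : Subgroup Q} (hne : L ≠ ⊥) :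
    ∃ A, IsMinNormalIn L A := by
  obtain ⟨A, hA⟩ := Set.Finite.exists_minimal
    (s := {A : Subgroup Q | A ≤ L ∧ L ≤ normalizer (A : Set Q) ∧ A ≠ ⊥}) (Set.toFinite _)
    ⟨L, le_rfl, le_normalizer, hne⟩
  refine ⟨A, hA.1.1, hA.1.2.1, hA.1.2.2, fun J hJ hJL => ?_⟩
  by_cases hJb : J = ⊥
  · exact .inl hJb
  · exact .inr (le_antisymm hJL (hA.2 ⟨hJL.trans hA.1.1, hJ, hJb⟩ hJL))

theorem commutator_le_inf_of_le_normalizer {A B : Subgroup Q} (hA : B ≤ normalizer (A : Set Q))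
    (hB : A ≤ normalizer (B : Set Q)) : ⁅A, B⁆ ≤ A ⊓ B := by
  refine commutator_le.2 fun a ha b hb => ⟨?_, ?_⟩
  · rw [commutatorElement_def, mul_assoc, mul_assoc, ← mul_assoc b]
    exact A.mul_mem ha (conj_mem_of_mem_normalizer (hA hb) (A.inv_mem ha))
  · rw [commutatorElement_def]
    exact B.mul_mem (conj_mem_of_mem_normalizer (hB ha) hb) (B.inv_mem hb)

theorem IsMinNormalIn.commutator_eq_bot [Finite Q] {L A B : Subgroup Q} (h : IsMinNormalIn L A)
    (h' : IsMinNormalIn L B) (hne : A ≠ B) : ⁅A, B⁆ = ⊥ := by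
  have hle := commutator_le_inf_of_le_normalizer (h'.1.trans h.2.1) (h.1.trans h'.2.1)
  have hn : L ≤ normalizer ((A ⊓ B : Subgroup Q) : Set Q) := fun x hx =>
    mem_normalizer_of_conj fun y hy => ⟨conj_mem_of_mem_normalizer (h.2.1 hx) hy.1,
      conj_mem_of_mem_normalizer (h'.2.1 hx) hy.2⟩
  rcases h.2.2.2 (A ⊓ B) hn inf_le_left with h1 | h1
  · exact eq_bot_iff.2 (hle.trans h1.le)
  rcases h'.2.2.2 (A ⊓ B) hn inf_le_right with h2 | h2
  · exact eq_bot_iff.2 (hle.trans h2.le)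
  · exact (hne (h1.symm.trans h2)).elim

end

section

variable {Q : Type} [Group Q]

theorem le_normalizer_conjSub [Finite Q] {L A : Subgroup Q} [hL : L.Normal]
    (h : L ≤ normalizer (A : Set Q)) (g : Q) : L ≤ normalizer (conjSub g A : Set Q) :=
  fun y hy => mem_normalizer_of_conj fun x hx => by
    rw [mem_conjSub] at hx ⊢
    have h1 := conj_mem_of_mem_normalizer (h (hL.conj_mem y hy g⁻¹)) hx
    convert h1 using 1
    group

theorem IsMinNormalIn.conjSub [Finite Q] {L A : Subgroup Q} [hL : L.Normal]
    (h : IsMinNormalIn L A) (g : Q) : IsMinNormalIn L (conjSub g A) := by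
  have hcL : ∀ x, _root_.conjSub x L = L := fun x => by
    ext y
    rw [mem_conjSub]
    exact ⟨fun hy => by simpa [mul_assoc] using hL.conj_mem _ hy x,
      fun hy => by simpa using hL.conj_mem _ hy x⁻¹⟩
  refine ⟨(conjSub_mono h.1).trans (hcL g).le, le_normalizer_conjSub h.2.1 g, fun h1 =>
    h.2.2.1 ((map_eq_bot_iff_of_injective _ (MulAut.conj g).injective).1 h1), fun K hK hKA => ?_⟩
  have h2 : _root_.conjSub g⁻¹ K ≤ A := by rwa [conjSub_le_iff, inv_inv]
  have h3 : K = _root_.conjSub g (_root_.conjSub g⁻¹ K) := by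
    rw [conjSub_conjSub, mul_inv_cancel, conjSub_one]
  rcases h.2.2.2 _ (le_normalizer_conjSub hK g⁻¹) h2 with h1 | h1
  · exact .inl (by rw [h3, h1]; exact Subgroup.map_bot _)
  · exact .inr (by rw [h3, h1])

theorem IsMinNormal.le_of_conjSub_le {L A X : Subgroup Q} (hL : IsMinNormal L)
    (hA : IsMinNormalIn L A) (h : ∀ g, conjSub g A ≤ X) : L ≤ X := by
  have := hL.1
  have h1 : normalClosure (A : Set Q) = L :=
    (hL.2.2 _ inferInstance (normalClosure_le_normal hA.1)).resolve_left fun h1 =>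
      hA.2.2.1 (eq_bot_iff.2 (le_normalClosure.trans h1.le))
  rw [← h1, normalClosure, closure_le]
  intro x hx
  obtain ⟨a, ha, hax⟩ := Group.mem_conjugatesOfSet_iff.1 hx
  obtain ⟨g, rfl⟩ := isConj_iff.1 hax
  exact h g (mem_map_of_mem (MulAut.conj g).toMonoidHom ha)

theorem IsMinNormal.isSimpleGroup [Finite Q] {L A : Subgroup Q} (hL : IsMinNormal L)
    (hA : IsMinNormalIn L A) : IsSimpleGroup A := by
  have := hL.1
  have : Nontrivial A := (nontrivial_iff_ne_bot A).2 hA.2.2.1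
  refine ⟨fun H hH => ?_⟩
  have hHA : H.map A.subtype ≤ A := map_subtype_le H
  have hAn : A ≤ normalizer (H.map A.subtype : Set Q) := fun a ha =>
    mem_normalizer_of_conj fun x hx => by
      obtain ⟨x, hx, rfl⟩ := hx
      exact ⟨_, hH.conj_mem x hx ⟨a, ha⟩, rfl⟩
  have hLn : L ≤ normalizer (H.map A.subtype : Set Q) := hL.le_of_conjSub_le hA fun g => by
    by_cases hg : A = conjSub g A
    · rwa [← hg]
    · have h1 := commutator_eq_bot_iff_le_centralizer.1
        ((hA.conjSub g).commutator_eq_bot hA (Ne.symm hg))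
      exact h1.trans ((centralizer_le hHA).trans (centralizer_le_normalizer _))
  rcases hA.2.2.2 _ hLn hHA with h1 | h1
  · exact .inl ((map_eq_bot_iff_of_injective _ (subtype_injective A)).1 h1)
  · refine .inr (map_injective (subtype_injective A) ?_)
    rw [h1, ← MonoidHom.range_eq_map, range_subtype]

theorem IsMinNormal.not_commutator_eq_bot [Finite Q] {L A : Subgroup Q} (hL : IsMinNormal L)
    (hA : IsMinNormalIn L A) (h : ¬ ⁅L, L⁆ = ⊥) : ¬ ⁅A, A⁆ = ⊥ := fun hAA => by
  have := hL.1
  have h1 : L ≤ centralizer (A : Set Q) := hL.le_of_conjSub_le hA fun g => by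
    rw [← commutator_eq_bot_iff_le_centralizer]
    by_cases hg : A = conjSub g A
    · rwa [← hg]
    · exact (hA.conjSub g).commutator_eq_bot hA (Ne.symm hg)
  rw [le_centralizer_iff] at h1
  refine (hL.2.2 (centralizer (L : Set Q) ⊓ L) inferInstance inf_le_right).elim (fun h2 => ?_)
    fun h2 => h (commutator_eq_bot_iff_le_centralizer.2 (inf_eq_right.1 h2))
  exact hA.2.2.1 (eq_bot_iff.2 ((le_inf h1 hA.1).trans h2.le))

theorem exists_semisimple_socle [Finite Q] (hQ : ∀ L : Subgroup Q, IsMinNormal L → ¬ ⁅L, L⁆ = ⊥) :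
    ∃ T : Subgroup Q, T.Normal ∧ (∀ L, IsMinNormal L → L ≤ T) ∧ IsSemisimpleGroup' T := by
  let ι := {A : Subgroup Q // ∃ L, IsMinNormal L ∧ IsMinNormalIn L A}
  let A : ι → Subgroup Q := Subtype.val
  have hconj : ∀ (L B : Subgroup Q), IsMinNormal L → IsMinNormalIn L B → ∀ g,
      conjSub g B ≤ ⨆ i, A i := fun L B hL hB g => by
    have := hL.1
    exact le_iSup A ⟨conjSub g B, L, hL, hB.conjSub g⟩
  refine ⟨⨆ i, A i, ⟨fun x hx g => ?_⟩, fun L hL => ?_,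
    isSemisimpleGroup_iSup A (fun i => ?_) (fun i => ?_) fun i j hij => ?_⟩
  · have h1 : (⨆ i, A i).map (MulAut.conj g).toMonoidHom ≤ ⨆ i, A i := by
      rw [Subgroup.map_iSup]
      refine iSup_le fun i => ?_
      obtain ⟨L, hL, hA⟩ := i.2
      exact hconj L _ hL hA g
    exact h1 (mem_map_of_mem _ hx)
  · obtain ⟨B, hB⟩ := exists_isMinNormalIn hL.2.1
    exact hL.le_of_conjSub_le hB (hconj L B hL hB)
  · obtain ⟨L, hL, hA⟩ := i.2
    exact hL.isSimpleGroup hA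
  · obtain ⟨L, hL, hA⟩ := i.2
    exact hL.not_commutator_eq_bot hA (hQ L hL)
  · obtain ⟨L, hL, hA⟩ := i.2
    obtain ⟨L', hL', hA'⟩ := j.2
    by_cases hLL : L = L'
    · subst hLL
      exact hA.commutator_eq_bot hA' fun h => hij (Subtype.ext h)
    · exact eq_bot_iff.2 ((commutator_mono hA.1 hA'.1).trans
        (hL.commutator_eq_bot hL' hLL).le)

end

section

variable {Q : Type} [Group Q]

theorem IsNonabelianChief.comap {G : Type*} [Group G] {f : G →* Q} (hf : Function.Surjective f)
    {M N : Subgroup Q} (h : IsNonabelianChief M N) :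
    IsNonabelianChief (M.comap f) (N.comap f) := by
  refine ⟨(comap_lt_comap_of_surjective hf).2 h.lt, fun K hK hNK hKM => ?_, fun hcon => ?_⟩
  · have hker : f.ker ≤ K := (f.ker_le_comap N).trans hNK
    have hNK' : N ≤ K.map f := by
      rw [← map_comap_eq_self_of_surjective hf N]
      exact Subgroup.map_mono hNK
    rcases h.chief (K.map f) (hK.map f hf) hNK' (map_le_iff_le_comap.2 hKM) with h1 | h1
    · exact .inl (by rw [← h1, comap_map_eq_self hker])
    · exact .inr (by rw [← h1, comap_map_eq_self hker])
  · apply h.nonabelian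
    have h1 := map_le_iff_le_comap.2 hcon
    rwa [map_commutator, map_comap_eq_self_of_surjective hf] at h1

theorem IsNonabelianChain.comap {G : Type*} [Group G] {f : G →* Q} (hf : Function.Surjective f)
    {n : ℕ} {M N : ℕ → Subgroup Q} (h : IsNonabelianChain n M N) :
    IsNonabelianChain n (fun i => (M i).comap f) fun i => (N i).comap f where
  normal_left i hi := (h.normal_left i hi).comap f
  normal_right i hi := (h.normal_right i hi).comap f
  chief i hi := (h.chief i hi).comap hf
  le i j hij hj := comap_mono (h.le i j hij hj)
  cent i j hij hj g hg hx := h.cent i j hij hj (f g) hg fun y hy => by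
    obtain ⟨x, rfl⟩ := hf y
    rw [← map_commutatorElement]
    exact hx x hy

theorem IsMinNormal.isNonabelianChief {L : Subgroup Q} (hL : IsMinNormal L) (h : ¬ ⁅L, L⁆ = ⊥) :
    IsNonabelianChief L ⊥ :=
  ⟨bot_lt_iff_ne_bot.2 hL.2.1, fun K hK _ hKL => hL.2.2 K hK hKL, fun h1 => h (eq_bot_iff.2 h1)⟩

theorem IsNonabelianChain.cons {n : ℕ} {M N : ℕ → Subgroup Q} (h : IsNonabelianChain n M N)
    {L : Subgroup Q} (hL : IsMinNormal L) (hLL : ¬ ⁅L, L⁆ = ⊥) (hLN : ∀ i < n, L ≤ N i)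
    (hc : 0 < n → centralizer (L : Set Q) ⊓ M 0 ≤ N 0) :
    IsNonabelianChain (n + 1) (fun i => i.casesOn L M) fun i => i.casesOn ⊥ N where
  normal_left i hi := by
    rcases i with _ | i
    · exact hL.1
    · exact h.normal_left i (by omega)
  normal_right i hi := by
    rcases i with _ | i
    · exact inferInstanceAs (⊥ : Subgroup Q).Normal
    · exact h.normal_right i (by omega)
  chief i hi := by
    rcases i with _ | i
    · exact hL.isNonabelianChief hLL
    · exact h.chief i (by omega)
  le i j hij hj := by
    rcases j with _ | j
    · omega
    rcases i with _ | i
    · exact hLN j (by omega)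
    · exact h.le i j (by omega) (by omega)
  cent i j hij hj g hg hx := by
    have := hL.1
    rcases j with _ | j
    · omega
    rcases i with _ | i
    · have hgL : g ∈ centralizer (L : Set Q) := mem_centralizer_iff.2 fun x hxL =>
        commutatorElement_eq_one_iff_mul_comm.1 (mem_bot.1 (hx x hxL))
      rcases j with _ | j
      · exact hc (by omega) ⟨hgL, hg⟩
      · refine h.cent 0 (j + 1) (by omega) (by omega) g hg fun x hxM => hc (by omega) ?_
        have := h.normal_left 0 (by omega)
        have h1 := commutator_le_inf (M 0) (centralizer (L : Set Q))
          (commutator_mem_commutator hxM hgL)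
        exact ⟨h1.2, h1.1⟩
    · exact h.cent i j (by omega) (by omega) g hg hx

theorem IsNonabelianChief.not_inf_le {M N K K' : Subgroup Q} [N.Normal] [K.Normal] [K'.Normal]
    (h : IsNonabelianChief M N) (hKM : K ≤ M) (hKM' : K' ≤ M) (hK : ¬ K ≤ N) (hK' : ¬ K' ≤ N) :
    ¬ K ⊓ K' ≤ N := fun hle => by
  have key : ∀ J : Subgroup Q, J.Normal → J ≤ M → ¬ J ≤ N →
      J.map (QuotientGroup.mk' N) = M.map (QuotientGroup.mk' N) := fun J _ hJM hJ => by
    have h1 := (h.chief (J ⊔ N) inferInstance le_sup_right (sup_le hJM h.lt.le)).resolve_left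
      fun h1 => hJ (le_sup_left.trans h1.le)
    rw [← h1, Subgroup.map_sup, QuotientGroup.map_mk'_self, sup_bot_eq]
  apply h.nonabelian
  have h2 : (⁅K, K'⁆).map (QuotientGroup.mk' N) ≤ ⊥ := by
    rw [map_le_iff_le_comap, MonoidHom.comap_bot, QuotientGroup.ker_mk']
    exact (commutator_le_inf K K').trans hle
  rw [map_commutator, key K inferInstance hKM hK, key K' inferInstance hKM' hK', ← map_commutator,
    map_le_iff_le_comap, MonoidHom.comap_bot, QuotientGroup.ker_mk'] at h2
  exact h2

theorem IsNonabelianChief.exists_centralizer_inf_le [Finite Q]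
    (hQ : ∀ L : Subgroup Q, IsMinNormal L → ¬ ⁅L, L⁆ = ⊥) {M N : Subgroup Q} [M.Normal] [N.Normal]
    (h : IsNonabelianChief M N) : ∃ L : Subgroup Q, IsMinNormal L ∧ centralizer (L : Set Q) ⊓ M ≤ N := by
  by_contra hcon
  push Not at hcon
  obtain ⟨K, hK⟩ := Set.Finite.exists_minimal
    (s := {K : Subgroup Q | K.Normal ∧ K ≤ M ∧ ¬ K ≤ N}) (Set.toFinite _)
    ⟨M, inferInstance, le_rfl, h.lt.not_ge⟩
  have := hK.1.1
  obtain ⟨L, hL, hLK⟩ := exists_isMinNormal hK.1.1 fun h1 => hK.1.2.2 (h1.trans_le bot_le)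
  have := hL.1
  have h1 := h.not_inf_le inf_le_right hK.1.2.1 (hcon L hL) hK.1.2.2
  have h2 := hK.2 ⟨inferInstance, inf_le_right.trans hK.1.2.1, h1⟩ inf_le_right
  exact hQ L hL (commutator_eq_bot_iff_le_centralizer.2
    (hLK.trans (h2.trans (inf_le_left.trans inf_le_left))))

theorem IsNonabelianChain.exists_cons [Finite Q] [Nontrivial Q]
    (hQ : ∀ L : Subgroup Q, IsMinNormal L → ¬ ⁅L, L⁆ = ⊥) {T : Subgroup Q}
    (hT : ∀ L, IsMinNormal L → L ≤ T) {n : ℕ} {M N : ℕ → Subgroup Q}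
    (h : IsNonabelianChain n M N) (hTN : ∀ i < n, T ≤ N i) :
    ∃ M' N' : ℕ → Subgroup Q, IsNonabelianChain (n + 1) M' N' := by
  obtain ⟨L, hL, hc⟩ : ∃ L : Subgroup Q, IsMinNormal L ∧
      (0 < n → centralizer (L : Set Q) ⊓ M 0 ≤ N 0) := by
    rcases Nat.eq_zero_or_pos n with rfl | hn
    · obtain ⟨L, hL, -⟩ := exists_isMinNormal (Q := Q) (K := ⊤) inferInstance top_ne_bot
      exact ⟨L, hL, fun h => (lt_irrefl _ h).elim⟩
    · have := h.normal_left 0 hn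
      have := h.normal_right 0 hn
      obtain ⟨L, hL, hc⟩ := (h.chief 0 hn).exists_centralizer_inf_le hQ
      exact ⟨L, hL, fun _ => hc⟩
  exact ⟨_, _, h.cons hL (hQ L hL) (fun i hi => (hT L hL).trans (hTN i hi)) hc⟩

theorem exists_maximal_isSolvable (G : Type) [Group G] [Finite G] :
    ∃ R : Subgroup G, ∃ _ : R.Normal, Group.IsSolvable R ∧
      ∀ L : Subgroup (G ⧸ R), IsMinNormal L → ¬ ⁅L, L⁆ = ⊥ := by
  obtain ⟨R, hR⟩ := Set.Finite.exists_maximal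
    (s := {R : Subgroup G | R.Normal ∧ Group.IsSolvable R}) (Set.toFinite _)
    ⟨⊥, inferInstance, inferInstance⟩
  have := hR.1.1
  have := hR.1.2
  refine ⟨R, inferInstance, inferInstance, fun L hL hLL => hL.2.1 ?_⟩
  let π := QuotientGroup.mk' R
  have hπ : Function.Surjective π := QuotientGroup.mk'_surjective R
  have hLs : Group.IsSolvable L := by
    have h1 := commutator_eq_bot_iff_le_centralizer.1 hLL
    exact Group.isSolvable_of_comm fun a b => Subtype.ext (mem_centralizer_iff.1 (h1 b.2) a a.2)
  have hRL : R ≤ L.comap π := by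
    refine fun x hx => mem_comap.2 ?_
    rw [show π x = 1 from (QuotientGroup.eq_one_iff x).2 hx]
    exact one_mem L
  have hs : Group.IsSolvable (L.comap π) := by
    refine Group.isSolvable_of_ker_le_range (inclusion hRL) (π.subgroupComap L) fun x hx => ?_
    have h1 : π x = 1 := congrArg Subtype.val hx
    exact ⟨⟨x, (QuotientGroup.eq_one_iff _).1 h1⟩, rfl⟩
  have h2 := hR.2 ⟨hL.1.comap π, hs⟩ hRL
  rw [eq_bot_iff, ← map_comap_eq_self_of_surjective hπ L, map_le_iff_le_comap, MonoidHom.comap_bot,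
    QuotientGroup.ker_mk']
  exact h2

theorem exists_hasSeries_of_isNonabelianChain {m S : ℕ}
    (hS : ∀ (K : Type) [Group K] [Finite K] [Group.IsSolvable K], (∀ g : K, g ^ m = 1) →
      cres^[S] (⊤ : Subgroup K) = ⊥) {G : Type} [Group G] [Finite G] (hG : ∀ g : G, g ^ m = 1) :
    HasSeries S (⊥ : Subgroup G) ⊤ ∨
      ∃ T : Subgroup G, ∃ _ : T.Normal, HasSeries (S + 1) ⊥ T ∧
        ∀ n M N, IsNonabelianChain (G := G ⧸ T) n M N →
          ∃ M' N', IsNonabelianChain (G := G) (n + 1) M' N' := by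
  obtain ⟨R, _, _, hR⟩ := exists_maximal_isSolvable G
  have hR0 : HasSeries S ⊥ R := by
    have h1 := hasSeries_cres S R
    rwa [← map_subtype_cres_iterate, hS R fun g => Subtype.ext (hG g), Subgroup.map_bot] at h1
  by_cases hRt : R = ⊤
  · exact .inl (hRt ▸ hR0)
  have : Nontrivial (G ⧸ R) := QuotientGroup.nontrivial_iff.2 hRt
  obtain ⟨T, hTn, hTL, hTs⟩ := exists_semisimple_socle hR
  let π := QuotientGroup.mk' R
  have hπ : Function.Surjective π := QuotientGroup.mk'_surjective R
  have hT1 : HasSeries 1 (⊥ : Subgroup (G ⧸ R)) T := by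
    refine hasSeries_one bot_le ⟨T, inferInstance, MonoidHom.id T, Function.surjective_id, ?_,
      .inr hTs⟩
    rw [bot_subgroupOf, MonoidHom.ker_eq_bot_iff]
    exact Function.injective_id
  have hT2 := hT1.comap hπ
  rw [MonoidHom.comap_bot, QuotientGroup.ker_mk'] at hT2
  have hTn' : (T.comap π).Normal := hTn.comap π
  refine .inr ⟨T.comap π, hTn', hR0.trans hT2, fun n M N h => ?_⟩
  let ψ : G ⧸ R →* G ⧸ T.comap π := QuotientGroup.lift R (QuotientGroup.mk' (T.comap π))
    fun x hx => (QuotientGroup.eq_one_iff x).2 (mem_comap.2 (by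
      rw [show π x = 1 from (QuotientGroup.eq_one_iff x).2 hx]
      exact one_mem T))
  have hψ : Function.Surjective ψ := fun y => by
    obtain ⟨x, rfl⟩ := QuotientGroup.mk'_surjective _ y
    exact ⟨π x, rfl⟩
  have hTψ : ∀ t ∈ T, ψ t = 1 := fun t ht => by
    obtain ⟨x, rfl⟩ := hπ t
    exact (QuotientGroup.eq_one_iff x).2 ht
  obtain ⟨M', N', h'⟩ := (h.comap hψ).exists_cons hR hTL fun i _ t ht => mem_comap.2 (by
    rw [hTψ t ht]
    exact one_mem _)
  exact ⟨_, _, h'.comap hπ⟩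

theorem exists_hasSeries {m S : ℕ}
    (hS : ∀ (K : Type) [Group K] [Finite K] [Group.IsSolvable K], (∀ g : K, g ^ m = 1) →
      cres^[S] (⊤ : Subgroup K) = ⊥) (ν : ℕ) :
    ∀ (G : Type) [Group G] [Finite G], (∀ g : G, g ^ m = 1) →
      (∀ n M N, IsNonabelianChain (G := G) n M N → n ≤ ν) →
      ∃ n ≤ (S + 1) * (ν + 1), HasSeries n (⊥ : Subgroup G) ⊤ := by
  induction ν with
  | zero =>
    intro G _ _ hG hν
    rcases exists_hasSeries_of_isNonabelianChain hS hG with h | ⟨T, _, -, h⟩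
    · exact ⟨S, by omega, h⟩
    · obtain ⟨M, N, h1⟩ := h 0 (fun _ => ⊤) (fun _ => ⊤) (by constructor <;> intros <;> omega)
      exact absurd (hν _ _ _ h1) (by omega)
  | succ ν ih =>
    intro G _ _ hG hν
    rcases exists_hasSeries_of_isNonabelianChain hS hG with h | ⟨T, _, hT, h⟩
    · exact ⟨S, by nlinarith, h⟩
    · obtain ⟨n, hn, hs⟩ := ih (G ⧸ T) (fun g => by
        obtain ⟨x, rfl⟩ := QuotientGroup.mk'_surjective T g
        rw [← map_pow, hG, map_one]) fun n M N h1 => by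
          obtain ⟨M', N', h2⟩ := h n M N h1
          exact Nat.le_of_succ_le_succ (hν _ _ _ h2)
      have h3 := hs.comap (QuotientGroup.mk'_surjective T)
      rw [MonoidHom.comap_bot, QuotientGroup.ker_mk', comap_top] at h3
      exact ⟨_, by linarith, hT.trans h3⟩

end

end

/-- **Theorem (Hall–Higman).** For every positive `m` there is a number `η = η(m)` such
that every finite group `G` of exponent dividing `m` has height `h(G) ≤ η`. -/
theorem height_le_of_exponent (m : ℕ) (hm : 0 < m) :
    ∃ η : ℕ, ∀ (G : Type) [Group G] [Fintype G],
      (∀ g : G, g ^ m = 1) → groupHeight G ≤ η := by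
  obtain ⟨S, hS⟩ := exists_cres_bound_of_exponent m hm
  obtain ⟨ν, hν⟩ := exists_bound_of_isNonabelianChain m hm
  refine ⟨(S + 1) * (ν + 1), fun G _ _ hG => ?_⟩
  obtain ⟨n, hn, h⟩ := exists_hasSeries hS ν G hG (hν G hG)
  exact (Nat.sInf_le h.hasNilpotentSemisimpleChain).trans hn
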